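/- Let Ω ⊂ ℂ^N be a bounded strongly pseudoconvex domain with C^{2,α}-smooth boundary, α ∈ (0,1], and let d_Ω be either the Carathéodory distance c_Ω, the Kobayashi distance k_Ω, or the Lempert function l_Ω of Ω. Then there exist constants 0 < c < C, depending only on Ω, such that for all z, w ∈ Ω: log(1 + c·A_Ω(z,w)) ≤ d_Ω(z,w) ≤ log(1 + C·A_Ω(z,w)). -/

import Mathlib

open Metric Set Filter Topology MeasureTheory

noncomputable section

namespace InvDist

/-- Complex Euclidean `N`-space. -/
abbrev E (N : ℕ) := EuclideanSpace ℂ (Fin N)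

variable {N : ℕ}

/-- The paper's Hermitian product `⟨a,b⟩ = ∑ a_j * conj (b_j)`. -/
def herm (a b : E N) : ℂ := ∑ j, a j * (starRingEnd ℂ) (b j)

/-- Euclidean distance to the boundary of `Ω`. -/
def bdist (Ω : Set (E N)) (x : E N) : ℝ := Metric.infDist x (frontier Ω)

/-- `π` selects, for each point of `Ω`, a closest point on the boundary. -/
def IsClosestPointSelection (Ω : Set (E N)) (π : E N → E N) : Prop :=
  ∀ z ∈ Ω, π z ∈ frontier Ω ∧ dist z (π z) = bdist Ω z

/-- `‖v_z‖`: modulus of the complex normal component of `v` with respect to the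
closest boundary point `π z`; the outer unit normal at `π z` is `(π z - z)/‖π z - z‖`. -/
def ncomp (Ω : Set (E N)) (π : E N → E N) (z v : E N) : ℝ :=
  ‖herm v (π z - z)‖ / bdist Ω z

/-- `‖v_z^ℝ‖`: modulus of the real normal component of `v` at `π z`. -/
def ncompR (Ω : Set (E N)) (π : E N → E N) (z v : E N) : ℝ :=
  |(herm v (π z - z)).re| / bdist Ω z

/-- The quantity `A_Ω(z,w)`. -/
def Afun (Ω : Set (E N)) (π : E N → E N) (z w : E N) : ℝ :=
  (ncomp Ω π z (z - w) + ‖z - w‖ ^ 2 + ‖z - w‖ * Real.sqrt (bdist Ω z)) /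
    (Real.sqrt (bdist Ω z) * Real.sqrt (bdist Ω w))

/-- `h_Ω(z,w) = ‖(z-w)_z‖ + ‖z-w‖ δ_Ω(z)^{1/2}`. -/
def hfun (Ω : Set (E N)) (π : E N → E N) (z w : E N) : ℝ :=
  ncomp Ω π z (z - w) + ‖z - w‖ * Real.sqrt (bdist Ω z)

/-- real analogue of `h_Ω`. -/
def hfunR (Ω : Set (E N)) (π : E N → E N) (z w : E N) : ℝ :=
  ncompR Ω π z (z - w) + ‖z - w‖ * Real.sqrt (bdist Ω z)

/-- inverse hyperbolic tangent -/
def artanh (x : ℝ) : ℝ := Real.log ((1 + x) / (1 - x)) / 2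

/-- The Lempert function of `Ω`. -/
def lempert (Ω : Set (E N)) (z w : E N) : ℝ :=
  artanh (sInf { r : ℝ | ∃ φ : ℂ → E N, DifferentiableOn ℂ φ (ball 0 1) ∧
    MapsTo φ (ball (0:ℂ) 1) Ω ∧ φ 0 = z ∧ ∃ a ∈ ball (0:ℂ) 1, φ a = w ∧ r = ‖a‖ })

/-- The Carathéodory distance of `Ω`. -/
def caratheodory (Ω : Set (E N)) (z w : E N) : ℝ :=
  artanh (sSup { r : ℝ | ∃ f : E N → ℂ, DifferentiableOn ℂ f Ω ∧
    MapsTo f Ω (ball (0:ℂ) 1) ∧ f z = 0 ∧ r = ‖f w‖ })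

/-- The Kobayashi distance: the largest pseudodistance not exceeding the Lempert
function, given as an infimum over chains. -/
def kobayashi (Ω : Set (E N)) (z w : E N) : ℝ :=
  sInf { r : ℝ | ∃ (n : ℕ) (p : Fin (n + 1) → E N), p 0 = z ∧ p (Fin.last n) = w ∧
    (∀ i, p i ∈ Ω) ∧ r = ∑ i : Fin n, lempert Ω (p i.castSucc) (p i.succ) }

/-- The Poincaré distance on the unit disc. -/
def poincare (ζ ξ : ℂ) : ℝ := artanh ‖(ζ - ξ) / (1 - (starRingEnd ℂ) ζ * ξ)‖

/-- A complex geodesic of `Ω`. -/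
def IsComplexGeodesic (Ω : Set (E N)) (φ : ℂ → E N) : Prop :=
  DifferentiableOn ℂ φ (ball 0 1) ∧ MapsTo φ (ball (0:ℂ) 1) Ω ∧
    ∀ ζ ∈ ball (0:ℂ) 1, ∀ ξ ∈ ball (0:ℂ) 1, kobayashi Ω (φ ζ) (φ ξ) = poincare ζ ξ

/-- `ρ` is `C^k` on `U` with `α`-Hölder `k`-th derivative. -/
def IsCkHolderOn (k : ℕ) (α : ℝ) (ρ : E N → ℝ) (U : Set (E N)) : Prop :=
  ContDiffOn ℝ k ρ U ∧ ∃ M : ℝ, ∀ x ∈ U, ∀ y ∈ U,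
    ‖iteratedFDeriv ℝ k ρ x - iteratedFDeriv ℝ k ρ y‖ ≤ M * ‖x - y‖ ^ α

/-- The Levi form of `ρ` at `p` evaluated at `v`. -/
def levi (ρ : E N → ℝ) (p v : E N) : ℝ :=
  (iteratedFDeriv ℝ 2 ρ p ![v, v] +
    iteratedFDeriv ℝ 2 ρ p ![(Complex.I : ℂ) • v, (Complex.I : ℂ) • v]) / 4

/-- Bounded strongly pseudoconvex domain with `C^{k,α}`-smooth boundary. -/
def IsStronglyPseudoconvexDomain (k : ℕ) (α : ℝ) (Ω : Set (E N)) : Prop :=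
  IsOpen Ω ∧ IsConnected Ω ∧ Bornology.IsBounded Ω ∧
  ∃ (U : Set (E N)) (ρ : E N → ℝ), IsOpen U ∧ closure Ω ⊆ U ∧
    IsCkHolderOn k α ρ U ∧ Ω = {x ∈ U | ρ x < 0} ∧
    (∀ p ∈ frontier Ω, fderiv ℝ ρ p ≠ 0) ∧
    ∀ p ∈ frontier Ω, ∀ v : E N, v ≠ 0 → fderiv ℝ ρ p v = 0 →
      fderiv ℝ ρ p ((Complex.I : ℂ) • v) = 0 → 0 < levi ρ p v

/-- `η` is the outer unit normal of `Ω` at the boundary point `p`. -/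
def IsOuterUnitNormalAt (Ω : Set (E N)) (p η : E N) : Prop :=
  ‖η‖ = 1 ∧ p ∈ frontier Ω ∧ ∃ ε > 0, ∀ t : ℝ, 0 < t → t < ε →
    p - t • η ∈ Ω ∧ bdist Ω (p - t • η) = t

open Classical in
/-- signed boundary distance -/
def signedDist (Ω : Set (E N)) (x : E N) : ℝ :=
  if x ∈ closure Ω then -(bdist Ω x) else bdist Ω x

/-- Hessian quadratic form of the signed boundary distance. -/
def hessSD (Ω : Set (E N)) (p v : E N) : ℝ :=
  iteratedFDeriv ℝ 2 (signedDist Ω) p ![v, v]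

/-- strict linear convexity at `p` (with outer unit normal `η`). -/
def StrictlyLinearlyConvexAt (Ω : Set (E N)) (p η : E N) : Prop :=
  ∀ v : E N, v ≠ 0 → herm v η = 0 → 0 < hessSD Ω p v

/-- strong convexity at `p` (with outer unit normal `η`). -/
def StronglyConvexAt (Ω : Set (E N)) (p η : E N) : Prop :=
  ∀ v : E N, v ≠ 0 → (herm v η).re = 0 → 0 < hessSD Ω p v

/-- `p` is a `C^k`-smooth boundary point of `Ω`. -/
def IsCkBoundaryPoint (k : ℕ) (Ω : Set (E N)) (p : E N) : Prop :=
  p ∈ frontier Ω ∧ ∃ (U : Set (E N)) (ρ : E N → ℝ), IsOpen U ∧ p ∈ U ∧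
    ContDiffOn ℝ k ρ U ∧ (∀ x ∈ U, (x ∈ Ω ↔ ρ x < 0)) ∧
    ∀ x ∈ U ∩ frontier Ω, fderiv ℝ ρ x ≠ 0

/-- bounded domain with `C^k`-smooth boundary. -/
def IsCkDomain (k : ℕ) (Ω : Set (E N)) : Prop :=
  IsOpen Ω ∧ IsConnected Ω ∧ Bornology.IsBounded Ω ∧
    ∀ p ∈ frontier Ω, IsCkBoundaryPoint k Ω p

/-- bounded domain with `C^{1,1}`-smooth boundary. -/
def IsC11Domain (Ω : Set (E N)) : Prop :=
  IsOpen Ω ∧ IsConnected Ω ∧ Bornology.IsBounded Ω ∧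
  ∀ p ∈ frontier Ω, ∃ (U : Set (E N)) (ρ : E N → ℝ), IsOpen U ∧ p ∈ U ∧
    IsCkHolderOn 1 1 ρ U ∧ (∀ x ∈ U, (x ∈ Ω ↔ ρ x < 0)) ∧
    ∀ x ∈ U ∩ frontier Ω, fderiv ℝ ρ x ≠ 0

/-- `p` is a `C^{2,α}`-smooth strongly pseudoconvex boundary point of `Ω`. -/
def IsSPSCBoundaryPoint (α : ℝ) (Ω : Set (E N)) (p : E N) : Prop :=
  p ∈ frontier Ω ∧ ∃ (U : Set (E N)) (ρ : E N → ℝ), IsOpen U ∧ p ∈ U ∧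
    IsCkHolderOn 2 α ρ U ∧ (∀ x ∈ U, (x ∈ Ω ↔ ρ x < 0)) ∧
    (∀ x ∈ U ∩ frontier Ω, fderiv ℝ ρ x ≠ 0) ∧
    ∀ x ∈ U ∩ frontier Ω, ∀ v : E N, v ≠ 0 → fderiv ℝ ρ x v = 0 →
      fderiv ℝ ρ x ((Complex.I : ℂ) • v) = 0 → 0 < levi ρ x v

instance (N : ℕ) : MeasurableSpace (E N) := borel _

instance (N : ℕ) : BorelSpace (E N) := ⟨rfl⟩

/-- Lebesgue measure on `E N`. -/
def vol (N : ℕ) : Measure (E N) :=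
  letI : InnerProductSpace ℝ (E N) := InnerProductSpace.rclikeToReal ℂ (E N)
  letI : MeasureSpace (E N) := measureSpaceOfInnerProductSpace
  volume

/-- Bergman kernel on the diagonal. -/
def bergmanKernelDiag (Ω : Set (E N)) (z : E N) : ℝ :=
  sSup { r : ℝ | ∃ f : E N → ℂ, DifferentiableOn ℂ f Ω ∧
    (∫ x in Ω, ‖f x‖ ^ 2 ∂(vol N)) ≤ 1 ∧ r = ‖f z‖ ^ 2 }

/-- `M_Ω(z;v)`. -/
def bergmanM (Ω : Set (E N)) (z v : E N) : ℝ :=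
  sSup { r : ℝ | ∃ f : E N → ℂ, DifferentiableOn ℂ f Ω ∧
    (∫ x in Ω, ‖f x‖ ^ 2 ∂(vol N)) ≤ 1 ∧ f z = 0 ∧ r = ‖fderiv ℂ f z v‖ }

/-- The Bergman metric. -/
def bergmanMetric (Ω : Set (E N)) (z v : E N) : ℝ :=
  bergmanM Ω z v / Real.sqrt (bergmanKernelDiag Ω z)

/-- The Bergman distance: inner distance of the Bergman metric. -/
def bergmanDist (Ω : Set (E N)) (z w : E N) : ℝ :=
  sInf { r : ℝ | ∃ γ : ℝ → E N, ContDiffOn ℝ 1 γ (Icc 0 1) ∧ γ 0 = z ∧ γ 1 = w ∧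
    (∀ t ∈ Icc (0:ℝ) 1, γ t ∈ Ω) ∧
    r = ∫ t in (0:ℝ)..(1:ℝ), bergmanMetric Ω (γ t) (derivWithin γ (Icc 0 1) t) }


open scoped ComplexConjugate
open Complex (I I_sq abs_re_le_norm add_im add_re conjCLE conj_conj conj_ofNat conj_ofReal inv_re
  mul_re normSq_apply normSq_eq_norm_sq normSq_pos norm_I norm_ofNat norm_real ofRealCLM ofReal_im
  ofReal_mul ofReal_pow ofReal_re ofReal_sum ofReal_zero one_im one_re re_add_im re_le_norm
  re_ofReal_mul real_smul sq_norm sub_im sub_re)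
open Finset (card_univ mul_sum sum_add_distrib sum_congr sum_const sum_le_sum sum_mul sum_nonneg
  sum_sub_distrib)
open Real (exp log exp_add exp_nonneg exp_zero log_le_log log_pow mul_self_sqrt norm_eq_abs
  norm_of_nonneg smoothTransition sq_sqrt sqrt_le_sqrt sqrt_nonneg sqrt_pos)
open RCLike (inner_apply norm_conj)

/-- The Wirtinger-type derivative of `f` in the direction `v` with coefficient `s`. -/
def cderiv (s : ℂ) (v : E N) (f : E N → ℂ) (x : E N) : ℂ :=
  (fderiv ℝ f x v + s * fderiv ℝ f x (I • v)) / 2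

/-- The standard basis vectors. -/
abbrev basisVec (j : Fin N) : E N := EuclideanSpace.single j 1

/-- The antiholomorphic derivative. -/
local notation "dbar" => cderiv I

/-- The holomorphic derivative. -/
local notation "dee" => cderiv (-I)

local notation "dbar[" j "]" => cderiv I (basisVec j)

local notation "dee[" j "]" => cderiv (-I) (basisVec j)

section Derivatives

variable {s : ℂ} {v : E N} {f g : E N → ℂ} {x : E N}

lemma cderiv_add (hf : DifferentiableAt ℝ f x) (hg : DifferentiableAt ℝ g x) :
    cderiv s v (fun y => f y + g y) x = cderiv s v f x + cderiv s v g x := by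
  simp only [cderiv, fderiv_fun_add hf hg, add_apply]; ring

lemma cderiv_sub (hf : DifferentiableAt ℝ f x) (hg : DifferentiableAt ℝ g x) :
    cderiv s v (fun y => f y - g y) x = cderiv s v f x - cderiv s v g x := by
  simp only [cderiv, fderiv_fun_sub hf hg, sub_apply]; ring

lemma cderiv_mul (hf : DifferentiableAt ℝ f x) (hg : DifferentiableAt ℝ g x) :
    cderiv s v (fun y => f y * g y) x = cderiv s v f x * g x + f x * cderiv s v g x := by
  simp only [cderiv, fderiv_fun_mul hf hg, add_apply, smul_apply, smul_eq_mul]; ring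

lemma cderiv_congr (h : f =ᶠ[𝓝 x] g) : cderiv s v f x = cderiv s v g x := by
  simp only [cderiv, h.fderiv_eq]

lemma fderiv_conj (v : E N) : fderiv ℝ (fun y => conj (f y)) x v = conj (fderiv ℝ f x v) := by
  change fderiv ℝ (conjCLE ∘ f) x v = _
  rw [Complex.conjCLE.comp_fderiv]; simp

lemma dbar_conj : dbar v (fun y => conj (f y)) x = conj (dee v f x) := by
  simp [cderiv, fderiv_conj, conj_ofNat]

lemma dee_conj : dee v (fun y => conj (f y)) x = conj (dbar v f x) := by
  simp [cderiv, fderiv_conj, conj_ofNat]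

lemma cderiv_cexp (hf : DifferentiableAt ℝ f x) :
    cderiv s v (fun y => Complex.exp (f y)) x = Complex.exp (f x) * cderiv s v f x := by
  simp only [cderiv, hf.hasFDerivAt.cexp.fderiv, smul_apply, smul_eq_mul]; ring

lemma cderiv_const_mul (hf : DifferentiableAt ℝ f x) (c : ℂ) :
    cderiv s v (fun y => c * f y) x = c * cderiv s v f x := by
  rw [cderiv_mul (differentiableAt_const c) hf]; simp [cderiv]

lemma contDiffAt_fderiv_apply {n m : WithTop ℕ∞} (hf : ContDiffAt ℝ n f x) (hmn : m + 1 ≤ n)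
    (v : E N) : ContDiffAt ℝ m (fun y => fderiv ℝ f y v) x :=
  (hf.fderiv_right hmn).clm_apply contDiffAt_const

lemma ContDiffAt.cderiv {n m : WithTop ℕ∞} (hf : ContDiffAt ℝ n f x) (hmn : m + 1 ≤ n)
    (v : E N) : ContDiffAt ℝ m (cderiv s v f) x :=
  ((contDiffAt_fderiv_apply hf hmn v).add
    (contDiffAt_const.mul (contDiffAt_fderiv_apply hf hmn _))).div_const 2

lemma ContDiff.cderiv {n m : WithTop ℕ∞} (hf : ContDiff ℝ n f) (hmn : m + 1 ≤ n) (v : E N) :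
    ContDiff ℝ m (cderiv s v f) :=
  contDiff_iff_contDiffAt.2 fun _ => ContDiffAt.cderiv hf.contDiffAt hmn v

lemma _root_.ContDiff.continuous_cderiv {n : WithTop ℕ∞} (hf : ContDiff ℝ n f)
    (hn : 1 ≤ n := by norm_num) : Continuous (cderiv s v f) :=
  (ContDiff.cderiv hf (m := 0) (by simpa using hn) v).continuous

lemma cderiv_eq_zero_of_notMem (hx : x ∉ tsupport f) : cderiv s v f x = 0 := by
  rw [cderiv_congr (notMem_tsupport_iff_eventuallyEq.1 hx)]; simp [cderiv]

lemma tsupport_cderiv_subset : tsupport (cderiv s v f) ⊆ tsupport f :=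
  closure_minimal (fun _ hx => by_contra fun h => hx (cderiv_eq_zero_of_notMem h))
    (isClosed_tsupport _)

lemma HasCompactSupport.cderiv (hf : HasCompactSupport f) (v : E N) :
    HasCompactSupport (cderiv s v f) :=
  hf.of_isClosed_subset (isClosed_tsupport _) tsupport_cderiv_subset

/-- The second real derivative in two directions is symmetric. -/
lemma fderiv_fderiv_comm (hf : ContDiffAt ℝ 2 f x) (u v : E N) :
    fderiv ℝ (fun y => fderiv ℝ f y u) x v = fderiv ℝ (fun y => fderiv ℝ f y v) x u := by
  have hd : DifferentiableAt ℝ (fderiv ℝ f) x :=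
    (hf.fderiv_right (m := 1) (by norm_num)).differentiableAt (by norm_num)
  simpa [fderiv_clm_apply hd (differentiableAt_const _)] using (hf.isSymmSndFDerivAt (by simp)) v u

lemma cderiv_comm (hf : ContDiffAt ℝ 2 f x) (s t : ℂ) (u v : E N) :
    cderiv s u (cderiv t v f) x = cderiv t v (cderiv s u f) x := by
  have hd : ∀ w : E N, DifferentiableAt ℝ (fun y => fderiv ℝ f y w) x := fun w =>
    (contDiffAt_fderiv_apply (m := 1) hf (by norm_num) w).differentiableAt (by norm_num)
  have e1 : ∀ (t : ℂ) (v w : E N), fderiv ℝ (cderiv t v f) x w =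
      (fderiv ℝ (fun y => fderiv ℝ f y v) x w +
        t * fderiv ℝ (fun y => fderiv ℝ f y (I • v)) x w) / 2 := by
    intro t v w
    have : HasFDerivAt (cderiv t v f) _ x :=
      (((hd v).hasFDerivAt.add ((hd (I • v)).hasFDerivAt.const_mul t)).mul_const ((2 : ℂ)⁻¹))
    rw [this.fderiv]; simp; ring
  rw [cderiv, cderiv, e1, e1, e1, e1, fderiv_fderiv_comm hf v u,
    fderiv_fderiv_comm hf v (I • u), fderiv_fderiv_comm hf (I • v) u,
    fderiv_fderiv_comm hf (I • v) (I • u)]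
  ring

end Derivatives

section IntegrationByParts

variable {μ : Measure (E N)} [μ.IsAddHaarMeasure] {f g : E N → ℂ}

lemma integral_mul_cderiv (hf : ContDiff ℝ 1 f) (hg : ContDiff ℝ 1 g)
    (hc : HasCompactSupport g) (s : ℂ) (v : E N) :
    ∫ x, f x * cderiv s v g x ∂μ = -∫ x, cderiv s v f x * g x ∂μ := by
  have i1 : ∀ v, Integrable (fun x => f x * fderiv ℝ g x v) μ := fun v =>
    (hf.continuous.mul ((hg.continuous_fderiv one_ne_zero).clm_apply
      continuous_const)).integrable_of_hasCompactSupport (hc.fderiv_apply ℝ v).mul_left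
  have i2 : ∀ v, Integrable (fun x => fderiv ℝ f x v * g x) μ := fun v =>
    (((hf.continuous_fderiv one_ne_zero).clm_apply
      continuous_const).mul hg.continuous).integrable_of_hasCompactSupport hc.mul_left
  have key : ∀ v, ∫ x, f x * fderiv ℝ g x v ∂μ = -∫ x, fderiv ℝ f x v * g x ∂μ := fun v =>
    integral_mul_fderiv_eq_neg_fderiv_mul_of_integrable (i2 v) (i1 v)
      ((hf.continuous.mul hg.continuous).integrable_of_hasCompactSupport hc.mul_left)
      (fun x _ => hf.differentiable one_ne_zero x) (fun x _ => hg.differentiable one_ne_zero x)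
  have e1 : ∀ x, f x * cderiv s v g x = (1 / 2 : ℂ) * (f x * fderiv ℝ g x v) +
      (s / 2) * (f x * fderiv ℝ g x (I • v)) := fun x => by simp only [cderiv]; ring
  have e2 : ∀ x, cderiv s v f x * g x = (1 / 2 : ℂ) * (fderiv ℝ f x v * g x) +
      (s / 2) * (fderiv ℝ f x (I • v) * g x) := fun x => by simp only [cderiv]; ring
  simp_rw [e1, e2]
  rw [integral_add ((i1 _).const_mul _) ((i1 _).const_mul _),
    integral_add ((i2 _).const_mul _) ((i2 _).const_mul _)]
  simp only [integral_const_mul, key]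
  ring

lemma integral_dbar_mul_dbar_comm (hf : ContDiff ℝ 2 f) (hg : ContDiff ℝ 2 g)
    (hc : HasCompactSupport g) (u v : E N) :
    ∫ x, dbar u f x * dbar v g x ∂μ = ∫ x, dbar v f x * dbar u g x ∂μ := by
  rw [integral_mul_cderiv (ContDiff.cderiv hf (by norm_num) u) (hg.of_le (by norm_num)) hc,
    integral_mul_cderiv (ContDiff.cderiv hf (by norm_num) v) (hg.of_le (by norm_num)) hc]
  simp_rw [cderiv_comm hf.contDiffAt _ _ u v]

/-- The commutator identity behind the weighted `L²` estimates. -/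
lemma integral_twisted_dee_mul_dbar {φ a b : E N → ℂ} (hφ : ContDiff ℝ 2 φ)
    (ha : ContDiff ℝ 2 a) (hac : HasCompactSupport a) (hb : ContDiff ℝ 2 b)
    (hbc : HasCompactSupport b) (u v : E N) :
    ∫ x, (dee u a x - dee u φ x * a x) * (dbar v b x - dbar v φ x * b x) * Complex.exp (-φ x) ∂μ =
      ∫ x, dbar v a x * dee u b x * Complex.exp (-φ x) ∂μ +
      ∫ x, dee u (dbar v φ) x * a x * b x * Complex.exp (-φ x) ∂μ := by
  set ω : E N → ℂ := fun x => Complex.exp (-φ x)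
  have hω2 : ContDiff ℝ 2 ω := hφ.neg.cexp
  have h12 : (1 : WithTop ℕ∞) ≤ 2 := by norm_num
  have hd : ∀ {f : E N → ℂ}, ContDiff ℝ 2 f → Differentiable ℝ f := fun h =>
    h.differentiable two_ne_zero
  have hd1 : ∀ {f : E N → ℂ} (s : ℂ) (v : E N), ContDiff ℝ 2 f → ContDiff ℝ 1 (cderiv s v f) :=
    fun s v h => ContDiff.cderiv h (by norm_num) v
  have hc1 : ∀ {f : E N → ℂ} (s : ℂ) (v : E N), ContDiff ℝ 1 f → Continuous (cderiv s v f) :=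
    fun s v h => h.continuous_cderiv
  have hω1 : ∀ s w x, cderiv s w ω x = -(ω x * cderiv s w φ x) := fun s w x => by
    have h1 : cderiv s w (fun y => -φ y) x = -cderiv s w φ x := by
      simpa using cderiv_const_mul (s := s) (v := w) (hd hφ x) (-1)
    exact (cderiv_cexp (hd hφ x).fun_neg).trans (by rw [h1, mul_neg])
  have hφv := hd1 I v hφ
  have hbv := hd1 I v hb
  have hbu := hd1 (-I) u hb
  have hqC : ContDiff ℝ 1 fun x => dbar v b x - dbar v φ x * b x := hbv.sub (hφv.mul (hb.of_le h12))
  have haω : ContDiff ℝ 2 fun x => a x * ω x := ha.mul hω2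
  have haωc : HasCompactSupport fun x => a x * ω x := hac.mul_right
  have e1 : ∫ x, (dee u a x - dee u φ x * a x) * (dbar v b x - dbar v φ x * b x) * ω x ∂μ =
      ∫ x, (dbar v b x - dbar v φ x * b x) * dee u (fun x => a x * ω x) x ∂μ := by
    congr 1; ext x
    rw [cderiv_mul (hd ha x) (hd hω2 x), hω1]; ring
  rw [e1, integral_mul_cderiv hqC (haω.of_le h12) haωc]
  have e2 : ∀ x, dee u (fun x => dbar v b x - dbar v φ x * b x) x = dee u (dbar v b) x -
      (dee u (dbar v φ) x * b x + dbar v φ x * dee u b x) := fun x => by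
    have h1 := hφv.differentiable one_ne_zero x
    rw [cderiv_sub (hbv.differentiable one_ne_zero x) (h1.fun_mul (hd hb x)),
      cderiv_mul h1 (hd hb x)]
  have e3 : ∫ x, dbar v (dee u b) x * (a x * ω x) ∂μ =
      -∫ x, (dbar v a x - dbar v φ x * a x) * ω x * dee u b x ∂μ := by
    rw [eq_neg_iff_add_eq_zero, add_comm, ← eq_neg_iff_add_eq_zero,
      ← integral_mul_cderiv hbu (haω.of_le h12) haωc]
    congr 1; ext x
    rw [cderiv_mul (hd ha x) (hd hω2 x), hω1]; ring
  have i0 : Integrable (fun x => dbar v (dee u b) x * (a x * ω x)) μ :=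
    ((hc1 _ v hbu).mul haω.continuous).integrable_of_hasCompactSupport haωc.mul_left
  have i1 : Integrable (fun x => (dee u (dbar v φ) x * b x + dbar v φ x * dee u b x) *
      (a x * ω x)) μ :=
    ((((hc1 _ u hφv).mul hb.continuous).add (hφv.continuous.mul hbu.continuous)).mul
      haω.continuous).integrable_of_hasCompactSupport haωc.mul_left
  have e4 : ∫ x, dee u (fun x => dbar v b x - dbar v φ x * b x) x * (a x * ω x) ∂μ =
      ∫ x, dbar v (dee u b) x * (a x * ω x) ∂μ -
      ∫ x, (dee u (dbar v φ) x * b x + dbar v φ x * dee u b x) * (a x * ω x) ∂μ := by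
    rw [← integral_sub i0 i1]
    congr 1; ext x
    rw [e2, cderiv_comm hb.contDiffAt]; ring
  rw [e4, e3]
  have i2 : Integrable (fun x => (dbar v a x - dbar v φ x * a x) * ω x * dee u b x) μ :=
    (((((hd1 _ v ha).continuous.sub (hφv.continuous.mul ha.continuous)).mul
      hω2.continuous).mul hbu.continuous)).integrable_of_hasCompactSupport
      (HasCompactSupport.cderiv hbc u).mul_left
  have i3 : Integrable (fun x => dbar v a x * dee u b x * ω x) μ :=
    (((hd1 _ v ha).continuous.mul hbu.continuous).mul
      hω2.continuous).integrable_of_hasCompactSupport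
      ((HasCompactSupport.cderiv hbc u).mul_left.mul_right)
  have i4 : Integrable (fun x => dee u (dbar v φ) x * a x * b x * ω x) μ :=
    ((((hc1 _ u hφv).mul ha.continuous).mul
      hb.continuous).mul hω2.continuous).integrable_of_hasCompactSupport (hbc.mul_left.mul_right)
  rw [← integral_add i3 i4, neg_sub, sub_neg_eq_add, ← integral_add i1 i2]
  congr 1; ext x; ring

end IntegrationByParts

section Estimates

set_option linter.unusedSectionVars false

variable {μ : Measure (E N)} [μ.IsAddHaarMeasure] {Ω D D' : Set (E N)} {x z w p v : E N}
  {ρ φ ψ η : E N → ℝ} {f g γ h u : E N → ℂ} {α β : Fin N → E N → ℂ} {ζ a b : ℂ}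
  {ε r r0 c0 L M C m R t τ A κ : ℝ} {σ : ℕ → E N → ℝ}

lemma smul_eq_re_add_im (c : ℂ) (u : E N) : c • u = c.re • u + c.im • (I • u) := by
  ext i
  simp only [PiLp.smul_apply, PiLp.add_apply, smul_eq_mul, real_smul]
  nth_rewrite 1 [← re_add_im c]
  ring

lemma eq_sum_single (a : E N) : a = ∑ j, a j • (EuclideanSpace.single j (1 : ℂ) : E N) := by
  ext i
  simp [Finset.sum_apply, Pi.single_apply]

/-- The sesquilinear form attached to a real bilinear form. -/
def sesq (B : E N →L[ℝ] E N →L[ℝ] ℝ) (u v : E N) : ℂ := ((B u v + B (I • u) (I • v) : ℝ) +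
    I * (B u (I • v) - B (I • u) v : ℝ)) / 4

lemma sesq_smul_left (B : E N →L[ℝ] E N →L[ℝ] ℝ) (c : ℂ) (u v : E N) :
    sesq B (c • u) v = c * sesq B u v := by
  have h1 : I • c • u = c.re • (I • u) + (-c.im) • u := by
    rw [smul_comm, smul_eq_re_add_im c, smul_smul I I]
    simp
  rw [sesq, h1, smul_eq_re_add_im c u]
  simp only [map_add, map_smul, add_apply, smul_apply, smul_eq_mul, sesq]
  nth_rewrite 9 [← re_add_im c]
  push_cast
  ring_nf
  simp only [I_sq]
  ring

lemma sesq_smul_right (B : E N →L[ℝ] E N →L[ℝ] ℝ) (c : ℂ) (u v : E N) :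
    sesq B u (c • v) = conj c * sesq B u v := by
  have h1 : I • c • v = c.re • (I • v) + (-c.im) • v := by
    rw [smul_comm, smul_eq_re_add_im c, smul_smul I I]
    simp
  have h2 : conj c = (c.re : ℂ) - c.im * I := by
    apply Complex.ext <;> simp
  rw [sesq, h1, smul_eq_re_add_im c v, h2]
  simp only [map_add, map_smul, smul_eq_mul, sesq]
  push_cast
  ring_nf
  simp only [I_sq]
  ring

lemma sesq_sum (B : E N →L[ℝ] E N →L[ℝ] ℝ) (a : E N) :
    ∑ j, ∑ k, sesq B (EuclideanSpace.single j 1) (EuclideanSpace.single k 1) * a j *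
      conj (a k) = sesq B a a := by
  have hl : ∀ (s : Fin N → E N) (v : E N), sesq B (∑ j, s j) v = ∑ j, sesq B (s j) v := by
    intro s v
    simp only [sesq, Finset.smul_sum, map_sum, sum_apply]
    rw [← sum_add_distrib, ← sum_sub_distrib, ← Finset.sum_div,
      ofReal_sum, ofReal_sum, mul_sum, ← sum_add_distrib]
  have hr : ∀ (s : Fin N → E N) (v : E N), sesq B v (∑ j, s j) = ∑ j, sesq B v (s j) := by
    intro s v
    simp only [sesq, Finset.smul_sum, map_sum]
    rw [← sum_add_distrib, ← sum_sub_distrib, ← Finset.sum_div,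
      ofReal_sum, ofReal_sum, mul_sum, ← sum_add_distrib]
  conv_rhs => rw [eq_sum_single a, hl]
  refine sum_congr rfl fun j _ => ?_
  rw [hr]
  refine sum_congr rfl fun k _ => ?_
  rw [sesq_smul_left, sesq_smul_right]; ring

lemma fderiv_ofReal (h : DifferentiableAt ℝ φ x) (v : E N) :
    fderiv ℝ (fun y => (φ y : ℂ)) x v = (fderiv ℝ φ x v : ℝ) := by
  have : HasFDerivAt (fun y => (φ y : ℂ)) (Complex.ofRealCLM.comp (fderiv ℝ φ x)) x :=
    Complex.ofRealCLM.hasFDerivAt.comp x h.hasFDerivAt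
  rw [this.fderiv]; simp

lemma contDiffAt_ofReal {n : WithTop ℕ∞} (h : ContDiffAt ℝ n φ x) :
    ContDiffAt ℝ n (fun y => (φ y : ℂ)) x :=
  Complex.ofRealCLM.contDiff.contDiffAt.comp x h

lemma eventually_differentiableAt (h : ContDiffAt ℝ 2 φ x) : ∀ᶠ y in 𝓝 x, DifferentiableAt ℝ φ y :=
  (h.eventually (by simp)).mono fun _ hy => hy.differentiableAt (by norm_num)

lemma dbar_ofReal (h : DifferentiableAt ℝ φ x) (v : E N) :
    dbar v (fun y => (φ y : ℂ)) x = conj (dee v (fun y => (φ y : ℂ)) x) := by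
  simp [cderiv, fderiv_ofReal h, conj_ofNat]

lemma dee_dbar_ofReal (h : ContDiffAt ℝ 2 φ x) (u v : E N) :
    dee u (dbar v (fun y => (φ y : ℂ))) x = sesq (fderiv ℝ (fderiv ℝ φ) x) u v := by
  have hd : DifferentiableAt ℝ (fderiv ℝ φ) x :=
    (h.fderiv_right (m := 1) (by norm_num)).differentiableAt (by norm_num)
  have e : dbar v (fun y => (φ y : ℂ)) =ᶠ[𝓝 x] fun y =>
      ((fderiv ℝ φ y v : ℝ) + I * (fderiv ℝ φ y (I • v) : ℝ)) / 2 := by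
    filter_upwards [eventually_differentiableAt h] with y hy
    simp only [cderiv, fderiv_ofReal hy]
  have e2 : ∀ w : E N, HasFDerivAt (fun y => ((fderiv ℝ φ y w : ℝ) : ℂ))
      (Complex.ofRealCLM.comp ((fderiv ℝ (fderiv ℝ φ) x).flip w)) x := by
    intro w
    have h1 : HasFDerivAt (fun y => fderiv ℝ φ y w) ((fderiv ℝ (fderiv ℝ φ) x).flip w) x := by
      have := hd.hasFDerivAt.clm_apply (hasFDerivAt_const w x)
      have h0 : (fderiv ℝ φ x).comp (0 : E N →L[ℝ] E N) + (fderiv ℝ (fderiv ℝ φ) x).flip w =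
          (fderiv ℝ (fderiv ℝ φ) x).flip w := by simp
      exact h0 ▸ this
    exact Complex.ofRealCLM.hasFDerivAt.comp x h1
  rw [cderiv_congr e]
  have h3 := ((e2 v).add ((e2 (I • v)).const_mul I)).mul_const ((2 : ℂ)⁻¹)
  have h4 : HasFDerivAt (fun y =>
      (((fderiv ℝ φ y v : ℝ) : ℂ) + I * (fderiv ℝ φ y (I • v) : ℝ)) / 2) _ x := h3
  rw [cderiv, h4.fderiv, sesq]
  simp only [smul_apply, add_apply, ContinuousLinearMap.comp_apply,
    ContinuousLinearMap.flip_apply, Complex.ofRealCLM_apply, smul_eq_mul]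
  push_cast
  ring_nf
  simp only [I_sq]
  ring

lemma levi_eq_sesq (h : ContDiffAt ℝ 2 φ x) (v : E N) :
    (levi φ x v : ℂ) = sesq (fderiv ℝ (fderiv ℝ φ) x) v v := by
  have hs : IsSymmSndFDerivAt ℝ φ x := h.isSymmSndFDerivAt (by simp)
  rw [levi, sesq, iteratedFDeriv_two_apply, iteratedFDeriv_two_apply, hs.eq v (I • v)]
  simp

lemma sum_dee_dbar_eq_levi (h : ContDiffAt ℝ 2 φ x) (a : E N) :
    ∑ j, ∑ k, dee (EuclideanSpace.single j 1) (dbar (EuclideanSpace.single k 1)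
      (fun y => (φ y : ℂ))) x * a j * conj (a k) = levi φ x a := by
  rw [levi_eq_sesq h, ← sesq_sum]
  simp_rw [dee_dbar_ofReal h]

/-- A smooth cutoff function for a compact set inside an open set. -/
lemma exists_cutoff {K : Set (E N)} (hK : IsCompact K) (hD : IsOpen D) (hKD : K ⊆ D) :
    ∃ θ : E N → ℝ, ContDiff ℝ 2 θ ∧ HasCompactSupport θ ∧ tsupport θ ⊆ D ∧
      (∀ x, θ x ∈ Icc (0 : ℝ) 1) ∧ ∀ᶠ x in 𝓝ˢ K, θ x = 1 := by
  obtain ⟨L, hL, hKL, hLD⟩ := exists_compact_between hK hD hKD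
  obtain ⟨f, h1, h0, hf⟩ := exists_contMDiffMap_one_nhds_of_subset_interior
    (n := 2) (modelWithCornersSelf ℝ (E N)) hK.isClosed hKL
  have hs : tsupport f ⊆ L := closure_minimal
    (fun x hx => by_contra fun h => hx (h0 x h)) hL.isClosed
  exact ⟨f, f.contMDiff.contDiff, hL.of_isClosed_subset (isClosed_tsupport _) hs,
    hs.trans hLD, hf, h1⟩

lemma contDiff_cutoff_mul (hD : IsOpen D) {θ : E N → ℝ}
    (hφ : ContDiffOn ℝ 2 φ D) (hθ : ContDiff ℝ 2 θ) (hs : tsupport θ ⊆ D) :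
    ContDiff ℝ 2 fun x => θ x * φ x := by
  rw [contDiff_iff_contDiffAt]
  intro x
  by_cases hx : x ∈ D
  · exact hθ.contDiffAt.mul (hφ.contDiffAt (hD.mem_nhds hx))
  · have : (fun x => θ x * φ x) =ᶠ[𝓝 x] fun _ => 0 := by
      filter_upwards [notMem_tsupport_iff_eventuallyEq.1 fun h => hx (hs h)] with y hy
      simp [hy]
    exact contDiffAt_const.congr_of_eventuallyEq this

lemma sum_normSq_sub {N : ℕ} (X : Fin N → Fin N → ℂ) : -(1 / 2) * ∑ j, ∑ k, ‖X k j - X j k‖ ^ 2 ≤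
      (∑ j, ∑ k, X k j * conj (X j k)).re := by
  have h : ∀ j k, ‖X k j - X j k‖ ^ 2 =
      ‖X k j‖ ^ 2 + ‖X j k‖ ^ 2 - 2 * (X k j * conj (X j k)).re := by
    intro j k
    simp only [← normSq_eq_norm_sq, Complex.normSq_sub]
  simp_rw [h, Complex.re_sum, sum_sub_distrib, ← mul_sum]
  have : 0 ≤ ∑ j, ∑ k, (‖X k j‖ ^ 2 + ‖X j k‖ ^ 2) :=
    sum_nonneg fun _ _ => sum_nonneg fun _ _ => by positivity
  linarith

lemma continuous_levi (hφ : ContDiff ℝ 2 φ) {a : E N → E N} (ha : Continuous a) :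
    Continuous fun x => levi φ x (a x) := by
  have h2 : Continuous fun x => fderiv ℝ (fderiv ℝ φ) x :=
    (hφ.fderiv_right (m := 1) (by norm_num)).continuous_fderiv (by norm_num)
  simp only [levi, iteratedFDeriv_two_apply]
  have hI : Continuous fun x => I • a x := ha.const_smul I
  exact (((h2.clm_apply ha).clm_apply ha).add ((h2.clm_apply hI).clm_apply hI)).div_const 4

set_option maxHeartbeats 1000000 in
/-- The Morrey–Kohn–Hörmander inequality with a globally defined weight. -/
lemma levi_inequality (hφ : ContDiff ℝ 2 φ)
    (hα : ∀ j, ContDiff ℝ 2 (α j)) (hc : ∀ j, HasCompactSupport (α j)) :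
    ∫ x, levi φ x (WithLp.toLp 2 fun j => α j x) * exp (-φ x) ∂μ ≤ ∫ x, ‖∑ j, (dee[j] (α j) x -
        dee[j] (fun y => (φ y : ℂ)) x * α j x)‖ ^ 2 * exp (-φ x) ∂μ +
      (1 / 2) * ∫ x, (∑ j, ∑ k, ‖dbar[k] (α j) x - dbar[j] (α k) x‖ ^ 2) * exp (-φ x) ∂μ := by
  set φc : E N → ℂ := fun y => (φ y : ℂ) with hφc
  have hφC : ContDiff ℝ 2 φc := Complex.ofRealCLM.contDiff.comp hφ
  have hφd : Differentiable ℝ φ := hφ.differentiable (by norm_num)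
  set δ : Fin N → E N → ℂ := fun j x => dee[j] (α j) x - dee[j] φc x * α j x with hδ
  set X : Fin N → Fin N → E N → ℂ := fun k j x => dbar[k] (α j) x with hX
  set ω : E N → ℂ := fun x => Complex.exp (-φc x) with hω
  have hωr : ∀ x, ω x = (exp (-φ x) : ℝ) := fun x => by simp [hω, hφc]
  have hωc : Continuous ω := hφC.continuous.neg.cexp
  have hδcont : ∀ j, Continuous (δ j) := fun j => (hα j).continuous_cderiv.sub
      (hφC.continuous_cderiv.mul (hα j).continuous)
  have hδc : ∀ j, HasCompactSupport (δ j) := fun j =>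
    (HasCompactSupport.cderiv (hc j) _).sub (hc j).mul_left
  have hXcont : ∀ k j, Continuous (X k j) := fun k j => (hα j).continuous_cderiv
  have hXc : ∀ k j, HasCompactSupport (X k j) := fun k j => HasCompactSupport.cderiv (hc j) _
  have hMcont : ∀ j k, Continuous (dee[j] (dbar[k] φc)) := fun j k =>
    (ContDiff.cderiv hφC (m := 1) (by norm_num) _).continuous_cderiv
  have key : ∀ j k, ∫ x, δ j x * conj (δ k x) * ω x ∂μ = ∫ x, X k j x * conj (X j k x) * ω x ∂μ +
      ∫ x, dee[j] (dbar[k] φc) x * α j x * conj (α k x) * ω x ∂μ := by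
    intro j k
    have hb : ContDiff ℝ 2 fun x => conj (α k x) := Complex.conjCLE.contDiff.comp (hα k)
    have hbc : HasCompactSupport fun x => conj (α k x) := (hc k).comp_left (g := conj) (map_zero _)
    have := integral_twisted_dee_mul_dbar (μ := μ) hφC (hα j) (hc j) hb hbc (basisVec j) (basisVec k)
    simp only [dbar_conj, dee_conj] at this
    rw [← this]
    congr 1; ext x
    simp only [hδ, map_sub, map_mul, hω]
    rw [show dbar[k] φc x = conj (dee[k] φc x) from
      dbar_ofReal (hφd x) _]
  have i1 : ∀ j k, Integrable (fun x => δ j x * conj (δ k x) * ω x) μ := fun j k =>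
    (((hδcont j).mul (Complex.continuous_conj.comp (hδcont k))).mul
      hωc).integrable_of_hasCompactSupport ((hδc j).mul_right.mul_right)
  have i2 : ∀ j k, Integrable (fun x => X k j x * conj (X j k x) * ω x) μ := fun j k =>
    (((hXcont k j).mul (Complex.continuous_conj.comp (hXcont j k))).mul
      hωc).integrable_of_hasCompactSupport ((hXc k j).mul_right.mul_right)
  have i3 : ∀ j k, Integrable (fun x => dee[j] (dbar[k] φc) x * α j x *
      conj (α k x) * ω x) μ := fun j k =>
    ((((hMcont j k).mul (hα j).continuous).mul (Complex.continuous_conj.comp (hα k).continuous)).mul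
      hωc).integrable_of_hasCompactSupport ((hc j).mul_left.mul_right.mul_right)
  have sum := sum_congr (rfl : (Finset.univ : Finset (Fin N)) = Finset.univ)
    fun j _ => sum_congr (rfl : (Finset.univ : Finset (Fin N)) = Finset.univ) fun k _ => key j k
  simp_rw [sum_add_distrib] at sum
  have isum : ∀ F : Fin N → Fin N → E N → ℂ, (∀ j k, Integrable (F j k) μ) →
      ∑ j, ∑ k, ∫ x, F j k x ∂μ = ∫ x, ∑ j, ∑ k, F j k x ∂μ := by
    intro F hF
    rw [integral_finsetSum _ fun j _ => integrable_finsetSum _ fun k _ => hF j k]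
    refine sum_congr rfl fun j _ => ?_
    rw [integral_finsetSum _ fun k _ => hF j k]
  rw [isum _ i1, isum _ i2, isum _ i3] at sum
  have e1 : ∀ x, ∑ j, ∑ k, δ j x * conj (δ k x) * ω x =
      ((‖∑ j, δ j x‖ ^ 2 * exp (-φ x) : ℝ) : ℂ) := by
    intro x
    simp_rw [← sum_mul, ← mul_sum, ← sum_mul, ← map_sum, Complex.mul_conj, normSq_eq_norm_sq, hωr]
    push_cast; rfl
  have e3 : ∀ x, ∑ j, ∑ k, dee[j] (dbar[k] φc) x * α j x * conj (α k x) * ω x =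
      ((levi φ x (WithLp.toLp 2 fun j => α j x) * exp (-φ x) : ℝ) : ℂ) := by
    intro x
    have := sum_dee_dbar_eq_levi (hφ.contDiffAt (x := x)) (WithLp.toLp 2 fun j => α j x)
    simp_rw [← sum_mul, hωr]
    push_cast
    rw [← this]
  simp_rw [e1, e3] at sum
  have i2' : Integrable (fun x => ∑ j, ∑ k, X k j x * conj (X j k x) * ω x) μ :=
    integrable_finsetSum _ fun j _ => integrable_finsetSum _ fun k _ => i2 j k
  rw [integral_complex_ofReal, integral_complex_ofReal] at sum
  have sre := congrArg Complex.re sum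
  rw [add_re, ofReal_re, ofReal_re] at sre
  have hre := integral_re (𝕜 := ℂ) i2'
  simp only [RCLike.re_to_complex] at hre
  rw [← hre] at sre
  have i4 : Integrable (fun x => (∑ j, ∑ k, ‖X k j x - X j k x‖ ^ 2) * exp (-φ x)) μ := by
    simp_rw [sum_mul]
    refine integrable_finsetSum _ fun j _ => integrable_finsetSum _ fun k _ => ?_
    have h1 : HasCompactSupport fun x => ‖X k j x - X j k x‖ ^ 2 := by
      have h2 : HasCompactSupport fun x => X k j x - X j k x := (hXc k j).sub (hXc j k)
      exact h2.comp_left (g := fun z : ℂ => ‖z‖ ^ 2) (by simp)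
    have h3 : Continuous fun x => ‖X k j x - X j k x‖ ^ 2 :=
      ((hXcont k j).sub (hXcont j k)).norm.pow 2
    have h4 : Continuous fun x => exp (-φ x) := Real.continuous_exp.comp hφ.continuous.neg
    exact (h3.mul h4).integrable_of_hasCompactSupport h1.mul_right
  have hmono : ∫ x, (-(1 / 2)) * ((∑ j, ∑ k, ‖X k j x - X j k x‖ ^ 2) * exp (-φ x)) ∂μ ≤
      ∫ x, (∑ j, ∑ k, X k j x * conj (X j k x) * ω x).re ∂μ := by
    refine integral_mono (i4.const_mul _) i2'.re fun x => ?_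
    simp_rw [← sum_mul, hωr, Complex.re_mul_ofReal, ← mul_assoc]
    exact mul_le_mul_of_nonneg_right (sum_normSq_sub fun k j => X k j x) (exp_nonneg _)
  rw [integral_const_mul] at hmono
  linarith

/-- Compactly supported `C²` test functions in an open set. -/
structure IsTest (D : Set (E N)) (γ : E N → ℂ) : Prop where
  contDiff : ContDiff ℝ 2 γ
  compact : HasCompactSupport γ
  sub : tsupport γ ⊆ D

lemma norm_toLp_sq (a : Fin N → ℂ) : ‖(WithLp.toLp 2 a : E N)‖ ^ 2 = ∑ j, ‖a j‖ ^ 2 := by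
  rw [EuclideanSpace.norm_sq_eq]

lemma norm_sum_mul_sq_le (a b : Fin N → ℂ) :
    ‖∑ j, a j * b j‖ ^ 2 ≤ (∑ j, ‖a j‖ ^ 2) * ∑ j, ‖b j‖ ^ 2 := by
  calc ‖∑ j, a j * b j‖ ^ 2 ≤ (∑ j, ‖a j‖ * ‖b j‖) ^ 2 := by
        gcongr; exact (norm_sum_le _ _).trans (by simp)
    _ ≤ _ := Finset.sum_mul_sq_le_sq_mul_sq _ _ _

lemma norm_sub_sq_le (a b : ℂ) : ‖a - b‖ ^ 2 ≤ 2 * ‖a‖ ^ 2 + 2 * ‖b‖ ^ 2 := by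
  have h := norm_sub_le a b
  nlinarith [sq_nonneg (‖a‖ - ‖b‖), norm_nonneg (a - b)]

lemma levi_zero (φ : E N → ℝ) (x : E N) : levi φ x 0 = 0 := by
  simp [levi, iteratedFDeriv_two_apply]

lemma levi_congr (h : φ =ᶠ[𝓝 x] ψ) (v : E N) : levi φ x v = levi ψ x v := by
  simp only [levi, iteratedFDeriv_two_apply, h.fderiv.fderiv_eq]

lemma weighted_inequality_global (hφ : ContDiff ℝ 2 φ) (hψ : ContDiff ℝ 2 ψ)
     (hα : ∀ j, ContDiff ℝ 2 (α j)) (hc : ∀ j, HasCompactSupport (α j))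
    (hlevi : ∀ x, (∃ j, α j x ≠ 0) → ∀ v : E N,
      2 * (∑ j, ‖dee[j] (fun y => (ψ y : ℂ)) x‖ ^ 2 + exp (ψ x)) * ‖v‖ ^ 2 ≤ levi φ x v) :
    ∫ x, (∑ j, ‖α j x‖ ^ 2) * exp (ψ x) * exp (-φ x) ∂μ ≤
      ∫ x, ‖∑ j, (dee[j] (α j) x - (dee[j] (fun y => (φ y : ℂ)) x -
        dee[j] (fun y => (ψ y : ℂ)) x) * α j x)‖ ^ 2 * exp (-φ x) ∂μ +
      (1 / 4) * ∫ x, (∑ j, ∑ k, ‖dbar[k] (α j) x - dbar[j] (α k) x‖ ^ 2) * exp (-φ x) ∂μ := by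
  have main := levi_inequality (μ := μ) hφ hα hc
  set p : Fin N → E N → ℂ := fun j => dee[j] (fun y => (φ y : ℂ)) with hp
  set q : Fin N → E N → ℂ := fun j => dee[j] (fun y => (ψ y : ℂ)) with hq
  have hpc : ∀ j, Continuous (p j) := fun j => (Complex.ofRealCLM.contDiff.comp hφ).continuous_cderiv
  have hqc : ∀ j, Continuous (q j) := fun j => (Complex.ofRealCLM.contDiff.comp hψ).continuous_cderiv
  have hαc : ∀ j, Continuous (α j) := fun j => (hα j).continuous
  have hdc : ∀ j, Continuous (dee[j] (α j)) := fun j => (hα j).continuous_cderiv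
  have hω : Continuous fun x => exp (-φ x) := Real.continuous_exp.comp hφ.continuous.neg
  have hκ : Continuous fun x => exp (ψ x) := Real.continuous_exp.comp hψ.continuous
  set S : Set (E N) := ⋃ j, tsupport (α j) with hS
  have hSc : IsCompact S := isCompact_iUnion fun j => hc j
  have hout : ∀ x, x ∉ S → ∀ j, x ∉ tsupport (α j) := fun x hx j h => hx (mem_iUnion.2 ⟨j, h⟩)
  have hz : ∀ x, x ∉ S → ∀ j, α j x = 0 := fun x hx j => image_eq_zero_of_notMem_tsupport (hout x hx j)
  have int : ∀ F : E N → ℝ, Continuous F → (∀ x, x ∉ S → F x = 0) → Integrable F μ :=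
    fun F hF h0 => hF.integrable_of_hasCompactSupport (HasCompactSupport.intro hSc h0)
  set A : E N → ℝ := fun x => ‖∑ j, (dee[j] (α j) x - (p j x - q j x) * α j x)‖ ^ 2 *
    exp (-φ x) with hA
  set B : E N → ℝ := fun x => (∑ j, ‖q j x‖ ^ 2) * (∑ j, ‖α j x‖ ^ 2) * exp (-φ x) with hB
  set C : E N → ℝ := fun x => (∑ j, ‖α j x‖ ^ 2) * exp (ψ x) * exp (-φ x) with hC
  set L : E N → ℝ := fun x => levi φ x (WithLp.toLp 2 fun j => α j x) * exp (-φ x) with hL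
  set G : E N → ℝ := fun x => ‖∑ j, (dee[j] (α j) x - p j x * α j x)‖ ^ 2 * exp (-φ x) with hG
  have hcont1 : Continuous fun x => ∑ j, ‖α j x‖ ^ 2 :=
    continuous_finsetSum _ fun j _ => (hαc j).norm.pow 2
  have iA : Integrable A μ := by
    refine int A (((continuous_finsetSum _ fun j _ =>
      (hdc j).sub (((hpc j).sub (hqc j)).mul (hαc j))).norm.pow 2).mul hω) fun x hx => ?_
    simp [hA, hz x hx, fun j s v => cderiv_eq_zero_of_notMem (s := s) (v := v) (hout x hx j)]
  have iG : Integrable G μ := by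
    refine int G (((continuous_finsetSum _ fun j _ =>
      (hdc j).sub ((hpc j).mul (hαc j))).norm.pow 2).mul hω) fun x hx => ?_
    simp [hG, hz x hx, fun j s v => cderiv_eq_zero_of_notMem (s := s) (v := v) (hout x hx j)]
  have iB : Integrable B μ := by
    refine int B (((continuous_finsetSum _ fun j _ => (hqc j).norm.pow 2).mul hcont1).mul hω)
      fun x hx => ?_
    simp [hB, hz x hx]
  have iC : Integrable C μ := by
    refine int C ((hcont1.mul hκ).mul hω) fun x hx => ?_
    simp [hC, hz x hx]
  have iL : Integrable L μ := by
    refine int L ((continuous_levi hφ ((PiLp.continuous_toLp 2 _).comp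
      (continuous_pi hαc))).mul hω) fun x hx => ?_
    have : (WithLp.toLp 2 fun j => α j x : E N) = 0 := by ext j; simp [hz x hx]
    simp [hL, this, levi_zero]
  have h1 : 2 * ∫ x, B x ∂μ + 2 * ∫ x, C x ∂μ ≤ ∫ x, L x ∂μ := by
    rw [← integral_const_mul, ← integral_const_mul, ← integral_add (iB.const_mul 2) (iC.const_mul 2)]
    refine integral_mono ((iB.const_mul 2).add (iC.const_mul 2)) iL fun x => ?_
    simp only [hB, hC, hL]
    by_cases hx : ∃ j, α j x ≠ 0
    · have := hlevi x hx (WithLp.toLp 2 fun j => α j x)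
      rw [norm_toLp_sq] at this
      have := mul_le_mul_of_nonneg_right this (exp_nonneg (-φ x))
      refine le_trans (le_of_eq ?_) this
      simp only [hq]; ring
    · push Not at hx
      have : (WithLp.toLp 2 fun j => α j x : E N) = 0 := by ext j; simp [hx]
      rw [this, levi_zero]; simp [hx]
  have h2 : ∫ x, G x ∂μ ≤ 2 * ∫ x, A x ∂μ + 2 * ∫ x, B x ∂μ := by
    rw [← integral_const_mul, ← integral_const_mul, ← integral_add (iA.const_mul 2) (iB.const_mul 2)]
    refine integral_mono iG ((iA.const_mul 2).add (iB.const_mul 2)) fun x => ?_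
    simp only [hG, hA, hB]
    have e : ∑ j, (dee[j] (α j) x - p j x * α j x) =
        ∑ j, (dee[j] (α j) x - (p j x - q j x) * α j x) - ∑ j, q j x * α j x := by
      rw [← sum_sub_distrib]; congr 1; ext j; ring
    have h3 := norm_sub_sq_le (∑ j, (dee[j] (α j) x - (p j x - q j x) * α j x)) (∑ j, q j x * α j x)
    have h4 := norm_sum_mul_sq_le (fun j => q j x) (fun j => α j x)
    rw [e]
    have h5 := mul_le_mul_of_nonneg_right (h3.trans (add_le_add_right
      (mul_le_mul_of_nonneg_left h4 zero_le_two) _)) (exp_nonneg (-φ x))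
    linarith
  change ∫ x, C x ∂μ ≤ ∫ x, A x ∂μ + _
  change ∫ x, L x ∂μ ≤ ∫ x, G x ∂μ + _ at main
  linarith

/-- The `L²` a priori inequality with two weights, for test forms in an open set. -/
lemma weighted_inequality (hD : IsOpen D) (hφ : ContDiffOn ℝ 2 φ D) (hψ : ContDiffOn ℝ 2 ψ D)
     (hα : ∀ j, IsTest D (α j))
    (hlevi : ∀ x ∈ D, ∀ v : E N,
      2 * (∑ j, ‖dee[j] (fun y => (ψ y : ℂ)) x‖ ^ 2 + exp (ψ x)) * ‖v‖ ^ 2 ≤ levi φ x v) :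
    ∫ x, (∑ j, ‖α j x‖ ^ 2) * exp (ψ x) * exp (-φ x) ∂μ ≤
      ∫ x, ‖∑ j, (dee[j] (α j) x - (dee[j] (fun y => (φ y : ℂ)) x -
        dee[j] (fun y => (ψ y : ℂ)) x) * α j x)‖ ^ 2 * exp (-φ x) ∂μ +
      (1 / 4) * ∫ x, (∑ j, ∑ k, ‖dbar[k] (α j) x - dbar[j] (α k) x‖ ^ 2) * exp (-φ x) ∂μ := by
  set S : Set (E N) := ⋃ j, tsupport (α j) with hS
  have hSc : IsCompact S := isCompact_iUnion fun j => (hα j).compact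
  have hSD : S ⊆ D := iUnion_subset fun j => (hα j).sub
  have hout : ∀ x, x ∉ S → ∀ j, x ∉ tsupport (α j) := fun x hx j h => hx (mem_iUnion.2 ⟨j, h⟩)
  have hz : ∀ x, x ∉ S → ∀ j, α j x = 0 := fun x hx j => image_eq_zero_of_notMem_tsupport (hout x hx j)
  obtain ⟨θ, hθ, -, hθD, -, hθ1⟩ := exists_cutoff hSc hD hSD
  have ev : ∀ f : E N → ℝ, ∀ x ∈ S, (fun y => θ y * f y) =ᶠ[𝓝 x] f := by
    intro f x hx
    filter_upwards [hθ1.filter_mono (nhds_le_nhdsSet hx)] with y hy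
    simp [hy]
  have hd : ∀ f : E N → ℝ, ∀ x ∈ S, ∀ v, dee v (fun y => ((θ y * f y : ℝ) : ℂ)) x =
      dee v (fun y => (f y : ℂ)) x := fun f x hx v =>
    cderiv_congr ((ev f x hx).fun_comp Complex.ofReal)
  have main := weighted_inequality_global (μ := μ) (contDiff_cutoff_mul hD hφ hθ hθD)
    (contDiff_cutoff_mul hD hψ hθ hθD) (fun j => (hα j).contDiff) (fun j => (hα j).compact) (by
      rintro x ⟨j, hj⟩ v
      have hx : x ∈ S := by_contra fun h => hj (hz x h j)
      have h1 : levi (fun y => θ y * φ y) x v = levi φ x v := levi_congr (ev φ x hx) v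
      rw [h1, (ev ψ x hx).eq_of_nhds]
      simp_rw [hd ψ x hx]
      exact hlevi x (hSD hx) v)
  convert main using 2
  · ext x
    by_cases hx : x ∈ S
    · rw [(ev ψ x hx).eq_of_nhds, (ev φ x hx).eq_of_nhds]
    · simp [hz x hx]
  · congr 1; ext x
    by_cases hx : x ∈ S
    · simp_rw [hd ψ x hx, hd φ x hx]
      rw [(ev φ x hx).eq_of_nhds]
    · simp [hz x hx, fun j s v => cderiv_eq_zero_of_notMem (s := s) (v := v) (hout x hx j)]
  · congr 1; congr 1; ext x
    by_cases hx : x ∈ S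
    · rw [(ev φ x hx).eq_of_nhds]
    · simp [fun j s v => cderiv_eq_zero_of_notMem (s := s) (v := v) (hout x hx j)]

/-- A nonnegative `C²` kernel of total mass one supported in the ball of radius `r` and invariant
under the circle action. -/
structure IsMollifier (μ : Measure (E N)) (r : ℝ) (η : E N → ℝ) : Prop where
  contDiff : ContDiff ℝ 2 η
  nonneg : ∀ x, 0 ≤ η x
  zero : ∀ x, r < ‖x‖ → η x = 0
  mass : ∫ x, η x ∂μ = 1
  circle : ∀ (ζ : ℂ) (x : E N), ‖ζ‖ = 1 → η (ζ • x) = η x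

/-- Convolution of a kernel with a function. -/
def moll (μ : Measure (E N)) (K g : E N → ℂ) (x : E N) : ℂ := ∫ y, K (x - y) * g y ∂μ

lemma exists_mollifier (hr : 0 < r) : ∃ η, IsMollifier (N := N) μ r η := by
  set f : E N → ℝ := fun x => smoothTransition (1 - ‖x‖ ^ 2 / r ^ 2) with hf
  have hfc : ContDiff ℝ 2 f := Real.smoothTransition.contDiff.comp
    (contDiff_const.sub ((contDiff_norm_sq ℝ).div_const _))
  have hf0 : ∀ x, r < ‖x‖ → f x = 0 := fun x hx => by
    apply Real.smoothTransition.zero_of_nonpos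
    rw [sub_nonpos, one_le_div (by positivity)]
    gcongr
  have hfs : HasCompactSupport f := HasCompactSupport.intro (isCompact_closedBall (0 : E N) r)
    fun x hx => hf0 x (by simpa using hx)
  have hpos : 0 < ∫ x, f x ∂μ := by
    refine hfc.continuous.integral_pos_of_hasCompactSupport_nonneg_nonzero hfs
      (fun x => Real.smoothTransition.nonneg _) (x := 0) ?_
    simp [hf]
  refine ⟨fun x => (∫ x, f x ∂μ)⁻¹ * f x, contDiff_const.mul hfc,
    fun x => mul_nonneg (inv_nonneg.2 hpos.le) (Real.smoothTransition.nonneg _),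
    fun x hx => by simp [hf0 x hx], ?_, fun ζ x hζ => by simp [hf, norm_smul, hζ]⟩
  rw [integral_const_mul, inv_mul_cancel₀ hpos.ne']

lemma IsMollifier.hasCompactSupport (h : IsMollifier μ r η) :
    HasCompactSupport η := HasCompactSupport.intro (isCompact_closedBall (0 : E N) r)
    fun x hx => h.zero x (by simpa using hx)

lemma IsMollifier.contDiff_complex (h : IsMollifier μ r η) :
    ContDiff ℝ 2 fun x => (η x : ℂ) := Complex.ofRealCLM.contDiff.comp h.contDiff

lemma IsMollifier.hasCompactSupport_complex (h : IsMollifier μ r η) :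
    HasCompactSupport fun x => (η x : ℂ) :=
  h.hasCompactSupport.comp_left (g := Complex.ofReal) ofReal_zero

lemma moll_eq_convolution (K g : E N → ℂ) :
    moll μ K g = convolution K g (ContinuousLinearMap.mul ℝ ℂ) μ := by
  ext x
  rw [convolution_eq_swap]; rfl

lemma contDiff_moll {K : E N → ℂ} {n : ℕ∞} (hK : ContDiff ℝ n K) (hc : HasCompactSupport K)
    (hg : LocallyIntegrable g μ) : ContDiff ℝ n (moll μ K g) := by
  rw [moll_eq_convolution]
  exact hc.contDiff_convolution_left _ hK hg

lemma fderiv_moll {K : E N → ℂ} (hK : ContDiff ℝ 1 K) (hc : HasCompactSupport K)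
    (hg : LocallyIntegrable g μ) (x v : E N) :
    fderiv ℝ (moll μ K g) x v = moll μ (fun y => fderiv ℝ K y v) g x := by
  rw [moll_eq_convolution, (hc.hasFDerivAt_convolution_left _ hK hg x).fderiv, convolution,
    ContinuousLinearMap.integral_apply, moll_eq_convolution, convolution]
  · simp
  · exact HasCompactSupport.convolutionExists_left _ (hc.fderiv ℝ)
      (hK.continuous_fderiv (by norm_num)) hg x

lemma integrable_moll {K : E N → ℂ} (hK : Continuous K) (hc : HasCompactSupport K)
    (hg : LocallyIntegrable g μ) (x : E N) : Integrable (fun y => K (x - y) * g y) μ := by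
  have h := (HasCompactSupport.convolutionExists_left (ContinuousLinearMap.mul ℝ ℂ) hc hK hg x
    : ConvolutionExistsAt K g x _ μ)
  exact h.integrable_swap

lemma cderiv_moll {K : E N → ℂ} (hK : ContDiff ℝ 1 K) (hc : HasCompactSupport K)
    (hg : LocallyIntegrable g μ) (s : ℂ) (x v : E N) :
    cderiv s v (moll μ K g) x = moll μ (cderiv s v K) g x := by
  have hi : ∀ w, Integrable (fun y => fderiv ℝ K (x - y) w * g y) μ := fun w =>
    integrable_moll (K := fun y => fderiv ℝ K y w)
      ((hK.continuous_fderiv (by norm_num)).clm_apply continuous_const) (hc.fderiv_apply ℝ w) hg x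
  have e : ∀ y, cderiv s v K (x - y) * g y = (1 / 2 : ℂ) * (fderiv ℝ K (x - y) v * g y) +
      (s / 2) * (fderiv ℝ K (x - y) (I • v) * g y) := fun y => by
    simp only [cderiv]; ring
  rw [cderiv, fderiv_moll hK hc hg, fderiv_moll hK hc hg]
  simp only [moll]
  simp_rw [e]
  rw [integral_add ((hi _).const_mul _) ((hi _).const_mul _), integral_const_mul,
    integral_const_mul]
  ring

lemma fderiv_comp_const_sub {K : E N → ℂ} (hK : ContDiff ℝ 1 K) (x y w : E N) :
    fderiv ℝ (fun y => K (x - y)) y w = -fderiv ℝ K (x - y) w := by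
  have h1 : HasFDerivAt (fun y : E N => x - y) (-ContinuousLinearMap.id ℝ (E N)) y :=
    (hasFDerivAt_id y).const_sub x
  have h2 := ((hK.differentiable (by norm_num) (x - y)).hasFDerivAt).comp y h1
  rw [show (fun y => K (x - y)) = K ∘ fun y => x - y from rfl, h2.fderiv]
  simp

lemma cderiv_comp_const_sub {K : E N → ℂ} (hK : ContDiff ℝ 1 K) (s : ℂ) (x y v : E N) :
    cderiv s v (fun y => K (x - y)) y = -cderiv s v K (x - y) := by
  simp only [cderiv, fderiv_comp_const_sub hK]; ring

lemma hasCompactSupport_const_sub {K : E N → ℂ} (hc : HasCompactSupport K) (x : E N) :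
    HasCompactSupport fun y => K (x - y) :=
  hc.comp_homeomorph (Homeomorph.subLeft x)

lemma lintegral_sq_le {ν : Measure (E N)} [IsProbabilityMeasure ν] {F : E N → ENNReal}
    (hF : AEMeasurable F ν) : (∫⁻ t, F t ∂ν) ^ 2 ≤ ∫⁻ t, F t ^ 2 ∂ν := by
  have h := ENNReal.lintegral_mul_le_Lp_mul_Lq ν (p := 2) (q := 2) (by constructor <;> norm_num) hF
    (aemeasurable_const (b := (1 : ENNReal)))
  simp only [Pi.mul_apply, mul_one, ENNReal.one_rpow, lintegral_const, measure_univ, one_div] at h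
  calc (∫⁻ t, F t ∂ν) ^ 2 ≤ ((∫⁻ t, F t ^ (2 : ℝ) ∂ν) ^ ((2 : ℝ)⁻¹)) ^ 2 := by gcongr
    _ = ∫⁻ t, F t ^ 2 ∂ν := by
      rw [← ENNReal.rpow_natCast, ← ENNReal.rpow_mul]; norm_num

lemma eLpNorm_two_sq (f : E N → ℂ) : eLpNorm f 2 μ ^ 2 = ∫⁻ x, ‖f x‖ₑ ^ 2 ∂μ := by
  rw [eLpNorm_eq_lintegral_rpow_enorm_toReal (by norm_num) (by norm_num),
    ← ENNReal.rpow_natCast, ← ENNReal.rpow_mul]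
  norm_num

lemma eLpNorm_moll_sub_le_of_measurable (hη : IsMollifier μ r η)
     (hgm : Measurable g) (hg : LocallyIntegrable g μ) {ε : ENNReal}
    (hε : ∀ t : E N, ‖t‖ ≤ r → eLpNorm (fun x => g (x - t) - g x) 2 μ ≤ ε) :
    eLpNorm (fun x => moll μ (fun y => (η y : ℂ)) g x - g x) 2 μ ≤ ε := by
  have hηm : Measurable fun t => ENNReal.ofReal (η t) :=
    ENNReal.measurable_ofReal.comp hη.contDiff.continuous.measurable
  set ν : Measure (E N) := μ.withDensity fun t => ENNReal.ofReal (η t) with hν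
  have hηi : Integrable η μ :=
    hη.contDiff.continuous.integrable_of_hasCompactSupport hη.hasCompactSupport
  have : IsProbabilityMeasure ν := by
    refine ⟨?_⟩
    rw [hν, withDensity_apply _ MeasurableSet.univ, Measure.restrict_univ,
      ← ofReal_integral_eq_lintegral_ofReal hηi (Filter.Eventually.of_forall hη.nonneg), hη.mass]
    simp
  have hpt : ∀ x, ‖moll μ (fun y => (η y : ℂ)) g x - g x‖ₑ ^ 2 ≤
      ∫⁻ t, ‖g (x - t) - g x‖ₑ ^ 2 ∂ν := by
    intro x
    have hi1 : Integrable (fun t => (η t : ℂ) * g (x - t)) μ :=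
      HasCompactSupport.convolutionExists_left (ContinuousLinearMap.mul ℝ ℂ)
        hη.hasCompactSupport_complex hη.contDiff_complex.continuous hg x
    have hi2 : Integrable (fun t => (η t : ℂ) * g x) μ := (hηi.ofReal (𝕜 := ℂ)).mul_const _
    have e : moll μ (fun y => (η y : ℂ)) g x - g x = ∫ t, (η t : ℂ) * (g (x - t) - g x) ∂μ := by
      simp_rw [mul_sub]
      rw [integral_sub hi1 hi2, integral_mul_const, integral_complex_ofReal, hη.mass,
        moll_eq_convolution, convolution]
      simp
    rw [e]
    have hF : Measurable fun t => ‖g (x - t) - g x‖ₑ :=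
      ((hgm.comp (measurable_const.sub measurable_id)).sub measurable_const).enorm
    refine le_trans ?_ (lintegral_sq_le hF.aemeasurable)
    gcongr
    refine (enorm_integral_le_lintegral_enorm _).trans (le_of_eq ?_)
    rw [hν, lintegral_withDensity_eq_lintegral_mul _ hηm hF]
    refine lintegral_congr fun t => ?_
    simp only [enorm_mul, Pi.mul_apply]
    congr 1
    rw [← ofReal_norm]
    simp [abs_of_nonneg (hη.nonneg t)]
  have hsq : eLpNorm (fun x => moll μ (fun y => (η y : ℂ)) g x - g x) 2 μ ^ 2 ≤ ε ^ 2 := by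
    rw [eLpNorm_two_sq]
    calc ∫⁻ x, ‖moll μ (fun y => (η y : ℂ)) g x - g x‖ₑ ^ 2 ∂μ
        ≤ ∫⁻ x, ∫⁻ t, ‖g (x - t) - g x‖ₑ ^ 2 ∂ν ∂μ := lintegral_mono hpt
      _ = ∫⁻ t, ∫⁻ x, ‖g (x - t) - g x‖ₑ ^ 2 ∂μ ∂ν := by
        refine lintegral_lintegral_swap ?_
        exact ((((hgm.comp (measurable_fst.sub measurable_snd)).sub
          (hgm.comp measurable_fst)).enorm).pow_const 2).aemeasurable
      _ ≤ ∫⁻ t, ε ^ 2 ∂ν := by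
        refine lintegral_mono_ae ?_
        rw [hν, ae_withDensity_iff hηm]
        refine Filter.Eventually.of_forall fun t ht => ?_
        have htr : ‖t‖ ≤ r := by
          by_contra h
          exact ht (by simp [hη.zero t (not_le.1 h)])
        rw [← eLpNorm_two_sq (μ := μ) fun x => g (x - t) - g x]
        gcongr
        exact hε t htr
      _ = ε ^ 2 := by simp
  exact (ENNReal.pow_le_pow_left_iff (by norm_num)).1 hsq

lemma exists_translate_close (hg : MemLp g 2 μ) {ε : ENNReal} (hε : 0 < ε) :
    ∃ δ > 0, ∀ t : E N, ‖t‖ ≤ δ → eLpNorm (fun x => g (x - t) - g x) 2 μ ≤ ε := by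
  have : Fact ((2 : ENNReal) ≠ ⊤) := ⟨by norm_num⟩
  have hcont : Continuous fun t : E N => DomAddAct.mk (-t) +ᵥ hg.toLp g := by
    have h : Continuous fun t : E N => DomAddAct.mk (-t) :=
      DomAddAct.continuous_mk.comp continuous_neg
    exact h.vadd continuous_const
  have ht := hcont.tendsto 0
  have e : ∀ t : E N, edist (DomAddAct.mk (-t) +ᵥ hg.toLp g) (DomAddAct.mk (-(0 : E N)) +ᵥ hg.toLp g)
      = eLpNorm (fun x => g (x - t) - g x) 2 μ := by
    intro t
    rw [DomAddAct.mk_vadd_toLp, DomAddAct.mk_vadd_toLp, Lp.edist_toLp_toLp]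
    congr 1; ext x
    simp [sub_eq_add_neg, add_comm]
  rw [EMetric.tendsto_nhds] at ht
  obtain ⟨δ, hδ, h⟩ := Metric.eventually_nhds_iff.1 (ht ε hε)
  refine ⟨δ / 2, by positivity, fun t hts => ?_⟩
  rw [← e]
  exact (h (by rw [dist_zero_right]; linarith)).le

/-- Mollifications of a square integrable function converge in `L²`. -/
lemma exists_moll_close (hg : MemLp g 2 μ) {ε : ENNReal} (hε : 0 < ε) :
    ∃ δ > 0, ∀ r ≤ δ, ∀ η : E N → ℝ, IsMollifier μ r η →
      eLpNorm (fun x => moll μ (fun y => (η y : ℂ)) g x - g x) 2 μ ≤ ε := by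
  obtain ⟨δ, hδ, h⟩ := exists_translate_close hg hε
  refine ⟨δ, hδ, fun r hr η hη => ?_⟩
  set g' := hg.1.mk g with hg'
  have hgg : g =ᵐ[μ] g' := hg.1.ae_eq_mk
  have hL : MemLp g' 2 μ := hg.ae_eq hgg
  have hm : Measurable g' := hg.1.stronglyMeasurable_mk.measurable
  have h1 := eLpNorm_moll_sub_le_of_measurable hη hm (hL.locallyIntegrable (by norm_num)) (ε := ε)
    fun t ht => by
      rw [← eLpNorm_congr_ae (f := fun x => g (x - t) - g x)]
      · exact h t (ht.trans hr)
      · have h2 := (measurePreserving_sub_right μ t).quasiMeasurePreserving.ae_eq_comp hgg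
        filter_upwards [hgg, h2] with x hx hx2
        simp only [Function.comp] at hx2
        rw [hx, hx2]
  have e : ∀ x, moll μ (fun y => (η y : ℂ)) g x = moll μ (fun y => (η y : ℂ)) g' x := fun x =>
    integral_congr_ae (hgg.mono fun y hy => by simp only [hy])
  refine le_trans (le_of_eq (eLpNorm_congr_ae ?_)) h1
  filter_upwards [hgg] with x hx
  rw [e, hx]

/-- A bounded measurable multiplier. -/
structure IsMult (μ : Measure (E N)) (m : E N → ℂ) : Prop where
  aesm : AEStronglyMeasurable m μ
  bdd : ∃ C : ℝ, ∀ x, ‖m x‖ ≤ C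

/-- Convergence in `L²` of a sequence of functions. -/
structure L2Lim (μ : Measure (E N)) (F : ℕ → E N → ℂ) (f : E N → ℂ) : Prop where
  mem : ∀ n, MemLp (F n) 2 μ
  memLim : MemLp f 2 μ
  tendsto : Tendsto (fun n => eLpNorm (fun x => F n x - f x) 2 μ) atTop (𝓝 0)

lemma IsMult.memLp {m : E N → ℂ} (hm : IsMult μ m) (hf : MemLp f 2 μ) :
    MemLp (fun x => m x * f x) 2 μ := by
  obtain ⟨C, hC⟩ := hm.bdd
  refine hf.of_le_mul (c := C) (hm.aesm.mul hf.1) (Filter.Eventually.of_forall fun x => ?_)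
  rw [norm_mul]
  exact mul_le_mul_of_nonneg_right (hC x) (norm_nonneg _)

lemma isMult_indicator {K : Set (E N)} (hK : IsCompact K)
     (hg : ContinuousOn g K) : IsMult μ (K.indicator g) := by
  refine ⟨(aestronglyMeasurable_indicator_iff hK.measurableSet).2
    (hg.aestronglyMeasurable hK.measurableSet), ?_⟩
  obtain ⟨C, hC⟩ := hK.exists_bound_of_continuousOn hg
  refine ⟨max C 0, fun x => ?_⟩
  by_cases hx : x ∈ K
  · rw [indicator_of_mem hx]; exact (hC x hx).trans (le_max_left _ _)
  · simp [indicator_of_notMem hx]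

lemma L2Lim.mult {m : E N → ℂ} {F : ℕ → E N → ℂ} (hm : IsMult μ m)
    (h : L2Lim μ F f) : L2Lim μ (fun n x => m x * F n x) fun x => m x * f x := by
  refine ⟨fun n => hm.memLp (h.mem n), hm.memLp h.memLim, ?_⟩
  obtain ⟨C, hC⟩ := hm.bdd
  have h1 : Tendsto (fun n => ENNReal.ofReal C * eLpNorm (fun x => F n x - f x) 2 μ) atTop
      (𝓝 0) := by
    have := ENNReal.Tendsto.const_mul h.tendsto (a := ENNReal.ofReal C) (Or.inr ENNReal.ofReal_ne_top)
    rwa [mul_zero] at this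
  refine tendsto_of_tendsto_of_tendsto_of_le_of_le tendsto_const_nhds h1 (fun _ => zero_le)
    fun n => ?_
  refine eLpNorm_le_mul_eLpNorm_of_ae_le_mul (Filter.Eventually.of_forall fun x => ?_) 2
  rw [← mul_sub, norm_mul]
  exact mul_le_mul_of_nonneg_right (hC x) (norm_nonneg _)

lemma L2Lim.sub {F G : ℕ → E N → ℂ} (hF : L2Lim μ F f) (hG : L2Lim μ G g) :
    L2Lim μ (fun n x => F n x - G n x) fun x => f x - g x := by
  refine ⟨fun n => (hF.mem n).sub (hG.mem n), hF.memLim.sub hG.memLim, ?_⟩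
  have h1 := hF.tendsto.add hG.tendsto
  rw [add_zero] at h1
  refine tendsto_of_tendsto_of_tendsto_of_le_of_le tendsto_const_nhds h1 (fun _ => zero_le)
    fun n => ?_
  have e : (fun x => F n x - G n x - (f x - g x)) = (fun x => F n x - f x) - fun x => G n x - g x := by
    ext x; simp only [Pi.sub_apply]; ring
  change eLpNorm (fun x => F n x - G n x - (f x - g x)) 2 μ ≤ _
  rw [e]
  exact eLpNorm_sub_le ((hF.mem n).sub hF.memLim).1 ((hG.mem n).sub hG.memLim).1 (by norm_num)

lemma L2Lim.sum {ι : Type*} (s : Finset ι) {F : ι → ℕ → E N → ℂ} {f : ι → E N → ℂ}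
    (h : ∀ i, L2Lim μ (F i) (f i)) :
    L2Lim μ (fun n x => ∑ i ∈ s, F i n x) fun x => ∑ i ∈ s, f i x := by
  refine ⟨fun n => memLp_finsetSum s fun i _ => (h i).mem n,
    memLp_finsetSum s fun i _ => (h i).memLim, ?_⟩
  have h1 := tendsto_finsetSum s fun i _ => (h i).tendsto
  simp only [Finset.sum_const_zero] at h1
  refine tendsto_of_tendsto_of_tendsto_of_le_of_le tendsto_const_nhds h1 (fun _ => zero_le)
    fun n => ?_
  have e : (fun x => ∑ i ∈ s, F i n x - ∑ i ∈ s, f i x) = ∑ i ∈ s, fun x => F i n x - f i x := by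
    ext x; simp [sum_sub_distrib]
  change eLpNorm (fun x => ∑ i ∈ s, F i n x - ∑ i ∈ s, f i x) 2 μ ≤ _
  rw [e]
  exact eLpNorm_sum_le (fun i _ => (((h i).mem n).sub (h i).memLim).1) (by norm_num)

lemma L2Lim.integral_norm_sq {F : ℕ → E N → ℂ} (h : L2Lim μ F f) :
    Tendsto (fun n => ∫ x, ‖F n x‖ ^ 2 ∂μ) atTop (𝓝 (∫ x, ‖f x‖ ^ 2 ∂μ)) := by
  have key : ∀ g : E N → ℂ, ∀ hg : MemLp g 2 μ, ∫ x, ‖g x‖ ^ 2 ∂μ = ‖hg.toLp g‖ ^ 2 := by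
    intro g hg
    rw [Lp.norm_toLp, ← ENNReal.toReal_pow, eLpNorm_two_sq,
      integral_eq_lintegral_of_nonneg_ae (f := fun x => ‖g x‖ ^ 2)
        (Filter.Eventually.of_forall fun x => by positivity) (hg.1.norm.pow 2)]
    congr 1
    refine lintegral_congr fun x => ?_
    rw [ENNReal.ofReal_pow (norm_nonneg _), ofReal_norm]
  rw [key f h.memLim]
  simp_rw [fun n => key (F n) (h.mem n)]
  have ht : Tendsto (fun n => (h.mem n).toLp (F n)) atTop (𝓝 (h.memLim.toLp f)) := by
    rw [tendsto_iff_edist_tendsto_0]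
    simp_rw [Lp.edist_toLp_toLp]
    exact h.tendsto
  exact (ht.norm).pow 2

lemma L2Lim.integral_weight {ι : Type*} [Fintype ι]
    {K : Set (E N)} (hK : IsCompact K) {W : E N → ℝ} (hW : ContinuousOn W K) (hW0 : ∀ x, 0 ≤ W x)
    {F : ι → ℕ → E N → ℂ} {f : ι → E N → ℂ} (h : ∀ i, L2Lim μ (F i) (f i))
    (hF : ∀ i n x, x ∉ K → F i n x = 0) (hf : ∀ i x, x ∉ K → f i x = 0) :
    Tendsto (fun n => ∫ x, (∑ i, ‖F i n x‖ ^ 2) * W x ∂μ) atTop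
      (𝓝 (∫ x, (∑ i, ‖f i x‖ ^ 2) * W x ∂μ)) := by
  set m : E N → ℂ := K.indicator fun x => (√(W x) : ℂ) with hm
  have hmm : IsMult μ m := isMult_indicator hK (Complex.continuous_ofReal.comp_continuousOn hW.sqrt)
  have pt : ∀ x (a : ℂ), (x ∉ K → a = 0) → ‖m x * a‖ ^ 2 = ‖a‖ ^ 2 * W x := by
    intro x a ha
    by_cases hx : x ∈ K
    · rw [hm, indicator_of_mem hx, norm_mul, mul_pow, norm_real, norm_eq_abs, sq_abs,
        sq_sqrt (hW0 x), mul_comm]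
    · simp [ha hx]
  have e : ∀ a : ι → E N → ℂ, (∀ i, MemLp (a i) 2 μ) → (∀ i x, x ∉ K → a i x = 0) →
      ∫ x, (∑ i, ‖a i x‖ ^ 2) * W x ∂μ = ∑ i, ∫ x, ‖m x * a i x‖ ^ 2 ∂μ := by
    intro a ha h0
    rw [← integral_finsetSum _ fun i _ => (hmm.memLp (ha i)).integrable_norm_pow (by norm_num)]
    congr 1; ext x
    rw [sum_mul]
    exact sum_congr rfl fun i _ => (pt x _ (h0 i x)).symm
  rw [e f (fun i => (h i).memLim) hf]
  simp_rw [fun n => e (fun i => F i n) (fun i => (h i).mem n) fun i => hF i n]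
  exact tendsto_finsetSum _ fun i _ => ((h i).mult hmm).integral_norm_sq

lemma moll_eq_zero {K : Set (E N)} (hg : ∀ x, x ∉ K → g x = 0)
    (hr : r ≤ ε) (hη : IsMollifier μ r η) (hx : x ∉ cthickening ε K) :
    moll μ (fun y => (η y : ℂ)) g x = 0 := by
  refine integral_eq_zero_of_ae (Filter.Eventually.of_forall fun y => ?_)
  by_cases hy : y ∈ K
  · have : r < ‖x - y‖ := by
      by_contra h
      exact hx (mem_cthickening_of_dist_le x y ε K hy (by rw [dist_eq_norm]; linarith [not_lt.1 h]))
    simp [hη.zero _ this]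
  · simp [hg y hy]

/-- The weighted a priori inequality for compactly supported square integrable forms whose
divergence and `∂̄` are square integrable in the weak sense. -/
lemma weak_inequality (hD : IsOpen D) (hφ : ContDiffOn ℝ 2 φ D) (hψ : ContDiffOn ℝ 2 ψ D)
    (hlevi : ∀ x ∈ D, ∀ v : E N,
      2 * (∑ j, ‖dee[j] (fun y => (ψ y : ℂ)) x‖ ^ 2 + exp (ψ x)) * ‖v‖ ^ 2 ≤ levi φ x v)
    {K : Set (E N)} (hK : IsCompact K) (hKD : K ⊆ D) {d : E N → ℂ} {σ : Fin N → Fin N → E N → ℂ}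
    (hα : ∀ j, MemLp (α j) 2 μ) (hd : MemLp d 2 μ) (hσ : ∀ j k, MemLp (σ j k) 2 μ)
    (hα0 : ∀ j x, x ∉ K → α j x = 0) (hd0 : ∀ x, x ∉ K → d x = 0)
    (hσ0 : ∀ j k x, x ∉ K → σ j k x = 0)
    (hdiv : ∀ β : E N → ℂ, ContDiff ℝ 2 β → HasCompactSupport β →
      ∑ j, ∫ x, α j x * dee[j] β x ∂μ = -∫ x, d x * β x ∂μ)
    (hcurl : ∀ j k, ∀ β : E N → ℂ, ContDiff ℝ 2 β → HasCompactSupport β →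
      ∫ x, α j x * dbar[k] β x ∂μ - ∫ x, α k x * dbar[j] β x ∂μ = -∫ x, σ j k x * β x ∂μ) :
    ∫ x, (∑ j, ‖α j x‖ ^ 2) * (exp (ψ x) * exp (-φ x)) ∂μ ≤
      ∫ x, ‖d x - ∑ j, (dee[j] (fun y => (φ y : ℂ)) x -
        dee[j] (fun y => (ψ y : ℂ)) x) * α j x‖ ^ 2 * exp (-φ x) ∂μ +
      (1 / 4) * ∫ x, (∑ j, ∑ k, ‖σ j k x‖ ^ 2) * exp (-φ x) ∂μ := by
  obtain ⟨ε, hε, hεD⟩ := hK.exists_cthickening_subset_open hD hKD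
  set K' := cthickening ε K with hK'
  have hK'c : IsCompact K' := hK.cthickening
  have hKK' : K ⊆ K' := self_subset_cthickening K
  set c : Fin N → E N → ℂ := fun j x => dee[j] (fun y => (φ y : ℂ)) x -
        dee[j] (fun y => (ψ y : ℂ)) x with hc
  have hcc : ∀ j, ContinuousOn (c j) K' := by
    have h0 : ∀ f : E N → ℝ, ContDiffOn ℝ 2 f D → ∀ j,
        ContinuousOn (dee[j] fun y => (f y : ℂ)) K' := fun f hf j x hx =>
      (ContDiffAt.cderiv (contDiffAt_ofReal (hf.contDiffAt (hD.mem_nhds (hεD hx)))) (m := 0)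
        (by norm_num) _).continuousAt.continuousWithinAt
    exact fun j => (h0 φ hφ j).sub (h0 ψ hψ j)
  have hφc : ContinuousOn φ K' := hφ.continuousOn.mono hεD
  have hψc : ContinuousOn ψ K' := hψ.continuousOn.mono hεD
  set r : ℕ → ℝ := fun n => ε / (n + 1) with hr
  have hr0 : ∀ n, 0 < r n := fun n => by positivity
  have hrε : ∀ n, r n ≤ ε := fun n => div_le_self hε.le (by linarith [n.cast_nonneg (α := ℝ)])
  have hrt : Tendsto r atTop (𝓝 0) := by
    have := tendsto_one_div_add_atTop_nhds_zero_nat (𝕜 := ℝ)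
    have := this.const_mul ε
    simpa [hr, div_eq_mul_inv] using this
  choose η hη using fun n => exists_mollifier (μ := μ) (hr0 n)
  set m : (E N → ℂ) → ℕ → E N → ℂ := fun g n => moll μ (fun y => (η n y : ℂ)) g with hm
  have hli : ∀ g : E N → ℂ, MemLp g 2 μ → LocallyIntegrable g μ := fun g hg =>
    hg.locallyIntegrable (by norm_num)
  have m2 : ∀ g, MemLp g 2 μ → ∀ n, ContDiff ℝ 2 (m g n) := fun g hg n =>
    contDiff_moll (hη n).contDiff_complex (hη n).hasCompactSupport_complex (hli g hg)
  have m0 : ∀ g, (∀ x, x ∉ K → g x = 0) → ∀ n x, x ∉ K' → m g n x = 0 := fun g hg n x hx =>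
    moll_eq_zero hg (hrε n) (hη n) hx
  have mL : ∀ g, MemLp g 2 μ → (∀ x, x ∉ K → g x = 0) → L2Lim μ (m g) g := by
    intro g hg h0
    refine ⟨fun n => (m2 g hg n).continuous.memLp_of_hasCompactSupport
      (HasCompactSupport.intro hK'c (m0 g h0 n)), hg, ?_⟩
    rw [ENNReal.tendsto_nhds_zero]
    intro e he
    obtain ⟨δ, hδ, H⟩ := exists_moll_close hg he
    filter_upwards [hrt.eventually (Iio_mem_nhds hδ)] with n hn
    exact H (r n) (le_of_lt hn) (η n) (hη n)
  have hη1 : ∀ n, ContDiff ℝ 1 fun x => (η n x : ℂ) := fun n =>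
    (hη n).contDiff_complex.of_le (by norm_num)
  have hηc : ∀ n, HasCompactSupport fun x => (η n x : ℂ) := fun n =>
    (hη n).hasCompactSupport_complex
  have ddiv : ∀ n x, ∑ j, dee[j] (m (α j) n) x = m d n x := by
    intro n x
    have h1 := hdiv (fun y => (η n (x - y) : ℂ))
      ((hη n).contDiff_complex.comp (contDiff_const.sub contDiff_id))
      (hasCompactSupport_const_sub (hηc n) x)
    have h2 : ∀ j y, α j y * dee[j] (fun y => (η n (x - y) : ℂ)) y =
        -(dee[j] (fun y => (η n y : ℂ)) (x - y) * α j y) := fun j y => by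
      rw [cderiv_comp_const_sub (hη1 n)]; ring
    simp_rw [h2, integral_neg, Finset.sum_neg_distrib] at h1
    simp only [hm, fun j => cderiv_moll (hη1 n) (hηc n) (hli _ (hα j)) (-I) x]
    simp only [moll]
    rw [neg_inj.1 h1]
    exact integral_congr_ae (Filter.Eventually.of_forall fun y => mul_comm _ _)
  have dcurl : ∀ n j k x, dbar[k] (m (α j) n) x - dbar[j] (m (α k) n) x = m (σ j k) n x := by
    intro n j k x
    have h1 := hcurl j k (fun y => (η n (x - y) : ℂ))
      ((hη n).contDiff_complex.comp (contDiff_const.sub contDiff_id))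
      (hasCompactSupport_const_sub (hηc n) x)
    have h2 : ∀ j k y, α j y * dbar[k] (fun y => (η n (x - y) : ℂ)) y =
        -(dbar[k] (fun y => (η n y : ℂ)) (x - y) * α j y) := fun j k y => by
      rw [cderiv_comp_const_sub (hη1 n)]; ring
    simp_rw [h2, integral_neg] at h1
    simp only [hm, fun j => cderiv_moll (hη1 n) (hηc n) (hli _ (hα j)) I x]
    simp only [moll]
    have h3 : ∫ y, (η n (x - y) : ℂ) * σ j k y ∂μ = ∫ y, σ j k y * (η n (x - y) : ℂ) ∂μ :=
      integral_congr_ae (Filter.Eventually.of_forall fun y => mul_comm _ _)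
    rw [h3]
    linear_combination -h1
  have ineq : ∀ n, ∫ x, (∑ j, ‖m (α j) n x‖ ^ 2) * (exp (ψ x) * exp (-φ x)) ∂μ ≤
      ∫ x, (∑ _i : Fin 1, ‖m d n x - ∑ j, K'.indicator (c j) x * m (α j) n x‖ ^ 2) * exp (-φ x) ∂μ +
      (1 / 4) * ∫ x, (∑ p : Fin N × Fin N, ‖m (σ p.1 p.2) n x‖ ^ 2) * exp (-φ x) ∂μ := by
    intro n
    have h := weighted_inequality (μ := μ) hD hφ hψ (α := fun j => m (α j) n) (fun j =>
      ⟨m2 _ (hα j) n, HasCompactSupport.intro hK'c (m0 _ (hα0 j) n),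
        (closure_minimal (fun x (hx : m (α j) n x ≠ 0) => by_contra fun h => hx (m0 _ (hα0 j) n x h))
          hK'c.isClosed).trans hεD⟩) hlevi
    simp_rw [dcurl n, sum_sub_distrib, ddiv n, mul_assoc] at h
    simp only [Finset.univ_unique, sum_const, Finset.card_singleton, one_smul,
      Fintype.sum_prod_type]
    have e : ∀ x, ∑ j, K'.indicator (c j) x * m (α j) n x = ∑ j, c j x * m (α j) n x := fun x =>
      sum_congr rfl fun j _ => by
        by_cases hx : x ∈ K'
        · rw [indicator_of_mem hx]
        · simp [m0 _ (hα0 j) n x hx]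
    simp_rw [e]
    exact h
  have hW2 : ContinuousOn (fun x => exp (-φ x)) K' := hφc.neg.rexp
  have hW1 : ContinuousOn (fun x => exp (ψ x) * exp (-φ x)) K' := hψc.rexp.mul hW2
  have t1 := L2Lim.integral_weight (μ := μ) hK'c hW1 (fun x => by positivity)
    (fun j => mL (α j) (hα j) (hα0 j)) (fun j n x hx => m0 _ (hα0 j) n x hx)
    fun j x hx => hα0 j x fun h => hx (hKK' h)
  have t2 := L2Lim.integral_weight (μ := μ) hK'c hW2 (fun x => by positivity)
    (F := fun (_ : Fin 1) n x => m d n x - ∑ j, K'.indicator (c j) x * m (α j) n x)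
    (f := fun (_ : Fin 1) x => d x - ∑ j, K'.indicator (c j) x * α j x)
    (fun _ => (mL d hd hd0).sub (L2Lim.sum _ fun j =>
      (mL (α j) (hα j) (hα0 j)).mult (isMult_indicator hK'c (hcc j))))
    (fun _ n x hx => by simp [m0 _ hd0 n x hx, hx])
    (fun _ x hx => by simp [hd0 x fun h => hx (hKK' h), hx])
  have t3 := L2Lim.integral_weight (μ := μ) hK'c hW2 (fun x => by positivity)
    (F := fun (p : Fin N × Fin N) n x => m (σ p.1 p.2) n x) (f := fun p => σ p.1 p.2)
    (fun p => mL _ (hσ p.1 p.2) (hσ0 p.1 p.2)) (fun p n x hx => m0 _ (hσ0 p.1 p.2) n x hx)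
    fun p x hx => hσ0 p.1 p.2 x fun h => hx (hKK' h)
  have lim := le_of_tendsto_of_tendsto' t1 (t2.add (t3.const_mul (1 / 4))) ineq
  simp only [Finset.univ_unique, sum_const, Finset.card_singleton, one_smul,
    Fintype.sum_prod_type] at lim
  have e : ∀ x, ∑ j, K'.indicator (c j) x * α j x = ∑ j, c j x * α j x := fun x =>
    sum_congr rfl fun j _ => by
      by_cases hx : x ∈ K'
      · rw [indicator_of_mem hx]
      · simp [hα0 j x fun h => hx (hKK' h)]
  simp_rw [e] at lim
  exact lim

/-- Weights and cutoff functions on an open set suitable for solving the `∂̄`-equation. -/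
structure WeightData (D : Set (E N)) (φ ψ : E N → ℝ) (σ : ℕ → E N → ℝ) : Prop where
  isOpen : IsOpen D
  contDiffOn_fst : ContDiffOn ℝ 2 φ D
  contDiffOn_snd : ContDiffOn ℝ 2 ψ D
  levi_le : ∀ x ∈ D, ∀ v : E N,
    2 * (∑ j, ‖dee[j] (fun y => (ψ y : ℂ)) x‖ ^ 2 + exp (ψ x)) * ‖v‖ ^ 2 ≤ levi φ x v
  contDiff_cut : ∀ n, ContDiff ℝ 2 (σ n)
  compact_cut : ∀ n, HasCompactSupport (σ n)
  sub_cut : ∀ n, tsupport (σ n) ⊆ D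
  cut_mem : ∀ n x, σ n x ∈ Icc (0 : ℝ) 1
  cut_eventually : ∀ x ∈ D, ∀ᶠ n in atTop, ∀ᶠ y in 𝓝 x, σ n y = 1
  cut_grad : ∀ n, ∀ x ∈ D, ∑ j, ‖dee[j] (fun y => (σ n y : ℂ)) x‖ ^ 2 ≤ exp (ψ x)

/-- The logarithmic derivative of the quotient of the weights. -/
def wlog (φ ψ : E N → ℝ) (j : Fin N) (x : E N) : ℂ :=
  dee[j] (fun y => (φ y : ℂ)) x - dee[j] (fun y => (ψ y : ℂ)) x

/-- The square root of the quotient of the weights. -/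
def wq (φ ψ : E N → ℝ) (x : E N) : ℂ := ((exp ((φ x - ψ x) / 2) : ℝ) : ℂ)


lemma continuous_of_continuousOn_of_zero {S : Set (E N)} (hD : IsOpen D) (hS : IsClosed S)
    (hSD : S ⊆ D) (hh : ContinuousOn h D) (h0 : ∀ x, x ∉ S → h x = 0) :
    Continuous h := by
  rw [continuous_iff_continuousAt]
  intro x
  by_cases hx : x ∈ D
  · exact hh.continuousAt (hD.mem_nhds hx)
  · have : h =ᶠ[𝓝 x] fun _ => 0 := by
      filter_upwards [hS.isOpen_compl.mem_nhds fun h => hx (hSD h)] with y hy using h0 y hy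
    exact continuousAt_const.congr this.symm

lemma integrable_mul_of_compact {a : E N → ℂ} (ha : MemLp a 2 μ) (hh : Continuous h)
    (hc : HasCompactSupport h) : Integrable (fun x => a x * h x) μ :=
  ha.integrable_mul (q := 2) (hh.memLp_of_hasCompactSupport hc)

lemma memLp_mul_of_compact {a : E N → ℂ} (ha : MemLp a 2 μ) (hh : Continuous h)
    (hc : HasCompactSupport h) : MemLp (fun x => h x * a x) 2 μ := by
  obtain ⟨C, hC⟩ := hh.bounded_above_of_compact_support hc
  exact IsMult.memLp ⟨hh.aestronglyMeasurable, C, hC⟩ ha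

lemma WeightData.continuousOn_wlog (w : WeightData D φ ψ σ) (j : Fin N) : ContinuousOn (wlog φ ψ j) D := by
  have h0 : ∀ f : E N → ℝ, ContDiffOn ℝ 2 f D →
      ContinuousOn (dee[j] fun y => (f y : ℂ)) D := fun f hf x hx =>
    (ContDiffAt.cderiv (contDiffAt_ofReal (hf.contDiffAt (w.isOpen.mem_nhds hx))) (m := 0)
      (by norm_num) _).continuousAt.continuousWithinAt
  exact (h0 φ w.contDiffOn_fst).sub (h0 ψ w.contDiffOn_snd)

lemma WeightData.continuousOn_wq (w : WeightData D φ ψ σ) : ContinuousOn (wq φ ψ) D :=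
  Complex.continuous_ofReal.comp_continuousOn
    (((w.contDiffOn_fst.continuousOn.sub w.contDiffOn_snd.continuousOn).div_const 2).rexp)

lemma norm_wq_sq_mul (φ ψ : E N → ℝ) (x : E N) : ‖wq φ ψ x‖ ^ 2 * exp (-φ x) = exp (-ψ x) := by
  rw [wq, norm_real, norm_eq_abs, sq_abs, ← Real.exp_nat_mul, ← exp_add]
  congr 1; push_cast; ring

lemma WeightData.cut_complex (w : WeightData D φ ψ σ) (n : ℕ) : IsTest D fun x => (σ n x : ℂ) where
  contDiff := Complex.ofRealCLM.contDiff.comp (w.contDiff_cut n)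
  compact := (w.compact_cut n).comp_left (g := Complex.ofReal) ofReal_zero
  sub := (tsupport_comp_subset (g := Complex.ofReal) ofReal_zero _).trans (w.sub_cut n)

lemma IsTest.mul {β : E N → ℂ} (hγ : IsTest D γ) (hβ : ContDiff ℝ 2 β) :
    IsTest D fun x => γ x * β x where
  contDiff := hγ.contDiff.mul hβ
  compact := hγ.compact.mul_right
  sub := (tsupport_mul_subset_left).trans hγ.sub

/-- The basic inequality for weakly closed forms with a given divergence. -/
lemma WeightData.closed_inequality (w : WeightData D φ ψ σ) {a : Fin N → E N → ℂ}
    (ha : ∀ j, MemLp (a j) 2 μ) (hg : Continuous g) (hgc : HasCompactSupport g)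
    (hgD : tsupport g ⊆ D)
    (hdiv : ∀ γ, IsTest D γ → ∑ j, ∫ x, a j x * (wq φ ψ x * (dee[j] γ x +
      wlog φ ψ j x * γ x)) ∂μ = ∫ x, g x * γ x ∂μ)
    (hcurl : ∀ j k, ∀ γ, IsTest D γ → ∫ x, a j x * (wq φ ψ x * dbar[k] γ x) ∂μ -
      ∫ x, a k x * (wq φ ψ x * dbar[j] γ x) ∂μ = 0) :
    ∫ x in D, ∑ j, ‖a j x‖ ^ 2 ∂μ ≤ ∫ x in D, ‖g x‖ ^ 2 * exp (-φ x) ∂μ := by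
  set q := wq φ ψ with hq
  set c := wlog φ ψ with hc
  set e : ℕ → E N → ℂ := fun n x => (σ n x : ℂ) with he
  have het : ∀ n, IsTest D (e n) := w.cut_complex
  have hDm : MeasurableSet D := w.isOpen.measurableSet
  have ez : ∀ n x, x ∉ tsupport (e n) → e n x = 0 := fun n x => image_eq_zero_of_notMem_tsupport
  have qc := w.continuousOn_wq
  have cc := w.continuousOn_wlog
  have dc : ∀ n j, Continuous (dee[j] (e n)) := fun n j => (het n).contDiff.continuous_cderiv
  have bc : ∀ n j, Continuous (dbar[j] (e n)) := fun n j => (het n).contDiff.continuous_cderiv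
  have dz : ∀ n j x, x ∉ tsupport (e n) → dee[j] (e n) x = 0 := fun n j x hx =>
    cderiv_eq_zero_of_notMem hx
  have bz : ∀ n j x, x ∉ tsupport (e n) → dbar[j] (e n) x = 0 := fun n j x hx =>
    cderiv_eq_zero_of_notMem hx
  have cont : ∀ n (h : E N → ℂ), ContinuousOn h D → (∀ x, x ∉ tsupport (e n) → h x = 0) →
      Continuous h ∧ HasCompactSupport h := fun n h h1 h0 =>
    ⟨continuous_of_continuousOn_of_zero w.isOpen (isClosed_tsupport _) (het n).sub h1 h0,
      HasCompactSupport.intro (het n).compact h0⟩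
  have k1 : ∀ n, Continuous (fun x => q x * e n x) ∧ HasCompactSupport fun x => q x * e n x :=
    fun n => cont n _ (qc.mul (het n).contDiff.continuous.continuousOn) fun x hx => by
      simp [ez n x hx]
  have k2 : ∀ n j, Continuous (fun x => q x * (dee[j] (e n) x + c j x * e n x)) ∧
      HasCompactSupport fun x => q x * (dee[j] (e n) x + c j x * e n x) :=
    fun n j => cont n _ (qc.mul ((dc n j).continuousOn.add
      ((cc j).mul (het n).contDiff.continuous.continuousOn))) fun x hx => by
        simp [ez n x hx, dz n j x hx]
  have k3 : ∀ n j, Continuous (fun x => q x * dbar[j] (e n) x) ∧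
      HasCompactSupport fun x => q x * dbar[j] (e n) x :=
    fun n j => cont n _ (qc.mul (bc n j).continuousOn) fun x hx => by simp [bz n j x hx]
  set d : ℕ → E N → ℂ := fun n x => -(g x * e n x) +
    ∑ j, q x * (dee[j] (e n) x + c j x * e n x) * a j x with hd
  set τ : ℕ → Fin N → Fin N → E N → ℂ := fun n j k x =>
    q x * dbar[k] (e n) x * a j x - q x * dbar[j] (e n) x * a k x with hσ
  have ineq : ∀ n, _ := fun n => weak_inequality (μ := μ) w.isOpen w.contDiffOn_fst w.contDiffOn_snd
    w.levi_le (het n).compact (het n).sub (α := fun j x => q x * e n x * a j x) (d := d n)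
    (σ := τ n) (fun j => memLp_mul_of_compact (ha j) (k1 n).1 (k1 n).2)
    ((((hg.mul (het n).contDiff.continuous).memLp_of_hasCompactSupport hgc.mul_right).neg).add
      (memLp_finsetSum _ fun j _ => memLp_mul_of_compact (ha j) (k2 n j).1 (k2 n j).2))
    (fun j k => (memLp_mul_of_compact (ha j) (k3 n k).1 (k3 n k).2).sub
      (memLp_mul_of_compact (ha k) (k3 n j).1 (k3 n j).2))
    (fun j x hx => by simp [ez n x hx])
    (fun x hx => by simp [hd, ez n x hx, fun j => dz n j x hx])
    (fun j k x hx => by simp [hσ, fun j => bz n j x hx])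
    (fun β hβ hβc => by
      have h := hdiv _ ((het n).mul hβ)
      have hβd : ∀ j, Continuous (dee[j] β) := fun j => hβ.continuous_cderiv
      have e1 : ∀ j x, a j x * (q x * (dee[j] (fun x => e n x * β x) x +
          c j x * (e n x * β x))) = q x * e n x * a j x * dee[j] β x +
          q x * (dee[j] (e n) x + c j x * e n x) * a j x * β x := fun j x => by
        rw [cderiv_mul ((het n).contDiff.differentiable (by norm_num) x)
          (hβ.differentiable (by norm_num) x)]
        ring
      have i1 : ∀ j, Integrable (fun x => q x * e n x * a j x * dee[j] β x) μ := fun j =>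
        integrable_mul_of_compact (memLp_mul_of_compact (ha j) (k1 n).1 (k1 n).2) (hβd j)
          (HasCompactSupport.cderiv hβc _)
      have i2 : ∀ j, Integrable (fun x => q x * (dee[j] (e n) x + c j x * e n x) *
          a j x * β x) μ := fun j =>
        integrable_mul_of_compact (memLp_mul_of_compact (ha j) (k2 n j).1 (k2 n j).2)
          hβ.continuous hβc
      simp_rw [e1, fun j => integral_add (i1 j) (i2 j), sum_add_distrib] at h
      have i3 : Integrable (fun x => -(g x * e n x) * β x) μ :=
        ((hg.mul (het n).contDiff.continuous).neg.mul hβ.continuous).integrable_of_hasCompactSupport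
          (hβc.mul_left)
      have e2 : ∫ x, d n x * β x ∂μ = ∫ x, -(g x * e n x) * β x ∂μ +
          ∑ j, ∫ x, q x * (dee[j] (e n) x + c j x * e n x) * a j x * β x ∂μ := by
        rw [← integral_finsetSum _ fun j _ => i2 j,
          ← integral_add i3 (integrable_finsetSum _ fun j _ => i2 j)]
        congr 1; ext x
        simp only [hd, add_mul, sum_mul]
      have e3 : ∫ x, -(g x * e n x) * β x ∂μ = -∫ x, g x * (e n x * β x) ∂μ := by
        rw [← integral_neg]; congr 1; ext x; ring
      rw [e2, e3, ← h]; ring)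
    (fun j k β hβ hβc => by
      have h := hcurl j k _ ((het n).mul hβ)
      have hβd : ∀ j, Continuous (dbar[j] β) := fun j => hβ.continuous_cderiv
      have e1 : ∀ j k x, a j x * (q x * dbar[k] (fun x => e n x * β x) x) =
          q x * e n x * a j x * dbar[k] β x +
          q x * dbar[k] (e n) x * a j x * β x := fun j k x => by
        rw [cderiv_mul ((het n).contDiff.differentiable (by norm_num) x)
          (hβ.differentiable (by norm_num) x)]
        ring
      have i1 : ∀ j k, Integrable (fun x => q x * e n x * a j x * dbar[k] β x) μ :=
        fun j k => integrable_mul_of_compact (memLp_mul_of_compact (ha j) (k1 n).1 (k1 n).2)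
          (hβd k) (HasCompactSupport.cderiv hβc _)
      have i2 : ∀ j k, Integrable (fun x => q x * dbar[k] (e n) x * a j x * β x) μ :=
        fun j k => integrable_mul_of_compact (memLp_mul_of_compact (ha j) (k3 n k).1 (k3 n k).2)
          hβ.continuous hβc
      simp_rw [e1, fun j k => integral_add (i1 j k) (i2 j k)] at h
      have e2 : ∫ x, τ n j k x * β x ∂μ = ∫ x, q x * dbar[k] (e n) x * a j x * β x ∂μ -
          ∫ x, q x * dbar[j] (e n) x * a k x * β x ∂μ := by
        rw [← integral_sub (i2 j k) (i2 k j)]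
        congr 1; ext x
        simp only [hσ, sub_mul]
      rw [e2]
      linear_combination h)
  have qq : ∀ x, ‖q x‖ ^ 2 * exp (-φ x) = exp (-ψ x) := norm_wq_sq_mul φ ψ
  set S : E N → ℝ := fun x => ∑ j, ‖a j x‖ ^ 2 with hS
  have hSi : Integrable S μ :=
    integrable_finsetSum _ fun j _ => (ha j).integrable_norm_pow (by norm_num)
  set P : ℕ → E N → ℝ := fun n x => (σ n x) ^ 2 * S x with hP
  set Q : ℕ → E N → ℝ := fun n x => ‖-(g x * e n x) +
    ∑ j, dee[j] (e n) x * (q x * a j x)‖ ^ 2 * exp (-φ x) with hQ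
  set R : ℕ → E N → ℝ := fun n x => (∑ j, ∑ k, ‖τ n j k x‖ ^ 2) * exp (-φ x) with hR
  have ineq2 : ∀ n, ∫ x in D, P n x ∂μ ≤ ∫ x in D, Q n x ∂μ + (1 / 4) * ∫ x in D, R n x ∂μ := by
    intro n
    have h := ineq n
    have hzD : ∀ x, x ∉ D → x ∉ tsupport (e n) := fun x hx h => hx ((het n).sub h)
    rw [setIntegral_eq_integral_of_forall_compl_eq_zero, setIntegral_eq_integral_of_forall_compl_eq_zero,
      setIntegral_eq_integral_of_forall_compl_eq_zero]
    · convert h using 2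
      · ext x
        simp only [hP, hS, norm_mul, mul_pow]
        rw [← mul_sum]
        have h1 := qq x
        have h2 : ‖q x‖ ^ 2 * (exp (ψ x) * exp (-φ x)) = 1 := by
          rw [mul_comm (exp _), ← mul_assoc, h1, ← exp_add]; simp
        rw [show ‖e n x‖ ^ 2 = σ n x ^ 2 by simp [he]]
        linear_combination (-(σ n x ^ 2) * ∑ i, ‖a i x‖ ^ 2) * h2
      · congr 1; ext x
        simp only [hQ]
        congr 3
        simp only [hd, add_sub_assoc, ← sum_sub_distrib]
        congr 1
        refine sum_congr rfl fun j _ => ?_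
        simp only [hc, wlog]; ring
    · intro x hx
      simp only [hR, hσ, fun j => bz n j x (hzD x hx)]; simp
    · intro x hx
      simp [hQ, ez n x (hzD x hx), fun j => dz n j x (hzD x hx)]
    · intro x hx
      have : σ n x = 0 := by simpa [he] using ez n x (hzD x hx)
      simp [hP, this]
  have am : ∀ j, AEStronglyMeasurable (a j) (μ.restrict D) := fun j => (ha j).1.restrict
  have ωm : AEStronglyMeasurable (fun x => exp (-φ x)) (μ.restrict D) :=
    (w.contDiffOn_fst.continuousOn.neg.rexp).aestronglyMeasurable hDm
  have qm : AEStronglyMeasurable q (μ.restrict D) := qc.aestronglyMeasurable hDm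
  have gωi : Integrable (fun x => ‖g x‖ ^ 2 * exp (-φ x)) (μ.restrict D) := by
    have h1 : ContinuousOn (fun x => ((‖g x‖ ^ 2 * exp (-φ x) : ℝ) : ℂ)) D :=
      Complex.continuous_ofReal.comp_continuousOn
        ((hg.norm.pow 2).continuousOn.mul w.contDiffOn_fst.continuousOn.neg.rexp)
    have hz : ∀ x, x ∉ tsupport g → ((‖g x‖ ^ 2 * exp (-φ x) : ℝ) : ℂ) = 0 := fun x hx => by
      simp [image_eq_zero_of_notMem_tsupport hx]
    have h2 := (continuous_of_continuousOn_of_zero w.isOpen (isClosed_tsupport _) hgD h1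
      hz).integrable_of_hasCompactSupport (μ := μ) (HasCompactSupport.intro hgc hz)
    have h3 := h2.re
    simp only [RCLike.re_to_complex, ofReal_re] at h3
    exact h3.restrict
  have grad : ∀ n, ∀ x ∈ D, (∑ j, ‖dee[j] (e n) x‖ ^ 2) * exp (-ψ x) ≤ 1 := by
    intro n x hx
    have := mul_le_mul_of_nonneg_right (w.cut_grad n x hx) (exp_nonneg (-ψ x))
    rwa [← exp_add, add_neg_cancel, exp_zero] at this
  have nbar : ∀ n j x, ‖dbar[j] (e n) x‖ = ‖dee[j] (e n) x‖ := fun n j x => by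
    rw [he, dbar_ofReal ((w.contDiff_cut n).differentiable (by norm_num) x), norm_conj]
  have dvan : ∀ n x, (∀ᶠ y in 𝓝 x, σ n y = 1) → (∀ j, dee[j] (e n) x = 0) ∧
      (∀ j, dbar[j] (e n) x = 0) ∧ e n x = 1 := by
    intro n x h
    have h1 : e n =ᶠ[𝓝 x] fun _ => (1 : ℂ) := h.mono fun y hy => by simp [he, hy]
    refine ⟨fun j => ?_, fun j => ?_, h1.eq_of_nhds⟩
    · rw [cderiv_congr h1]; simp [cderiv]
    · rw [cderiv_congr h1]; simp [cderiv]
  have σm : ∀ n, Continuous (σ n) := fun n => (w.contDiff_cut n).continuous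
  have tP : Tendsto (fun n => ∫ x in D, P n x ∂μ) atTop (𝓝 (∫ x in D, S x ∂μ)) := by
    refine tendsto_integral_of_dominated_convergence S
      (fun n => ((σm n).pow 2).aestronglyMeasurable.mul hSi.1.restrict) hSi.restrict
      (fun n => Filter.Eventually.of_forall fun x => ?_) ?_
    · have hS0 : 0 ≤ S x := sum_nonneg fun j _ => by positivity
      rw [norm_of_nonneg (by positivity)]
      have := w.cut_mem n x
      exact mul_le_of_le_one_left hS0 (pow_le_one₀ this.1 this.2)
    · filter_upwards [ae_restrict_mem hDm] with x hx
      refine tendsto_const_nhds.congr' ?_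
      filter_upwards [w.cut_eventually x hx] with n hn
      simp [hP, hn.self_of_nhds]
  have tQ : Tendsto (fun n => ∫ x in D, Q n x ∂μ) atTop
      (𝓝 (∫ x in D, ‖g x‖ ^ 2 * exp (-φ x) ∂μ)) := by
    refine tendsto_integral_of_dominated_convergence
      (fun x => 2 * (‖g x‖ ^ 2 * exp (-φ x)) + 2 * S x) (fun n => ?_)
      ((gωi.const_mul 2).add (hSi.restrict.const_mul 2)) (fun n => ?_) ?_
    · refine AEStronglyMeasurable.mul (AEStronglyMeasurable.pow (AEStronglyMeasurable.norm
        (((hg.mul (het n).contDiff.continuous).neg.aestronglyMeasurable).add ?_)) 2) ωm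
      exact Finset.aestronglyMeasurable_fun_sum _ fun j _ =>
        (dc n j).aestronglyMeasurable.mul (qm.mul (am j))
    · filter_upwards [ae_restrict_mem hDm] with x hx
      rw [norm_of_nonneg (by positivity)]
      have h1 := norm_sub_sq_le (-(g x * e n x)) (-∑ j, dee[j] (e n) x * (q x * a j x))
      rw [sub_neg_eq_add, norm_neg, norm_neg, norm_mul, mul_pow] at h1
      have h2 := norm_sum_mul_sq_le (fun j => dee[j] (e n) x) fun j => q x * a j x
      simp only [norm_mul, mul_pow] at h2
      rw [← mul_sum] at h2
      have h3 : ‖e n x‖ ^ 2 ≤ 1 := by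
        have := w.cut_mem n x
        simp only [he, norm_real, norm_eq_abs, sq_abs]
        exact pow_le_one₀ this.1 this.2
      have hS0 : 0 ≤ S x := sum_nonneg fun j _ => by positivity
      have h4 := mul_le_mul_of_nonneg_right (grad n x hx) hS0
      have h5 := mul_le_mul_of_nonneg_right (h1.trans (add_le_add (mul_le_mul_of_nonneg_left
        (mul_le_of_le_one_right (by positivity) h3) zero_le_two)
        (mul_le_mul_of_nonneg_left h2 zero_le_two))) (exp_nonneg (-φ x))
      refine h5.trans ?_
      have := qq x
      rw [← this] at h4
      change _ ≤ 2 * (‖g x‖ ^ 2 * exp (-φ x)) + 2 * S x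
      have h6 : (∑ i, ‖a i x‖ ^ 2) = S x := rfl
      rw [h6]
      linarith
    · filter_upwards [ae_restrict_mem hDm] with x hx
      refine tendsto_const_nhds.congr' ?_
      filter_upwards [w.cut_eventually x hx] with n hn
      obtain ⟨h1, -, h3⟩ := dvan n x hn
      simp [hQ, h1, h3]
  have tR : Tendsto (fun n => ∫ x in D, R n x ∂μ) atTop (𝓝 (∫ _x in D, (0 : ℝ) ∂μ)) := by
    refine tendsto_integral_of_dominated_convergence (fun x => 4 * S x) (fun n => ?_)
      (hSi.restrict.const_mul 4) (fun n => ?_) ?_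
    · refine AEStronglyMeasurable.mul ?_ ωm
      refine Finset.aestronglyMeasurable_fun_sum _ fun j _ =>
        Finset.aestronglyMeasurable_fun_sum _ fun k _ => AEStronglyMeasurable.pow
        (AEStronglyMeasurable.norm (AEStronglyMeasurable.sub ?_ ?_)) 2
      · exact (qm.mul (bc n k).aestronglyMeasurable).mul (am j)
      · exact (qm.mul (bc n j).aestronglyMeasurable).mul (am k)
    · filter_upwards [ae_restrict_mem hDm] with x hx
      rw [norm_of_nonneg (by positivity)]
      have hS0 : 0 ≤ S x := sum_nonneg fun j _ => by positivity
      set G : ℝ := ∑ j, ‖dee[j] (e n) x‖ ^ 2 with hG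
      have h1 : ∑ j, ∑ k, ‖τ n j k x‖ ^ 2 ≤ 4 * (‖q x‖ ^ 2 * (S x * G)) := by
        have h2 : ∀ j k, ‖τ n j k x‖ ^ 2 ≤ 2 * ‖q x‖ ^ 2 * (‖a j x‖ ^ 2 *
            ‖dee[k] (e n) x‖ ^ 2) + 2 * ‖q x‖ ^ 2 * (‖dee[j] (e n) x‖ ^ 2 * ‖a k x‖ ^ 2) := by
          intro j k
          have := norm_sub_sq_le (q x * dbar[k] (e n) x * a j x) (q x * dbar[j] (e n) x * a k x)
          simp only [norm_mul, mul_pow, nbar] at this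
          refine this.trans (le_of_eq ?_)
          ring
        refine (sum_le_sum fun j _ => sum_le_sum fun k _ => h2 j k).trans ?_
        simp_rw [sum_add_distrib, ← mul_sum, ← sum_mul]
        apply le_of_eq
        simp only [hS, hG]; ring
      have h3 := mul_le_mul_of_nonneg_right h1 (exp_nonneg (-φ x))
      refine h3.trans ?_
      have h4 := mul_le_mul_of_nonneg_right (grad n x hx) hS0
      rw [← qq x] at h4
      change _ ≤ 4 * S x
      linarith
    · filter_upwards [ae_restrict_mem hDm] with x hx
      refine tendsto_const_nhds.congr' ?_
      filter_upwards [w.cut_eventually x hx] with n hn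
      obtain ⟨-, h2, -⟩ := dvan n x hn
      simp [hR, hσ, h2]
  have lim := le_of_tendsto_of_tendsto' tP (tQ.add (tR.const_mul (1 / 4))) ineq2
  simpa using lim

lemma exists_inner_eq_of_submodule {G : Type*} [NormedAddCommGroup G] [InnerProductSpace ℂ G]
    [CompleteSpace G] (S : Submodule ℂ (G × ℂ)) (hC : 0 ≤ C)
    (hS : ∀ p ∈ S, ‖p.2‖ ≤ C * ‖p.1‖) : ∃ U : G, ‖U‖ ≤ C ∧ ∀ p ∈ S, p.2 = inner ℂ U p.1 := by
  have h0 : ∀ p ∈ S, p.1 = 0 → p.2 = 0 := fun p hp h => by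
    have := hS p hp
    rw [h, norm_zero, mul_zero] at this
    exact norm_le_zero_iff.1 this
  set f := S.toLinearPMap with hf
  obtain ⟨T, hT, hTn⟩ := exists_extension_norm_eq (𝕜 := ℂ) f.domain
    (f.toFun.mkContinuous C fun x => hS _ (S.mem_graph_toLinearPMap h0 x))
  refine ⟨(InnerProductSpace.toDual ℂ G).symm T, ?_, fun p hp => ?_⟩
  · rw [LinearIsometryEquiv.norm_map, hTn]
    exact LinearMap.mkContinuous_norm_le _ hC _
  · rw [InnerProductSpace.toDual_symm_apply]
    have h1 : p.1 ∈ f.domain := ⟨p, hp, rfl⟩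
    have h2 := hT ⟨p.1, h1⟩
    rw [h2]
    have h3 := S.sub_mem hp (S.mem_graph_toLinearPMap h0 ⟨p.1, h1⟩)
    have h4 := h0 _ h3 (by simp)
    exact sub_eq_zero.1 h4

lemma contDiff_of_contDiffOn_of_zero {S : Set (E N)} (hD : IsOpen D) (hS : IsClosed S)
    (hSD : S ⊆ D) (hh : ContDiffOn ℝ 2 h D) (h0 : ∀ x, x ∉ S → h x = 0) :
    ContDiff ℝ 2 h := by
  rw [contDiff_iff_contDiffAt]
  intro x
  by_cases hx : x ∈ D
  · exact hh.contDiffAt (hD.mem_nhds hx)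
  · have : h =ᶠ[𝓝 x] fun _ => 0 := by
      filter_upwards [hS.isOpen_compl.mem_nhds fun h => hx (hSD h)] with y hy using h0 y hy
    exact contDiffAt_const.congr_of_eventuallyEq this

lemma IsTest.of_mul (hD : IsOpen D) (hγ : IsTest D γ)
    (hh : ContDiffOn ℝ 2 h D) : IsTest D fun x => h x * γ x where
  contDiff := contDiff_of_contDiffOn_of_zero hD (isClosed_tsupport γ) hγ.sub
    (hh.mul hγ.contDiff.contDiffOn) fun x hx => by simp [image_eq_zero_of_notMem_tsupport hx]
  compact := hγ.compact.mul_left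
  sub := (tsupport_mul_subset_right).trans hγ.sub

lemma IsTest.conj (hγ : IsTest D γ) : IsTest D fun x => conj (γ x) where
  contDiff := Complex.conjCLE.contDiff.comp hγ.contDiff
  compact := hγ.compact.comp_left (g := conj) (map_zero _)
  sub := (tsupport_comp_subset (g := conj) (map_zero _) _).trans hγ.sub

lemma IsTest.add {β : E N → ℂ} (hγ : IsTest D γ) (hβ : IsTest D β) :
    IsTest D fun x => γ x + β x where
  contDiff := hγ.contDiff.add hβ.contDiff
  compact := hγ.compact.add hβ.compact
  sub := (tsupport_add γ β).trans (union_subset hγ.sub hβ.sub)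

lemma IsTest.const_mul (hγ : IsTest D γ) (c : ℂ) : IsTest D fun x => c * γ x where
  contDiff := contDiff_const.mul hγ.contDiff
  compact := hγ.compact.mul_left
  sub := (tsupport_mul_subset_right).trans hγ.sub

lemma isTest_zero : IsTest D fun _ => (0 : ℂ) where
  contDiff := contDiff_const
  compact := HasCompactSupport.zero
  sub := by simp [tsupport]

section L2Tuples

variable {ν : Measure (E N)}

/-- Square integrable tuples as elements of a Hilbert space. -/
def toTuple (h : Fin N → E N → ℂ) (hh : ∀ j, MemLp (h j) 2 ν) :
    PiLp 2 fun _ : Fin N => Lp ℂ 2 ν := WithLp.toLp 2 fun j => (hh j).toLp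

lemma inner_toTuple (h : Fin N → E N → ℂ) (hh : ∀ j, MemLp (h j) 2 ν)
    (a : PiLp 2 fun _ : Fin N => Lp ℂ 2 ν) :
    inner ℂ (toTuple h hh) a = ∑ j, ∫ x, a j x * conj (h j x) ∂ν := by
  rw [PiLp.inner_apply]
  refine sum_congr rfl fun j _ => ?_
  rw [L2.inner_def]
  refine integral_congr_ae ?_
  filter_upwards [(hh j).coeFn_toLp] with x hx
  simp only [toTuple, inner_apply, hx]

lemma norm_sq_tuple (a : PiLp 2 fun _ : Fin N => Lp ℂ 2 ν) :
    ‖a‖ ^ 2 = ∫ x, ∑ j, ‖a j x‖ ^ 2 ∂ν := by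
  rw [PiLp.norm_sq_eq_of_L2, integral_finsetSum _ fun j _ =>
    (Lp.memLp (a j)).integrable_norm_pow (by norm_num)]
  refine sum_congr rfl fun j _ => ?_
  rw [← @inner_self_eq_norm_sq ℂ, L2.inner_def, ← integral_re (L2.integrable_inner _ _)]
  simp [← ofReal_pow]

end L2Tuples

lemma exists_projection_orthogonal {G : Type*} [NormedAddCommGroup G] [InnerProductSpace ℂ G]
    [CompleteSpace G] (B : Set G) (b : G) : ∃ p : G, (∀ u ∈ B, inner ℂ u p = 0) ∧
      ∀ r : G, (∀ u ∈ B, inner ℂ u r = 0) → inner ℂ r p = inner ℂ r b := by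
  set Z := (Submodule.span ℂ B)ᗮ with hZ
  have memZ : ∀ a, a ∈ Z ↔ ∀ u ∈ B, inner ℂ u a = 0 := by
    intro a
    rw [hZ, Submodule.mem_orthogonal]
    constructor
    · exact fun h u hu => h _ (Submodule.subset_span hu)
    · intro h u hu
      induction hu using Submodule.span_induction with
      | mem x hx => exact h x hx
      | zero => exact inner_zero_left _
      | add x y _ _ hx hy => rw [inner_add_left, hx, hy, add_zero]
      | smul c x _ hx => rw [inner_smul_left, hx, mul_zero]
  refine ⟨Z.starProjection b, (memZ _).1 (Submodule.starProjection_apply_mem _ _), fun r hr => ?_⟩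
  rw [← Submodule.inner_starProjection_left_eq_right,
    Submodule.starProjection_eq_self_iff.2 ((memZ r).2 hr)]


lemma IsTest.memLp (hD : IsOpen D) (hγ : IsTest D γ)
    (hh : ContinuousOn h D) (h0 : ∀ x, x ∉ tsupport γ → h x = 0) :
    MemLp h 2 (μ.restrict D) :=
  ((continuous_of_continuousOn_of_zero hD (isClosed_tsupport _) hγ.sub hh
    h0).memLp_of_hasCompactSupport (HasCompactSupport.intro hγ.compact h0)).restrict _

lemma wq_mul_wq_swap (φ ψ : E N → ℝ) (x : E N) : wq φ ψ x * wq ψ φ x = 1 := by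
  rw [wq, wq, ← ofReal_mul, ← exp_add, ← Complex.ofReal_one]
  congr 1; rw [← exp_zero]; congr 1; ring

lemma conj_wq (φ ψ : E N → ℝ) (x : E N) : conj (wq φ ψ x) = wq φ ψ x := conj_ofReal _

lemma WeightData.contDiffOn_wq_sq (w : WeightData D φ ψ σ) : ContDiffOn ℝ 2 (fun x => wq φ ψ x ^ 2) D :=
  ((Complex.ofRealCLM.contDiff.comp_contDiffOn
    (((w.contDiffOn_fst.sub w.contDiffOn_snd).div_const 2).exp)).pow 2)

lemma WeightData.dee_wq_sq (w : WeightData D φ ψ σ) (hx : x ∈ D) (j : Fin N) :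
    dee[j] (fun x => wq φ ψ x ^ 2) x = wq φ ψ x ^ 2 * wlog φ ψ j x := by
  have e : (fun x => wq φ ψ x ^ 2) = fun x => Complex.exp ((φ x : ℂ) - (ψ x : ℂ)) := by
    ext x
    rw [wq, ← ofReal_pow, ← Real.exp_nat_mul, ← Complex.ofReal_sub, ← Complex.ofReal_exp]
    congr 2; push_cast; ring
  have d : ∀ f : E N → ℝ, ContDiffOn ℝ 2 f D → DifferentiableAt ℝ (fun y => (f y : ℂ)) x :=
    fun f hf => (contDiffAt_ofReal (hf.contDiffAt (w.isOpen.mem_nhds hx))).differentiableAt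
      (by norm_num)
  have h := cderiv_cexp (s := -I) (v := basisVec j) ((d φ w.contDiffOn_fst).sub (d ψ w.contDiffOn_snd))
  rw [congrFun e x, wlog]
  simp only [e]
  refine h.trans ?_
  congr 1
  exact cderiv_sub (d φ w.contDiffOn_fst) (d ψ w.contDiffOn_snd)

lemma WeightData.dee_wq_sq_mul (w : WeightData D φ ψ σ) (hγ : IsTest D γ) (hx : x ∈ D)
    (j : Fin N) : dee[j] (fun x => wq φ ψ x ^ 2 * γ x) x =
      wq φ ψ x ^ 2 * (dee[j] γ x + wlog φ ψ j x * γ x) := by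
  rw [cderiv_mul ((w.contDiffOn_wq_sq.contDiffAt (w.isOpen.mem_nhds hx)).differentiableAt
    (by norm_num)) (hγ.contDiff.differentiable (by norm_num) x), w.dee_wq_sq hx]
  ring

/-- A tuple `a` is weakly closed, after multiplication by `wq`. -/
def WClosed (μ : Measure (E N)) (D : Set (E N)) (q : E N → ℂ) (a : Fin N → E N → ℂ) : Prop :=
  ∀ j k, ∀ γ, IsTest D γ → ∫ x in D, a j x * (q x * dbar[k] γ x) ∂μ -
      ∫ x in D, a k x * (q x * dbar[j] γ x) ∂μ = 0

lemma wClosed_congr {q : E N → ℂ} {a b : Fin N → E N → ℂ}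
    (h : ∀ j, a j =ᵐ[μ.restrict D] b j) (ha : WClosed μ D q a) : WClosed μ D q b := by
  intro j k γ hγ
  have e : ∀ (j : Fin N) (t : E N → ℂ), ∫ x in D, a j x * t x ∂μ = ∫ x in D, b j x * t x ∂μ :=
    fun j t => integral_congr_ae ((h j).mono fun x hx => by simp only [hx])
  have := ha j k γ hγ
  rwa [e j fun x => q x * dbar[k] γ x, e k fun x => q x * dbar[j] γ x] at this

/-- The generators of the orthogonal complement of the space of weakly closed tuples. -/
def curlGen (q γ : E N → ℂ) (j k i : Fin N) (x : E N) : ℂ :=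
  conj ((if i = j then q x * dbar[k] γ x else 0) - if i = k then q x * dbar[j] γ x else 0)

lemma WeightData.memLp_dbar (w : WeightData D φ ψ σ) (hγ : IsTest D γ) (j : Fin N) :
    MemLp (fun x => wq φ ψ x * dbar[j] γ x) 2 (μ.restrict D) :=
  hγ.memLp w.isOpen (w.continuousOn_wq.mul
    hγ.contDiff.continuous_cderiv.continuousOn) fun x hx => by
      rw [cderiv_eq_zero_of_notMem hx, mul_zero]

lemma WeightData.memLp_curlGen (w : WeightData D φ ψ σ) (hγ : IsTest D γ) (j k i : Fin N) :
    MemLp (curlGen (wq φ ψ) γ j k i) 2 (μ.restrict D) := by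
  refine MemLp.star (f := fun x => (if i = j then wq φ ψ x * dbar[k] γ x else 0) -
    if i = k then wq φ ψ x * dbar[j] γ x else 0) (MemLp.sub ?_ ?_)
  · by_cases h : i = j
    · simpa only [h, if_true] using w.memLp_dbar hγ k
    · simp only [h, if_false]; exact MemLp.zero
  · by_cases h : i = k
    · simpa only [h, if_true] using w.memLp_dbar hγ j
    · simp only [h, if_false]; exact MemLp.zero

lemma WeightData.inner_curlGen (w : WeightData D φ ψ σ) (hγ : IsTest D γ) (j k : Fin N)
    (a : PiLp 2 fun _ : Fin N => Lp ℂ 2 (μ.restrict D)) :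
    inner ℂ (toTuple (curlGen (wq φ ψ) γ j k) (w.memLp_curlGen hγ j k)) a =
      ∫ x in D, a j x * (wq φ ψ x * dbar[k] γ x) ∂μ -
      ∫ x in D, a k x * (wq φ ψ x * dbar[j] γ x) ∂μ := by
  rw [inner_toTuple]
  have h : ∀ i, ∫ x in D, a i x * conj (curlGen (wq φ ψ) γ j k i x) ∂μ =
      (if i = j then ∫ x in D, a i x * (wq φ ψ x * dbar[k] γ x) ∂μ else 0) -
      if i = k then ∫ x in D, a i x * (wq φ ψ x * dbar[j] γ x) ∂μ else 0 := by
    intro i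
    simp only [curlGen, conj_conj, mul_sub, mul_ite, mul_zero]
    have i1 : ∀ k, Integrable (fun x => a i x * (wq φ ψ x * dbar[k] γ x))
      (μ.restrict D) := fun k => (Lp.memLp (a i)).integrable_mul (q := 2) (w.memLp_dbar hγ k)
    split_ifs
    · rw [integral_sub (i1 _) (i1 _)]
    · simp
    · simp [integral_neg]
    · simp
  simp_rw [h, sum_sub_distrib, Finset.sum_ite_eq', Finset.mem_univ, if_true]

/-- The orthogonal projection of a tuple to the weakly closed tuples. -/
lemma WeightData.exists_projection (w : WeightData D φ ψ σ) (b : PiLp 2 fun _ : Fin N => Lp ℂ 2 (μ.restrict D)) :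
    ∃ p : PiLp 2 fun _ : Fin N => Lp ℂ 2 (μ.restrict D), WClosed μ D (wq φ ψ) (fun j => p j) ∧
      ∀ r : PiLp 2 fun _ : Fin N => Lp ℂ 2 (μ.restrict D),
        WClosed μ D (wq φ ψ) (fun j => r j) → inner ℂ r p = inner ℂ r b := by
  obtain ⟨p, hp, hr⟩ := exists_projection_orthogonal {b | ∃ (γ : E N → ℂ)
    (hγ : IsTest D γ) (j k : Fin N),
      b = toTuple (curlGen (wq φ ψ) γ j k) (w.memLp_curlGen hγ j k)} b
  refine ⟨p, fun j k γ hγ => ?_, fun r h => hr r ?_⟩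
  · rw [← w.inner_curlGen hγ j k p]
    exact hp _ ⟨γ, hγ, j, k, rfl⟩
  · rintro u ⟨γ, hγ, j, k, rfl⟩
    rw [w.inner_curlGen hγ j k r]
    exact h j k γ hγ


lemma WeightData.memLp_twisted (w : WeightData D φ ψ σ) (hγ : IsTest D γ) (j : Fin N) :
    MemLp (fun x => conj (wq φ ψ x * (dee[j] γ x + wlog φ ψ j x * γ x))) 2 (μ.restrict D) := by
  refine MemLp.star (f := fun x => wq φ ψ x * (dee[j] γ x + wlog φ ψ j x * γ x))
    (hγ.memLp w.isOpen (w.continuousOn_wq.mul ((hγ.contDiff.continuous_cderiv.continuousOn).add ((w.continuousOn_wlog j).mul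
        hγ.contDiff.continuous.continuousOn))) fun x hx => ?_)
  rw [cderiv_eq_zero_of_notMem hx, image_eq_zero_of_notMem_tsupport hx]; ring

lemma WeightData.wClosed_twisted (w : WeightData D φ ψ σ) (hγ : IsTest D γ) :
    WClosed μ D (wq φ ψ) fun j x => conj (wq φ ψ x * (dee[j] γ x + wlog φ ψ j x * γ x)) := by
  intro j k β hβ
  have hχ := (hγ.of_mul w.isOpen w.contDiffOn_wq_sq).conj
  have e : ∀ j k, ∫ x in D, conj (wq φ ψ x * (dee[j] γ x +
      wlog φ ψ j x * γ x)) * (wq φ ψ x * dbar[k] β x) ∂μ =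
      ∫ x, dbar[j] (fun x => conj (wq φ ψ x ^ 2 * γ x)) x * dbar[k] β x ∂μ := by
    intro j k
    refine Eq.trans ?_ (setIntegral_eq_integral_of_forall_compl_eq_zero (s := D) ?_)
    · refine setIntegral_congr_fun w.isOpen.measurableSet fun x hx => ?_
      rw [dbar_conj, w.dee_wq_sq_mul hγ hx, map_mul, map_mul, map_pow, conj_wq]
      ring
    · intro x hx
      rw [cderiv_eq_zero_of_notMem (fun h => hx (hβ.sub h)), mul_zero]
  rw [e, e, integral_dbar_mul_dbar_comm hχ.contDiff hβ.contDiff hβ.compact, sub_self]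

/-- The divergence of a tuple. -/
def divg (φ ψ : E N → ℝ) (β : Fin N → E N → ℂ) (x : E N) : ℂ :=
  ∑ j, (-dee[j] (β j) x + wlog φ ψ j x * β j x)

lemma divg_eq_zero (hx : x ∉ ⋃ j, tsupport (β j)) : divg φ ψ β x = 0 := by
  refine Finset.sum_eq_zero fun j _ => ?_
  have : x ∉ tsupport (β j) := fun h => hx (mem_iUnion_of_mem j h)
  rw [cderiv_eq_zero_of_notMem this, image_eq_zero_of_notMem_tsupport this]; ring

lemma WeightData.continuousOn_divg (w : WeightData D φ ψ σ) (hβ : ∀ j, IsTest D (β j)) :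
    ContinuousOn (divg φ ψ β) D :=
  continuousOn_finsetSum _ fun j _ => (hβ j).contDiff.continuous_cderiv.neg.continuousOn.add ((w.continuousOn_wlog j).mul
      (hβ j).contDiff.continuous.continuousOn)

lemma WeightData.integral_divg_mul (w : WeightData D φ ψ σ) (hβ : ∀ j, IsTest D (β j))
    (hγ : IsTest D γ) : ∫ x, divg φ ψ β x * γ x ∂μ =
      ∑ j, ∫ x in D, wq ψ φ x * β j x * (wq φ ψ x * (dee[j] γ x + wlog φ ψ j x * γ x)) ∂μ := by
  have c1 : ∀ j, Continuous (dee[j] γ) := fun j => hγ.contDiff.continuous_cderiv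
  have c2 : ∀ j, Continuous (dee[j] (β j)) := fun j => (hβ j).contDiff.continuous_cderiv
  have c3 : ∀ j, Continuous fun x => wlog φ ψ j x * β j x := fun j =>
    continuous_of_continuousOn_of_zero w.isOpen (isClosed_tsupport _) (hβ j).sub
      ((w.continuousOn_wlog j).mul (hβ j).contDiff.continuous.continuousOn) fun x hx => by
        rw [image_eq_zero_of_notMem_tsupport hx, mul_zero]
  have i1 : ∀ j, Integrable (fun x => β j x * dee[j] γ x) μ := fun j =>
    ((hβ j).contDiff.continuous.mul (c1 j)).integrable_of_hasCompactSupport (hβ j).compact.mul_right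
  have i2 : ∀ j, Integrable (fun x => dee[j] (β j) x * γ x) μ := fun j =>
    ((c2 j).mul hγ.contDiff.continuous).integrable_of_hasCompactSupport hγ.compact.mul_left
  have i3 : ∀ j, Integrable (fun x => wlog φ ψ j x * β j x * γ x) μ := fun j =>
    ((c3 j).mul hγ.contDiff.continuous).integrable_of_hasCompactSupport hγ.compact.mul_left
  have e : ∀ j, ∫ x in D, wq ψ φ x * β j x * (wq φ ψ x * (dee[j] γ x +
        wlog φ ψ j x * γ x)) ∂μ = ∫ x, (-dee[j] (β j) x + wlog φ ψ j x * β j x) * γ x ∂μ := by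
    intro j
    rw [setIntegral_eq_integral_of_forall_compl_eq_zero fun x hx => by
      rw [image_eq_zero_of_notMem_tsupport fun h => hx ((hβ j).sub h)]; ring]
    have e1 : ∀ x, wq ψ φ x * β j x * (wq φ ψ x * (dee[j] γ x +
        wlog φ ψ j x * γ x)) = β j x * dee[j] γ x + wlog φ ψ j x * β j x * γ x := by
      intro x
      linear_combination (β j x * (dee[j] γ x + wlog φ ψ j x * γ x)) * wq_mul_wq_swap φ ψ x
    have e2 : ∀ x, (-dee[j] (β j) x + wlog φ ψ j x * β j x) * γ x =
      -(dee[j] (β j) x * γ x) + wlog φ ψ j x * β j x * γ x := fun x => by ring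
    have i4 : Integrable (fun x => -(dee[j] (β j) x * γ x)) μ := (i2 j).neg
    simp_rw [e1, e2]
    rw [integral_add (i1 j) (i3 j), integral_add i4 (i3 j), integral_neg,
      integral_mul_cderiv ((hβ j).contDiff.of_le (by norm_num)) (hγ.contDiff.of_le (by norm_num))
        hγ.compact]
  simp_rw [e]
  rw [← integral_finsetSum]
  · simp only [divg, sum_mul]
  · intro j _
    refine (((i2 j).neg).add (i3 j)).congr (Eventually.of_forall fun x => ?_)
    simp only [Pi.neg_apply, Pi.add_apply]; ring

lemma WeightData.memLp_swap (w : WeightData D φ ψ σ) (hγ : IsTest D γ) :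
    MemLp (fun x => wq ψ φ x * γ x) 2 (μ.restrict D) := by
  refine hγ.memLp w.isOpen (ContinuousOn.mul ?_ hγ.contDiff.continuous.continuousOn)
    fun x hx => by rw [image_eq_zero_of_notMem_tsupport hx, mul_zero]
  exact Complex.continuous_ofReal.comp_continuousOn
    (((w.contDiffOn_snd.continuousOn.sub w.contDiffOn_fst.continuousOn).div_const 2).rexp)

lemma WeightData.duality_estimate (w : WeightData D φ ψ σ) (hβ : ∀ j, IsTest D (β j))
    {F : Fin N → E N → ℂ} (hF : ∀ j, MemLp (F j) 2 (μ.restrict D))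
    (hc : WClosed μ D (wq φ ψ) F) :
    ‖∑ j, ∫ x in D, wq ψ φ x * β j x * conj (F j x) ∂μ‖ ≤
      ‖toTuple F hF‖ * √(∫ x in D, ‖divg φ ψ β x‖ ^ 2 * exp (-φ x) ∂μ) := by
  set b := toTuple (ν := μ.restrict D) (fun j x => wq ψ φ x * β j x)
    (fun j => w.memLp_swap (hβ j)) with hb
  have hbc : ∀ j, b j =ᵐ[μ.restrict D] fun x => wq ψ φ x * β j x := fun j =>
    (w.memLp_swap (hβ j)).coeFn_toLp
  have pair : ∀ (r : Fin N → E N → ℂ) (hr : ∀ j, MemLp (r j) 2 (μ.restrict D)),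
      inner ℂ (toTuple r hr) b = ∑ j, ∫ x in D, wq ψ φ x * β j x * conj (r j x) ∂μ := by
    intro r hr
    rw [inner_toTuple]
    refine sum_congr rfl fun j _ => integral_congr_ae ?_
    filter_upwards [hbc j] with x hx
    rw [hx]
  have closed : ∀ (r : Fin N → E N → ℂ) (hr : ∀ j, MemLp (r j) 2 (μ.restrict D)),
      WClosed μ D (wq φ ψ) r → WClosed μ D (wq φ ψ) fun j => toTuple r hr j :=
    fun r hr h => wClosed_congr (fun j => (hr j).coeFn_toLp.symm) h
  obtain ⟨p, hp, hpr⟩ := w.exists_projection b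
  have hS : IsClosed (⋃ j, tsupport (β j)) := isClosed_iUnion_of_finite fun j => isClosed_tsupport _
  have hSc : IsCompact (⋃ j, tsupport (β j)) := isCompact_iUnion fun j => (hβ j).compact
  have hSD : (⋃ j, tsupport (β j)) ⊆ D := iUnion_subset fun j => (hβ j).sub
  have hz : ∀ x, x ∉ (⋃ j, tsupport (β j)) → divg φ ψ β x = 0 := fun x hx => divg_eq_zero hx
  have ind : ∀ j (t : E N → ℂ), ∫ x, D.indicator (p j) x * t x ∂μ = ∫ x in D, p j x * t x ∂μ := by
    intro j t
    rw [← integral_indicator w.isOpen.measurableSet]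
    congr 1; ext x
    by_cases hx : x ∈ D <;> simp [hx]
  have key := w.closed_inequality (μ := μ) (a := fun j => D.indicator (p j)) (g := divg φ ψ β)
    (fun j => (memLp_indicator_iff_restrict w.isOpen.measurableSet).2 (Lp.memLp (p j)))
    (continuous_of_continuousOn_of_zero w.isOpen hS hSD (w.continuousOn_divg hβ) hz)
    (HasCompactSupport.intro hSc hz)
    ((closure_minimal (fun x hx => by
      by_contra h; exact hx (hz x h)) hS).trans hSD)
    (fun γ hγ => by
      have h1 := hpr _ (closed _ (fun j => w.memLp_twisted hγ j) (w.wClosed_twisted hγ))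
      rw [pair, inner_toTuple] at h1
      simp only [conj_conj] at h1
      simp_rw [ind, w.integral_divg_mul hβ hγ]
      exact h1)
    (fun j k γ hγ => by simp only [ind]; exact hp j k γ hγ)
  have hn : ‖p‖ ^ 2 ≤ ∫ x in D, ‖divg φ ψ β x‖ ^ 2 * exp (-φ x) ∂μ := by
    rw [norm_sq_tuple]
    refine le_trans (le_of_eq ?_) key
    refine setIntegral_congr_fun w.isOpen.measurableSet fun x hx => ?_
    simp [hx]
  rw [← pair F hF, ← hpr _ (closed F hF hc)]
  refine (norm_inner_le_norm _ _).trans (mul_le_mul_of_nonneg_left ?_ (norm_nonneg _))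
  exact Real.le_sqrt_of_sq_le hn


lemma WeightData.memLp_divg (w : WeightData D φ ψ σ) (hβ : ∀ j, IsTest D (β j)) :
    MemLp (fun x => wq (fun _ => 0) φ x * divg φ ψ β x) 2 (μ.restrict D) := by
  have hS : IsClosed (⋃ j, tsupport (β j)) := isClosed_iUnion_of_finite fun j => isClosed_tsupport _
  have hSc : IsCompact (⋃ j, tsupport (β j)) := isCompact_iUnion fun j => (hβ j).compact
  have hSD : (⋃ j, tsupport (β j)) ⊆ D := iUnion_subset fun j => (hβ j).sub
  have hz : ∀ x, x ∉ (⋃ j, tsupport (β j)) → wq (fun _ => 0) φ x * divg φ ψ β x = 0 :=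
    fun x hx => by rw [divg_eq_zero hx, mul_zero]
  have hq : ContinuousOn (wq (fun _ => 0) φ) D := Complex.continuous_ofReal.comp_continuousOn
    (((continuousOn_const.sub w.contDiffOn_fst.continuousOn).div_const 2).rexp)
  exact ((continuous_of_continuousOn_of_zero w.isOpen hS hSD (hq.mul (w.continuousOn_divg hβ))
    hz).memLp_of_hasCompactSupport (HasCompactSupport.intro hSc hz)).restrict _

lemma divg_add {γ : Fin N → E N → ℂ} (hβ : ∀ j, IsTest D (β j))
    (hγ : ∀ j, IsTest D (γ j)) (x : E N) :
    divg φ ψ (fun j x => β j x + γ j x) x = divg φ ψ β x + divg φ ψ γ x := by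
  simp only [divg, ← sum_add_distrib]
  refine sum_congr rfl fun j _ => ?_
  rw [cderiv_add ((hβ j).contDiff.differentiable (by norm_num) x)
    ((hγ j).contDiff.differentiable (by norm_num) x)]
  ring

lemma divg_const_mul (hβ : ∀ j, IsTest D (β j)) (c : ℂ) (x : E N) :
    divg φ ψ (fun j x => c * β j x) x = c * divg φ ψ β x := by
  simp only [divg, mul_sum]
  refine sum_congr rfl fun j _ => ?_
  rw [cderiv_const_mul ((hβ j).contDiff.differentiable (by norm_num) x)]
  ring

lemma norm_sq_Lp {ν : Measure (E N)} (u : Lp ℂ 2 ν) : ‖u‖ ^ 2 = ∫ x, ‖u x‖ ^ 2 ∂ν := by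
  rw [← @inner_self_eq_norm_sq ℂ, L2.inner_def, ← integral_re (L2.integrable_inner _ _)]
  simp [← ofReal_pow]

/-- Existence of weak solutions of the `∂̄`-equation with weighted `L²` estimates. -/
lemma WeightData.exists_weak_solution (w : WeightData D φ ψ σ) {F : Fin N → E N → ℂ} (hF : ∀ j, MemLp (F j) 2 (μ.restrict D))
    (hc : WClosed μ D (wq φ ψ) F) :
    ∃ U : E N → ℂ, MemLp U 2 (μ.restrict D) ∧
      ∫ x in D, ‖U x‖ ^ 2 ∂μ ≤ ∫ x in D, ∑ j, ‖F j x‖ ^ 2 ∂μ ∧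
      ∀ j γ, IsTest D γ → ∫ x in D, U x * (wq (fun _ => 0) φ x * wq φ ψ x ^ 2 *
        dbar[j] γ x) ∂μ = -∫ x in D, F j x * (wq φ ψ x * γ x) ∂μ := by
  have iF : ∀ β : Fin N → E N → ℂ, (∀ j, IsTest D (β j)) → ∀ j, Integrable (fun x =>
      wq ψ φ x * β j x * conj (F j x)) (μ.restrict D) := fun β hβ j =>
    (w.memLp_swap (hβ j)).integrable_mul (q := 2) (hF j).star
  set S : Submodule ℂ (Lp ℂ 2 (μ.restrict D) × ℂ) :=
    { carrier := {p | ∃ β : Fin N → E N → ℂ, (∀ j, IsTest D (β j)) ∧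
        p.1 =ᵐ[μ.restrict D] (fun x => wq (fun _ => 0) φ x * divg φ ψ β x) ∧
        p.2 = ∑ j, ∫ x in D, wq ψ φ x * β j x * conj (F j x) ∂μ}
      add_mem' := by
        rintro p q ⟨β, hβ, h1, h2⟩ ⟨γ, hγ, h3, h4⟩
        refine ⟨fun j x => β j x + γ j x, fun j => (hβ j).add (hγ j), ?_, ?_⟩
        · filter_upwards [Lp.coeFn_add p.1 q.1, h1, h3] with x e1 e2 e3
          rw [Prod.fst_add, e1, Pi.add_apply, e2, e3, divg_add hβ hγ]; ring
        · rw [Prod.snd_add, h2, h4, ← sum_add_distrib]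
          refine sum_congr rfl fun j _ => ?_
          rw [← integral_add (iF β hβ j) (iF γ hγ j)]
          congr 1; ext x; ring
      zero_mem' := by
        refine ⟨fun _ _ => 0, fun j => isTest_zero, ?_, by simp⟩
        filter_upwards [Lp.coeFn_zero ℂ 2 (μ.restrict D)] with x hx
        rw [Prod.fst_zero, hx]; simp [divg, cderiv]
      smul_mem' := by
        rintro c p ⟨β, hβ, h1, h2⟩
        refine ⟨fun j x => c * β j x, fun j => (hβ j).const_mul c, ?_, ?_⟩
        · filter_upwards [Lp.coeFn_smul c p.1, h1] with x e1 e2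
          rw [Prod.smul_fst, e1, Pi.smul_apply, e2, divg_const_mul hβ, smul_eq_mul]; ring
        · rw [Prod.smul_snd, h2, smul_eq_mul, mul_sum]
          refine sum_congr rfl fun j _ => ?_
          rw [← integral_const_mul]
          congr 1; ext x; ring } with hS
  have memS : ∀ p, p ∈ S ↔ ∃ β : Fin N → E N → ℂ, (∀ j, IsTest D (β j)) ∧
        p.1 =ᵐ[μ.restrict D] (fun x => wq (fun _ => 0) φ x * divg φ ψ β x) ∧
        p.2 = ∑ j, ∫ x in D, wq ψ φ x * β j x * conj (F j x) ∂μ := fun p => Iff.rfl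
  have bound : ∀ p ∈ S, ‖p.2‖ ≤ ‖toTuple F hF‖ * ‖p.1‖ := by
    rintro p ⟨β, hβ, h1, h2⟩
    rw [h2]
    refine (w.duality_estimate hβ hF hc).trans (mul_le_mul_of_nonneg_left ?_ (norm_nonneg _))
    refine Real.sqrt_le_iff.2 ⟨norm_nonneg _, le_of_eq ?_⟩
    rw [norm_sq_Lp]
    refine integral_congr_ae (h1.mono fun x hx => ?_)
    simp only
    rw [hx, norm_mul, mul_pow, wq, norm_real, norm_eq_abs, sq_abs, ← Real.exp_nat_mul, mul_comm]
    congr 2; push_cast; ring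
  obtain ⟨U, hU, hUS⟩ := exists_inner_eq_of_submodule S (norm_nonneg _) bound
  refine ⟨U, Lp.memLp U, ?_, fun j γ hγ => ?_⟩
  · rw [← norm_sq_Lp]
    refine (pow_le_pow_left₀ (norm_nonneg _) hU 2).trans (le_of_eq ?_)
    rw [norm_sq_tuple]
    refine integral_congr_ae ?_
    have : ∀ᵐ x ∂(μ.restrict D), ∀ j, toTuple F hF j x = F j x :=
      (ae_all_iff.2 fun j => (hF j).coeFn_toLp)
    filter_upwards [this] with x hx
    simp only [hx]
  · set β : Fin N → E N → ℂ := fun i x => if i = j then wq φ ψ x ^ 2 * conj (γ x) else 0 with hβd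
    have hβ : ∀ i, IsTest D (β i) := by
      intro i
      by_cases h : i = j
      · simpa only [hβd, h, if_true] using hγ.conj.of_mul w.isOpen w.contDiffOn_wq_sq
      · simpa only [hβd, h, if_false] using isTest_zero
    have hdiv : ∀ x ∈ D, divg φ ψ β x = -(wq φ ψ x ^ 2 * conj (dbar[j] γ x)) := by
      intro x hx
      rw [divg, Finset.sum_eq_single j]
      · simp only [hβd, if_true]
        rw [w.dee_wq_sq_mul hγ.conj hx, dee_conj]
        ring
      · intro i _ hi
        simp [hβd, hi, cderiv]
      · simp
    have h := hUS ((w.memLp_divg hβ).toLp, ∑ j, ∫ x in D, wq ψ φ x * β j x *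
      conj (F j x) ∂μ) ⟨β, hβ, (w.memLp_divg hβ).coeFn_toLp, rfl⟩
    simp only at h
    rw [L2.inner_def, Finset.sum_eq_single j (fun i _ hi => by simp [hβd, hi]) (by simp)] at h
    have h1 : ∫ x in D, inner ℂ (U x) ((w.memLp_divg (μ := μ) hβ).toLp _ x) ∂μ =
        -conj (∫ x in D, U x * (wq (fun _ => 0) φ x * wq φ ψ x ^ 2 *
        dbar[j] γ x) ∂μ) := by
      rw [← integral_conj, ← integral_neg]
      refine integral_congr_ae ?_
      filter_upwards [(w.memLp_divg (μ := μ) hβ).coeFn_toLp, ae_restrict_mem w.isOpen.measurableSet]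
        with x hx hxD
      rw [hx, hdiv x hxD, inner_apply]
      simp only [map_mul, map_pow, conj_wq]
      ring
    have h2 : ∫ x in D, wq ψ φ x * β j x * conj (F j x) ∂μ =
        conj (∫ x in D, F j x * (wq φ ψ x * γ x) ∂μ) := by
      rw [← integral_conj]
      congr 1; ext x
      simp only [hβd, if_true, map_mul, conj_wq]
      linear_combination (wq φ ψ x * conj (γ x) * conj (F j x)) * wq_mul_wq_swap φ ψ x
    rw [h1, h2] at h
    have := congrArg conj h
    simp only [map_neg, conj_conj] at this
    rw [this, neg_neg]

/-- A real differentiable function annihilated by all antiholomorphic derivatives is complex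
differentiable. -/
lemma differentiableAt_of_dbar_eq_zero (hf : DifferentiableAt ℝ f x)
    (h : ∀ j, dbar[j] f x = 0) : DifferentiableAt ℂ f x := by
  set L := fderiv ℝ f x with hL
  have hI : ∀ j : Fin N, L (I • basisVec j) = I * L (basisVec j) := by
    intro j
    have := h j
    simp only [cderiv, ← hL, div_eq_zero_iff, OfNat.ofNat_ne_zero, or_false] at this
    linear_combination (-I) * this + L (I • basisVec j) * I_sq
  have hsum : ∀ v : E N, L v = ∑ j, v j * L (basisVec j) := by
    intro v
    conv_lhs => rw [eq_sum_single v, map_sum]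
    refine sum_congr rfl fun j _ => ?_
    rw [smul_eq_re_add_im, map_add, map_smul, map_smul]
    have := hI j
    simp only [basisVec] at this
    rw [this]
    nth_rewrite 3 [← re_add_im (v j)]
    simp only [real_smul]
    ring
  rw [differentiableAt_iff_restrictScalars ℝ hf]
  refine ⟨⟨⟨⟨L, map_add L⟩, fun c v => ?_⟩, L.continuous⟩, ?_⟩
  · simp only [hsum v, hsum (c • v), RingHom.id_apply, smul_eq_mul, mul_sum,
      PiLp.smul_apply, mul_assoc]
  · ext v; rfl

lemma dbar_eq_zero (hf : DifferentiableAt ℂ f x) (v : E N) : dbar v f x = 0 := by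
  have h : fderiv ℝ f x = (fderiv ℂ f x).restrictScalars ℝ :=
    (hf.hasFDerivAt.restrictScalars ℝ).fderiv
  simp only [cderiv, h, ContinuousLinearMap.coe_restrictScalars', map_smul, smul_eq_mul]
  linear_combination (fderiv ℂ f x v / 2) * I_sq

/-- Mollifying a weakly holomorphic function gives a holomorphic function. -/
lemma IsMollifier.differentiableAt_moll (hη : IsMollifier μ r η)
     (hu : LocallyIntegrable u μ) {V : Set (E N)}
    (hw : ∀ j β, IsTest V β → ∫ y, u y * dbar[j] β y ∂μ = 0) (hx : closedBall x r ⊆ V) :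
    DifferentiableAt ℂ (moll μ (fun y => (η y : ℂ)) u) x := by
  have hK : ContDiff ℝ 1 fun y => (η y : ℂ) := hη.contDiff_complex.of_le (by norm_num)
  have hm : ContDiff ℝ 1 (moll μ (fun y => (η y : ℂ)) u) :=
    contDiff_moll (n := 1) hK hη.hasCompactSupport_complex hu
  refine differentiableAt_of_dbar_eq_zero (hm.differentiable (by norm_num) x) fun j => ?_
  rw [cderiv_moll hK hη.hasCompactSupport_complex hu]
  have ht : IsTest V fun y => (η (x - y) : ℂ) := by
    refine ⟨hη.contDiff_complex.comp (contDiff_const.sub contDiff_id),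
      hasCompactSupport_const_sub hη.hasCompactSupport_complex x, ?_⟩
    refine Subset.trans (closure_minimal (fun y hy => ?_) isClosed_closedBall) hx
    by_contra h
    refine hy ?_
    simp only [Complex.ofReal_eq_zero]
    exact hη.zero _ (by simpa [dist_eq_norm, norm_sub_rev] using h)
  have e := hw j _ ht
  simp only [cderiv_comp_const_sub hK] at e
  rw [moll, ← neg_eq_zero, ← integral_neg, ← e]
  refine integral_congr_ae (Eventually.of_forall fun y => ?_)
  simp only
  ring

/-- Invariance of Haar integrals under multiplication by a unimodular scalar. -/
lemma integral_comp_circle_smul (F : E N → ℂ) (hζ : ‖ζ‖ = 1) : ∫ x, F (ζ • x) ∂μ = ∫ x, F x ∂μ := by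
  have hζ0 : ζ ≠ 0 := by rintro rfl; simp at hζ
  let e : E N ≃ₜ E N := Homeomorph.smulOfNeZero ζ hζ0
  let a : E N ≃+ E N := DistribMulAction.toAddEquiv₀ (E N) ζ hζ0
  have : (Measure.map e μ).IsAddHaarMeasure :=
    AddEquiv.isAddHaarMeasure_map μ a e.continuous e.symm.continuous
  have hmap : Measure.map e μ = μ := by
    have h := Measure.isAddLeftInvariant_eq_smul (Measure.map e μ) μ
    have hb : Measure.map e μ (ball 0 1) = μ (ball 0 1) := by
      rw [Measure.map_apply e.continuous.measurable measurableSet_ball]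
      congr 1
      ext y
      simp [e, norm_smul, hζ]
    rw [h, Measure.smul_apply] at hb
    have hpos : μ (ball (0 : E N) 1) ≠ 0 := (measure_ball_pos μ _ one_pos).ne'
    have hfin : μ (ball (0 : E N) 1) ≠ ⊤ := measure_ball_lt_top.ne
    rw [ENNReal.smul_def, smul_eq_mul, ← one_mul (μ (ball (0 : E N) 1)), ← mul_assoc, mul_one,
      ENNReal.mul_left_inj hpos hfin] at hb
    rw [h, show Measure.addHaarScalarFactor (Measure.map e μ) μ = 1 by exact_mod_cast hb, one_smul]
  conv_rhs => rw [← hmap]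
  rw [e.measurableEmbedding.integral_map]
  rfl

/-- The mean value property of a circle invariant mollifier. -/
lemma IsMollifier.moll_eq (hη : IsMollifier μ r η) {W : Set (E N)} (hh : DifferentiableOn ℂ h W)
    (hx : closedBall x r ⊆ W) (hg : ∀ y ∈ closedBall x r, g y = h y) :
    moll μ (fun y => (η y : ℂ)) g x = h x := by
  have hηneg : ∀ v, η (-v) = η v := fun v => by
    have := hη.circle (-1) v (by simp)
    simpa using this
  have e1 : moll μ (fun y => (η y : ℂ)) g x = ∫ v, (η v : ℂ) * h (x + v) ∂μ := by
    rw [moll, ← integral_add_left_eq_self _ x]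
    refine integral_congr_ae (Eventually.of_forall fun v => ?_)
    simp only [sub_add_cancel_left, hηneg]
    by_cases hv : r < ‖v‖
    · simp [hη.zero v hv]
    · rw [hg _ (by simpa using hv)]
  have hseg : ∀ v : E N, ‖v‖ ≤ r → ∀ ζ : ℂ, ‖ζ‖ ≤ 1 → x + ζ • v ∈ W := fun v hv ζ hζ => hx (by
    simp only [mem_closedBall, dist_self_add_left, norm_smul]
    exact (mul_le_of_le_one_left (norm_nonneg _) hζ).trans hv)
  have e2 : ∀ θ : ℝ, ∫ v, (η v : ℂ) * h (x + v) ∂μ =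
      ∫ v in closedBall 0 r, (η v : ℂ) * h (x + circleMap 0 1 θ • v) ∂μ := by
    intro θ
    have hz : ‖circleMap 0 1 θ‖ = 1 := by simp
    rw [← integral_comp_circle_smul _ hz]
    refine Eq.trans ?_ (setIntegral_eq_integral_of_forall_compl_eq_zero fun v hv => ?_).symm
    · simp only [hη.circle _ _ hz]
    · rw [hη.zero v (by simpa using hv)]; simp
  have hint : Integrable (Function.uncurry fun (θ : ℝ) (v : E N) =>
      (η v : ℂ) * h (x + circleMap 0 1 θ • v))
      ((volume.restrict (uIoc 0 (2 * Real.pi))).prod (μ.restrict (closedBall 0 r))) := by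
    rw [Measure.prod_restrict]
    have hc : ContinuousOn (Function.uncurry fun (θ : ℝ) (v : E N) =>
        (η v : ℂ) * h (x + circleMap 0 1 θ • v)) (uIcc 0 (2 * Real.pi) ×ˢ closedBall 0 r) := by
      refine ContinuousOn.mul ?_ ?_
      · exact (hη.contDiff_complex.continuous.comp continuous_snd).continuousOn
      · refine hh.continuousOn.comp (t := W) ?_ fun p hp => hseg _ (by simpa using hp.2) _ (by simp)
        exact (continuous_const.add
          (((continuous_circleMap 0 1).comp continuous_fst).smul continuous_snd)).continuousOn
    exact IntegrableOn.mono_set (hc.integrableOn_compact (isCompact_uIcc.prod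
      (isCompact_closedBall _ _))) (prod_mono uIoc_subset_uIcc Subset.rfl)
  have hmv : ∀ v : E N, ‖v‖ ≤ r →
      ∫ θ in (0 : ℝ)..2 * Real.pi, h (x + circleMap 0 1 θ • v) = 2 * Real.pi * h x := by
    intro v hv
    have hd : DifferentiableOn ℂ (fun ζ : ℂ => h (x + ζ • v)) (closedBall 0 1) :=
      hh.comp ((differentiableOn_const _).add (differentiableOn_id.smul_const v))
        fun ζ hζ => hseg v hv ζ (by simpa using hζ)
    have hd' : DiffContOnCl ℂ (fun ζ : ℂ => h (x + ζ • v)) (ball 0 |1|) := by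
      rw [abs_one]
      exact ⟨hd.mono ball_subset_closedBall, hd.continuousOn.mono closure_ball_subset_closedBall⟩
    have := hd'.circleAverage
    rw [Real.circleAverage_def] at this
    simp only [zero_smul, add_zero] at this
    rw [← this, real_smul, ← mul_assoc]
    push_cast
    rw [mul_inv_cancel₀ (by exact_mod_cast Real.two_pi_pos.ne'), one_mul]
  have e3 : (2 * Real.pi : ℂ) * ∫ v, (η v : ℂ) * h (x + v) ∂μ = 2 * Real.pi * h x := by
    calc (2 * Real.pi : ℂ) * ∫ v, (η v : ℂ) * h (x + v) ∂μ
        = ∫ _θ in (0 : ℝ)..2 * Real.pi, ∫ v, (η v : ℂ) * h (x + v) ∂μ := by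
          rw [intervalIntegral.integral_const, sub_zero, real_smul]; push_cast; rfl
      _ = ∫ θ in (0 : ℝ)..2 * Real.pi, ∫ v in closedBall 0 r,
            (η v : ℂ) * h (x + circleMap 0 1 θ • v) ∂μ := by simp only [← e2]
      _ = ∫ v in closedBall 0 r, (∫ θ in (0 : ℝ)..2 * Real.pi,
            (η v : ℂ) * h (x + circleMap 0 1 θ • v)) ∂μ := intervalIntegral_integral_swap hint
      _ = ∫ v in closedBall 0 r, (η v : ℂ) * (2 * Real.pi * h x) ∂μ := by
          refine setIntegral_congr_fun measurableSet_closedBall fun v hv => ?_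
          rw [intervalIntegral.integral_const_mul, hmv v (by simpa using hv)]
      _ = ∫ v, (η v : ℂ) * (2 * Real.pi * h x) ∂μ :=
          setIntegral_eq_integral_of_forall_compl_eq_zero fun v hv => by
            rw [hη.zero v (by simpa using hv)]; simp
      _ = 2 * Real.pi * h x := by
          rw [integral_mul_const, integral_complex_ofReal, hη.mass]; simp
  rw [e1]
  exact mul_left_cancel₀ (by exact_mod_cast Real.two_pi_pos.ne') e3

/-- A pointwise bound for mollifications of square integrable functions. -/
lemma IsMollifier.norm_moll_le (hη : IsMollifier μ r η) (hu : MemLp u 2 μ) (x : E N) :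
    ‖moll μ (fun y => (η y : ℂ)) u x‖ ≤ √(∫ y, η y ^ 2 ∂μ) * √(∫ y, ‖u y‖ ^ 2 ∂μ) := by
  have hi : MemLp (fun y => η (x - y)) 2 μ :=
    (hη.contDiff.continuous.comp (continuous_const.sub continuous_id)).memLp_of_hasCompactSupport
      (hη.hasCompactSupport.comp_homeomorph (Homeomorph.subLeft x))
  have h := integral_mul_le_Lp_mul_Lq_of_nonneg (μ := μ) (p := 2) (q := 2)
    (by constructor <;> norm_num) (f := fun y => η (x - y)) (g := fun y => ‖u y‖)
    (Eventually.of_forall fun y => hη.nonneg _) (Eventually.of_forall fun y => norm_nonneg _)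
    (by simpa using hi) (by simpa using hu.norm)
  calc ‖moll μ (fun y => (η y : ℂ)) u x‖ ≤ ∫ y, ‖(η (x - y) : ℂ) * u y‖ ∂μ :=
        norm_integral_le_integral_norm _
    _ = ∫ y, η (x - y) * ‖u y‖ ∂μ := by
        refine integral_congr_ae (Eventually.of_forall fun y => ?_)
        simp only [norm_mul, norm_real, norm_eq_abs, abs_of_nonneg (hη.nonneg _)]
    _ ≤ _ := h
    _ = _ := by
        have e := integral_sub_left_eq_self (fun y => η y ^ 2) μ x
        simp only [Real.rpow_ofNat, one_div, Real.sqrt_eq_rpow, e]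

lemma levi_eq_hess (ρ : E N → ℝ) (x v : E N) : levi ρ x v = (fderiv ℝ (fderiv ℝ ρ) x v v +
      fderiv ℝ (fderiv ℝ ρ) x (I • v) (I • v)) / 4 := by
  simp [levi, iteratedFDeriv_two_apply]

lemma levi_smul (ρ : E N → ℝ) (x v : E N) (t : ℝ) : levi ρ x (t • v) = t ^ 2 * levi ρ x v := by
  simp only [levi_eq_hess, smul_comm _ t, map_smul, smul_apply, smul_eq_mul]; ring

lemma abs_levi_sub_le (ρ : E N → ℝ) (x y v : E N) :
    |levi ρ x v - levi ρ y v| ≤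
      ‖fderiv ℝ (fderiv ℝ ρ) x - fderiv ℝ (fderiv ℝ ρ) y‖ * ‖v‖ ^ 2 := by
  set B := fderiv ℝ (fderiv ℝ ρ) x - fderiv ℝ (fderiv ℝ ρ) y with hB
  have h1 := B.le_opNorm₂ v v
  have h2 := B.le_opNorm₂ (I • v) (I • v)
  rw [norm_smul, norm_I, one_mul] at h2
  have e : levi ρ x v - levi ρ y v = (B v v + B (I • v) (I • v)) / 4 := by
    simp only [levi_eq_hess, hB, sub_apply]; ring
  rw [e, abs_div, abs_of_pos (by norm_num : (0:ℝ) < 4)]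
  have h3 := abs_add_le (B v v) (B (I • v) (I • v))
  rw [norm_eq_abs] at h1 h2
  have : 0 ≤ ‖B‖ * ‖v‖ ^ 2 := by positivity
  nlinarith

/-- The Levi form of a composition with a function of one variable. -/
lemma levi_comp (hρ : ContDiffAt ℝ 2 ρ x) {g g1 : ℝ → ℝ} {g2 : ℝ}
    (h1 : ∀ᶠ y in 𝓝 (ρ x), HasDerivAt g (g1 y) y) (h2 : HasDerivAt g1 g2 (ρ x)) (v : E N) :
    levi (fun y => g (ρ y)) x v = g1 (ρ x) * levi ρ x v +
      g2 * (fderiv ℝ ρ x v ^ 2 + fderiv ℝ ρ x (I • v) ^ 2) / 4 := by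
  have hd : DifferentiableAt ℝ (fderiv ℝ ρ) x :=
    (hρ.fderiv_right (m := 1) (by norm_num)).differentiableAt (by norm_num)
  have e1 : fderiv ℝ (fun y => g (ρ y)) =ᶠ[𝓝 x] fun y => g1 (ρ y) • fderiv ℝ ρ y := by
    filter_upwards [hρ.continuousAt.eventually h1, eventually_differentiableAt hρ] with y hy hy'
    exact (hy.comp_hasFDerivAt y hy'.hasFDerivAt).fderiv
  have e2 : HasFDerivAt (fun y => g1 (ρ y)) (g2 • fderiv ℝ ρ x) x :=
    h2.comp_hasFDerivAt x (hρ.differentiableAt (by norm_num)).hasFDerivAt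
  have e3 := (e2.smul hd.hasFDerivAt).fderiv
  simp only [levi_eq_hess, e1.fderiv_eq]
  have e4 : fderiv ℝ (fun y => g1 (ρ y) • fderiv ℝ ρ y) x = _ := e3
  rw [e4]
  simp only [add_apply, smul_apply, ContinuousLinearMap.smulRight_apply, smul_eq_mul]
  ring

lemma continuous_hess (h : ContDiff ℝ 2 ρ) : Continuous (fderiv ℝ (fderiv ℝ ρ)) :=
  (h.fderiv_right (m := 1) (by norm_num)).continuous_fderiv (by norm_num)

lemma exists_norm_sub_le {V W : Type*} [NormedAddCommGroup V] [NormedAddCommGroup W] {f : V → W}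
    (hf : UniformContinuous f) (hκ : 0 < κ) :
    ∃ r > 0, ∀ x y, ‖x - y‖ < r → ‖f x - f y‖ ≤ κ := by
  obtain ⟨r, hr, h⟩ := Metric.uniformContinuous_iff.1 hf κ hκ
  refine ⟨r, hr, fun x y hxy => ?_⟩
  rw [← dist_eq_norm] at hxy ⊢
  exact (h hxy).le

lemma hasCompactSupport_hess (hs : HasCompactSupport ρ) :
    HasCompactSupport (fderiv ℝ (fderiv ℝ ρ)) :=
  (hs.fderiv ℝ).fderiv ℝ

lemma uniformContinuous_hess (h : ContDiff ℝ 2 ρ) (hs : HasCompactSupport ρ) :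
    UniformContinuous (fderiv ℝ (fderiv ℝ ρ)) :=
  (hasCompactSupport_hess hs).uniformContinuous_of_continuous (continuous_hess h)

lemma uniformContinuous_fderiv (h : ContDiff ℝ 2 ρ) (hs : HasCompactSupport ρ) :
    UniformContinuous (fderiv ℝ ρ) :=
  (hs.fderiv ℝ).uniformContinuous_of_continuous (h.continuous_fderiv (by norm_num))

lemma exists_hess_close (h : ContDiff ℝ 2 ρ) (hs : HasCompactSupport ρ)
    (hκ : 0 < κ) : ∃ r > 0, ∀ x y, ‖x - y‖ < r →
      ‖fderiv ℝ (fderiv ℝ ρ) x - fderiv ℝ (fderiv ℝ ρ) y‖ ≤ κ :=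
  exists_norm_sub_le (V := E N) (W := E N →L[ℝ] E N →L[ℝ] ℝ) (f := fderiv ℝ (fderiv ℝ ρ))
    (uniformContinuous_hess h hs) hκ

lemma exists_fderiv_close (h : ContDiff ℝ 2 ρ) (hs : HasCompactSupport ρ)
    (hκ : 0 < κ) : ∃ r > 0, ∀ x y, ‖x - y‖ < r → ‖fderiv ℝ ρ x - fderiv ℝ ρ y‖ ≤ κ :=
  exists_norm_sub_le (V := E N) (W := E N →L[ℝ] ℝ) (f := fderiv ℝ ρ)
    (uniformContinuous_fderiv h hs) hκ

lemma continuous_levi_prod (h : ContDiff ℝ 2 ρ) :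
    Continuous fun p : E N × E N => levi ρ p.1 p.2 := by
  simp only [levi_eq_hess]
  have hH := (continuous_hess h).comp (continuous_fst (X := E N) (Y := E N))
  exact (((hH.clm_apply continuous_snd).clm_apply continuous_snd).add
    ((hH.clm_apply (continuous_snd.const_smul I)).clm_apply
      (continuous_snd.const_smul I))).div_const 4

/-- A global strictly plurisubharmonic (near the boundary) defining function. -/
structure DefFun (Ω : Set (E N)) (ρ : E N → ℝ) (r0 c0 : ℝ) : Prop where
  bounded : Bornology.IsBounded Ω
  nonempty : (frontier Ω).Nonempty
  contDiff : ContDiff ℝ 2 ρ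
  compact : HasCompactSupport ρ
  r₀_pos : 0 < r0
  c₀_pos : 0 < c0
  mem_iff : ∀ x, x ∈ Ω ↔ ρ x < 0
  levi_le : ∀ x, infDist x (frontier Ω) ≤ r0 → ∀ v, c0 * ‖v‖ ^ 2 ≤ levi ρ x v
  grad_le : ∀ x, infDist x (frontier Ω) ≤ r0 → c0 ≤ ‖fderiv ℝ ρ x‖

/-- If `a > 0` wherever the nonnegative function `b` vanishes on a compact set, then
`K a + K² b` is positive for large `K`. -/
lemma exists_large_combination {X : Type*} [TopologicalSpace X] {S : Set X} (hS : IsCompact S)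
    {a b : X → ℝ} (ha : ContinuousOn a S) (hb : ContinuousOn b S) (hb0 : ∀ x ∈ S, 0 ≤ b x)
    (hab : ∀ x ∈ S, b x = 0 → 0 < a x) :
    ∃ K > 0, ∃ c > 0, ∀ x ∈ S, c ≤ K * a x + K ^ 2 * b x := by
  obtain ⟨M, hM⟩ := hS.exists_bound_of_continuousOn ha
  have hpos : ∃ b0 > 0, ∀ x ∈ S, b x ≤ b0 → 0 < a x := by
    by_contra! hcon
    have hne : ∀ n : ℕ, ∃ x ∈ S, b x ≤ 1 / (n + 1) ∧ a x ≤ 0 := fun n =>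
      hcon (1 / (n + 1)) (by positivity)
    choose x hxS hxb hxa using hne
    have hT : IsCompact (S ∩ {y | a y ≤ 0}) := by
      obtain ⟨F, hF, hFe⟩ := (continuousOn_iff_isClosed.1 ha) (Iic 0) isClosed_Iic
      rw [show S ∩ {y | a y ≤ 0} = S ∩ F by
        rw [inter_comm S F, ← hFe]; ext; simp [and_comm]]
      exact hS.inter_right hF
    obtain ⟨y, hy, hmin⟩ := hT.exists_isMinOn ⟨x 0, hxS 0, hxa 0⟩ (hb.mono inter_subset_left)
    have hy0 : b y ≤ 0 := by
      refine ge_of_tendsto' tendsto_one_div_add_atTop_nhds_zero_nat fun n => ?_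
      exact (hmin ⟨hxS n, hxa n⟩).trans (hxb n)
    exact absurd (hab y hy.1 (le_antisymm hy0 (hb0 y hy.1))) (not_lt.2 hy.2)
  obtain ⟨b0, hb₀, hpos⟩ := hpos
  have hK : 0 < (|M| + 1) / b0 := by positivity
  refine ⟨(|M| + 1) / b0, hK, ?_⟩
  set K := (|M| + 1) / b0 with hKd
  rcases S.eq_empty_or_nonempty with rfl | hne
  · exact ⟨1, one_pos, by simp⟩
  obtain ⟨y, hy, hmin⟩ := hS.exists_isMinOn hne ((ha.const_mul K).add (hb.const_mul (K ^ 2)))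
  have hall : ∀ x ∈ S, 0 < K * a x + K ^ 2 * b x := by
    intro x hx
    by_cases h : b x ≤ b0
    · have h1 := mul_pos hK (hpos x hx h)
      have h2 := mul_nonneg (sq_nonneg K) (hb0 x hx)
      linarith
    · have h1 := hM x hx
      rw [norm_eq_abs] at h1
      have h2 : -|M| ≤ a x := by
        have := neg_abs_le (a x); have := le_abs_self M; linarith
      have h3 : |M| + 1 ≤ K * b x := by
        rw [show |M| + 1 = K * b0 by rw [hKd]; field_simp]
        gcongr
        exact (not_le.1 h).le
      nlinarith
  exact ⟨_, hall y hy, fun x hx => hmin hx⟩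

lemma isCompact_frontier (hb : Bornology.IsBounded Ω) : IsCompact (frontier Ω) :=
  hb.isCompact_closure.of_isClosed_subset isClosed_frontier frontier_subset_closure

lemma exists_mem_frontier_dist_le (hb : Bornology.IsBounded Ω)
    (hne : (frontier Ω).Nonempty) (x : E N) :
    ∃ p ∈ frontier Ω, dist x p = infDist x (frontier Ω) := by
  obtain ⟨p, hp, h⟩ := (isCompact_frontier hb).exists_infDist_eq_dist hne x
  exact ⟨p, hp, h.symm⟩

/-- A defining function of a strongly pseudoconvex domain may be taken to be global. -/
lemma exists_global_defining {α : ℝ} (hΩ : IsStronglyPseudoconvexDomain 2 α Ω) :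
    ∃ σ : E N → ℝ, ContDiff ℝ 2 σ ∧ HasCompactSupport σ ∧ (∀ x, x ∈ Ω ↔ σ x < 0) ∧
      (∀ p ∈ frontier Ω, σ p = 0) ∧ (∀ p ∈ frontier Ω, fderiv ℝ σ p ≠ 0) ∧
      ∀ p ∈ frontier Ω, ∀ v : E N, v ≠ 0 → fderiv ℝ σ p v = 0 →
        fderiv ℝ σ p (I • v) = 0 → 0 < levi σ p v := by
  obtain ⟨ho, -, hb, U, ρ, hU, hΩU, ⟨hρ, -⟩, hmem, hgrad, hlevi⟩ := hΩ
  have hmem' : ∀ x ∈ U, x ∈ Ω ↔ ρ x < 0 := fun x hx => by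
    rw [hmem]; exact ⟨fun h => h.2, fun h => ⟨hx, h⟩⟩
  obtain ⟨θ, hθ, hθc, hθU, hθ01, hθ1⟩ := exists_cutoff hb.isCompact_closure hU hΩU
  have hθ1' : ∀ x ∈ closure Ω, ∀ᶠ y in 𝓝 x, θ y = 1 := fun x hx =>
    hθ1.filter_mono (nhds_le_nhdsSet hx)
  set σ : E N → ℝ := fun x => θ x * ρ x with hσ
  have hσc : ContDiff ℝ 2 σ := contDiff_cutoff_mul hU hρ hθ hθU
  have hσs : HasCompactSupport σ := hθc.mul_right
  have hσρ : ∀ x ∈ closure Ω, σ =ᶠ[𝓝 x] ρ := fun x hx => by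
    filter_upwards [hθ1' x hx] with y hy; simp [hσ, hy]
  have hσm : ∀ x, x ∈ Ω ↔ σ x < 0 := by
    intro x
    refine ⟨fun hx => ?_, fun hx => ?_⟩
    · rw [(hσρ x (subset_closure hx)).eq_of_nhds]
      exact (hmem' x (hΩU (subset_closure hx))).1 hx
    · have hxU : x ∈ U := by
        by_contra h
        have : θ x = 0 := image_eq_zero_of_notMem_tsupport fun h' => h (hθU h')
        simp [hσ, this] at hx
      rw [hmem' x hxU]
      by_contra h
      exact absurd hx (not_lt.2 (mul_nonneg (hθ01 x).1 (not_lt.1 h)))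
  have hσ0 : ∀ p ∈ frontier Ω, σ p = 0 := by
    intro p hp
    refine le_antisymm ?_ (not_lt.1 fun h => ?_)
    · exact closure_minimal (fun x hx => ((hσm x).1 hx).le)
        (isClosed_le hσc.continuous continuous_const) (frontier_subset_closure hp)
    · rw [ho.frontier_eq] at hp
      exact hp.2 ((hσm p).2 h)
  refine ⟨σ, hσc, hσs, hσm, hσ0, fun p hp => ?_, fun p hp v hv h1 h2 => ?_⟩
  · rw [(hσρ p (frontier_subset_closure hp)).fderiv_eq]
    exact hgrad p hp
  · rw [(hσρ p (frontier_subset_closure hp)).fderiv_eq] at h1 h2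
    rw [levi_congr (hσρ p (frontier_subset_closure hp))]
    exact hlevi p hp v hv h1 h2

/-- A defining function of a strongly pseudoconvex domain may be taken to be global and strictly
plurisubharmonic on the boundary. -/
lemma exists_strict_defining {α : ℝ} (hΩ : IsStronglyPseudoconvexDomain 2 α Ω) :
    ∃ (τ : E N → ℝ) (c : ℝ), 0 < c ∧ ContDiff ℝ 2 τ ∧ HasCompactSupport τ ∧
      (∀ x, x ∈ Ω ↔ τ x < 0) ∧ (∀ p ∈ frontier Ω, fderiv ℝ τ p ≠ 0) ∧
      ∀ p ∈ frontier Ω, ∀ v, c * ‖v‖ ^ 2 ≤ levi τ p v := by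
  obtain ⟨σ, hσc, hσs, hσm, hσ0, hgrad, hlevi⟩ := exists_global_defining hΩ
  have hb : Bornology.IsBounded Ω := hΩ.2.2.1
  have hF : IsCompact (frontier Ω) := isCompact_frontier hb
  have hdc : Continuous (fderiv ℝ σ) := hσc.continuous_fderiv (by norm_num)
  obtain ⟨K, hK, c, hc, hKc⟩ := exists_large_combination (hF.prod (isCompact_sphere (0 : E N) 1))
    (a := fun p : E N × E N => levi σ p.1 p.2)
    (b := fun p : E N × E N => (fderiv ℝ σ p.1 p.2 ^ 2 + fderiv ℝ σ p.1 (I • p.2) ^ 2) / 4)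
    (continuous_levi_prod hσc).continuousOn
    (Continuous.continuousOn (((((hdc.comp continuous_fst).clm_apply continuous_snd).pow 2).add
      (((hdc.comp continuous_fst).clm_apply (continuous_snd.const_smul I)).pow 2)).div_const 4))
    (fun x _ => by positivity)
    (by
      rintro ⟨p, v⟩ ⟨hp, hv⟩ h0
      simp only at hp h0
      have hv0 : v ≠ 0 := by rintro rfl; simp at hv
      have e1 : fderiv ℝ σ p v = 0 := by
        nlinarith [sq_nonneg (fderiv ℝ σ p v), sq_nonneg (fderiv ℝ σ p (I • v))]
      have e2 : fderiv ℝ σ p (I • v) = 0 := by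
        nlinarith [sq_nonneg (fderiv ℝ σ p v), sq_nonneg (fderiv ℝ σ p (I • v))]
      exact hlevi p hp v hv0 e1 e2)
  set τ : E N → ℝ := fun x => exp (K * σ x) - 1 with hτ
  have hτc : ContDiff ℝ 2 τ := ((contDiff_const.mul hσc).exp).sub contDiff_const
  have hτs : HasCompactSupport τ := hσs.comp_left (g := fun y => exp (K * y) - 1) (by simp)
  have hτm : ∀ x, x ∈ Ω ↔ τ x < 0 := by
    intro x
    rw [hσm, hτ]
    simp only [sub_neg, Real.exp_lt_one_iff]
    exact ⟨fun h => mul_neg_of_pos_of_neg hK h, fun h => by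
      by_contra h'
      exact absurd h (not_lt.2 (mul_nonneg hK.le (not_lt.1 h')))⟩
  have hexp : ∀ y, HasDerivAt (fun y => exp (K * y)) (K * exp (K * y)) y := by
    intro y
    have := ((hasDerivAt_id y).const_mul K).exp
    simpa [mul_comm] using this
  have hexp1 : ∀ y, HasDerivAt (fun y => exp (K * y) - 1) (K * exp (K * y)) y :=
    fun y => (hexp y).sub_const 1
  have hexp2 : ∀ y, HasDerivAt (fun y => K * exp (K * y)) (K * (K * exp (K * y))) y :=
    fun y => (hexp y).const_mul K
  have hτlevi : ∀ p ∈ frontier Ω, ∀ v, c * ‖v‖ ^ 2 ≤ levi τ p v := by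
    intro p hp v
    rcases eq_or_ne v 0 with rfl | hv
    · simp [levi_zero]
    have hv' : 0 < ‖v‖ := norm_pos_iff.2 hv
    have h1 := hKc (p, ‖v‖⁻¹ • v) ⟨hp, by simp [norm_smul, hv'.ne']⟩
    have h2 := levi_comp (hσc.contDiffAt (x := p)) (Eventually.of_forall hexp1) (hexp2 _)
      (‖v‖⁻¹ • v)
    have h3 : c ≤ levi τ p (‖v‖⁻¹ • v) := by
      rw [hτ, h2, hσ0 p hp]
      simp only [mul_zero, exp_zero, mul_one]
      simp only at h1
      linarith
    rw [levi_smul, inv_pow, ← div_eq_inv_mul, le_div_iff₀ (by positivity)] at h3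
    exact h3
  have hτd : ∀ p ∈ frontier Ω, fderiv ℝ τ p = K • fderiv ℝ σ p := by
    intro p hp
    have h1 := ((hexp1 (σ p)).comp_hasFDerivAt p
      (hσc.differentiable (by norm_num) p).hasFDerivAt).fderiv
    rw [hσ0 p hp, mul_zero, exp_zero, mul_one] at h1
    exact h1
  refine ⟨τ, c, hc, hτc, hτs, hτm, fun p hp => ?_, hτlevi⟩
  rw [hτd p hp]
  exact smul_ne_zero hK.ne' (hgrad p hp)

/-- Every bounded strongly pseudoconvex domain has a defining function that is strictly
plurisubharmonic near the boundary. -/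
theorem exists_defFun {α : ℝ} (hΩ : IsStronglyPseudoconvexDomain 2 α Ω)
    (hne : (frontier Ω).Nonempty) : ∃ ρ r0 c0, DefFun Ω ρ r0 c0 := by
  obtain ⟨τ, c, hc, hτc, hτs, hτm, hgrad, hτlevi⟩ := exists_strict_defining hΩ
  have hb : Bornology.IsBounded Ω := hΩ.2.2.1
  have hF : IsCompact (frontier Ω) := isCompact_frontier hb
  have hτdc : Continuous (fderiv ℝ τ) := hτc.continuous_fderiv (by norm_num)
  obtain ⟨p0, hp0, hmin⟩ := hF.exists_isMinOn hne (hτdc.norm.continuousOn)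
  have hg : 0 < ‖fderiv ℝ τ p0‖ := by
    exact norm_pos_iff.2 (hgrad p0 hp0)
  obtain ⟨r1, hr1, h1⟩ := exists_hess_close hτc hτs (half_pos hc)
  obtain ⟨r2, hr2, h2⟩ := exists_fderiv_close hτc hτs (half_pos hg)
  refine ⟨τ, min r1 r2 / 2, min (c / 2) (‖fderiv ℝ τ p0‖ / 2), hb, hne, hτc, hτs,
    half_pos (lt_min hr1 hr2), lt_min (half_pos hc) (half_pos hg), hτm, fun x hx v => ?_, fun x hx => ?_⟩
  · obtain ⟨p, hp, hxp⟩ := exists_mem_frontier_dist_le hb hne x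
    have hd : dist x p < r1 := by
      rw [hxp]; have := min_le_left r1 r2; have := lt_min hr1 hr2; linarith
    have h3 := abs_levi_sub_le τ x p v
    have h4 := h1 x p (dist_eq_norm x p ▸ hd)
    have h5 := hτlevi p hp v
    have h6 := mul_le_mul_of_nonneg_right h4 (sq_nonneg ‖v‖)
    have h7 := mul_le_mul_of_nonneg_right (min_le_left (c / 2) (‖fderiv ℝ τ p0‖ / 2))
      (sq_nonneg ‖v‖)
    have := neg_abs_le (levi τ x v - levi τ p v)
    linarith
  · obtain ⟨p, hp, hxp⟩ := exists_mem_frontier_dist_le hb hne x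
    have hd : dist x p < r2 := by
      rw [hxp]; have := min_le_right r1 r2; have := lt_min hr1 hr2; linarith
    have h4 := h2 x p (dist_eq_norm x p ▸ hd)
    have h5 : ‖fderiv ℝ τ p0‖ ≤ ‖fderiv ℝ τ p‖ := hmin hp
    have h6 := norm_sub_norm_le (fderiv ℝ τ p) (fderiv ℝ τ x)
    rw [norm_sub_rev] at h6
    have := min_le_right (c / 2) (‖fderiv ℝ τ p0‖ / 2)
    linarith

/-- The complex-linear functional with real part `dρ(p)`, that is `2∂ρ(p)`. -/
def cgrad (ρ : E N → ℝ) (p : E N) : E N →L[ℂ] ℂ := StrongDual.extendRCLike (𝕜 := ℂ) (fderiv ℝ ρ p)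

lemma norm_extendRCLike_apply_le (f : E N →L[ℝ] ℝ) (v : E N) :
    ‖StrongDual.extendRCLike (𝕜 := ℂ) f v‖ ≤ ‖f‖ * ‖v‖ := by
  set c := StrongDual.extendRCLike (𝕜 := ℂ) f v with hc
  have h1 : ‖c‖ ^ 2 = f (conj c • v) := Module.Dual.norm_extendRCLike_apply_sq f.toLinearMap v
  have h2 := (le_abs_self _).trans (f.le_opNorm (conj c • v))
  rw [← h1, norm_smul, norm_conj] at h2
  rcases (norm_nonneg c).eq_or_lt with h | h
  · rw [← h]; positivity
  · nlinarith

lemma cgrad_re (ρ : E N → ℝ) (p v : E N) : (cgrad ρ p v).re = fderiv ℝ ρ p v :=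
  StrongDual.re_extendRCLike_apply (𝕜 := ℂ) _ v

lemma cgrad_im (ρ : E N → ℝ) (p v : E N) : (cgrad ρ p v).im = -fderiv ℝ ρ p (I • v) :=
  StrongDual.im_extendRCLike_apply (𝕜 := ℂ) _ v

lemma norm_cgrad_apply_le (ρ : E N → ℝ) (p v : E N) : ‖cgrad ρ p v‖ ≤ ‖fderiv ℝ ρ p‖ * ‖v‖ :=
  norm_extendRCLike_apply_le _ v

lemma norm_cgrad_sub_apply_le (ρ : E N → ℝ) (p q v : E N) :
    ‖cgrad ρ p v - cgrad ρ q v‖ ≤ ‖fderiv ℝ ρ p - fderiv ℝ ρ q‖ * ‖v‖ := by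
  have h := norm_extendRCLike_apply_le (fderiv ℝ ρ p - fderiv ℝ ρ q) v
  convert h using 2
  simp only [cgrad, StrongDual.extendRCLike_apply, sub_apply]
  push_cast; ring

/-- Quantitative second-order regularity of a function. -/
structure HasC2Bound (ρ : E N → ℝ) (L : ℝ) : Prop where
  one_le : 1 ≤ L
  fderiv_le : ∀ x, ‖fderiv ℝ ρ x‖ ≤ L
  fderiv_sub_le : ∀ x y, ‖fderiv ℝ ρ x - fderiv ℝ ρ y‖ ≤ L * ‖x - y‖
  hess_le : ∀ x, ‖fderiv ℝ (fderiv ℝ ρ) x‖ ≤ L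
  sub_le : ∀ x y, |ρ x - ρ y| ≤ L * ‖x - y‖
  taylor : ∀ x y, |ρ y - ρ x - fderiv ℝ ρ x (y - x)| ≤ L * ‖y - x‖ ^ 2

lemma exists_hess_bound (h : ContDiff ℝ 2 ρ) (hs : HasCompactSupport ρ) :
    ∃ L, ∀ x, ‖fderiv ℝ (fderiv ℝ ρ) x‖ ≤ L := by
  have hc : Continuous fun x => ‖fderiv ℝ (fderiv ℝ ρ) x‖ :=
    (continuous_norm (E := E N →L[ℝ] E N →L[ℝ] ℝ)).comp (continuous_hess h)
  have hk : IsCompact (tsupport (fderiv ℝ (fderiv ℝ ρ))) := hasCompactSupport_hess hs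
  obtain ⟨C, hC⟩ := hk.exists_bound_of_continuousOn hc.continuousOn
  refine ⟨max C 0, fun x => ?_⟩
  by_cases hx : x ∈ tsupport (fderiv ℝ (fderiv ℝ ρ))
  · exact ((le_abs_self _).trans (hC x hx)).trans (le_max_left _ _)
  · have h0 : fderiv ℝ (fderiv ℝ ρ) x = 0 := image_eq_zero_of_notMem_tsupport hx
    rw [h0]
    exact ContinuousLinearMap.opNorm_zero.trans_le (le_max_right _ _)

lemma exists_fderiv_bound (h : ContDiff ℝ 2 ρ) (hs : HasCompactSupport ρ) :
    ∃ L, ∀ x, ‖fderiv ℝ ρ x‖ ≤ L := by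
  have hc : Continuous fun x => ‖fderiv ℝ ρ x‖ := (h.continuous_fderiv (by norm_num)).norm
  obtain ⟨C, hC⟩ := (hs.fderiv ℝ).norm.exists_bound_of_continuous hc
  exact ⟨C, fun x => by simpa using hC x⟩

lemma exists_hasC2Bound (h : ContDiff ℝ 2 ρ) (hs : HasCompactSupport ρ) : ∃ L, HasC2Bound ρ L := by
  obtain ⟨L1, h1⟩ := exists_fderiv_bound h hs
  obtain ⟨L2, h2⟩ := exists_hess_bound h hs
  set L := max 1 (max L1 L2)
  have hL1 : ∀ x, ‖fderiv ℝ ρ x‖ ≤ L := fun x =>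
    (h1 x).trans ((le_max_left _ _).trans (le_max_right _ _))
  have hL2 : ∀ x, ‖fderiv ℝ (fderiv ℝ ρ) x‖ ≤ L := fun x =>
    (h2 x).trans ((le_max_right _ _).trans (le_max_right _ _))
  have hd : Differentiable ℝ ρ := h.differentiable (by norm_num)
  have hd' : Differentiable ℝ (fderiv ℝ ρ) :=
    (h.fderiv_right (m := 1) (by norm_num)).differentiable (by norm_num)
  have hL0 : 0 ≤ L := zero_le_one.trans (le_max_left _ _)
  have h3 : ∀ x y, ‖fderiv ℝ ρ x - fderiv ℝ ρ y‖ ≤ L * ‖x - y‖ := fun x y =>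
    convex_univ.norm_image_sub_le_of_norm_fderiv_le (fun z _ => hd' z) (fun z _ => hL2 z)
      (mem_univ y) (mem_univ x)
  refine ⟨L, le_max_left _ _, hL1, h3, hL2, fun x y => ?_, fun x y => ?_⟩
  · exact convex_univ.norm_image_sub_le_of_norm_fderiv_le (fun z _ => hd z) (fun z _ => hL1 z)
      (mem_univ y) (mem_univ x)
  · have := (convex_closedBall x ‖y - x‖).norm_image_sub_le_of_norm_fderiv_le' (f := ρ)
      (φ := fderiv ℝ ρ x) (C := L * ‖y - x‖) (𝕜 := ℝ) (fun z _ => hd z)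
      (fun z hz => (h3 z x).trans (by
        rw [mem_closedBall, dist_eq_norm] at hz
        gcongr))
      (mem_closedBall_self (norm_nonneg _)) (y := y) (by simp [dist_eq_norm])
    rw [norm_eq_abs] at this
    rw [pow_two, ← mul_assoc]
    exact this

/-- Uniform second-order Taylor expansion. -/
lemma exists_taylor_two (h : ContDiff ℝ 2 ρ) (hs : HasCompactSupport ρ)
    (hκ : 0 < κ) : ∃ r > 0, ∀ p v, ‖v‖ < r →
      |ρ (p + v) - ρ p - fderiv ℝ ρ p v - fderiv ℝ (fderiv ℝ ρ) p v v / 2| ≤ κ * ‖v‖ ^ 2 := by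
  obtain ⟨r, hr, hH⟩ := exists_hess_close h hs hκ
  refine ⟨r, hr, fun p v hv => ?_⟩
  have hd : Differentiable ℝ ρ := h.differentiable (by norm_num)
  have hd' : Differentiable ℝ (fderiv ℝ ρ) :=
    (h.fderiv_right (m := 1) (by norm_num)).differentiable (by norm_num)
  set H := fderiv ℝ (fderiv ℝ ρ) p with hHd
  have h1 : ∀ t ∈ Icc (0:ℝ) 1, ‖fderiv ℝ ρ (p + t • v) - fderiv ℝ ρ p - H (t • v)‖ ≤ κ * ‖v‖ := by
    intro t ht
    have htv : ‖t • v‖ ≤ ‖v‖ := by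
      rw [norm_smul, norm_of_nonneg ht.1]
      exact mul_le_of_le_one_left (norm_nonneg _) ht.2
    have := (convex_closedBall p ‖v‖).norm_image_sub_le_of_norm_fderiv_le' (f := fderiv ℝ ρ)
      (φ := H) (C := κ) (𝕜 := ℝ) (fun z _ => hd' z)
      (fun z hz => hH z p (by
        rw [mem_closedBall, dist_eq_norm] at hz
        exact hz.trans_lt hv))
      (mem_closedBall_self (norm_nonneg _)) (y := p + t • v) (by simpa [dist_eq_norm] using htv)
    rw [add_sub_cancel_left] at this
    exact this.trans (by gcongr)
  have hline : ∀ t : ℝ, HasDerivAt (fun t : ℝ => p + t • v) v t := fun t => by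
    simpa using ((hasDerivAt_id t).smul_const v).const_add p
  have hder : ∀ t : ℝ, HasDerivAt (fun t : ℝ => ρ (p + t • v) - t * fderiv ℝ ρ p v - t ^ 2 / 2 * H v v)
      (fderiv ℝ ρ (p + t • v) v - fderiv ℝ ρ p v - t * H v v) t := by
    intro t
    have e1 := (hd (p + t • v)).hasFDerivAt.comp_hasDerivAt t (hline t)
    have e2 := (hasDerivAt_id t).mul_const (fderiv ℝ ρ p v)
    have e3 := (((hasDerivAt_id t).pow 2).div_const 2).mul_const (H v v)
    refine ((e1.sub e2).sub e3).congr_deriv ?_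
    simp
  have h2 := (convex_Icc (0:ℝ) 1).norm_image_sub_le_of_norm_hasDerivWithin_le
    (C := κ * ‖v‖ ^ 2) (fun t _ => (hder t).hasDerivWithinAt) (fun t ht => by
      have e := (fderiv ℝ ρ (p + t • v) - fderiv ℝ ρ p - H (t • v)).le_opNorm v
      have e' : (fderiv ℝ ρ (p + t • v) - fderiv ℝ ρ p - H (t • v)) v =
          fderiv ℝ ρ (p + t • v) v - fderiv ℝ ρ p v - t * H v v := by
        simp
      rw [e'] at e
      refine e.trans ?_
      have := mul_le_mul_of_nonneg_right (h1 t ht) (norm_nonneg v)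
      rw [pow_two, ← mul_assoc]
      exact this)
    (left_mem_Icc.2 zero_le_one) (right_mem_Icc.2 zero_le_one)
  rw [norm_eq_abs] at h2
  have e : ρ (p + v) - ρ p - fderiv ℝ ρ p v - H v v / 2 =
      ρ (p + (1:ℝ) • v) - 1 * fderiv ℝ ρ p v - 1 ^ 2 / 2 * H v v -
        (ρ (p + (0:ℝ) • v) - 0 * fderiv ℝ ρ p v - 0 ^ 2 / 2 * H v v) := by
    rw [one_smul, zero_smul, add_zero]; ring
  rw [e]
  refine h2.trans_eq ?_
  norm_num

namespace DefFun

lemma isOpen (h : DefFun Ω ρ r0 c0) : IsOpen Ω := by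
  have : Ω = ρ ⁻¹' Iio 0 := by ext x; exact h.mem_iff x
  rw [this]
  exact isOpen_Iio.preimage h.contDiff.continuous

lemma nonpos_of_mem_closure (h : DefFun Ω ρ r0 c0) (hx : x ∈ closure Ω) : ρ x ≤ 0 :=
  closure_minimal (t := {x | ρ x ≤ 0}) (fun x hx => ((h.mem_iff x).1 hx).le)
    (isClosed_le h.contDiff.continuous continuous_const) hx

lemma eq_zero (h : DefFun Ω ρ r0 c0) (hp : p ∈ frontier Ω) : ρ p = 0 := by
  refine le_antisymm (h.nonpos_of_mem_closure (frontier_subset_closure hp)) (not_lt.1 fun h' => ?_)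
  rw [h.isOpen.frontier_eq] at hp
  exact hp.2 ((h.mem_iff p).2 h')

lemma pos_of_notMem_closure (h : DefFun Ω ρ r0 c0) (hx : x ∉ closure Ω)
    (hd : infDist x (frontier Ω) ≤ r0) : 0 < ρ x := by
  have hnn : ∀ y ∉ closure Ω, 0 ≤ ρ y := fun y hy =>
    not_lt.1 fun h' => hy (subset_closure ((h.mem_iff y).2 h'))
  refine lt_of_le_of_ne (hnn x hx) fun h0 => ?_
  have hmin : IsLocalMin ρ x := by
    filter_upwards [isClosed_closure.isOpen_compl.mem_nhds hx] with y hy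
    rw [← h0]; exact hnn y hy
  have := h.grad_le x hd
  rw [IsLocalMin.fderiv_eq_zero hmin, norm_zero] at this
  exact absurd h.c₀_pos (not_lt.2 this)

lemma ball_subset (h : DefFun Ω ρ r0 c0) (hz : z ∈ Ω) : ball z (bdist Ω z) ⊆ Ω := by
  have hu : Ω ≠ univ := by
    rintro rfl
    simpa using h.nonempty
  obtain ⟨y, hy, hzy⟩ := exists_mem_frontier_infDist_compl_eq_dist hz hu
  intro x hx
  by_contra hxΩ
  have h1 : infDist z Ωᶜ ≤ dist z x := infDist_le_dist_of_mem hxΩ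
  have h2 : bdist Ω z ≤ dist z y := infDist_le_dist_of_mem hy
  rw [mem_ball, dist_comm] at hx
  linarith

lemma bdist_pos (h : DefFun Ω ρ r0 c0) (hz : z ∈ Ω) : 0 < bdist Ω z := by
  refine (isClosed_frontier.notMem_iff_infDist_pos h.nonempty).1 fun hz' => ?_
  rw [h.isOpen.frontier_eq] at hz'
  exact hz'.2 hz

/-- At a nearest boundary point, the differential is a positive multiple of the normal. -/
lemma exists_normal (h : DefFun Ω ρ r0 c0) (hz : z ∈ Ω) (hp : p ∈ frontier Ω)
    (hzp : dist z p = bdist Ω z) :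
    ∃ l : ℝ, 0 < l ∧ ∀ v, cgrad ρ p v = l * herm v (p - z) := by
  set n := p - z with hn
  have hδ := h.bdist_pos hz
  have hd : Differentiable ℝ ρ := h.contDiff.differentiable (by norm_num)
  have hnn : ‖n‖ = bdist Ω z := by rw [← hzp, dist_comm, dist_eq_norm]
  set m : E N → ℝ := fun v => (herm v n).re with hm
  have hherm : ∀ v w : E N, herm v w = inner ℂ w v := fun v w => by
    simp only [herm, PiLp.inner_apply, inner_apply]
  have hmn : m n = ‖n‖ ^ 2 := by
    simp only [hm, hherm]
    exact inner_self_eq_norm_sq (𝕜 := ℂ) n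
  have hmadd : ∀ v w, m (v + w) = m v + m w := fun v w => by
    simp [hm, hherm]
  have hmsmul : ∀ (t : ℝ) v, m (t • v) = t * m v := fun t v => by
    simp [hm, hherm, inner_smul_right_eq_smul]
  have hnsq : 0 < ‖n‖ ^ 2 := by rw [hnn]; positivity
  set ℓ := fderiv ℝ ρ p with hℓ
  have hneg : ∀ v, m v < 0 → ℓ v ≤ 0 := by
    intro v hv
    have hline : HasDerivAt (fun t : ℝ => p + t • v) v 0 := by
      simpa using ((hasDerivAt_id (0:ℝ)).smul_const v).const_add p
    have h1 : HasDerivAt (fun t : ℝ => ρ (p + t • v)) (ℓ v) 0 := by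
      refine HasFDerivAt.comp_hasDerivAt (0:ℝ) ?_ hline
      simpa using (hd p).hasFDerivAt
    have h2 := (hasDerivWithinAt_iff_tendsto_slope' (s := Ioi (0:ℝ)) (by simp)).1
      h1.hasDerivWithinAt
    refine le_of_tendsto h2 ?_
    have hev : ∀ᶠ t in 𝓝[>] (0:ℝ), t * ‖v‖ ^ 2 < -2 * m v := by
      have : Tendsto (fun t : ℝ => t * ‖v‖ ^ 2) (𝓝[>] 0) (𝓝 0) := by
        have : Tendsto (fun t : ℝ => t * ‖v‖ ^ 2) (𝓝 0) (𝓝 (0 * ‖v‖ ^ 2)) := tendsto_id.mul_const _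
        rw [zero_mul] at this
        exact this.mono_left nhdsWithin_le_nhds
      exact this.eventually (eventually_lt_nhds (by linarith))
    filter_upwards [hev, self_mem_nhdsWithin] with t ht ht0
    have ht0' : (0:ℝ) < t := ht0
    have hmem : p + t • v ∈ Ω := by
      refine h.ball_subset hz ?_
      rw [mem_ball, dist_eq_norm, ← hnn, show p + t • v - z = n + t • v by rw [hn]; abel]
      have e : ‖n + t • v‖ ^ 2 = ‖n‖ ^ 2 + 2 * (t * m v) + t ^ 2 * ‖v‖ ^ 2 := by
        rw [@norm_add_sq ℂ, norm_smul, mul_pow, norm_eq_abs, sq_abs]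
        rw [← hmsmul, hm]
        simp only [hherm]; rfl
      refine lt_of_pow_lt_pow_left₀ 2 (norm_nonneg _) ?_
      rw [e]
      nlinarith
    rw [slope_def_field]
    refine div_nonpos_of_nonpos_of_nonneg ?_ (by linarith)
    have := (h.mem_iff _).1 hmem
    simp only [zero_smul, add_zero, h.eq_zero hp]
    linarith
  have hker' : ∀ v, m v = 0 → ℓ v ≤ 0 := by
    intro v hv
    have h1 : ∀ s > 0, ℓ v ≤ s * ℓ n := by
      intro s hs
      have h2 := hneg (v + (-s) • n) (by rw [hmadd, hmsmul, hv, hmn]; nlinarith)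
      rw [map_add, map_smul, smul_eq_mul] at h2
      linarith
    have h3 : Tendsto (fun s : ℝ => s * ℓ n) (𝓝[>] 0) (𝓝 0) := by
      have : Tendsto (fun t : ℝ => t * ℓ n) (𝓝 0) (𝓝 (0 * ℓ n)) := tendsto_id.mul_const _
      rw [zero_mul] at this
      exact this.mono_left nhdsWithin_le_nhds
    exact ge_of_tendsto h3 (by filter_upwards [self_mem_nhdsWithin] with s hs using h1 s hs)
  have hker : ∀ v, m v = 0 → ℓ v = 0 := by
    intro v hv
    have h1 := hker' (-v) (by have := hmsmul (-1) v; simp [hv] at this; simpa using this)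
    rw [map_neg] at h1
    exact le_antisymm (hker' v hv) (by linarith)
  have hform : ∀ v, ℓ v = ℓ n / ‖n‖ ^ 2 * m v := by
    intro v
    have h1 := hker (v + (-(m v / ‖n‖ ^ 2)) • n) (by
      rw [hmadd, hmsmul, hmn, neg_mul, div_mul_cancel₀ _ hnsq.ne', add_neg_cancel])
    rw [map_add, map_smul, smul_eq_mul] at h1
    have : ℓ v = m v / ‖n‖ ^ 2 * ℓ n := by linarith
    rw [this]; ring
  have hl0 : 0 ≤ ℓ n := by
    have := hneg (-n) (by have := hmsmul (-1) n; rw [neg_one_smul] at this; rw [this, hmn]; linarith)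
    rw [map_neg] at this; linarith
  have hl1 : ℓ n ≠ 0 := by
    intro h0
    have h1 : ℓ = 0 := by ext v; rw [hform, h0]; simp
    have h2 := h.grad_le p (by rw [infDist_zero_of_mem hp]; exact h.r₀_pos.le)
    rw [← hℓ, h1, norm_zero] at h2
    exact absurd h.c₀_pos (not_lt.2 h2)
  refine ⟨ℓ n / ‖n‖ ^ 2, div_pos (lt_of_le_of_ne hl0 hl1.symm) hnsq, fun v => ?_⟩
  apply Complex.ext
  · rw [cgrad_re, ← hℓ, hform, re_ofReal_mul]
  · rw [cgrad_im, ← hℓ, hform, Complex.im_ofReal_mul, hm]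
    simp only [hherm, inner_smul_right]
    simp

end DefFun

/-- The quantity `‖(z-w)_z‖ + ‖z-w‖² + ‖z-w‖ δ(z)^{1/2}` expressed through a defining function. -/
def hquant (ρ : E N → ℝ) (z w : E N) : ℝ := ‖cgrad ρ z (z - w)‖ + ‖z - w‖ ^ 2 + ‖z - w‖ * √(-ρ z)

/-- The quantity `A_Ω` expressed through a defining function. -/
def aquant (ρ : E N → ℝ) (z w : E N) : ℝ := hquant ρ z w / (√(-ρ z) * √(-ρ w))

lemma norm_herm_le (v w : E N) : ‖herm v w‖ ≤ ‖v‖ * ‖w‖ := by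
  have h : herm v w = inner ℂ w v := by
    simp only [herm, PiLp.inner_apply, inner_apply]
  rw [h, mul_comm]
  exact norm_inner_le_norm w v

lemma norm_herm_self (v : E N) : ‖herm v v‖ = ‖v‖ ^ 2 := by
  have h : herm v v = inner ℂ v v := by
    simp only [herm, PiLp.inner_apply, inner_apply]
  rw [h, inner_self_eq_norm_sq_to_K]
  simp

namespace DefFun

lemma neg_le_bdist (h : DefFun Ω ρ r0 c0) (hL : HasC2Bound ρ L) (x : E N) :
    |ρ x| ≤ L * bdist Ω x := by
  obtain ⟨p, hp, hxp⟩ := exists_mem_frontier_dist_le h.bounded h.nonempty x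
  have h1 := hL.sub_le x p
  rw [h.eq_zero hp, sub_zero, ← dist_eq_norm, hxp] at h1
  exact h1

lemma exists_bdist_bound (h : DefFun Ω ρ r0 c0) : ∃ B > 0, ∀ x ∈ Ω, bdist Ω x ≤ B := by
  obtain ⟨B, hB⟩ := h.bounded.isCompact_closure.exists_bound_of_continuousOn
    (continuous_infDist_pt (frontier Ω)).continuousOn
  exact ⟨|B| + 1, by positivity, fun x hx => ((le_abs_self _).trans
    (hB x (subset_closure hx))).trans ((le_abs_self B).trans (by linarith))⟩

/-- At a nearest boundary point, the complex normal component is comparable to `∂ρ`. -/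
lemma norm_cgrad_nearest (h : DefFun Ω ρ r0 c0) (hL : HasC2Bound ρ L) (hz : z ∈ Ω)
    (hp : p ∈ frontier Ω) (hzp : dist z p = bdist Ω z) (v : E N) :
    c0 * (‖herm v (p - z)‖ / bdist Ω z) ≤ ‖cgrad ρ p v‖ ∧
      ‖cgrad ρ p v‖ ≤ L * (‖herm v (p - z)‖ / bdist Ω z) ∧
      fderiv ℝ ρ p (p - z) = ‖cgrad ρ p (p - z)‖ ∧ c0 * bdist Ω z ≤ ‖cgrad ρ p (p - z)‖ := by
  obtain ⟨l, hl, hlv⟩ := h.exists_normal hz hp hzp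
  have hδ := h.bdist_pos hz
  have hnn : ‖p - z‖ = bdist Ω z := by rw [← hzp, dist_comm, dist_eq_norm]
  have e1 : ∀ v, ‖cgrad ρ p v‖ = l * ‖herm v (p - z)‖ := fun v => by
    rw [hlv, norm_mul, norm_real, norm_of_nonneg hl.le]
  have hl1 : l * bdist Ω z ≤ L := by
    have h1 := norm_cgrad_apply_le ρ p (p - z)
    rw [e1, norm_herm_self, hnn] at h1
    have h2 := hL.fderiv_le p
    have h3 : l * bdist Ω z * bdist Ω z ≤ L * bdist Ω z := by nlinarith
    exact le_of_mul_le_mul_right h3 hδ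
  have hl2 : c0 ≤ l * bdist Ω z := by
    refine (h.grad_le p (by rw [infDist_zero_of_mem hp]; exact h.r₀_pos.le)).trans ?_
    refine ContinuousLinearMap.opNorm_le_bound _ (by positivity) fun v => ?_
    rw [← cgrad_re]
    refine (abs_re_le_norm _).trans ?_
    rw [e1]
    have := norm_herm_le v (p - z)
    rw [hnn] at this
    nlinarith
  have e2 : ∀ v, ‖cgrad ρ p v‖ = l * bdist Ω z * (‖herm v (p - z)‖ / bdist Ω z) := fun v => by
    rw [e1]; field_simp
  have hq : ∀ v, 0 ≤ ‖herm v (p - z)‖ / bdist Ω z := fun v => by positivity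
  refine ⟨?_, ?_, ?_, ?_⟩
  · rw [e2]; exact mul_le_mul_of_nonneg_right hl2 (hq v)
  · rw [e2]; exact mul_le_mul_of_nonneg_right hl1 (hq v)
  · have h4 : herm (p - z) (p - z) = (‖p - z‖ ^ 2 : ℝ) := by
      have h : herm (p - z) (p - z) = inner ℂ (p - z) (p - z) := by
        simp only [herm, PiLp.inner_apply, inner_apply]
      rw [h, inner_self_eq_norm_sq_to_K]
      norm_cast
    rw [e1, norm_herm_self, ← cgrad_re, hlv, h4, ← ofReal_mul, ofReal_re]
  · rw [e1, norm_herm_self, hnn]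
    nlinarith

/-- The defining function dominates the boundary distance. -/
lemma exists_bdist_le (h : DefFun Ω ρ r0 c0) : ∃ a > 0, ∀ x ∈ Ω, a * bdist Ω x ≤ -ρ x := by
  obtain ⟨L, hL⟩ := exists_hasC2Bound h.contDiff h.compact
  obtain ⟨B, hB, hBx⟩ := h.exists_bdist_bound
  have hL0 : 0 < L := zero_lt_one.trans_le hL.one_le
  have hc := h.c₀_pos
  set η := c0 / (2 * L) with hη
  have hη0 : 0 < η := by positivity
  have hK : IsCompact (closure Ω ∩ {x | η ≤ infDist x (frontier Ω)}) :=
    h.bounded.isCompact_closure.inter_right (isClosed_le continuous_const (continuous_infDist_pt _))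
  have hfar : ∃ m > 0, ∀ x ∈ closure Ω ∩ {x | η ≤ infDist x (frontier Ω)}, m ≤ -ρ x := by
    rcases (closure Ω ∩ {x | η ≤ infDist x (frontier Ω)}).eq_empty_or_nonempty with he | hne
    · exact ⟨1, one_pos, by simp [he]⟩
    · obtain ⟨y, hy, hmin⟩ := hK.exists_isMinOn hne h.contDiff.continuous.neg.continuousOn
      refine ⟨-ρ y, ?_, fun x hx => hmin hx⟩
      have hyΩ : y ∈ Ω := by
        by_contra hyn
        have : y ∈ frontier Ω := by rw [h.isOpen.frontier_eq]; exact ⟨hy.1, hyn⟩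
        have h2 : η ≤ infDist y (frontier Ω) := hy.2
        rw [infDist_zero_of_mem this] at h2
        linarith
      have := (h.mem_iff y).1 hyΩ
      linarith
  obtain ⟨m, hm, hmx⟩ := hfar
  refine ⟨min (c0 / 2) (m / B), lt_min (by positivity) (by positivity), fun x hx => ?_⟩
  have hδ := h.bdist_pos hx
  by_cases hd : η ≤ bdist Ω x
  · have h1 := hmx x ⟨subset_closure hx, hd⟩
    refine le_trans ?_ h1
    calc min (c0 / 2) (m / B) * bdist Ω x ≤ m / B * B :=
          mul_le_mul (min_le_right _ _) (hBx x hx) hδ.le (by positivity)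
      _ = m := by field_simp
  · obtain ⟨p, hp, hxp⟩ := exists_mem_frontier_dist_le h.bounded h.nonempty x
    have hnn : ‖x - p‖ = bdist Ω x := by rw [← dist_eq_norm]; exact hxp
    have h1 := h.norm_cgrad_nearest hL hx hp hxp 0
    have h2 := (abs_le.1 (hL.taylor p x)).2
    rw [h.eq_zero hp, hnn] at h2
    have h3 : fderiv ℝ ρ p (x - p) = -fderiv ℝ ρ p (p - x) := by
      rw [← map_neg, neg_sub]
    have h4 : L * bdist Ω x ^ 2 ≤ c0 / 2 * bdist Ω x := by
      have : L * bdist Ω x ≤ c0 / 2 := by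
        have := mul_le_mul_of_nonneg_left (not_le.1 hd).le hL0.le
        refine this.trans_eq ?_
        rw [hη]; field_simp
      nlinarith
    have h5 := mul_le_mul_of_nonneg_right (min_le_left (c0 / 2) (m / B)) hδ.le
    rw [h3, h1.2.2.1] at h2
    linarith [h1.2.2.2]

/-- `A_Ω` is comparable to its counterpart defined through `ρ`. -/
lemma exists_afun_comparable (h : DefFun Ω ρ r0 c0) : ∃ C ≥ 1, ∀ π : E N → E N,
    IsClosestPointSelection Ω π → ∀ z ∈ Ω, ∀ w ∈ Ω,
      Afun Ω π z w ≤ C * aquant ρ z w ∧ aquant ρ z w ≤ C * Afun Ω π z w := by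
  obtain ⟨L, hL⟩ := exists_hasC2Bound h.contDiff h.compact
  obtain ⟨B, hB, hBx⟩ := h.exists_bdist_bound
  obtain ⟨a, ha, hax⟩ := h.exists_bdist_le
  have hL0 : 0 < L := zero_lt_one.trans_le hL.one_le
  have hc := h.c₀_pos
  set C1 := L + L * √B + 1 + √L with hC1
  set C2 := 1 / c0 + L * √B / (c0 * √a) + 1 + 1 / √a with hC2
  have hC₁0 : 0 < C1 := by positivity
  have hC₂0 : 0 < C2 := by positivity
  refine ⟨1 + (C1 / a + C2 * L), by linarith [show 0 < C1 / a + C2 * L by positivity],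
    fun π hπ z hz w hw => ?_⟩
  obtain ⟨hp, hzp⟩ := hπ z hz
  have hδ := h.bdist_pos hz
  have hδ' := h.bdist_pos hw
  have hσ : ∀ x ∈ Ω, √(-ρ x) ≤ √L * √(bdist Ω x) ∧ √a * √(bdist Ω x) ≤ √(-ρ x) := fun x hx => by
    rw [← Real.sqrt_mul hL0.le, ← Real.sqrt_mul ha.le]
    exact ⟨sqrt_le_sqrt ((neg_le_abs _).trans (h.neg_le_bdist hL x)), sqrt_le_sqrt (hax x hx)⟩
  obtain ⟨s1, s2⟩ := hσ z hz
  obtain ⟨s3, s4⟩ := hσ w hw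
  obtain ⟨n1, n2, -, -⟩ := h.norm_cgrad_nearest hL hz hp hzp (z - w)
  change c0 * ncomp Ω π z (z - w) ≤ _ at n1
  change _ ≤ L * ncomp Ω π z (z - w) at n2
  have hn0 : 0 ≤ ncomp Ω π z (z - w) := by unfold ncomp; positivity
  unfold Afun aquant hquant
  set n := ncomp Ω π z (z - w)
  set d := ‖z - w‖ with hd
  have hd0 : 0 ≤ d := norm_nonneg _
  set s := √(bdist Ω z) with hs
  set s' := √(bdist Ω w)
  set σ := √(-ρ z)
  set σ' := √(-ρ w)
  have hs0 : 0 < s := sqrt_pos.2 hδ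
  have hs0' : 0 < s' := sqrt_pos.2 hδ'
  have hsa : 0 < √a := sqrt_pos.2 ha
  have hσ0 : 0 < σ := lt_of_lt_of_le (by positivity) s2
  have hσ0' : 0 < σ' := lt_of_lt_of_le (by positivity) s4
  have hsB : s ≤ √B := sqrt_le_sqrt (hBx z hz)
  have hdiff : |‖cgrad ρ z (z - w)‖ - ‖cgrad ρ (π z) (z - w)‖| ≤ L * √B * (s * d) := by
    refine (abs_norm_sub_norm_le _ _).trans ((norm_cgrad_sub_apply_le ρ z (π z) (z - w)).trans ?_)
    have h1 := hL.fderiv_sub_le z (π z)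
    rw [← dist_eq_norm z, hzp, ← sq_sqrt hδ.le, ← hs] at h1
    calc ‖fderiv ℝ ρ z - fderiv ℝ ρ (π z)‖ * ‖z - w‖ ≤ L * s ^ 2 * d := by gcongr
      _ = L * s * (s * d) := by ring
      _ ≤ L * √B * (s * d) := by gcongr
  obtain ⟨d1, d2⟩ := abs_le.1 hdiff
  set g := ‖cgrad ρ z (z - w)‖
  have hg0 : 0 ≤ g := norm_nonneg _
  have hLa : √L * √L = L := mul_self_sqrt hL0.le
  have haa : √a * √a = a := mul_self_sqrt ha.le
  have hsd : 0 ≤ s * d := by positivity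
  have hup : g + d ^ 2 + d * σ ≤ C1 * (n + d ^ 2 + d * s) := by
    have e1 : d * σ ≤ √L * (d * s) := by
      rw [show √L * (d * s) = d * (√L * s) by ring]; gcongr
    have e2 : 0 ≤ (1 + √L + L * √B) * n := by positivity
    have e3 : 0 ≤ (L + L * √B + √L) * d ^ 2 := by positivity
    have e4 : 0 ≤ (L + 1) * (d * s) := by positivity
    rw [hC1]; linarith
  have hlow : n + d ^ 2 + d * s ≤ C2 * (g + d ^ 2 + d * σ) := by
    have e0 : s ≤ 1 / √a * σ := by
      rw [one_div, ← div_eq_inv_mul, le_div_iff₀ hsa]; linarith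
    have e1 : d * s ≤ 1 / √a * (d * σ) := by
      rw [show 1 / √a * (d * σ) = d * (1 / √a * σ) by ring]; gcongr
    have e2 : n ≤ 1 / c0 * g + L * √B / (c0 * √a) * (d * σ) := by
      have : c0 * n ≤ g + L * √B * (1 / √a * (d * σ)) := by
        have := mul_le_mul_of_nonneg_left e1 (show 0 ≤ L * √B by positivity)
        linarith
      calc n = (c0 * n) / c0 := by field_simp
        _ ≤ (g + L * √B * (1 / √a * (d * σ))) / c0 := by gcongr
        _ = _ := by field_simp
    have e3 : 0 ≤ (L * √B / (c0 * √a) + 1 + 1 / √a) * g := by positivity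
    have e4 : 0 ≤ (1 / c0 + L * √B / (c0 * √a) + 1 / √a) * d ^ 2 := by positivity
    have e5 : 0 ≤ (1 / c0 + 1) * (d * σ) := by positivity
    rw [hC2]; linarith
  have hss : σ * σ' ≤ L * (s * s') := by
    calc σ * σ' ≤ (√L * s) * (√L * s') := by gcongr
      _ = √L * √L * (s * s') := by ring
      _ = _ := by rw [hLa]
  have hss' : a * (s * s') ≤ σ * σ' := by
    calc a * (s * s') = √a * √a * (s * s') := by rw [haa]
      _ = (√a * s) * (√a * s') := by ring
      _ ≤ _ := by gcongr
  have hA0 : 0 ≤ n + d ^ 2 + d * s := by positivity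
  have hQ0 : 0 ≤ g + d ^ 2 + d * σ := by positivity
  constructor
  · rw [div_le_iff₀ (by positivity)]
    have : C2 * (g + d ^ 2 + d * σ) ≤ (C2 * L) * ((g + d ^ 2 + d * σ) / (σ * σ')) * (s * s') := by
      rw [show (C2 * L) * ((g + d ^ 2 + d * σ) / (σ * σ')) * (s * s') =
        C2 * (g + d ^ 2 + d * σ) * ((L * (s * s')) / (σ * σ')) by ring]
      exact le_mul_of_one_le_right (by positivity) ((one_le_div (by positivity)).2 hss)
    refine (hlow.trans this).trans ?_
    gcongr
    linarith [show 0 < C1 / a by positivity]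
  · rw [div_le_iff₀ (by positivity)]
    have : C1 * (n + d ^ 2 + d * s) ≤ (C1 / a) * ((n + d ^ 2 + d * s) / (s * s')) * (σ * σ') := by
      rw [show (C1 / a) * ((n + d ^ 2 + d * s) / (s * s')) * (σ * σ') =
        C1 * (n + d ^ 2 + d * s) * ((σ * σ') / (a * (s * s'))) by field_simp]
      exact le_mul_of_one_le_right (by positivity) ((one_le_div (by positivity)).2 hss')
    refine (hup.trans this).trans ?_
    gcongr
    linarith [show 0 < C2 * L by positivity]

end DefFun

lemma hasDerivAt_max_pow (n : ℕ) (y : ℝ) :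
    HasDerivAt (fun y : ℝ => max y 0 ^ (n + 2)) ((n + 2 : ℕ) * max y 0 ^ (n + 1)) y := by
  have key : ∀ y : ℝ, y ≠ 0 →
      HasDerivAt (fun y : ℝ => max y 0 ^ (n + 2)) ((n + 2 : ℕ) * max y 0 ^ (n + 1)) y := by
    intro y hy
    rcases lt_or_gt_of_ne hy with h | h
    · have e : (fun y : ℝ => max y 0 ^ (n + 2)) =ᶠ[𝓝 y] fun _ => 0 := by
        filter_upwards [Iio_mem_nhds h] with x hx
        rw [max_eq_right (le_of_lt hx)]; simp
      rw [max_eq_right h.le]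
      simpa using (hasDerivAt_const y (0 : ℝ)).congr_of_eventuallyEq e
    · have e : (fun y : ℝ => max y 0 ^ (n + 2)) =ᶠ[𝓝 y] fun y => y ^ (n + 2) := by
        filter_upwards [Ioi_mem_nhds h] with x hx
        rw [max_eq_left (le_of_lt hx)]
      rw [max_eq_left h.le]
      exact (hasDerivAt_pow (n + 2) y).congr_of_eventuallyEq e
  rcases eq_or_ne y 0 with rfl | hy
  · exact hasDerivAt_of_hasDerivAt_of_ne (fun y hy => key y hy) (by fun_prop) (by fun_prop)
  · exact key y hy

lemma contDiff_max_cube : ContDiff ℝ 2 fun y : ℝ => max y 0 ^ 3 := by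
  have h1 : deriv (fun y : ℝ => max y 0 ^ 3) = fun y => 3 * max y 0 ^ 2 := by
    ext y; exact_mod_cast (hasDerivAt_max_pow 1 y).deriv
  have h2 : deriv (fun y : ℝ => max y 0 ^ 2) = fun y => 2 * max y 0 := by
    ext y; simpa using (hasDerivAt_max_pow 0 y).deriv
  have h3 : ContDiff ℝ 1 fun y : ℝ => max y 0 ^ 2 := by
    rw [show (1 : WithTop ℕ∞) = 0 + 1 by norm_num, contDiff_succ_iff_deriv]
    refine ⟨fun y => (hasDerivAt_max_pow 0 y).differentiableAt, by simp, ?_⟩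
    rw [h2, contDiff_zero]; fun_prop
  rw [show (2 : WithTop ℕ∞) = 1 + 1 by norm_num, contDiff_succ_iff_deriv]
  refine ⟨fun y => (hasDerivAt_max_pow 1 y).differentiableAt, by simp, ?_⟩
  rw [h1]; exact contDiff_const.mul h3

/-- The profile of the weight: a multiple of `max (y + τ) 0 ^ 3 / (ε - y)`. -/
def profile (M τ ε y : ℝ) : ℝ := M * (max (y + τ) 0 ^ 3 * (ε - y)⁻¹)

/-- The derivative of `profile`. -/
def profile' (M τ ε y : ℝ) : ℝ :=
  M * (3 * max (y + τ) 0 ^ 2 * (ε - y)⁻¹ + max (y + τ) 0 ^ 3 * (ε - y)⁻¹ ^ 2)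

/-- The second derivative of `profile`. -/
def profile'' (M τ ε y : ℝ) : ℝ :=
  M * (6 * max (y + τ) 0 * (ε - y)⁻¹ + 6 * max (y + τ) 0 ^ 2 * (ε - y)⁻¹ ^ 2 +
    2 * max (y + τ) 0 ^ 3 * (ε - y)⁻¹ ^ 3)

lemma hasDerivAt_inv_sub {y : ℝ} (h : y < ε) :
    HasDerivAt (fun y => (ε - y)⁻¹) ((ε - y)⁻¹ ^ 2) y := by
  have h1 : ε - y ≠ 0 := (sub_pos.2 h).ne'
  have := ((hasDerivAt_id y).const_sub ε).inv h1
  refine this.congr_deriv ?_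
  simp [inv_pow]

lemma hasDerivAt_profile (M τ : ℝ) {y : ℝ} (h : y < ε) :
    HasDerivAt (profile M τ ε) (profile' M τ ε y) y := by
  have h1 := (hasDerivAt_max_pow 1 (y + τ)).comp_add_const y τ
  have := ((h1.mul (hasDerivAt_inv_sub h)).const_mul M)
  refine this.congr_deriv ?_
  simp only [profile']; push_cast; ring

lemma hasDerivAt_profile' (M τ : ℝ) {y : ℝ} (h : y < ε) :
    HasDerivAt (profile' M τ ε) (profile'' M τ ε y) y := by
  have h1 := (hasDerivAt_max_pow 1 (y + τ)).comp_add_const y τ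
  have h0 := (hasDerivAt_max_pow 0 (y + τ)).comp_add_const y τ
  have hi := hasDerivAt_inv_sub h
  have := (((h0.const_mul 3).mul hi).add (h1.mul (hi.pow 2))).const_mul M
  refine this.congr_deriv ?_
  simp only [profile'', Pi.pow_apply]
  generalize (ε - y)⁻¹ = k
  generalize max (y + τ) 0 = m
  push_cast; ring

lemma profile'_nonneg {y : ℝ} (hM : 0 ≤ M) (h : y < ε) : 0 ≤ profile' M τ ε y := by
  have := sub_pos.2 h
  unfold profile'; positivity

lemma profile''_nonneg {y : ℝ} (hM : 0 ≤ M) (h : y < ε) : 0 ≤ profile'' M τ ε y := by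
  have := sub_pos.2 h
  unfold profile''; positivity

lemma profile_nonneg {y : ℝ} (hM : 0 ≤ M) (h : y < ε) : 0 ≤ profile M τ ε y := by
  have := sub_pos.2 h
  unfold profile; positivity

lemma le_profile' {y : ℝ} (hM : 0 ≤ M) (h : y < ε) :
    M * (max (y + τ) 0 ^ 3 / (ε - y) ^ 2) ≤ profile' M τ ε y := by
  have := sub_pos.2 h
  unfold profile'
  have : 0 ≤ M * (3 * max (y + τ) 0 ^ 2 * (ε - y)⁻¹) := by positivity
  rw [mul_add, inv_pow, div_eq_mul_inv (_ ^ 3)]; linarith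

lemma contDiffOn_profile (M τ ε : ℝ) : ContDiffOn ℝ 2 (profile M τ ε) (Iio ε) := by
  refine contDiffOn_const.mul (ContDiffOn.mul ?_ ?_)
  · exact (contDiff_max_cube.comp (contDiff_id.add contDiff_const)).contDiffOn
  · exact (contDiffOn_const.sub contDiffOn_id).inv fun x hx => (sub_pos.2 hx).ne'

lemma dee_comp_real (hρ : DifferentiableAt ℝ ρ x) {g : ℝ → ℝ} {g' : ℝ}
    (hg : HasDerivAt g g' (ρ x)) (v : E N) :
    dee v (fun y => (g (ρ y) : ℂ)) x = g' * dee v (fun y => (ρ y : ℂ)) x := by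
  have h1 := hg.comp_hasFDerivAt x hρ.hasFDerivAt
  have h2 : fderiv ℝ (fun y => g (ρ y)) x = g' • fderiv ℝ ρ x := h1.fderiv
  have h3 : DifferentiableAt ℝ (fun y => g (ρ y)) x := h1.differentiableAt
  simp only [cderiv, fderiv_ofReal hρ, fderiv_ofReal h3, h2, smul_apply, smul_eq_mul]
  push_cast; ring

lemma norm_dee_basisVec_le (hρ : DifferentiableAt ℝ ρ x) (j : Fin N) :
    ‖dee[j] (fun y => (ρ y : ℂ)) x‖ ≤ ‖fderiv ℝ ρ x‖ := by
  have hv : ‖(basisVec j : E N)‖ = 1 := by simp [basisVec]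
  have h1 := (fderiv ℝ ρ x).le_opNorm (basisVec j)
  have h2 := (fderiv ℝ ρ x).le_opNorm (I • basisVec j)
  have h3 := norm_add_le ((fderiv ℝ ρ x (basisVec j) : ℝ) : ℂ)
    (-I * ((fderiv ℝ ρ x (I • basisVec j) : ℝ) : ℂ))
  simp only [norm_smul, norm_mul, norm_neg, norm_I, one_mul, norm_real, hv, mul_one] at h1 h2 h3
  simp only [cderiv, fderiv_ofReal hρ, norm_div, norm_ofNat]
  rw [div_le_iff₀ (by norm_num)]
  linarith

lemma levi_add_norm_sq {f : E N → ℝ} (hf : ContDiffAt ℝ 2 f x) (A : ℝ) (v : E N) :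
    levi (fun y => f y + A * ‖y‖ ^ 2) x v = levi f x v + A * ‖v‖ ^ 2 := by
  let _ : InnerProductSpace ℝ (E N) := InnerProductSpace.rclikeToReal ℂ (E N)
  have h0 : ∀ y : E N, HasFDerivAt (fun y : E N => ‖y‖ ^ 2) (2 • innerSL ℝ y) y := fun y =>
    (hasStrictFDerivAt_norm_sq y).hasFDerivAt
  have e1 : fderiv ℝ (fun y => f y + A * ‖y‖ ^ 2) =ᶠ[𝓝 x]
      fun y => fderiv ℝ f y + A • (2 • innerSL ℝ y) := by
    filter_upwards [eventually_differentiableAt hf] with y hy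
    exact (hy.hasFDerivAt.add ((h0 y).const_mul A)).fderiv
  have hd : DifferentiableAt ℝ (fderiv ℝ f) x :=
    (hf.fderiv_right (m := 1) (by norm_num)).differentiableAt (by norm_num)
  have h2 : HasFDerivAt (fun y : E N => A • (2 • innerSL ℝ y))
      (A • ((2 : ℕ) • (innerSL ℝ : E N →L[ℝ] E N →L[ℝ] ℝ))) x :=
    ((innerSL ℝ : E N →L[ℝ] E N →L[ℝ] ℝ).hasFDerivAt.const_smul (2 : ℕ)).const_smul A
  have e3 := (hd.hasFDerivAt.add h2).fderiv
  simp only [levi_eq_hess, e1.fderiv_eq]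
  have e4 : fderiv ℝ (fun y => fderiv ℝ f y + A • (2 • innerSL ℝ y)) x = _ := e3
  rw [e4]
  have hin : ∀ u : E N, innerSL ℝ u u = ‖u‖ ^ 2 := fun u => real_inner_self_eq_norm_sq u
  simp only [add_apply, smul_apply, hin, norm_smul, norm_I, one_mul, smul_eq_mul, nsmul_eq_mul]
  push_cast; ring

/-- An enlargement of `Ω` on which `ρ < ε`. -/
def collar (Ω : Set (E N)) (ρ : E N → ℝ) (r0 ε : ℝ) : Set (E N) :=
  Ω ∪ {x | infDist x (frontier Ω) < r0 ∧ ρ x < ε}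

namespace DefFun

lemma isOpen_collar (h : DefFun Ω ρ r0 c0) (ε : ℝ) : IsOpen (collar Ω ρ r0 ε) :=
  h.isOpen.union ((isOpen_lt (continuous_infDist_pt _) continuous_const).inter
    (isOpen_lt h.contDiff.continuous continuous_const))

lemma lt_of_mem_collar (h : DefFun Ω ρ r0 c0) (hε : 0 < ε) (hx : x ∈ collar Ω ρ r0 ε) : ρ x < ε := by
  rcases hx with hx | hx
  · exact ((h.mem_iff x).1 hx).trans hε
  · exact hx.2

lemma isBounded_infDist_le (h : DefFun Ω ρ r0 c0) (r : ℝ) :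
    Bornology.IsBounded {x | infDist x (frontier Ω) ≤ r} := by
  refine ((isCompact_frontier h.bounded).isBounded.thickening (δ := r + 1)).subset fun x hx => ?_
  rw [mem_thickening_iff_infDist_lt h.nonempty]
  exact lt_of_le_of_lt hx (by linarith)

/-- Away from the boundary but within distance `r0` of it and outside `Ω`, `ρ` is bounded below. -/
lemma exists_collar_gap (h : DefFun Ω ρ r0 c0) : ∃ ε1 > 0, ∀ x ∉ Ω,
    infDist x (frontier Ω) ≤ r0 → ρ x < ε1 → infDist x (frontier Ω) ≤ r0 / 2 := by
  set K : Set (E N) := {x | infDist x (frontier Ω) ≤ r0} ∩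
    ({x | r0 / 2 ≤ infDist x (frontier Ω)} ∩ Ωᶜ) with hK
  have hc : IsCompact K := by
    refine isCompact_of_isClosed_isBounded ?_ ((h.isBounded_infDist_le r0).subset inter_subset_left)
    exact (isClosed_le (continuous_infDist_pt _) continuous_const).inter
      ((isClosed_le continuous_const (continuous_infDist_pt _)).inter h.isOpen.isClosed_compl)
  have hpos : ∀ x ∈ K, 0 < ρ x := fun x hx => by
    refine h.pos_of_notMem_closure (fun hcl => ?_) hx.1
    have hf : x ∈ frontier Ω := by rw [h.isOpen.frontier_eq]; exact ⟨hcl, hx.2.2⟩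
    have h1 := hx.2.1
    rw [mem_ofPred_eq, infDist_zero_of_mem hf] at h1
    linarith [h.r₀_pos]
  rcases K.eq_empty_or_nonempty with hE | hne
  · refine ⟨1, one_pos, fun x hx h1 _ => ?_⟩
    by_contra h2
    have : x ∈ K := ⟨h1, (not_le.1 h2).le, hx⟩
    simp [hE] at this
  · obtain ⟨y, hy, hmin⟩ := hc.exists_isMinOn hne h.contDiff.continuous.continuousOn
    refine ⟨ρ y, hpos y hy, fun x hx h1 h3 => ?_⟩
    by_contra h2
    exact absurd (hmin (show x ∈ K from ⟨h1, (not_le.1 h2).le, hx⟩)) (not_le.2 h3)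

lemma isCompact_sublevel (h : DefFun Ω ρ r0 c0) {ε1 : ℝ} (hε1 : ∀ x ∉ Ω,
    infDist x (frontier Ω) ≤ r0 → ρ x < ε1 → infDist x (frontier Ω) ≤ r0 / 2) {s : ℝ}
    (hε : ε ≤ ε1) (hs : s < ε) : IsCompact {x ∈ collar Ω ρ r0 ε | ρ x ≤ s} := by
  have hr := h.r₀_pos
  have e : {x ∈ collar Ω ρ r0 ε | ρ x ≤ s} =
      (closure Ω ∪ {x | infDist x (frontier Ω) ≤ r0 / 2}) ∩ {x | ρ x ≤ s} := by
    ext x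
    constructor
    · rintro ⟨hx, hxs⟩
      refine ⟨?_, hxs⟩
      by_cases hΩ : x ∈ Ω
      · exact Or.inl (subset_closure hΩ)
      · rcases hx with hx | hx
        · exact absurd hx hΩ
        · exact Or.inr (hε1 x hΩ hx.1.le (hx.2.trans_le hε))
    · rintro ⟨hx, hxs⟩
      refine ⟨?_, hxs⟩
      by_cases hΩ : x ∈ Ω
      · exact Or.inl hΩ
      · refine Or.inr ⟨?_, lt_of_le_of_lt hxs hs⟩
        rcases hx with hx | hx
        · have hf : x ∈ frontier Ω := by rw [h.isOpen.frontier_eq]; exact ⟨hx, hΩ⟩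
          rw [infDist_zero_of_mem hf]; exact hr
        · exact lt_of_le_of_lt hx (by linarith)
  rw [e]
  refine isCompact_of_isClosed_isBounded ?_ ?_
  · exact (isClosed_closure.union (isClosed_le (continuous_infDist_pt _) continuous_const)).inter
      (isClosed_le h.contDiff.continuous continuous_const)
  · exact (h.bounded.closure.union (h.isBounded_infDist_le _)).subset inter_subset_left

lemma isBounded_collar (h : DefFun Ω ρ r0 c0) (ε : ℝ) : Bornology.IsBounded (collar Ω ρ r0 ε) :=
  h.bounded.union ((h.isBounded_infDist_le r0).subset fun _ hx => hx.1.le)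

end DefFun

lemma exists_smoothTransition_deriv_bound : ∃ B : ℝ, 0 ≤ B ∧ ∀ y, |deriv smoothTransition y| ≤ B ∧
      (y ∉ Icc (0 : ℝ) 1 → deriv smoothTransition y = 0) := by
  have hc : Continuous (deriv smoothTransition) :=
    (Real.smoothTransition.contDiff (n := 1)).continuous_deriv le_rfl
  have h0 : ∀ y ∉ Icc (0 : ℝ) 1, deriv smoothTransition y = 0 := by
    intro y hy
    rcases not_and_or.1 hy with hy | hy
    · have e : smoothTransition =ᶠ[𝓝 y] fun _ => 0 := by
        filter_upwards [Iio_mem_nhds (not_le.1 hy)] with x hx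
        exact Real.smoothTransition.zero_of_nonpos (le_of_lt hx)
      rw [e.deriv_eq]; simp
    · have e : smoothTransition =ᶠ[𝓝 y] fun _ => 1 := by
        filter_upwards [Ioi_mem_nhds (not_le.1 hy)] with x hx
        exact Real.smoothTransition.one_of_one_le (le_of_lt hx)
      rw [e.deriv_eq]; simp
  obtain ⟨B, hB⟩ := isCompact_Icc.exists_bound_of_continuousOn (s := Icc (0 : ℝ) 1) hc.continuousOn
  have hB0 : 0 ≤ B := (norm_nonneg _).trans (hB 0 (by simp))
  refine ⟨B, hB0, fun y => ⟨?_, h0 y⟩⟩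
  by_cases hy : y ∈ Icc (0 : ℝ) 1
  · exact hB y hy
  · rw [h0 y hy]; simpa using hB0

open Classical in
/-- Cutoff functions exhausting the collar. -/
def collarCut (Ω : Set (E N)) (ρ : E N → ℝ) (r0 ε : ℝ) (n : ℕ) (x : E N) : ℝ :=
  if x ∈ collar Ω ρ r0 ε then smoothTransition ((n + 1) * (ε - ρ x) - 1) else 0

/-- The first weight on the collar. -/
def collarWeight (ρ : E N → ℝ) (M τ ε A : ℝ) (x : E N) : ℝ := profile M τ ε (ρ x) + A * ‖x‖ ^ 2

/-- The second weight on the collar. -/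
def collarLog (ρ : E N → ℝ) (C ε : ℝ) (x : E N) : ℝ := log C - 2 * log (ε - ρ x)

lemma exp_collarLog (hC : 0 < C) (hx : ρ x < ε) : exp (collarLog ρ C ε x) = C / (ε - ρ x) ^ 2 := by
  have := sub_pos.2 hx
  rw [collarLog, Real.exp_sub, Real.exp_log hC, two_mul, exp_add, Real.exp_log this, sq]

namespace DefFun

lemma collarCut_eq_zero {n : ℕ}
    (hx : x ∉ {x ∈ collar Ω ρ r0 ε | ρ x ≤ ε - 1 / (n + 1)}) : collarCut Ω ρ r0 ε n x = 0 := by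
  unfold collarCut
  split_ifs with hD
  · refine Real.smoothTransition.zero_of_nonpos ?_
    have h1 : ε - 1 / (n + 1) < ρ x := not_le.1 fun h' => hx ⟨hD, h'⟩
    have h2 : (0 : ℝ) < n + 1 := by positivity
    have h3 : ε - ρ x < 1 / (n + 1) := by linarith
    rw [lt_div_iff₀ h2] at h3
    linarith
  · rfl

lemma collarCut_eventuallyEq (h : DefFun Ω ρ r0 c0) (n : ℕ)
    (hx : x ∈ collar Ω ρ r0 ε) : collarCut Ω ρ r0 ε n =ᶠ[𝓝 x]
      fun y => smoothTransition ((n + 1) * (ε - ρ y) - 1) := by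
  filter_upwards [(h.isOpen_collar ε).mem_nhds hx] with y hy
  rw [collarCut, if_pos hy]

lemma levi_collarWeight_ge (h : DefFun Ω ρ r0 c0) {a : ℝ}
    (ha' : ∀ x ∈ Ω, a * bdist Ω x ≤ -ρ x) {Q : ℝ} (hε : 0 < ε) (hM : 0 ≤ M)
    (hτ : 0 < τ) (hτa : τ ≤ a * r0) (ha : 0 < a) (hMQ : 2 * Q ≤ M * (τ / 2) ^ 3 * c0)
    (hA : 8 * Q / τ ^ 2 ≤ A) (hQ : 0 ≤ Q) (hx : x ∈ collar Ω ρ r0 ε) (v : E N) :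
    2 * (Q / (ε - ρ x) ^ 2) * ‖v‖ ^ 2 ≤ levi (collarWeight ρ M τ ε A) x v := by
  have hc := h.c₀_pos
  have hlt := h.lt_of_mem_collar hε hx
  have ht := sub_pos.2 hlt
  have hA0 : 0 ≤ A := le_trans (by positivity) hA
  have hprof : ContDiffAt ℝ 2 (fun y => profile M τ ε (ρ y)) x :=
    ((contDiffOn_profile M τ ε).contDiffAt (Iio_mem_nhds hlt)).comp x h.contDiff.contDiffAt
  have e1 : levi (collarWeight ρ M τ ε A) x v = _ := levi_add_norm_sq hprof A v
  rw [e1, levi_comp h.contDiff.contDiffAt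
    (eventually_of_mem (Iio_mem_nhds hlt) fun y hy => hasDerivAt_profile M τ hy)
    (hasDerivAt_profile' M τ hlt)]
  have h2 : 0 ≤ profile'' M τ ε (ρ x) * (fderiv ℝ ρ x v ^ 2 + fderiv ℝ ρ x (I • v) ^ 2) / 4 := by
    have := profile''_nonneg (τ := τ) hM hlt
    positivity
  have h1 : profile' M τ ε (ρ x) * (c0 * ‖v‖ ^ 2) ≤ profile' M τ ε (ρ x) * levi ρ x v := by
    rcases le_or_gt (infDist x (frontier Ω)) r0 with hd | hd
    · exact mul_le_mul_of_nonneg_left (h.levi_le x hd v) (profile'_nonneg hM hlt)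
    · have hxΩ : x ∈ Ω := hx.resolve_right fun h' => by linarith [h'.1]
      have h3 : ρ x + τ ≤ 0 := by
        have := ha' x hxΩ
        have h4 : a * r0 ≤ a * bdist Ω x := mul_le_mul_of_nonneg_left hd.le ha.le
        linarith
      simp [profile', max_eq_right h3]
  have h3 : 2 * (Q / (ε - ρ x) ^ 2) ≤ profile' M τ ε (ρ x) * c0 + A := by
    rcases le_or_gt (-(τ / 2)) (ρ x) with hy | hy
    · have h4 := mul_le_mul_of_nonneg_right (le_profile' (τ := τ) hM hlt) hc.le
      have h5 : (τ / 2) ^ 3 ≤ max (ρ x + τ) 0 ^ 3 :=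
        pow_le_pow_left₀ (by positivity) ((by linarith : τ / 2 ≤ ρ x + τ).trans (le_max_left _ _)) 3
      have h6 : 2 * (Q / (ε - ρ x) ^ 2) ≤ M * (max (ρ x + τ) 0 ^ 3 / (ε - ρ x) ^ 2) * c0 := by
        have : M * (max (ρ x + τ) 0 ^ 3 / (ε - ρ x) ^ 2) * c0 =
          (M * max (ρ x + τ) 0 ^ 3 * c0) / (ε - ρ x) ^ 2 := by ring
        rw [this, ← mul_div_assoc]
        exact div_le_div_of_nonneg_right (hMQ.trans (by gcongr)) (by positivity)
      linarith
    · have h4 : 0 ≤ profile' M τ ε (ρ x) * c0 := mul_nonneg (profile'_nonneg hM hlt) hc.le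
      have h5 : τ / 2 ≤ ε - ρ x := by linarith
      have h6 : 2 * (Q / (ε - ρ x) ^ 2) ≤ 8 * Q / τ ^ 2 := by
        calc 2 * (Q / (ε - ρ x) ^ 2) ≤ 2 * (Q / (τ / 2) ^ 2) := by gcongr
          _ = _ := by field_simp; ring
      linarith
  have h4 := mul_le_mul_of_nonneg_right h3 (sq_nonneg ‖v‖)
  nlinarith

lemma exp_collarLog_sub_le (h : DefFun Ω ρ r0 c0) (hε : 0 < ε) (hM : 0 < M)
    (hτ : 0 < τ) (hA : 0 ≤ A) (hC : 0 < C) (hx : x ∈ collar Ω ρ r0 ε) :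
    exp (collarLog ρ C ε x - collarWeight ρ M τ ε A x) ≤
      max (4 * C / τ ^ 2) (2 * C / (M * (τ / 2) ^ 3) ^ 2) := by
  have hlt := h.lt_of_mem_collar hε hx
  have ht := sub_pos.2 hlt
  have hw : profile M τ ε (ρ x) ≤ collarWeight ρ M τ ε A x := by
    unfold collarWeight; nlinarith [mul_nonneg hA (sq_nonneg ‖x‖)]
  rw [Real.exp_sub, exp_collarLog hC hlt]
  rcases le_or_gt (-(τ / 2)) (ρ x) with hy | hy
  · refine le_trans ?_ (le_max_right _ _)
    have h5 : (τ / 2) ^ 3 ≤ max (ρ x + τ) 0 ^ 3 :=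
      pow_le_pow_left₀ (by positivity) ((by linarith : τ / 2 ≤ ρ x + τ).trans (le_max_left _ _)) 3
    have h6 : M * (τ / 2) ^ 3 / (ε - ρ x) ≤ collarWeight ρ M τ ε A x := by
      refine le_trans ?_ hw
      rw [profile, ← mul_assoc, ← div_eq_mul_inv]
      gcongr
    have h7 := Real.quadratic_le_exp_of_nonneg (by positivity : 0 ≤ M * (τ / 2) ^ 3 / (ε - ρ x))
    have h8 : (M * (τ / 2) ^ 3 / (ε - ρ x)) ^ 2 / 2 ≤ exp (collarWeight ρ M τ ε A x) := by
      have : 0 ≤ M * (τ / 2) ^ 3 / (ε - ρ x) := by positivity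
      linarith [Real.exp_le_exp.2 h6]
    calc C / (ε - ρ x) ^ 2 / exp (collarWeight ρ M τ ε A x)
        ≤ C / (ε - ρ x) ^ 2 / ((M * (τ / 2) ^ 3 / (ε - ρ x)) ^ 2 / 2) := by gcongr
      _ = 2 * C / (M * (τ / 2) ^ 3) ^ 2 := by field_simp
  · refine le_trans ?_ (le_max_left _ _)
    have h5 : τ / 2 ≤ ε - ρ x := by linarith
    have h6 : 1 ≤ exp (collarWeight ρ M τ ε A x) :=
      Real.one_le_exp ((profile_nonneg hM.le hlt).trans hw)
    calc C / (ε - ρ x) ^ 2 / exp (collarWeight ρ M τ ε A x)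
        ≤ C / (τ / 2) ^ 2 / 1 := by gcongr
      _ = 4 * C / τ ^ 2 := by field_simp; ring

/-- The weights needed to solve the `∂̄`-equation on the collar. -/
lemma exists_weightData (h : DefFun Ω ρ r0 c0) : ∃ ε1 > 0,
    (∀ x ∉ Ω, infDist x (frontier Ω) ≤ r0 → ρ x < ε1 → infDist x (frontier Ω) ≤ r0 / 2) ∧
    ∀ ε, 0 < ε → ε ≤ ε1 → ∃ (φ ψ : E N → ℝ) (η : ℕ → E N → ℝ) (K : ℝ),
      WeightData (collar Ω ρ r0 ε) φ ψ η ∧ ∀ x ∈ collar Ω ρ r0 ε, exp (ψ x - φ x) ≤ K := by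
  obtain ⟨L, hL⟩ := exists_hasC2Bound h.contDiff h.compact
  obtain ⟨a, ha, hax⟩ := h.exists_bdist_le
  obtain ⟨ε1, hε1, hgap⟩ := h.exists_collar_gap
  obtain ⟨B, hB0, hB⟩ := exists_smoothTransition_deriv_bound
  have hc := h.c₀_pos
  have hr := h.r₀_pos
  have hL0 : 0 < L := zero_lt_one.trans_le hL.one_le
  refine ⟨ε1, hε1, hgap, fun ε hε hεε => ?_⟩
  set τ := a * r0 with hτ
  have hτ0 : 0 < τ := by positivity
  set C := 4 * N * B ^ 2 * L ^ 2 + 1 with hC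
  have hC0 : 0 < C := by positivity
  set Q := 4 * N * L ^ 2 + C with hQ
  have hQ0 : 0 < Q := by positivity
  set M := 2 * Q / ((τ / 2) ^ 3 * c0) with hM
  have hM0 : 0 < M := by positivity
  set A := 8 * Q / τ ^ 2 with hA
  have hlt : ∀ x ∈ collar Ω ρ r0 ε, ρ x < ε := fun x hx => h.lt_of_mem_collar hε hx
  have hdee : ∀ x j, ‖dee[j] (fun y => (ρ y : ℂ)) x‖ ≤ L := fun x j =>
    (norm_dee_basisVec_le (h.contDiff.differentiable (by norm_num) x) j).trans (hL.fderiv_le x)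
  have hcomp : ∀ n : ℕ, IsCompact {x ∈ collar Ω ρ r0 ε | ρ x ≤ ε - 1 / (n + 1)} := fun n => by
    refine h.isCompact_sublevel hgap hεε ?_
    have : (0 : ℝ) < 1 / (n + 1) := by positivity
    linarith
  have hts : ∀ n : ℕ, tsupport (collarCut Ω ρ r0 ε n) ⊆
      {x ∈ collar Ω ρ r0 ε | ρ x ≤ ε - 1 / (n + 1)} := fun n => by
    refine closure_minimal (fun x hx => ?_) (hcomp n).isClosed
    by_contra h'
    exact hx (collarCut_eq_zero h')
  refine ⟨collarWeight ρ M τ ε A, collarLog ρ C ε, collarCut Ω ρ r0 ε, _, ⟨h.isOpen_collar ε,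
    ?_, ?_, ?_, ?_, ?_, ?_, ?_, ?_, ?_⟩, fun x hx =>
      h.exp_collarLog_sub_le hε hM0 hτ0 (by positivity) hC0 hx⟩
  · refine ContDiffOn.add ?_ ?_
    · exact (contDiffOn_profile M τ ε).comp h.contDiff.contDiffOn hlt
    · let _ : InnerProductSpace ℝ (E N) := InnerProductSpace.rclikeToReal ℂ (E N)
      exact contDiffOn_const.mul (contDiff_norm_sq ℝ).contDiffOn
  · exact contDiffOn_const.sub (contDiffOn_const.mul
      ((contDiffOn_const.sub h.contDiff.contDiffOn).log fun x hx => (sub_pos.2 (hlt x hx)).ne'))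
  · intro x hx v
    have ht := sub_pos.2 (hlt x hx)
    refine le_trans ?_ (h.levi_collarWeight_ge hax hε hM0.le hτ0 le_rfl ha
      (le_of_eq (by rw [hM]; field_simp)) le_rfl hQ0.le hx v)
    refine mul_le_mul_of_nonneg_right (mul_le_mul_of_nonneg_left ?_ (by norm_num)) (sq_nonneg _)
    rw [exp_collarLog hC0 (hlt x hx), hQ, add_div (4 * (N : ℝ) * L ^ 2) C]
    refine add_le_add ?_ le_rfl
    have e1 : ∀ j, ‖dee[j] (fun y => (collarLog ρ C ε y : ℂ)) x‖ ^ 2 ≤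
        4 * L ^ 2 / (ε - ρ x) ^ 2 := by
      intro j
      have hd : HasDerivAt (fun y => log C - 2 * log (ε - y)) (2 / (ε - ρ x)) (ρ x) := by
        have := ((((hasDerivAt_id (ρ x)).const_sub ε).log ht.ne').const_mul 2).const_sub (log C)
        refine this.congr_deriv ?_
        simp only [id]; ring
      have e2 := dee_comp_real (h.contDiff.differentiable (by norm_num) x) hd (basisVec j)
      have e3 : dee[j] (fun y => (collarLog ρ C ε y : ℂ)) x = _ := e2
      rw [e3, norm_mul, norm_real, norm_of_nonneg (by positivity), mul_pow, div_pow]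
      calc 2 ^ 2 / (ε - ρ x) ^ 2 * ‖dee[j] (fun y => (ρ y : ℂ)) x‖ ^ 2
          ≤ 2 ^ 2 / (ε - ρ x) ^ 2 * L ^ 2 := by gcongr; exact hdee x j
        _ = _ := by ring
    refine (sum_le_sum fun j _ => e1 j).trans (le_of_eq ?_)
    simp only [sum_const, card_univ, Fintype.card_fin, nsmul_eq_mul]; ring
  · intro n
    rw [contDiff_iff_contDiffAt]
    intro x
    by_cases hx : x ∈ collar Ω ρ r0 ε
    · refine ContDiffAt.congr_of_eventuallyEq ?_ (h.collarCut_eventuallyEq n hx)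
      exact Real.smoothTransition.contDiff.contDiffAt.comp x
        ((contDiff_const.mul (contDiff_const.sub h.contDiff)).sub contDiff_const).contDiffAt
    · have : collarCut Ω ρ r0 ε n =ᶠ[𝓝 x] fun _ => 0 := by
        filter_upwards [(hcomp n).isClosed.isOpen_compl.mem_nhds fun h' => hx h'.1] with y hy
        exact collarCut_eq_zero hy
      exact contDiffAt_const.congr_of_eventuallyEq this
  · exact fun n => (hcomp n).of_isClosed_subset (isClosed_tsupport _) (hts n)
  · exact fun n => (hts n).trans (sep_subset _ _)
  · intro n x
    unfold collarCut
    split_ifs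
    · exact ⟨Real.smoothTransition.nonneg _, Real.smoothTransition.le_one _⟩
    · simp
  · intro x hx
    have ht := sub_pos.2 (hlt x hx)
    obtain ⟨n0, hn0⟩ := exists_nat_gt (2 / (ε - ρ x))
    filter_upwards [eventually_ge_atTop n0] with n hn
    have h1 : 1 < (n + 1) * (ε - ρ x) - 1 := by
      have h2 : 2 / (ε - ρ x) < n + 1 := by
        have : (n0 : ℝ) ≤ n := by exact_mod_cast hn
        linarith
      rw [div_lt_iff₀ ht] at h2
      linarith
    have hcont : Continuous fun y => ((n : ℝ) + 1) * (ε - ρ y) - 1 := by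
      have := h.contDiff.continuous
      fun_prop
    filter_upwards [h.collarCut_eventuallyEq n hx, hcont.continuousAt.eventually_const_lt h1]
      with y hy hy'
    rw [hy]
    exact Real.smoothTransition.one_of_one_le hy'.le
  · intro n x hx
    have ht := sub_pos.2 (hlt x hx)
    rw [exp_collarLog hC0 (hlt x hx)]
    have e1 : ∀ j, ‖dee[j] (fun y => (collarCut Ω ρ r0 ε n y : ℂ)) x‖ ^ 2 ≤
        4 * B ^ 2 * L ^ 2 / (ε - ρ x) ^ 2 := by
      intro j
      set s := ((n : ℝ) + 1) * (ε - ρ x) - 1 with hs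
      have hd : HasDerivAt (fun y => smoothTransition (((n : ℝ) + 1) * (ε - y) - 1))
          (deriv smoothTransition s * -((n : ℝ) + 1)) (ρ x) := by
        have h1 : HasDerivAt (fun y => ((n : ℝ) + 1) * (ε - y) - 1) (-((n : ℝ) + 1)) (ρ x) := by
          have := (((hasDerivAt_id (ρ x)).const_sub ε).const_mul ((n : ℝ) + 1)).sub_const 1
          exact this.congr_deriv (by ring)
        have h2 : HasDerivAt smoothTransition (deriv smoothTransition s) s :=
          ((Real.smoothTransition.contDiff (n := 1)).differentiable (by norm_num) s).hasDerivAt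
        exact h2.comp (ρ x) h1
      have ev : (fun y => (collarCut Ω ρ r0 ε n y : ℂ)) =ᶠ[𝓝 x]
          fun y => ((smoothTransition (((n : ℝ) + 1) * (ε - ρ y) - 1) : ℝ) : ℂ) := by
        filter_upwards [h.collarCut_eventuallyEq n hx] with y hy
        rw [hy]
      rw [cderiv_congr ev, dee_comp_real (h.contDiff.differentiable (by norm_num) x) hd (basisVec j),
        norm_mul, norm_real, norm_eq_abs, abs_mul, abs_neg,
        abs_of_nonneg (by positivity : (0 : ℝ) ≤ n + 1)]
      have h3 : |deriv smoothTransition s| * ((n : ℝ) + 1) ≤ 2 * B / (ε - ρ x) := by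
        by_cases hsI : s ∈ Icc (0 : ℝ) 1
        · have h4 : (n : ℝ) + 1 ≤ 2 / (ε - ρ x) := by
            rw [le_div_iff₀ ht]; linarith [hsI.2]
          calc _ ≤ B * (2 / (ε - ρ x)) := by gcongr; exact (hB s).1
            _ = _ := by ring
        · rw [(hB s).2 hsI]; simp; positivity
      calc (|deriv smoothTransition s| * ((n : ℝ) + 1) *
            ‖dee[j] (fun y => (ρ y : ℂ)) x‖) ^ 2
          ≤ (2 * B / (ε - ρ x) * L) ^ 2 := by gcongr; exact hdee x j
        _ = _ := by rw [mul_pow, div_pow]; ring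
    refine (sum_le_sum fun j _ => e1 j).trans ?_
    simp only [sum_const, card_univ, Fintype.card_fin, nsmul_eq_mul]
    rw [← mul_div_assoc]
    gcongr
    rw [hC]; linarith

end DefFun

lemma norm_wq (φ ψ : E N → ℝ) (x : E N) : ‖wq φ ψ x‖ = √(exp (φ x - ψ x)) := by
  rw [wq, norm_real, norm_of_nonneg (Real.exp_pos _).le, Real.exp_half]

/-- Solution of the `∂̄`-equation with bounded data on the collar, with `L²` bounds on a slightly
smaller set. -/
lemma WeightData.exists_bounded_solution (w : WeightData D φ ψ σ) (hDb : Bornology.IsBounded D) {K : ℝ}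
    (hK : ∀ x ∈ D, exp (ψ x - φ x) ≤ K) (hD' : IsCompact D')
    (hDD : D' ⊆ D) :
    ∃ C, 0 ≤ C ∧ ∀ f : Fin N → E N → ℂ, (∀ j, AEStronglyMeasurable (f j) (μ.restrict D)) →
      ∀ B, 0 ≤ B → (∀ j, ∀ x ∈ D, ‖f j x‖ ≤ B) → WClosed μ D (fun _ => 1) f →
      ∃ u : E N → ℂ, MemLp u 2 (μ.restrict D') ∧ ∫ x in D', ‖u x‖ ^ 2 ∂μ ≤ C * B ^ 2 ∧
        ∀ j γ, IsTest D γ → ∫ x in D, u x * dbar[j] γ x ∂μ = -∫ x in D, f j x * γ x ∂μ := by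
  have hDm := w.isOpen.measurableSet
  have hμD : μ D < ⊤ := hDb.measure_lt_top
  have : IsFiniteMeasure (μ.restrict D) := ⟨by simpa using hμD⟩
  set K' := max K 0 with hK'
  have hwc : ContinuousOn (wq ψ φ) D := by
    have h1 := w.contDiffOn_fst.continuousOn
    have h2 := w.contDiffOn_snd.continuousOn
    unfold wq; fun_prop
  have hqc : ContinuousOn (fun x => wq (fun _ => 0) φ x * wq φ ψ x ^ 2) D := by
    have h1 := w.contDiffOn_fst.continuousOn
    have h2 := w.contDiffOn_snd.continuousOn
    unfold wq; fun_prop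
  obtain ⟨C1, hC1⟩ := hD'.exists_bound_of_continuousOn (hqc.mono hDD)
  set C2 := max C1 0 with hC2
  have hwK : ∀ x ∈ D, ‖wq ψ φ x‖ ≤ √K' := fun x hx => by
    rw [norm_wq]; exact sqrt_le_sqrt ((hK x hx).trans (le_max_left _ _))
  have hsw : ∀ x, wq ψ φ x * wq φ ψ x = 1 := fun x => wq_mul_wq_swap ψ φ x
  refine ⟨C2 ^ 2 * (N * K' * μ.real D), by positivity, fun f hfm B hB hfB hcl => ?_⟩
  set F : Fin N → E N → ℂ := fun j x => f j x * wq ψ φ x with hF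
  have hFb : ∀ j, ∀ x ∈ D, ‖F j x‖ ≤ B * √K' := fun j x hx => by
    rw [hF, norm_mul]; gcongr
    · exact hfB j x hx
    · exact hwK x hx
  have hFL : ∀ j, MemLp (F j) 2 (μ.restrict D) := fun j =>
    MemLp.of_bound ((hfm j).mul (hwc.aestronglyMeasurable hDm)) (B * √K')
      ((ae_restrict_iff' hDm).2 (ae_of_all _ (hFb j)))
  have hFe : ∀ j x (c : ℂ), F j x * (wq φ ψ x * c) = f j x * c := fun j x c => by
    rw [hF]
    calc f j x * wq ψ φ x * (wq φ ψ x * c) = f j x * (wq ψ φ x * wq φ ψ x) * c := by ring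
      _ = _ := by rw [hsw, mul_one]
  have hFc : WClosed μ D (wq φ ψ) F := fun j k γ hγ => by
    have := hcl j k γ hγ
    simp only [hFe]
    simpa using this
  obtain ⟨U, hU, hUb, hUe⟩ := w.exists_weak_solution hFL hFc
  have hUD : MemLp U 2 (μ.restrict D') := hU.mono_measure (Measure.restrict_mono hDD le_rfl)
  have hb : ∀ x ∈ D', ‖U x * (wq (fun _ => 0) φ x * wq φ ψ x ^ 2)‖ ≤ C2 * ‖U x‖ := fun x hx => by
    rw [norm_mul, mul_comm]
    exact mul_le_mul_of_nonneg_right ((hC1 x hx).trans (le_max_left _ _)) (norm_nonneg _)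
  have hD'm := hD'.measurableSet
  refine ⟨fun x => U x * (wq (fun _ => 0) φ x * wq φ ψ x ^ 2), ?_, ?_, fun j γ hγ => ?_⟩
  · exact hUD.of_le_mul (hUD.1.mul ((hqc.mono hDD).aestronglyMeasurable hD'm))
      ((ae_restrict_iff' hD'm).2 (ae_of_all _ hb))
  · have h1 : ∫ x in D', ‖U x * (wq (fun _ => 0) φ x * wq φ ψ x ^ 2)‖ ^ 2 ∂μ ≤
        ∫ x in D', C2 ^ 2 * ‖U x‖ ^ 2 ∂μ := by
      refine integral_mono_of_nonneg (ae_of_all _ fun x => by positivity)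
        (hUD.integrable_norm_pow (by norm_num) |>.const_mul _) ?_
      refine (ae_restrict_iff' hD'm).2 (ae_of_all _ fun x hx => ?_)
      simp only [← mul_pow]
      exact pow_le_pow_left₀ (norm_nonneg _) (hb x hx) 2
    have h2 : ∫ x in D', ‖U x‖ ^ 2 ∂μ ≤ ∫ x in D, ‖U x‖ ^ 2 ∂μ :=
      setIntegral_mono_set (hU.integrable_norm_pow (by norm_num))
        (ae_of_all _ fun x => by positivity) (ae_of_all _ hDD)
    have h3 : ∫ x in D, ∑ j, ‖F j x‖ ^ 2 ∂μ ≤ N * (B ^ 2 * K') * μ.real D := by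
      refine (Real.le_norm_self _).trans (norm_setIntegral_le_of_norm_le_const hμD fun x hx => ?_)
      rw [norm_of_nonneg (by positivity)]
      refine (sum_le_sum fun j _ => pow_le_pow_left₀ (norm_nonneg _) (hFb j x hx) 2).trans
        (le_of_eq ?_)
      simp only [sum_const, card_univ, Fintype.card_fin, nsmul_eq_mul, mul_pow]
      rw [sq_sqrt (le_max_right _ _)]
    rw [integral_const_mul] at h1
    calc _ ≤ C2 ^ 2 * ∫ x in D', ‖U x‖ ^ 2 ∂μ := h1
      _ ≤ C2 ^ 2 * (N * (B ^ 2 * K') * μ.real D) := by gcongr; exact h2.trans (hUb.trans h3)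
      _ = _ := by ring
  · have := hUe j γ hγ
    simp only [hFe] at this
    rw [← this]
    congr 1; ext x; ring

/-- Solution of the `∂̄`-equation with bounded data on the collar. -/
lemma DefFun.exists_dbar_solution (h : DefFun Ω ρ r0 c0) : ∃ ε1 > 0,
    (∀ x ∉ Ω, infDist x (frontier Ω) ≤ r0 → ρ x < ε1 → infDist x (frontier Ω) ≤ r0 / 2) ∧
    ∀ ε, 0 < ε → ε ≤ ε1 → ∃ C, 0 ≤ C ∧ ∀ f : Fin N → E N → ℂ,
      (∀ j, AEStronglyMeasurable (f j) (μ.restrict (collar Ω ρ r0 ε))) →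
      ∀ B, 0 ≤ B → (∀ j, ∀ x ∈ collar Ω ρ r0 ε, ‖f j x‖ ≤ B) →
      WClosed μ (collar Ω ρ r0 ε) (fun _ => 1) f →
      ∃ u : E N → ℂ, MemLp u 2 (μ.restrict {x ∈ collar Ω ρ r0 ε | ρ x ≤ ε / 2}) ∧
        ∫ x in {x ∈ collar Ω ρ r0 ε | ρ x ≤ ε / 2}, ‖u x‖ ^ 2 ∂μ ≤ C * B ^ 2 ∧
        ∀ j γ, IsTest (collar Ω ρ r0 ε) γ → ∫ x in collar Ω ρ r0 ε, u x * dbar[j] γ x ∂μ =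
          -∫ x in collar Ω ρ r0 ε, f j x * γ x ∂μ := by
  obtain ⟨ε1, hε1, hgap, hW⟩ := h.exists_weightData
  refine ⟨ε1, hε1, hgap, fun ε hε hεε => ?_⟩
  obtain ⟨φ, ψ, η, K, w, hK⟩ := hW ε hε hεε
  exact w.exists_bounded_solution (h.isBounded_collar ε) hK
    (h.isCompact_sublevel hgap hεε (by linarith)) (sep_subset _ _)

/-- The complex bilinear part of a real bilinear form. -/
def bilinPart (H : E N →L[ℝ] E N →L[ℝ] ℝ) : E N →L[ℂ] E N →L[ℂ] ℂ := LinearMap.toContinuousLinearMap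
    { toFun := fun u => (1 / 2 : ℂ) • (StrongDual.extendRCLike (𝕜 := ℂ) (H u) -
        I • StrongDual.extendRCLike (𝕜 := ℂ) (H (I • u)))
      map_add' := fun u v => by
        ext w
        simp [StrongDual.extendRCLike_apply]; ring
      map_smul' := fun c u => by
        ext w
        have h1 : H (c • u) = c.re • H u + c.im • H (I • u) := by
          conv_lhs => rw [smul_eq_re_add_im c u]
          simp
        have h2 : H (I • c • u) = c.re • H (I • u) - c.im • H u := by
          have : I • c • u = c.re • (I • u) - c.im • u := by
            rw [smul_eq_re_add_im c u, smul_add, smul_comm _ c.re, smul_comm _ c.im, smul_smul,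
              Complex.I_mul_I]
            simp [sub_eq_add_neg]
          rw [this]; simp
        simp only [h1, h2, StrongDual.extendRCLike_apply, smul_apply, add_apply,
          sub_apply, smul_eq_mul, RingHom.id_apply]
        conv_rhs => rw [← re_add_im c]
        simp only [RCLike.I_to_complex]
        push_cast
        linear_combination (1 / 2 * (c.im * H (I • u) w) -
          1 / 2 * (I * c.im * H (I • u) (I • w))) * Complex.I_mul_I }

lemma bilinPart_apply (H : E N →L[ℝ] E N →L[ℝ] ℝ) (u w : E N) :
    bilinPart H u w = (1 / 2 : ℂ) * ((H u w - I * H u (I • w)) -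
      I * (H (I • u) w - I * H (I • u) (I • w))) := by
  simp [bilinPart, StrongDual.extendRCLike_apply]

lemma re_bilinPart_self (H : E N →L[ℝ] E N →L[ℝ] ℝ) (v : E N) :
    (bilinPart H v v).re = (H v v - H (I • v) (I • v)) / 2 := by
  rw [bilinPart_apply]; simp; ring

lemma norm_bilinPart_self_le {H : E N →L[ℝ] E N →L[ℝ] ℝ} (hH : ‖H‖ ≤ L) (v : E N) :
    ‖bilinPart H v v‖ ≤ 2 * L * ‖v‖ ^ 2 := by
  have hb : ∀ a b : E N, ‖a‖ = ‖v‖ → ‖b‖ = ‖v‖ → ‖((H a b : ℝ) : ℂ)‖ ≤ L * ‖v‖ ^ 2 := by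
    intro a b ha hb
    rw [norm_real]
    have := H.le_opNorm₂ a b
    rw [ha, hb] at this
    nlinarith [mul_le_mul_of_nonneg_right hH (sq_nonneg ‖v‖)]
  have hI : ‖I • v‖ = ‖v‖ := by simp [norm_smul]
  rw [bilinPart_apply, norm_mul]
  have h1 := hb v v rfl rfl
  have h2 := hb v (I • v) rfl hI
  have h3 := hb (I • v) v hI rfl
  have h4 := hb (I • v) (I • v) hI hI
  have t : ∀ a b c d : ℂ, ‖(a - I * b) - I * (c - I * d)‖ ≤ ‖a‖ + ‖b‖ + (‖c‖ + ‖d‖) := by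
    intro a b c d
    refine (norm_sub_le _ _).trans (add_le_add ((norm_sub_le _ _).trans ?_) ?_)
    · simp
    · rw [norm_mul, norm_I, one_mul]
      refine (norm_sub_le _ _).trans ?_
      simp
  have h5 := t (H v v) (H v (I • v)) (H (I • v) v) (H (I • v) (I • v))
  have h6 : ‖(1 / 2 : ℂ)‖ = 1 / 2 := by norm_num
  rw [h6]
  linarith

/-- The Levi polynomial of `ρ` at `p`. -/
def leviPoly (ρ : E N → ℝ) (p x : E N) : ℂ :=
  cgrad ρ p (x - p) + 1 / 2 * bilinPart (fderiv ℝ (fderiv ℝ ρ) p) (x - p) (x - p)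

lemma differentiable_leviPoly (ρ : E N → ℝ) (p : E N) : Differentiable ℂ (leviPoly ρ p) := by
  have h1 : Differentiable ℂ fun x : E N => x - p := differentiable_id.sub_const p
  refine ((cgrad ρ p).differentiable.comp h1).add (Differentiable.const_mul ?_ _)
  exact ((bilinPart (fderiv ℝ (fderiv ℝ ρ) p)).differentiable.comp h1).clm_apply h1

lemma norm_leviPoly_sub_le (hL : HasC2Bound ρ L) (p x : E N) :
    ‖leviPoly ρ p x - cgrad ρ p (x - p)‖ ≤ L * ‖x - p‖ ^ 2 := by
  rw [leviPoly, add_sub_cancel_left, norm_mul]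
  have := norm_bilinPart_self_le (hL.hess_le p) (x - p)
  have h6 : ‖(1 / 2 : ℂ)‖ = 1 / 2 := by norm_num
  rw [h6]
  linarith

lemma DefFun.exists_re_leviPoly_le (h : DefFun Ω ρ r0 c0) : ∃ r > 0, ∀ p ∈ frontier Ω,
    ∀ x, ‖x - p‖ < r → (leviPoly ρ p x).re ≤ ρ x - c0 / 2 * ‖x - p‖ ^ 2 := by
  obtain ⟨r, hr, H⟩ := exists_taylor_two h.contDiff h.compact (half_pos h.c₀_pos)
  refine ⟨r, hr, fun p hp x hx => ?_⟩
  have h1 := (abs_le.1 (H p (x - p) hx)).1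
  have h2 := h.levi_le p (by rw [infDist_zero_of_mem hp]; exact h.r₀_pos.le) (x - p)
  rw [levi_eq_hess] at h2
  rw [h.eq_zero hp, add_sub_cancel] at h1
  have h3 : (leviPoly ρ p x).re = fderiv ℝ ρ p (x - p) +
      1 / 2 * (bilinPart (fderiv ℝ (fderiv ℝ ρ) p) (x - p) (x - p)).re := by
    rw [leviPoly, add_re, cgrad_re]
    simp
  rw [h3, re_bilinPart_self]
  linarith

/-- A pair of cutoff functions centred at `p` at the scale `R`. -/
structure IsCutPair (p : E N) (R B : ℝ) (χ θ : E N → ℂ) : Prop where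
  contDiff : ContDiff ℝ 2 χ
  contDiff' : ContDiff ℝ 2 θ
  norm_le : ∀ x, ‖χ x‖ ≤ 1
  norm_le' : ∀ x, ‖θ x‖ ≤ 1
  one : ∀ x, ‖x - p‖ ≤ 2 * R → ∀ᶠ y in 𝓝 x, χ y = 1
  zero : ∀ x, 3 * R ≤ ‖x - p‖ → ∀ᶠ y in 𝓝 x, χ y = 0
  one' : ∀ x, 3 / 2 * R ≤ ‖x - p‖ → ‖x - p‖ ≤ 7 / 2 * R → ∀ᶠ y in 𝓝 x, θ y = 1
  zero' : ∀ x, ‖x - p‖ ≤ R ∨ 4 * R ≤ ‖x - p‖ → ∀ᶠ y in 𝓝 x, θ y = 0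
  dbar_le : ∀ j x, ‖dbar[j] χ x‖ ≤ B

lemma exists_cutPair (hR : 0 < R) : ∃ B : ℝ, 0 ≤ B ∧ ∀ p : E N, ∃ χ θ, IsCutPair p R B χ θ := by
  obtain ⟨χ, hχ, hχc, hχs, hχI, hχ1⟩ := exists_cutoff (isCompact_closedBall (0 : E N) (2 * R))
    isOpen_ball (closedBall_subset_ball (show 2 * R < 3 * R by linarith))
  obtain ⟨θ, hθ, hθc, hθs, hθI, hθ1⟩ := exists_cutoff
    (K := closedBall (0 : E N) (7 / 2 * R) ∩ {x | 3 / 2 * R ≤ ‖x‖})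
    (D := ball (0 : E N) (4 * R) ∩ {x | R < ‖x‖})
    ((isCompact_closedBall _ _).inter_right (isClosed_le continuous_const continuous_norm))
    (isOpen_ball.inter (isOpen_lt continuous_const continuous_norm))
    (inter_subset_inter (closedBall_subset_ball (by linarith))
      fun x (hx : 3 / 2 * R ≤ ‖x‖) => show R < ‖x‖ by linarith)
  have hχ' : ContDiff ℝ 2 fun x => (χ x : ℂ) := Complex.ofRealCLM.contDiff.comp hχ
  have hθ' : ContDiff ℝ 2 fun x => (θ x : ℂ) := Complex.ofRealCLM.contDiff.comp hθ
  have hχc' : HasCompactSupport fun x => (χ x : ℂ) :=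
    hχc.comp_left (g := fun t : ℝ => (t : ℂ)) (by simp)
  have hb : ∀ j : Fin N, ∃ B, ∀ x, ‖dbar[j] (fun x => (χ x : ℂ)) x‖ ≤ B := fun j =>
    (HasCompactSupport.cderiv hχc' (basisVec j)).exists_bound_of_continuous hχ'.continuous_cderiv
  choose B hB using hb
  refine ⟨∑ j, |B j|, sum_nonneg fun _ _ => abs_nonneg _, fun p =>
    ⟨fun x => (χ (x - p) : ℂ), fun x => (θ (x - p) : ℂ), ?_⟩⟩
  have hsub : ContDiff ℝ 2 fun x : E N => x - p := contDiff_id.sub contDiff_const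
  have tr : ∀ {P : E N → Prop} {x : E N}, (∀ᶠ y in 𝓝 (x - p), P y) → ∀ᶠ y in 𝓝 x, P (y - p) :=
    fun h => hsub.continuous.continuousAt.eventually h
  have hn : ∀ t : ℝ, t ∈ Icc (0 : ℝ) 1 → ‖(t : ℂ)‖ ≤ 1 := fun t ht => by
    rw [norm_real, norm_eq_abs, abs_of_nonneg ht.1]; exact ht.2
  refine ⟨hχ'.comp hsub, hθ'.comp hsub, fun x => hn _ (hχI _), fun x => hn _ (hθI _),
    fun x hx => ?_, fun x hx => ?_, fun x hx hx' => ?_, fun x hx => ?_, fun j x => ?_⟩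
  · refine (tr (P := fun y => χ y = 1) ?_).mono fun y hy => by simp [hy]
    exact eventually_nhdsSet_iff_forall.1 hχ1 _ (by simpa using hx)
  · refine (tr (P := fun y => χ y = 0) ?_).mono fun y hy => by simp [hy]
    refine notMem_tsupport_iff_eventuallyEq.1 fun hm => ?_
    have := hχs hm
    rw [mem_ball_zero_iff] at this
    linarith
  · refine (tr (P := fun y => θ y = 1) ?_).mono fun y hy => by simp [hy]
    exact eventually_nhdsSet_iff_forall.1 hθ1 _ ⟨by simpa using hx', hx⟩
  · refine (tr (P := fun y => θ y = 0) ?_).mono fun y hy => by simp [hy]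
    refine notMem_tsupport_iff_eventuallyEq.1 fun hm => ?_
    obtain ⟨h1, h2⟩ := hθs hm
    rw [mem_ball_zero_iff] at h1
    have h2 : R < ‖x - p‖ := h2
    rcases hx with hx | hx <;> linarith
  · have : dbar[j] (fun x => (χ (x - p) : ℂ)) x = dbar[j] (fun x => (χ x : ℂ)) (x - p) := by
      simp only [cderiv]
      rw [fderiv_comp_sub (f := fun x => (χ x : ℂ)) p]
    rw [this]
    exact (hB j _).trans ((le_abs_self _).trans
      (Finset.single_le_sum (f := fun j => |B j|) (fun _ _ => abs_nonneg _) (Finset.mem_univ j)))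

lemma setIntegral_mul_dbar_eq (hγ : IsTest D γ) (f : E N → ℂ)
    (v : E N) : ∫ x in D, f x * dbar v γ x ∂μ = ∫ x, f x * dbar v γ x ∂μ :=
  setIntegral_eq_integral_of_forall_compl_eq_zero fun x hx => by
    rw [cderiv_eq_zero_of_notMem fun h => hx (hγ.sub h), mul_zero]

lemma setIntegral_mul_test_eq (hγ : IsTest D γ) (f : E N → ℂ) :
    ∫ x in D, f x * γ x ∂μ = ∫ x, f x * γ x ∂μ :=
  setIntegral_eq_integral_of_forall_compl_eq_zero fun x hx => by
    rw [image_eq_zero_of_notMem_tsupport fun h => hx (hγ.sub h), mul_zero]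

/-- The product rule for `q * γ`, valid everywhere when multiplied by a function vanishing
off the support of `γ`. -/
lemma dbar_test_mul (hD : IsOpen D) {q : E N → ℂ} (hγ : IsTest D γ)
    (hq : ContDiffOn ℝ 2 q D) (hx : x ∈ D) (v : E N) :
    dbar v (fun y => q y * γ y) x = dbar v q x * γ x + q x * dbar v γ x :=
  cderiv_mul ((hq.contDiffAt (hD.mem_nhds hx)).differentiableAt (by norm_num))
    (hγ.contDiff.differentiable (by norm_num) x)

lemma wClosed_dbar_mul (hD : IsOpen D) {χ q : E N → ℂ} (hχ : ContDiff ℝ 2 χ)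
    (hq : ContDiffOn ℝ 2 q D)
    (h0 : ∀ j k, ∀ x ∈ D, dbar[j] χ x * dbar[k] q x = 0) :
    WClosed μ D (fun _ => 1) fun j x => dbar[j] χ x * q x := by
  intro j k γ hγ
  have hβ := hγ.of_mul hD hq
  have key : ∀ j k, ∫ x in D, dbar[j] χ x * q x * (1 * dbar[k] γ x) ∂μ =
      ∫ x, dbar[j] χ x * dbar[k] (fun y => q y * γ y) x ∂μ := by
    intro j k
    rw [← setIntegral_mul_dbar_eq hβ]
    refine setIntegral_congr_fun hD.measurableSet fun x hx => ?_
    rw [dbar_test_mul hD hγ hq hx]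
    linear_combination (-γ x) * h0 j k x hx
  rw [key j k, key k j, integral_dbar_mul_dbar_comm hχ hβ.contDiff hβ.compact, sub_self]

lemma integral_mul_mul_dbar (hD : IsOpen D) {χ q : E N → ℂ}
    (hχ : ContDiff ℝ 2 χ) (hq : ContDiffOn ℝ 2 q D) (hγ : IsTest D γ) (v : E N)
    (h0 : ∀ x ∈ D, χ x * γ x * dbar v q x = 0) :
    ∫ x in D, χ x * q x * dbar v γ x ∂μ = -∫ x in D, dbar v χ x * q x * γ x ∂μ := by
  have hβ := hγ.of_mul hD hq
  have h1 : ∫ x in D, χ x * q x * dbar v γ x ∂μ = ∫ x, χ x * dbar v (fun y => q y * γ y) x ∂μ := by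
    rw [← setIntegral_mul_dbar_eq hβ]
    refine setIntegral_congr_fun hD.measurableSet fun x hx => ?_
    rw [dbar_test_mul hD hγ hq hx]
    linear_combination -h0 x hx
  rw [h1, integral_mul_cderiv (hχ.of_le (by norm_num)) (hβ.contDiff.of_le (by norm_num)) hβ.compact,
    ← setIntegral_mul_test_eq hβ]
  simp only [mul_assoc]

/-- Bounded weakly closed data on `D` admit solutions of the `∂̄`-equation that are square
integrable on `D'`, with constant `C`. -/
def DbarSolvable (μ : Measure (E N)) (D D' : Set (E N)) (C : ℝ) : Prop :=
  ∀ f : Fin N → E N → ℂ, (∀ j, AEStronglyMeasurable (f j) (μ.restrict D)) →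
    ∀ B, 0 ≤ B → (∀ j, ∀ x ∈ D, ‖f j x‖ ≤ B) → WClosed μ D (fun _ => 1) f →
    ∃ u : E N → ℂ, MemLp u 2 (μ.restrict D') ∧ ∫ x in D', ‖u x‖ ^ 2 ∂μ ≤ C * B ^ 2 ∧
      ∀ j γ, IsTest D γ → ∫ x in D, u x * dbar[j] γ x ∂μ = -∫ x in D, f j x * γ x ∂μ

lemma contDiffOn_cut_div {B : ℝ} {χ θ P : E N → ℂ}
    (hc : IsCutPair p R B χ θ) (hP : ContDiff ℂ 2 P) (hm : 0 < m)
    (hPm : ∀ x ∈ D, R < ‖x - p‖ → ‖x - p‖ < 4 * R → m ≤ ‖P x‖) :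
    ContDiffOn ℝ 2 (fun x => θ x * (P x)⁻¹) D := by
  intro x hx
  refine ContDiffAt.contDiffWithinAt ?_
  by_cases h : ‖x - p‖ ≤ R ∨ 4 * R ≤ ‖x - p‖
  · refine (contDiffAt_const (c := (0 : ℂ))).congr_of_eventuallyEq ?_
    filter_upwards [hc.zero' x h] with y hy
    rw [hy, zero_mul]
  · push Not at h
    have h0 : P x ≠ 0 := fun h0 => by
      have := hPm x hx h.1 h.2
      rw [h0, norm_zero] at this; linarith
    have : ContDiff ℝ 2 P := hP.restrict_scalars ℝ
    exact hc.contDiff'.contDiffAt.mul (this.contDiffAt.inv h0)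

lemma dbar_cut_div {B : ℝ} {χ θ P : E N → ℂ} (hc : IsCutPair p R B χ θ)
    (hP : ContDiff ℂ 2 P) (h0 : P x ≠ 0) (h1 : 3 / 2 * R ≤ ‖x - p‖)
    (h2 : ‖x - p‖ ≤ 7 / 2 * R) (v : E N) : dbar v (fun x => θ x * (P x)⁻¹) x = 0 := by
  rw [cderiv_congr (g := fun x => (P x)⁻¹) ((hc.one' x h1 h2).mono fun y hy => by rw [hy, one_mul])]
  exact dbar_eq_zero (((hP.differentiable (by norm_num)) x).fun_inv h0) v

lemma integrable_mul_dbar_test (hγ : IsTest D γ)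
    (hu : MemLp u 2 μ) (v : E N) : Integrable (fun x => u x * dbar v γ x) μ := by
  have h1 : Continuous (dbar v γ) := hγ.contDiff.continuous_cderiv
  have h2 : HasCompactSupport (dbar v γ) := HasCompactSupport.cderiv hγ.compact v
  have := (hu.locallyIntegrable (by norm_num)).integrable_smul_left_of_hasCompactSupport h1 h2
  refine this.congr (ae_of_all _ fun x => ?_)
  simp [mul_comm]

lemma memLp_indicator_of_subset {V : Set (E N)} (hV : IsOpen V) (h : V ⊆ D')
    (hu : MemLp u 2 (μ.restrict D')) : MemLp (V.indicator u) 2 μ :=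
  (memLp_indicator_iff_restrict hV.measurableSet).2
    (hu.mono_measure (Measure.restrict_mono h le_rfl))

lemma integral_indicator_sq_le {V : Set (E N)} (hV : IsOpen V) (h : V ⊆ D')
    (hu : MemLp u 2 (μ.restrict D')) :
    ∫ x, ‖V.indicator u x‖ ^ 2 ∂μ ≤ ∫ x in D', ‖u x‖ ^ 2 ∂μ := by
  have : (fun x => ‖V.indicator u x‖ ^ 2) = V.indicator fun x => ‖u x‖ ^ 2 := by
    ext x; by_cases hx : x ∈ V <;> simp [hx]
  rw [this, integral_indicator hV.measurableSet]
  have hi : Integrable (fun x => ‖u x‖ ^ 2) (μ.restrict D') :=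
    (memLp_two_iff_integrable_sq_norm hu.1).1 hu
  exact setIntegral_mono_set hi (ae_of_all _ fun x => by positivity) (ae_of_all _ h)

lemma exists_glued_pieces {D'' : Set (E N)} {B : ℝ}
    (hS : DbarSolvable μ D D' C) (hD : IsOpen D) (hDm : μ D ≠ ⊤) (hD'' : IsOpen D'')
    (h'' : D'' ⊆ D') (h' : D' ⊆ D) (hR : 0 < R) (hm : 0 < m) (hB : 0 ≤ B)
     {χ θ P : E N → ℂ} (hc : IsCutPair p R B χ θ) (hP : ContDiff ℂ 2 P)
    (hPm : ∀ x ∈ D, R < ‖x - p‖ → ‖x - p‖ < 4 * R → m ≤ ‖P x‖) :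
    ∃ u1 u2 : E N → ℂ, MemLp u1 2 μ ∧ MemLp u2 2 μ ∧
      ∫ x, ‖u1 x‖ ^ 2 ∂μ ≤ 2 * (C * (B / m) ^ 2 + (1 / m) ^ 2 * μ.real D) ∧
      ∫ x, ‖u2 x‖ ^ 2 ∂μ ≤ 2 * (C * (B / m) ^ 2 + (1 / m) ^ 2 * μ.real D) ∧
      (∀ x ∈ D'', 3 / 2 * R < ‖x - p‖ → ‖x - p‖ < 2 * R → u1 x - u2 x = (P x)⁻¹) ∧
      (∀ j γ, IsTest (D'' ∩ {x | ‖x - p‖ < 2 * R}) γ → ∫ x, u1 x * dbar[j] γ x ∂μ = 0) ∧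
      ∀ j γ, IsTest (D'' ∩ {x | 3 / 2 * R < ‖x - p‖}) γ → ∫ x, u2 x * dbar[j] γ x ∂μ = 0 := by
  set q : E N → ℂ := fun x => θ x * (P x)⁻¹ with hq
  have hqD : ContDiffOn ℝ 2 q D := contDiffOn_cut_div hc hP hm hPm
  have hqb : ∀ x ∈ D, ‖q x‖ ≤ 1 / m := by
    intro x hx
    by_cases h : ‖x - p‖ ≤ R ∨ 4 * R ≤ ‖x - p‖
    · rw [hq]; simp only [(hc.zero' x h).self_of_nhds, zero_mul, norm_zero]; positivity
    · push Not at h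
      rw [hq]; simp only [norm_mul, norm_inv]
      have h1 := hPm x hx h.1 h.2
      calc ‖θ x‖ * ‖P x‖⁻¹ ≤ 1 * m⁻¹ :=
            mul_le_mul (hc.norm_le' x) (inv_anti₀ hm h1) (by positivity) zero_le_one
        _ = 1 / m := by ring
  have hq0 : ∀ x ∈ D, 3 / 2 * R < ‖x - p‖ → ‖x - p‖ < 3 * R → ∀ v, dbar v q x = 0 := by
    intro x hx h1 h2 v
    refine dbar_cut_div hc hP (fun h0 => ?_) h1.le (by linarith) v
    have := hPm x hx (by linarith) (by linarith)
    rw [h0, norm_zero] at this; linarith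
  have hχ0 : ∀ x, ‖x - p‖ ≤ 2 * R ∨ 3 * R ≤ ‖x - p‖ → ∀ v, dbar v χ x = 0 := by
    rintro x (h | h) v
    · rw [cderiv_congr (g := fun _ => 1) (hc.one x h)]; simp [cderiv]
    · rw [cderiv_congr (g := fun _ => 0) (hc.zero x h)]; simp [cderiv]
  have hχd : ∀ v, Continuous (dbar v χ) := fun v => hc.contDiff.continuous_cderiv
  obtain ⟨u, hu, huB, hsol⟩ := hS (fun j x => dbar[j] χ x * q x)
    (fun j => ((hχd _).continuousOn.mul hqD.continuousOn).aestronglyMeasurable hD.measurableSet)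
    (B / m) (by positivity)
    (fun j x hx => by
      rw [norm_mul, div_eq_mul_one_div]
      exact mul_le_mul (hc.dbar_le j x) (hqb x hx) (norm_nonneg _) hB)
    (wClosed_dbar_mul hD hc.contDiff hqD fun j k x hx => by
      by_cases h : ‖x - p‖ ≤ 2 * R ∨ 3 * R ≤ ‖x - p‖
      · rw [hχ0 x h, zero_mul]
      · push Not at h
        rw [hq0 x hx (by linarith) h.2, mul_zero])
  set V1 : Set (E N) := D'' ∩ {x | ‖x - p‖ < 2 * R} with hV1
  set V2 : Set (E N) := D'' ∩ {x | 3 / 2 * R < ‖x - p‖} with hV2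
  have hn : Continuous fun x : E N => ‖x - p‖ := by fun_prop
  have hV₁o : IsOpen V1 := hD''.inter (isOpen_lt hn continuous_const)
  have hV₂o : IsOpen V2 := hD''.inter (isOpen_lt continuous_const hn)
  have hV₁D : V1 ⊆ D' := inter_subset_left.trans h''
  have hV₂D : V2 ⊆ D' := inter_subset_left.trans h''
  set b : E N → ℂ := fun x => χ x * q x with hb
  have hbb : ∀ x ∈ D, ‖b x‖ ≤ 1 / m := fun x hx => by
    rw [hb]; simp only [norm_mul]
    calc ‖χ x‖ * ‖q x‖ ≤ 1 * (1 / m) :=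
          mul_le_mul (hc.norm_le x) (hqb x hx) (norm_nonneg _) zero_le_one
      _ = 1 / m := one_mul _
  have hfin : IsFiniteMeasure (μ.restrict D) := ⟨by
    rw [Measure.restrict_apply_univ]; exact hDm.lt_top⟩
  have hbm : MemLp b 2 (μ.restrict D) := by
    refine MemLp.of_bound ((hc.contDiff.continuous.continuousOn.mul
      hqD.continuousOn).aestronglyMeasurable hD.measurableSet) (1 / m) ?_
    exact (ae_restrict_iff' hD.measurableSet).2 (ae_of_all _ hbb)
  have hu1 := memLp_indicator_of_subset hV₁o hV₁D hu
  have hu2 := memLp_indicator_of_subset hV₂o hV₂D hu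
  have hb2 := memLp_indicator_of_subset hV₂o (hV₂D.trans h') hbm
  have hI1 := integral_indicator_sq_le hV₁o hV₁D hu
  have hI2 := integral_indicator_sq_le hV₂o hV₂D hu
  have hI3 := integral_indicator_sq_le hV₂o (hV₂D.trans h') hbm
  have hI4 : ∫ x in D, ‖b x‖ ^ 2 ∂μ ≤ (1 / m) ^ 2 * μ.real D := by
    refine (Real.le_norm_self _).trans
      (norm_setIntegral_le_of_norm_le_const hDm.lt_top fun x hx => ?_)
    rw [norm_pow, norm_norm]
    exact pow_le_pow_left₀ (norm_nonneg _) (hbb x hx) 2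
  have hI5 : 0 ≤ ∫ x, ‖V1.indicator u x‖ ^ 2 ∂μ := integral_nonneg fun x => by positivity
  have hr0 : 0 ≤ (1 / m) ^ 2 * μ.real D := by positivity
  refine ⟨V1.indicator u, fun x => V2.indicator u x - V2.indicator b x, hu1, hu2.sub hb2,
    by linarith, ?_, ?_, ?_, ?_⟩
  · have i1 : Integrable (fun x => ‖V2.indicator u x‖ ^ 2) μ :=
      (memLp_two_iff_integrable_sq_norm hu2.1).1 hu2
    have i2 : Integrable (fun x => ‖V2.indicator b x‖ ^ 2) μ :=
      (memLp_two_iff_integrable_sq_norm hb2.1).1 hb2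
    have i3 : Integrable (fun x => ‖V2.indicator u x - V2.indicator b x‖ ^ 2) μ :=
      (memLp_two_iff_integrable_sq_norm (hu2.sub hb2).1).1 (hu2.sub hb2)
    calc ∫ x, ‖V2.indicator u x - V2.indicator b x‖ ^ 2 ∂μ
        ≤ ∫ x, (2 * ‖V2.indicator u x‖ ^ 2 + 2 * ‖V2.indicator b x‖ ^ 2) ∂μ := by
          refine integral_mono i3 ((i1.const_mul 2).add (i2.const_mul 2)) fun x => ?_
          have := norm_sub_le (V2.indicator u x) (V2.indicator b x)
          beta_reduce
          nlinarith [norm_nonneg (V2.indicator u x - V2.indicator b x),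
            sq_nonneg (‖V2.indicator u x‖ - ‖V2.indicator b x‖)]
      _ = 2 * ∫ x, ‖V2.indicator u x‖ ^ 2 ∂μ + 2 * ∫ x, ‖V2.indicator b x‖ ^ 2 ∂μ := by
          rw [integral_add (i1.const_mul 2) (i2.const_mul 2), integral_const_mul,
            integral_const_mul]
      _ ≤ _ := by linarith
  · intro x hx h1 h2
    have m1 : x ∈ V1 := ⟨hx, h2⟩
    have m2 : x ∈ V2 := ⟨hx, h1⟩
    simp only [indicator_of_mem m1, indicator_of_mem m2, hb, hq]
    rw [(hc.one x h2.le).self_of_nhds, (hc.one' x h1.le (by linarith)).self_of_nhds]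
    ring
  · intro j γ hγ
    have hγD : IsTest D γ := ⟨hγ.1, hγ.2, hγ.3.trans (hV₁D.trans h')⟩
    have e1 : ∫ x, V1.indicator u x * dbar[j] γ x ∂μ = ∫ x in D, u x * dbar[j] γ x ∂μ := by
      rw [setIntegral_mul_dbar_eq hγD]
      refine integral_congr_ae (ae_of_all _ fun x => ?_)
      by_cases hx : x ∈ V1
      · simp [hx]
      · simp [cderiv_eq_zero_of_notMem fun h => hx (hγ.sub h)]
    rw [e1, hsol j γ hγD, setIntegral_mul_test_eq hγD, neg_eq_zero]
    refine integral_eq_zero_of_ae (ae_of_all _ fun x => ?_)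
    by_cases hx : x ∈ V1
    · simp [hχ0 x (Or.inl hx.2.le)]
    · simp [image_eq_zero_of_notMem_tsupport fun h => hx (hγ.sub h)]
  · intro j γ hγ
    have hγD : IsTest D γ := ⟨hγ.1, hγ.2, hγ.3.trans (hV₂D.trans h')⟩
    have e1 : ∀ w : E N → ℂ, ∫ x, V2.indicator w x * dbar[j] γ x ∂μ =
        ∫ x in D, w x * dbar[j] γ x ∂μ := by
      intro w
      rw [setIntegral_mul_dbar_eq hγD]
      refine integral_congr_ae (ae_of_all _ fun x => ?_)
      by_cases hx : x ∈ V2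
      · simp [hx]
      · simp [cderiv_eq_zero_of_notMem fun h => hx (hγ.sub h)]
    have i1 := integrable_mul_dbar_test (v := basisVec j) hγ hu2
    have i2 := integrable_mul_dbar_test (v := basisVec j) hγ hb2
    simp only [sub_mul]
    rw [integral_sub i1 i2, e1, e1, hsol j γ hγD, integral_mul_mul_dbar hD hc.contDiff hqD hγD,
      sub_self]
    intro x hx
    by_cases hγx : x ∈ V2
    · rcases lt_or_ge ‖x - p‖ (3 * R) with h | h
      · rw [hq0 x hx hγx.2 h, mul_zero]
      · rw [(hc.zero x h).self_of_nhds]; ring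
    · rw [image_eq_zero_of_notMem_tsupport fun h => hγx (hγ.sub h)]; ring

lemma exists_glued_inverse {D'' : Set (E N)} {δ : ℝ}
    (hS : DbarSolvable μ D D' C) (hD : IsOpen D) (hDm : μ D ≠ ⊤) (hD'' : IsOpen D'')
    (h'' : D'' ⊆ D') (h' : D' ⊆ D) (hR : 0 < R) (hm : 0 < m) (hδ : 0 < δ) (hδR : δ < R / 8)
    (hΩ : IsOpen Ω) (hΩD : ∀ x ∈ Ω, closedBall x δ ⊆ D'') :
    ∃ M : ℝ, 0 < M ∧ ∀ (p : E N) (P : E N → ℂ), ContDiff ℂ 2 P →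
      (∀ x ∈ D, R < ‖x - p‖ → ‖x - p‖ < 4 * R → m ≤ ‖P x‖) →
      (∀ x ∈ Ω, ‖x - p‖ < 2 * R → P x ≠ 0) →
      ∃ F : E N → ℂ, DifferentiableOn ℂ F Ω ∧ ∀ x ∈ Ω,
        (‖x - p‖ < 7 / 4 * R → ‖F x - (P x)⁻¹‖ ≤ M) ∧ (7 / 4 * R ≤ ‖x - p‖ → ‖F x‖ ≤ M) := by
  obtain ⟨B, hB, hcut⟩ := exists_cutPair (N := N) hR
  obtain ⟨η, hη⟩ := exists_mollifier (μ := μ) (N := N) hδ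
  set S := 2 * (C * (B / m) ^ 2 + (1 / m) ^ 2 * μ.real D) with hSd
  set M := √(∫ y, η y ^ 2 ∂μ) * √S with hM
  refine ⟨M + 1, by positivity, fun p P hP hPm hP0 => ?_⟩
  obtain ⟨χ, θ, hc⟩ := hcut p
  obtain ⟨u1, u2, hu1, hu2, hb1, hb2, hdiff, hw1, hw2⟩ :=
    exists_glued_pieces hS hD hDm hD'' h'' h' hR hm hB hc hP hPm
  set K : E N → ℂ := fun y => (η y : ℂ) with hK
  have hl1 : LocallyIntegrable u1 μ := hu1.locallyIntegrable (by norm_num)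
  have hl2 : LocallyIntegrable u2 μ := hu2.locallyIntegrable (by norm_num)
  have hn1 : ∀ x, ‖moll μ K u1 x‖ ≤ M := fun x => (hη.norm_moll_le hu1 x).trans
    (mul_le_mul_of_nonneg_left (sqrt_le_sqrt hb1) (sqrt_nonneg _))
  have hn2 : ∀ x, ‖moll μ K u2 x‖ ≤ M := fun x => (hη.norm_moll_le hu2 x).trans
    (mul_le_mul_of_nonneg_left (sqrt_le_sqrt hb2) (sqrt_nonneg _))
  have tri : ∀ {x y : E N}, y ∈ closedBall x δ → ‖y - p‖ ≤ ‖x - p‖ + δ ∧ ‖x - p‖ - δ ≤ ‖y - p‖ := by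
    intro x y hy
    rw [mem_closedBall, dist_eq_norm y x] at hy
    have h1 := norm_add_le (y - x) (x - p)
    have h2 := norm_sub_le (y - p) (y - x)
    rw [show y - x + (x - p) = y - p by abel] at h1
    rw [show y - p - (y - x) = x - p by abel] at h2
    constructor <;> linarith
  have hd1 : ∀ x ∈ Ω, ‖x - p‖ < 15 / 8 * R → DifferentiableAt ℂ (moll μ K u1) x :=
    fun x hx h => hη.differentiableAt_moll hl1 hw1
      fun y hy => ⟨hΩD x hx hy, show ‖y - p‖ < 2 * R by linarith [(tri hy).1]⟩
  have hd2 : ∀ x ∈ Ω, 13 / 8 * R < ‖x - p‖ → DifferentiableAt ℂ (moll μ K u2) x :=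
    fun x hx h => hη.differentiableAt_moll hl2 hw2
      fun y hy => ⟨hΩD x hx hy, show 3 / 2 * R < ‖y - p‖ by linarith [(tri hy).2]⟩
  have heq : ∀ x ∈ Ω, 13 / 8 * R < ‖x - p‖ → ‖x - p‖ < 15 / 8 * R →
      (P x)⁻¹ - moll μ K u1 x = -moll μ K u2 x := by
    intro x hx h1 h2
    have hKc : Continuous K := hη.contDiff_complex.continuous
    have hKs : HasCompactSupport K := hη.hasCompactSupport_complex
    have e1 : moll μ K u1 x - moll μ K u2 x = moll μ K (fun y => u1 y - u2 y) x := by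
      rw [moll, moll, moll, ← integral_sub (integrable_moll hKc hKs hl1 x)
        (integrable_moll hKc hKs hl2 x)]
      simp only [mul_sub]
    have e2 : moll μ K (fun y => u1 y - u2 y) x = (P x)⁻¹ := by
      refine hη.moll_eq (W := D'' ∩ {y | 3 / 2 * R < ‖y - p‖ ∧ ‖y - p‖ < 2 * R})
        (h := fun y => (P y)⁻¹) (fun y hy => ?_) (fun y hy => ?_) fun y hy => ?_
      · refine ((hP.differentiable (by norm_num) y).fun_inv fun h0 => ?_).differentiableWithinAt
        have := hPm y (h' (h'' hy.1)) (by linarith [hy.2.1]) (by linarith [hy.2.2])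
        rw [h0, norm_zero] at this; linarith
      · exact ⟨hΩD x hx hy, show 3 / 2 * R < ‖y - p‖ by linarith [(tri hy).2],
          show ‖y - p‖ < 2 * R by linarith [(tri hy).1]⟩
      · exact hdiff y (hΩD x hx hy) (by linarith [(tri hy).2]) (by linarith [(tri hy).1])
    rw [e2] at e1
    rw [← e1]; ring
  have hnc : Continuous fun x : E N => ‖x - p‖ := by fun_prop
  refine ⟨fun x => if ‖x - p‖ < 7 / 4 * R then (P x)⁻¹ - moll μ K u1 x else -moll μ K u2 x,
    fun x hx => DifferentiableAt.differentiableWithinAt ?_, fun x hx => ⟨fun h => ?_, fun h => ?_⟩⟩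
  · rcases lt_or_ge ‖x - p‖ (15 / 8 * R) with h | h
    · refine (((hP.differentiable (by norm_num) x).fun_inv (hP0 x hx (by linarith))).fun_sub
        (hd1 x hx h)).congr_of_eventuallyEq ?_
      filter_upwards [hΩ.mem_nhds hx, (isOpen_lt hnc continuous_const).mem_nhds h] with y hy hy'
      have hy' : ‖y - p‖ < 15 / 8 * R := hy'
      split_ifs with h1
      · rfl
      · exact (heq y hy (by push Not at h1; linarith) hy').symm
    · have h : 13 / 8 * R < ‖x - p‖ := by linarith
      refine (hd2 x hx h).fun_neg.congr_of_eventuallyEq ?_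
      filter_upwards [hΩ.mem_nhds hx, (isOpen_lt continuous_const hnc).mem_nhds h] with y hy hy'
      have hy' : 13 / 8 * R < ‖y - p‖ := hy'
      split_ifs with h1
      · exact heq y hy hy' (by linarith)
      · rfl
  · simp only [if_pos h, sub_sub_cancel_left, norm_neg]
    linarith [hn1 x]
  · simp only [if_neg h.not_gt, norm_neg]
    linarith [hn2 x]

lemma contDiff_leviPoly (ρ : E N → ℝ) (p : E N) : ContDiff ℂ 2 (leviPoly ρ p) := by
  have h1 : ContDiff ℂ 2 fun x : E N => x - p := contDiff_id.sub contDiff_const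
  refine ((cgrad ρ p).contDiff.comp h1).add (contDiff_const.mul ?_)
  exact ((bilinPart (fderiv ℝ (fderiv ℝ ρ) p)).contDiff.comp h1).clm_apply h1

/-- Estimates for `1 / (2M - F)` when `F` is within `M` of `1 / P` and `Re P < 0`. -/
lemma inv_sub_estimates (hM : 0 < M) {F P : ℂ} (hP : P.re < 0) (hF : ‖F - P⁻¹‖ ≤ M) :
    0 < ((2 * M - F)⁻¹ : ℂ).re ∧ 2 * M - F ≠ 0 ∧ ‖P‖ ≤ ‖(2 * M - F : ℂ)⁻¹‖ * (1 + 3 * M * ‖P‖) ∧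
      ‖(2 * M - F : ℂ)⁻¹‖ ≤ 6 * ‖P‖ := by
  have hP0 : P ≠ 0 := fun h => by simp [h] at hP
  have hPn : 0 < ‖P‖ := norm_pos_iff.2 hP0
  have hre : P⁻¹.re < 0 := by
    rw [inv_re]; exact div_neg_of_neg_of_pos hP (normSq_pos.2 hP0)
  have h1 : M ≤ (2 * M - F : ℂ).re := by
    have := (abs_re_le_norm (F - P⁻¹)).trans hF
    have := (abs_le.1 this).2
    simp only [sub_re, mul_re, ofReal_re, ofReal_im, Complex.re_ofNat, Complex.im_ofNat] at *
    linarith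
  have h0 : (2 * M - F : ℂ) ≠ 0 := fun h => by rw [h] at h1; simp at h1; linarith
  have hn0 : 0 < ‖(2 * M - F : ℂ)‖ := norm_pos_iff.2 h0
  have hn : M ≤ ‖(2 * M - F : ℂ)‖ := h1.trans ((le_abs_self _).trans (abs_re_le_norm _))
  have h2M : ‖(2 * M : ℂ)‖ = 2 * M := by simp [abs_of_pos hM]
  have e1 : ‖(2 * M - F : ℂ)‖ ≤ 3 * M + ‖P‖⁻¹ := by
    have : (2 * M - F : ℂ) = 2 * M - (F - P⁻¹) - P⁻¹ := by ring
    rw [this]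
    refine (norm_sub_le _ _).trans ?_
    rw [norm_inv]
    linarith [norm_sub_le (2 * M : ℂ) (F - P⁻¹)]
  have e2 : ‖P‖⁻¹ ≤ ‖(2 * M - F : ℂ)‖ + 3 * M := by
    have : P⁻¹ = (2 * M : ℂ) - (F - P⁻¹) - (2 * M - F) := by ring
    rw [← norm_inv, this]
    refine (norm_sub_le _ _).trans ?_
    linarith [norm_sub_le (2 * M : ℂ) (F - P⁻¹)]
  refine ⟨?_, h0, ?_, ?_⟩
  · rw [inv_re]; exact div_pos (hM.trans_le h1) (normSq_pos.2 h0)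
  · rw [norm_inv, inv_mul_eq_div, le_div_iff₀ hn0]
    calc ‖P‖ * ‖(2 * M - F : ℂ)‖ ≤ ‖P‖ * (3 * M + ‖P‖⁻¹) := by gcongr
      _ = 1 + 3 * M * ‖P‖ := by field_simp; ring
  · rw [norm_inv, inv_le_iff_one_le_mul₀ hn0]
    have e3 : 1 ≤ ‖P‖ * (‖(2 * M - F : ℂ)‖ + 3 * M) := by
      calc (1 : ℝ) = ‖P‖ * ‖P‖⁻¹ := by field_simp
        _ ≤ _ := by gcongr
    nlinarith

lemma peak_estimates {T σ : ℝ} {F P G : ℂ} (hM : 0 < M) (hR : 0 < R) (hL1 : 1 ≤ L)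
    (hc0 : 0 < c0) (hT : 0 < T) (hσ : 0 < σ) (hTle : ‖G‖ + t ^ 2 + σ ≤ T)
    (hPs : ‖P - G‖ ≤ L * t ^ 2)
    (hnear : t < 7 / 4 * R → ‖F - P⁻¹‖ ≤ M ∧ P.re ≤ -σ - c0 / 2 * t ^ 2)
    (hfar : 7 / 4 * R ≤ t → ‖F‖ ≤ M) :
    2 * M - F ≠ 0 ∧ 0 < ((2 * M - F : ℂ)⁻¹).re ∧
      min (1 / ((2 + 2 * (L + 1) / c0) * (1 + 3 * M * (L * T)))) (1 / (3 * M * T)) *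
        (‖G‖ + t ^ 2 + σ) ≤ ‖(2 * M - F : ℂ)⁻¹‖ ∧
      ‖(2 * M - F : ℂ)⁻¹‖ ≤ max (6 * L) (1 / (M * R ^ 2)) * (‖G‖ + t ^ 2) := by
  have hTnn : 0 ≤ ‖G‖ + t ^ 2 + σ := by positivity
  have hG0 : 0 ≤ ‖G‖ := norm_nonneg _
  have hG1 : ‖G‖ ≤ L * ‖G‖ := le_mul_of_one_le_left hG0 hL1
  have hLσ : 0 ≤ L * σ := by positivity
  rcases lt_or_ge t (7 / 4 * R) with hlt | hge
  · obtain ⟨hFP, hlv⟩ := hnear hlt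
    have hq0 : 0 ≤ c0 / 2 * t ^ 2 := by positivity
    obtain ⟨h1, h2, h3, h4⟩ := inv_sub_estimates hM (by linarith) hFP
    have hPle : ‖P‖ ≤ ‖G‖ + L * t ^ 2 := by
      have := norm_add_le (P - G) G
      rw [sub_add_cancel] at this
      linarith
    have hAle : ‖G‖ ≤ ‖P‖ + L * t ^ 2 := by
      have := norm_sub_le P (P - G)
      rw [sub_sub_cancel] at this
      linarith
    have hPge : σ + c0 / 2 * t ^ 2 ≤ ‖P‖ := by
      have := (neg_abs_le _).trans' (neg_le_neg (abs_re_le_norm P))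
      linarith
    have hK : ‖G‖ + t ^ 2 + σ ≤ (2 + 2 * (L + 1) / c0) * ‖P‖ := by
      have e1 : t ^ 2 ≤ 2 / c0 * ‖P‖ := by
        rw [div_mul_eq_mul_div, le_div_iff₀ hc0]; linarith
      have e2 : (2 + 2 * (L + 1) / c0) * ‖P‖ = 2 * ‖P‖ + (L + 1) * (2 / c0 * ‖P‖) := by ring
      rw [e2]
      have e3 : (L + 1) * t ^ 2 ≤ (L + 1) * (2 / c0 * ‖P‖) := by gcongr
      have e4 : 0 ≤ c0 / 2 * t ^ 2 := by positivity
      linarith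
    have hPT : ‖P‖ ≤ L * T := by
      have : ‖P‖ ≤ L * (‖G‖ + t ^ 2 + σ) := by linarith
      exact this.trans (by gcongr)
    refine ⟨h2, h1, ?_, h4.trans ?_⟩
    · refine (mul_le_mul_of_nonneg_right (min_le_left _ _) hTnn).trans ?_
      rw [one_div_mul_eq_div, div_le_iff₀ (by positivity)]
      calc ‖G‖ + t ^ 2 + σ ≤ (2 + 2 * (L + 1) / c0) * ‖P‖ := hK
        _ ≤ (2 + 2 * (L + 1) / c0) * (‖(2 * M - F : ℂ)⁻¹‖ * (1 + 3 * M * ‖P‖)) := by gcongr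
        _ ≤ (2 + 2 * (L + 1) / c0) * (‖(2 * M - F : ℂ)⁻¹‖ * (1 + 3 * M * (L * T))) := by gcongr
        _ = _ := by ring
    · calc 6 * ‖P‖ ≤ 6 * L * (‖G‖ + t ^ 2) := by linarith
        _ ≤ _ := mul_le_mul_of_nonneg_right (le_max_left _ _) (by positivity)
  · have hFM := hfar hge
    have hre : M ≤ (2 * M - F : ℂ).re := by
      have := (abs_le.1 ((abs_re_le_norm (F)).trans hFM)).2
      simp only [sub_re, mul_re, ofReal_re, ofReal_im, Complex.re_ofNat, Complex.im_ofNat]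
      linarith
    have h0 : (2 * M - F : ℂ) ≠ 0 := fun h => by rw [h] at hre; simp at hre; linarith
    have hn : M ≤ ‖(2 * M - F : ℂ)‖ := hre.trans ((le_abs_self _).trans (abs_re_le_norm _))
    have h2M : ‖(2 * M : ℂ)‖ = 2 * M := by simp [abs_of_pos hM]
    have hn' : ‖(2 * M - F : ℂ)‖ ≤ 3 * M := by
      linarith [norm_sub_le (2 * M : ℂ) (F)]
    refine ⟨h0, ?_, ?_, ?_⟩
    · rw [inv_re]; exact div_pos (hM.trans_le hre) (normSq_pos.2 h0)
    · refine (mul_le_mul_of_nonneg_right (min_le_right _ _) hTnn).trans ?_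
      rw [norm_inv]
      calc 1 / (3 * M * T) * (‖G‖ + t ^ 2 + σ) ≤ 1 / (3 * M * T) * T := by gcongr
        _ = (3 * M)⁻¹ := by field_simp
        _ ≤ _ := inv_anti₀ (by linarith) hn'
    · refine le_trans ?_ (mul_le_mul_of_nonneg_right (le_max_right _ _) (by positivity))
      rw [norm_inv]
      have : R ^ 2 ≤ t ^ 2 := by gcongr; linarith
      calc ‖(2 * M - F : ℂ)‖⁻¹ ≤ M⁻¹ := inv_anti₀ hM hn
        _ = 1 / (M * R ^ 2) * R ^ 2 := by field_simp
        _ ≤ _ := by gcongr; linarith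

lemma DefFun.exists_peak (h : DefFun Ω ρ r0 c0) : ∃ c C : ℝ, 0 < c ∧ 0 < C ∧
    ∀ p ∈ frontier Ω, ∃ g : E N → ℂ, DifferentiableOn ℂ g Ω ∧ ∀ x ∈ Ω, 0 < (g x).re ∧
      c * (‖cgrad ρ p (x - p)‖ + ‖x - p‖ ^ 2 + -ρ x) ≤ ‖g x‖ ∧
      ‖g x‖ ≤ C * (‖cgrad ρ p (x - p)‖ + ‖x - p‖ ^ 2) := by
  obtain ⟨L, hL⟩ := exists_hasC2Bound h.contDiff h.compact
  have hL1 := hL.one_le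
  have hc0 := h.c₀_pos
  obtain ⟨r, hr, hlevi⟩ := h.exists_re_leviPoly_le
  obtain ⟨ε1, hε1, -, hsolv⟩ := h.exists_dbar_solution (μ := (Measure.addHaar : Measure (E N)))
  set R := r / 4 with hRdef
  have hR : 0 < R := by positivity
  set ε := min ε1 (c0 * R ^ 2 / 4) with hεdef
  have hε : 0 < ε := lt_min hε1 (by positivity)
  have hεR : ε ≤ c0 * R ^ 2 / 4 := min_le_right _ _
  obtain ⟨C, -, hS⟩ := hsolv ε hε (min_le_left _ _)
  set m := c0 * R ^ 2 / 4 with hmdef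
  have hm : 0 < m := by positivity
  set δ := min (R / 16) (min (ε / (4 * L)) (r0 / 4)) with hδdef
  have hr0 := h.r₀_pos
  have hδ : 0 < δ := lt_min (by positivity) (lt_min (by positivity) (by positivity))
  have hδ1 : δ ≤ R / 16 := min_le_left _ _
  have hδ2 : L * δ ≤ ε / 4 := by
    have : δ ≤ ε / (4 * L) := (min_le_right _ _).trans (min_le_left _ _)
    rw [le_div_iff₀ (by positivity)] at this
    linarith
  have hδ3 : δ ≤ r0 / 4 := (min_le_right _ _).trans (min_le_right _ _)
  have hΩD : ∀ x ∈ Ω, closedBall x δ ⊆ collar Ω ρ r0 ε ∩ {x | ρ x < ε / 2} := by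
    intro x hx y hy
    by_cases hyΩ : y ∈ Ω
    · exact ⟨Or.inl hyΩ, ((h.mem_iff y).1 hyΩ).trans (by positivity)⟩
    have hxy : dist y x ≤ δ := hy
    have h1 : bdist Ω x ≤ dist y x := by
      by_contra hlt
      exact hyΩ (h.ball_subset hx (by push Not at hlt; exact hlt))
    have h2 : infDist y (frontier Ω) ≤ bdist Ω x + dist y x := infDist_le_infDist_add_dist
    have h3 : ρ y ≤ ρ x + L * δ := by
      have h4 := (abs_le.1 (hL.sub_le y x)).2
      rw [← dist_eq_norm y x] at h4
      nlinarith
    have h5 := (h.mem_iff x).1 hx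
    exact ⟨Or.inr ⟨by linarith, by linarith⟩, show ρ y < ε / 2 by linarith⟩
  obtain ⟨M, hM, hF⟩ := exists_glued_inverse (μ := (Measure.addHaar : Measure (E N))) (R := R)
    (m := m) (D'' := collar Ω ρ r0 ε ∩ {x | ρ x < ε / 2}) hS (h.isOpen_collar ε)
    (h.isBounded_collar ε).measure_lt_top.ne
    ((h.isOpen_collar ε).inter (isOpen_lt h.contDiff.continuous continuous_const))
    (fun x hx => ⟨hx.1, le_of_lt hx.2⟩) (sep_subset _ _) hR hm hδ (by linarith) h.isOpen hΩD
  obtain ⟨Bd, hBd0, hBd⟩ : ∃ Bd : ℝ, 0 < Bd ∧ ∀ x ∈ Ω, ∀ p ∈ frontier Ω, ‖x - p‖ ≤ Bd := by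
    obtain ⟨B, hB⟩ := Metric.isBounded_iff.1 h.bounded.closure
    refine ⟨|B| + 1, by positivity, fun x hx p hp => ?_⟩
    rw [← dist_eq_norm x p]
    exact (hB (subset_closure hx) (frontier_subset_closure hp)).trans
      ((le_abs_self _).trans (by linarith))
  set T := 2 * L * Bd + Bd ^ 2 with hT
  have hTpos : 0 < T := by positivity
  set K1 := 2 + 2 * (L + 1) / c0 with hK1
  have hK₁pos : 0 < K1 := by positivity
  refine ⟨min (1 / (K1 * (1 + 3 * M * (L * T)))) (1 / (3 * M * T)),
    max (6 * L) (1 / (M * R ^ 2)), by positivity, by positivity, fun p hp => ?_⟩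
  have hre : ∀ x ∈ Ω, ‖x - p‖ < 2 * R → (leviPoly ρ p x).re < 0 := fun x hx hxp => by
    have h1 := hlevi p hp x (by linarith)
    have h2 := (h.mem_iff x).1 hx
    have : 0 ≤ c0 / 2 * ‖x - p‖ ^ 2 := by positivity
    linarith
  obtain ⟨F, hFd, hFe⟩ := hF p (leviPoly ρ p) (contDiff_leviPoly ρ p) (fun x hx h1 h2 => by
      have h3 := hlevi p hp x (by linarith)
      have h4 := h.lt_of_mem_collar hε hx
      have h5 := (neg_abs_le _).trans' (neg_le_neg (abs_re_le_norm (leviPoly ρ p x)))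
      have h6 : c0 / 2 * R ^ 2 ≤ c0 / 2 * ‖x - p‖ ^ 2 := by gcongr
      linarith)
    (fun x hx hxp h0 => by have := hre x hx hxp; rw [h0] at this; simp at this)
  have est : ∀ x ∈ Ω, 2 * M - F x ≠ 0 ∧ 0 < ((2 * M - F x : ℂ)⁻¹).re ∧
      min (1 / (K1 * (1 + 3 * M * (L * T)))) (1 / (3 * M * T)) *
        (‖cgrad ρ p (x - p)‖ + ‖x - p‖ ^ 2 + -ρ x) ≤ ‖(2 * M - F x : ℂ)⁻¹‖ ∧
      ‖(2 * M - F x : ℂ)⁻¹‖ ≤ max (6 * L) (1 / (M * R ^ 2)) *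
        (‖cgrad ρ p (x - p)‖ + ‖x - p‖ ^ 2) := by
    intro x hx
    have hσ := (h.mem_iff x).1 hx
    have hG : ‖cgrad ρ p (x - p)‖ ≤ L * ‖x - p‖ := (norm_cgrad_apply_le ρ p _).trans
      (mul_le_mul_of_nonneg_right (hL.fderiv_le p) (norm_nonneg _))
    have hσ' : -ρ x ≤ L * ‖x - p‖ := by
      have := (abs_le.1 (hL.sub_le x p)).1
      rw [h.eq_zero hp] at this
      linarith
    have hd := hBd x hx p hp
    refine peak_estimates hM hR hL1 hc0 hTpos (by linarith) ?_
      (norm_leviPoly_sub_le hL p x) (fun hn => ⟨(hFe x hx).1 hn, ?_⟩) (hFe x hx).2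
    · have h1 : L * ‖x - p‖ ≤ L * Bd := by gcongr
      have h2 : ‖x - p‖ ^ 2 ≤ Bd ^ 2 := by gcongr
      rw [hT]; linarith
    · linarith [hlevi p hp x (by linarith)]
  exact ⟨fun x => (2 * M - F x : ℂ)⁻¹, ((differentiableOn_const _).sub hFd).inv
    fun x hx => (est x hx).1, fun x hx => (est x hx).2⟩

/-- A holomorphic self-combination of two functions `s, t` peaking at different points, equal to
`s` up to `O(t (1 - s)²)` and to `-t` up to `O(s (1 - t)²)`. -/
def glue (s t : ℂ) : ℂ :=
  s - t * (1 - s) ^ 2 - (1 - s) ^ 2 / ((1 - s) ^ 2 + (1 - t) ^ 2) * (s * t * (4 - s - t))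

lemma glue_swap {s t : ℂ} (h : (1 - s) ^ 2 + (1 - t) ^ 2 ≠ 0) : glue t s = -glue s t := by
  have h' : (1 - t) ^ 2 + (1 - s) ^ 2 ≠ 0 := by rwa [add_comm]
  unfold glue
  field_simp
  ring

lemma three_fifths_le_norm_sub {u : ℂ} (ha : ‖1 - a‖ ^ 2 + ‖a‖ ^ 2 ≤ 1) (hu : u ^ 2 = -1) :
    3 / 5 ≤ ‖a - u‖ := by
  have h1 : ‖a - 1 / 2‖ ≤ 1 / 2 := by
    refine abs_le_of_sq_le_sq' ?_ (by norm_num) |>.2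
    rw [← normSq_eq_norm_sq] at ha ⊢
    rw [← normSq_eq_norm_sq] at ha
    simp only [normSq_apply, sub_re, sub_im, one_re, one_im] at ha ⊢
    norm_num at ha ⊢
    nlinarith
  have hu2 : u = I ∨ u = -I := by
    rw [← sq_eq_sq_iff_eq_or_eq_neg, hu, I_sq]
  have h2 : 11 / 10 ≤ ‖(1 / 2 : ℂ) - u‖ := by
    refine abs_le_of_sq_le_sq' ?_ (norm_nonneg _) |>.2
    rw [← normSq_eq_norm_sq]
    rcases hu2 with rfl | rfl <;>
    · simp only [normSq_apply, sub_re, sub_im]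
      norm_num
  have h3 := norm_sub_le_norm_sub_add_norm_sub (1 / 2 : ℂ) a u
  rw [norm_sub_rev (1 / 2 : ℂ) a] at h3
  linarith

lemma glue_estimates {s t : ℂ} (hs : ‖s‖ ^ 2 + ‖1 - s‖ ^ 2 < 1) (hs1 : s ≠ 1) (ht : ‖t‖ ≤ 1 / 50) :
    (1 - s) ^ 2 + (1 - t) ^ 2 ≠ 0 ∧ ‖glue s t‖ < 1 ∧ ‖1 - glue s t‖ ≤ 2 * ‖1 - s‖ := by
  have hσ0 : 0 < ‖1 - s‖ := norm_pos_iff.2 (sub_ne_zero.2 hs1.symm)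
  have hs' : ‖s‖ ≤ 1 := by nlinarith [norm_nonneg s]
  have hσ1 : ‖1 - s‖ ≤ 1 := by nlinarith [norm_nonneg s]
  have key : ∀ u : ℂ, u ^ 2 = -1 → ‖u‖ = 1 → 29 / 50 ≤ ‖(1 - s) - u * (1 - t)‖ := fun u hu hu1 => by
    have h1 := three_fifths_le_norm_sub (a := 1 - s) (u := u) (by rw [sub_sub_cancel]; exact hs.le) hu
    have h2 : (1 - s) - u * (1 - t) = (1 - s - u) + u * t := by ring
    have h3 := norm_sub_norm_le (1 - s - u) (-(u * t))
    rw [norm_neg, norm_mul, hu1, sub_neg_eq_add, one_mul] at h3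
    rw [h2]; linarith
  have hfac : (1 - s) ^ 2 + (1 - t) ^ 2 = ((1 - s) - I * (1 - t)) * ((1 - s) - -I * (1 - t)) := by
    linear_combination (1 - t) ^ 2 * I_sq
  have hden : 1 / 3 ≤ ‖(1 - s) ^ 2 + (1 - t) ^ 2‖ := by
    rw [hfac, norm_mul]
    have h1 := key I I_sq (by simp)
    have h2 := key (-I) (by simp) (by simp)
    calc (1 / 3 : ℝ) ≤ 29 / 50 * (29 / 50) := by norm_num
      _ ≤ _ := mul_le_mul h1 h2 (by norm_num) (norm_nonneg _)
  have hden0 : (1 - s) ^ 2 + (1 - t) ^ 2 ≠ 0 := fun h => by rw [h] at hden; norm_num at hden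
  have hdiff : ‖glue s t - s‖ ≤ 2 / 5 * ‖1 - s‖ ^ 2 := by
    have h1 : ‖t * (1 - s) ^ 2‖ ≤ 1 / 50 * ‖1 - s‖ ^ 2 := by
      rw [norm_mul, norm_pow]; gcongr
    have h2 : ‖(4 - s - t : ℂ)‖ ≤ 6 := by
      refine (norm_sub_le _ _).trans ?_
      have := norm_sub_le (4 : ℂ) s
      have h4 : ‖(4 : ℂ)‖ = 4 := by norm_num
      linarith
    have h3 : ‖s * t * (4 - s - t)‖ ≤ 6 / 50 := by
      rw [norm_mul, norm_mul]
      calc ‖s‖ * ‖t‖ * ‖4 - s - t‖ ≤ 1 * (1 / 50) * 6 := by gcongr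
        _ = _ := by norm_num
    have h4 : ‖(1 - s) ^ 2 / ((1 - s) ^ 2 + (1 - t) ^ 2)‖ ≤ 3 * ‖1 - s‖ ^ 2 := by
      rw [norm_div, norm_pow, div_le_iff₀ (by linarith)]
      nlinarith [sq_nonneg ‖1 - s‖]
    have h5 : glue s t - s = -(t * (1 - s) ^ 2) -
        (1 - s) ^ 2 / ((1 - s) ^ 2 + (1 - t) ^ 2) * (s * t * (4 - s - t)) := by
      unfold glue; ring
    rw [h5]
    refine (norm_sub_le _ _).trans ?_
    rw [norm_neg, norm_mul (_ / _)]
    calc _ ≤ 1 / 50 * ‖1 - s‖ ^ 2 + 3 * ‖1 - s‖ ^ 2 * (6 / 50) := by gcongr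
      _ ≤ _ := by nlinarith [sq_nonneg ‖1 - s‖]
  refine ⟨hden0, ?_, ?_⟩
  · have h1 : ‖s‖ ≤ 1 - ‖1 - s‖ ^ 2 / 2 := by nlinarith [norm_nonneg s, sq_nonneg (‖s‖ - 1)]
    have h2 := norm_add_le s (glue s t - s)
    rw [add_sub_cancel] at h2
    nlinarith
  · have h2 := norm_sub_le (1 - s) (glue s t - s)
    rw [show 1 - s - (glue s t - s) = 1 - glue s t by ring] at h2
    nlinarith

/-- The peaking function attached to `G` in the right half-plane. -/
lemma div_add_estimates (hm : 0 < m) {G : ℂ} (hG : 0 < G.re) :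
    (m + G : ℂ) ≠ 0 ∧ (m / (m + G) : ℂ) ≠ 1 ∧ 1 - (m / (m + G) : ℂ) = G / (m + G) ∧
      ‖(m / (m + G) : ℂ)‖ ^ 2 + ‖1 - (m / (m + G) : ℂ)‖ ^ 2 < 1 ∧
      ‖1 - (m / (m + G) : ℂ)‖ ≤ ‖G‖ / m ∧ ‖(m / (m + G) : ℂ)‖ ≤ m / ‖G‖ ∧
      ‖G‖ / (m + ‖G‖) ≤ ‖1 - (m / (m + G) : ℂ)‖ := by
  have hG0 : G ≠ 0 := fun h => by simp [h] at hG
  have hGn : 0 < ‖G‖ := norm_pos_iff.2 hG0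
  have hre : m + G.re = (m + G : ℂ).re := by simp
  have h0 : (m + G : ℂ) ≠ 0 := fun h => by rw [h] at hre; simp at hre; linarith
  have hn0 : 0 < ‖(m + G : ℂ)‖ := norm_pos_iff.2 h0
  have hsq : m ^ 2 + ‖G‖ ^ 2 < ‖(m + G : ℂ)‖ ^ 2 := by
    rw [← normSq_eq_norm_sq, ← normSq_eq_norm_sq]
    simp only [normSq_apply, add_re, add_im, ofReal_re, ofReal_im]
    nlinarith
  have hm' : m ≤ ‖(m + G : ℂ)‖ := by nlinarith [sq_nonneg ‖G‖]
  have hG' : ‖G‖ ≤ ‖(m + G : ℂ)‖ := by nlinarith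
  have hsub : 1 - (m / (m + G) : ℂ) = G / (m + G) := by field_simp; ring
  have hmn : ‖(m : ℂ)‖ = m := by simp [abs_of_pos hm]
  refine ⟨h0, fun h => ?_, hsub, ?_, ?_, ?_, ?_⟩
  · rw [h, sub_self] at hsub
    exact (div_ne_zero hG0 h0) hsub.symm
  · rw [hsub, norm_div, norm_div, hmn, div_pow, div_pow, ← add_div, div_lt_one (by positivity)]
    exact hsq
  · rw [hsub, norm_div]; gcongr
  · rw [norm_div, hmn]; gcongr
  · rw [hsub, norm_div]
    gcongr
    exact (norm_add_le _ _).trans (by rw [hmn])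

lemma pick_identity (a b : ℂ) :
    ‖1 - conj a * b‖ ^ 2 - ‖b - a‖ ^ 2 = (1 - ‖a‖ ^ 2) * (1 - ‖b‖ ^ 2) := by
  simp only [← normSq_eq_norm_sq, normSq_apply, sub_re, sub_im,
    mul_re, Complex.mul_im, Complex.conj_re, Complex.conj_im, one_re,
    one_im]
  ring

lemma one_sub_conj_mul_ne_zero (ha : ‖a‖ < 1) (hb : ‖b‖ < 1) : 1 - conj a * b ≠ 0 := by
  intro h
  have h1 := pick_identity a b
  rw [h] at h1
  have : 0 < (1 - ‖a‖ ^ 2) * (1 - ‖b‖ ^ 2) :=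
    mul_pos (by nlinarith [norm_nonneg a]) (by nlinarith [norm_nonneg b])
  simp at h1
  nlinarith [sq_nonneg ‖b - a‖]

lemma one_sub_norm_moebius_sq (ha : ‖a‖ < 1) (hb : ‖b‖ < 1) : 1 - ‖(b - a) / (1 - conj a * b)‖ ^ 2 =
      (1 - ‖a‖ ^ 2) * (1 - ‖b‖ ^ 2) / ‖1 - conj a * b‖ ^ 2 := by
  have h0 := norm_ne_zero_iff.2 (one_sub_conj_mul_ne_zero ha hb)
  rw [norm_div, div_pow, ← pick_identity, sub_div, div_self (pow_ne_zero 2 h0)]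

lemma norm_moebius_lt_one (ha : ‖a‖ < 1) (hb : ‖b‖ < 1) : ‖(b - a) / (1 - conj a * b)‖ < 1 := by
  have h1 := one_sub_norm_moebius_sq ha hb
  have h0 := norm_pos_iff.2 (one_sub_conj_mul_ne_zero ha hb)
  have : 0 < (1 - ‖a‖ ^ 2) * (1 - ‖b‖ ^ 2) / ‖1 - conj a * b‖ ^ 2 :=
    div_pos (mul_pos (by nlinarith [norm_nonneg a]) (by nlinarith [norm_nonneg b])) (by positivity)
  nlinarith [norm_nonneg ((b - a) / (1 - conj a * b))]

/-- Postcompose a holomorphic map to the disc with a disc automorphism to send `z` to `0`. -/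
lemma exists_moebius_normalized {F : E N → ℂ} (hF : DifferentiableOn ℂ F Ω)
    (hm : MapsTo F Ω (ball (0 : ℂ) 1)) (hz : z ∈ Ω) (hw : w ∈ Ω) :
    ∃ f : E N → ℂ, DifferentiableOn ℂ f Ω ∧ MapsTo f Ω (ball (0 : ℂ) 1) ∧ f z = 0 ∧
      1 - ‖f w‖ ^ 2 = (1 - ‖F z‖ ^ 2) * (1 - ‖F w‖ ^ 2) / ‖1 - conj (F z) * F w‖ ^ 2 := by
  have h1 : ∀ x ∈ Ω, ‖F x‖ < 1 := fun x hx => mem_ball_zero_iff.1 (hm hx)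
  refine ⟨fun x => (F x - F z) / (1 - conj (F z) * F x), ?_, fun x hx => ?_, ?_, ?_⟩
  · simp only [div_eq_mul_inv]
    exact (hF.sub_const _).fun_mul <| ((hF.const_mul _).const_sub _).fun_inv fun x hx => one_sub_conj_mul_ne_zero (h1 z hz) (h1 x hx)
  · exact mem_ball_zero_iff.2 (norm_moebius_lt_one (h1 z hz) (h1 x hx))
  · simp
  · exact one_sub_norm_moebius_sq (h1 z hz) (h1 w hw)

lemma one_sub_norm_sq_le {F : ℂ} (hF : ‖F‖ < 1) (u : ℂ) (hu : ‖u‖ = 1) :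
    1 - ‖F‖ ^ 2 ≤ 2 * ‖u - F‖ := by
  have := norm_sub_norm_le u F
  rw [hu] at this
  nlinarith [norm_nonneg F]

/-- `|f(w)|` bounded below in the regime of comparable points. -/
lemma log_le_artanh_of_mul_le {A0 c c' : ℝ} (ht1 : t < 1) (hA : 0 ≤ A) (hAA : A ≤ A0)
    (hc : 0 < c) (hct : c * A ≤ t) (hc'0 : 0 < c') (hc'1 : c' ≤ c / 2) (hc'2 : c' ^ 2 * A0 ≤ c) :
    log (1 + c' * A) ≤ artanh t := by
  have ht0 : 0 ≤ t := le_trans (by positivity) hct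
  have h1 : (1 + c' * A) ^ 2 ≤ (1 + t) / (1 - t) := by
    rw [le_div_iff₀ (by linarith)]
    have e1 : c' ^ 2 * A * A ≤ c * A := by
      have : c' ^ 2 * A ≤ c := le_trans (by gcongr) hc'2
      gcongr
    have e2 : 2 * (c' * A) ≤ c * A := by nlinarith
    have e3 : (1 + c' * A) ^ 2 ≤ 1 + 2 * t := by nlinarith
    nlinarith
  unfold artanh
  rw [le_div_iff₀ (by norm_num), mul_comm]
  have := log_le_log (by positivity) h1
  rwa [log_pow, Nat.cast_ofNat] at this

/-- `|f(w)|` bounded below in the regime of distant points. -/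
lemma log_le_artanh_of_one_sub_sq_le {A0 c' : ℝ} (ht0 : 0 ≤ t) (ht1 : t < 1) (hA0 : 0 < A0)
    (hAA : A0 ≤ A) (hct : 1 - t ^ 2 ≤ C / A ^ 2) (hc'0 : 0 < c')
    (hc' : C * (1 / A0 + c') ^ 2 ≤ 1) :
    log (1 + c' * A) ≤ artanh t := by
  have hA : 0 < A := hA0.trans_le hAA
  have h1 : (1 + c' * A) ^ 2 ≤ (1 + t) / (1 - t) := by
    rw [le_div_iff₀ (by linarith)]
    have e1 : 1 + c' * A ≤ (1 / A0 + c') * A := by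
      have : 1 ≤ A / A0 := (one_le_div hA0).2 hAA
      rw [add_mul, one_div_mul_eq_div]; linarith
    have e2 : (1 + c' * A) ^ 2 ≤ (1 / A0 + c') ^ 2 * A ^ 2 := by
      rw [← mul_pow]; gcongr
    rw [le_div_iff₀ (by positivity)] at hct
    have e3 : 1 - t ≤ 1 - t ^ 2 := by nlinarith
    have e4 : (1 + c' * A) ^ 2 * (1 - t) ≤ (1 / A0 + c') ^ 2 * (A ^ 2 * (1 - t ^ 2)) := by
      calc (1 + c' * A) ^ 2 * (1 - t) ≤ (1 / A0 + c') ^ 2 * A ^ 2 * (1 - t ^ 2) := by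
            gcongr
        _ = _ := by ring
    have e5 : (1 / A0 + c') ^ 2 * (A ^ 2 * (1 - t ^ 2)) ≤ (1 / A0 + c') ^ 2 * C := by
      gcongr; linarith
    linarith
  unfold artanh
  rw [le_div_iff₀ (by norm_num), mul_comm]
  have := log_le_log (by positivity) h1
  rwa [log_pow, Nat.cast_ofNat] at this

section HGeometry

variable {D : ℝ}

/-- The peaking quantity at a boundary point. -/
def pquant (ρ : E N → ℝ) (p x : E N) : ℝ := ‖cgrad ρ p (x - p)‖ + ‖x - p‖ ^ 2

lemma pquant_nonneg (ρ : E N → ℝ) (p x : E N) : 0 ≤ pquant ρ p x := by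
  unfold pquant; positivity

lemma hquant_nonneg (ρ : E N → ℝ) (z w : E N) : 0 ≤ hquant ρ z w := by
  unfold hquant; positivity

lemma aquant_nonneg (ρ : E N → ℝ) (z w : E N) : 0 ≤ aquant ρ z w :=
  div_nonneg (hquant_nonneg ρ z w) (by positivity)

lemma norm_cgrad_sub_comm (ρ : E N → ℝ) (p x y : E N) :
    ‖cgrad ρ p (x - y)‖ = ‖cgrad ρ p (y - x)‖ := by
  rw [← neg_sub, map_neg, norm_neg]

lemma HasC2Bound.norm_cgrad_le (hL : HasC2Bound ρ L) (p v : E N) : ‖cgrad ρ p v‖ ≤ L * ‖v‖ :=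
  (norm_cgrad_apply_le ρ p v).trans (mul_le_mul_of_nonneg_right (hL.fderiv_le p) (norm_nonneg _))

lemma HasC2Bound.norm_cgrad_le_add (hL : HasC2Bound ρ L) (p q v : E N) :
    ‖cgrad ρ p v‖ ≤ ‖cgrad ρ q v‖ + L * (‖p - q‖ * ‖v‖) := by
  have h1 := norm_sub_norm_le (cgrad ρ p v) (cgrad ρ q v)
  have h2 := (norm_cgrad_sub_apply_le ρ p q v).trans
    (mul_le_mul_of_nonneg_right (hL.fderiv_sub_le p q) (norm_nonneg v))
  linarith

lemma norm_cgrad_add_le (ρ : E N → ℝ) (p u v : E N) :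
    ‖cgrad ρ p (u + v)‖ ≤ ‖cgrad ρ p u‖ + ‖cgrad ρ p v‖ := by
  rw [map_add]; exact norm_add_le _ _

/-- A nearest point, with the distance controlled by the defining function. -/
structure IsNear (Ω : Set (E N)) (ρ : E N → ℝ) (D : ℝ) (z p : E N) : Prop where
  mem : p ∈ frontier Ω
  pos : 0 < -ρ z
  le : ‖z - p‖ ≤ D * -ρ z
  sq_le : ‖z - p‖ ^ 2 ≤ D * -ρ z

lemma DefFun.exists_isNear (h : DefFun Ω ρ r0 c0) : ∃ D : ℝ, 0 < D ∧
    ∀ z ∈ Ω, ∃ p, IsNear Ω ρ D z p := by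
  obtain ⟨B, hB, hBd⟩ := h.exists_bdist_bound
  obtain ⟨a, ha, had⟩ := h.exists_bdist_le
  refine ⟨(1 + B) / a, by positivity, fun z hz => ?_⟩
  obtain ⟨p, hp, hzp⟩ := exists_mem_frontier_dist_le h.bounded h.nonempty z
  have h1 := had z hz
  have h2 := hBd z hz
  have h3 := h.bdist_pos hz
  have hσ := (h.mem_iff z).1 hz
  have hd : ‖z - p‖ = bdist Ω z := by rw [← dist_eq_norm z p, hzp]; rfl
  refine ⟨p, hp, by linarith, ?_, ?_⟩
  · rw [hd, div_mul_eq_mul_div, le_div_iff₀ ha]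
    nlinarith
  · rw [hd, div_mul_eq_mul_div, le_div_iff₀ ha]
    nlinarith

lemma mul_le_sq_add_sq {a b : ℝ} : a * b ≤ a ^ 2 + b ^ 2 := by
  nlinarith [sq_nonneg (a - b), sq_nonneg (a + b)]

lemma norm_add_sq_le_two (u v : E N) : ‖u + v‖ ^ 2 ≤ 2 * ‖u‖ ^ 2 + 2 * ‖v‖ ^ 2 := by
  have h := norm_add_le u v
  have : ‖u + v‖ ^ 2 ≤ (‖u‖ + ‖v‖) ^ 2 := by gcongr
  nlinarith [sq_nonneg (‖u‖ - ‖v‖)]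

lemma norm_mul_sqrt_le {s : ℝ} (hs : 0 ≤ s) (v : E N) : ‖v‖ * √s ≤ ‖v‖ ^ 2 + s := by
  have := mul_le_sq_add_sq (a := ‖v‖) (b := √s)
  rwa [sq_sqrt hs] at this

lemma IsNear.pquant_self_le (hL : HasC2Bound ρ L) (hz : IsNear Ω ρ D z p) :
    pquant ρ p z ≤ (L + 1) * D * -ρ z := by
  have h1 := hL.norm_cgrad_le p (z - p)
  have h2 : L * ‖z - p‖ ≤ L * (D * -ρ z) :=
    mul_le_mul_of_nonneg_left hz.le (by linarith [hL.one_le])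
  have h3 := hz.sq_le
  unfold pquant
  linarith

lemma IsNear.hquant_le (hL : HasC2Bound ρ L) (hD : 0 < D) (hz : IsNear Ω ρ D z p)
    (w : E N) : hquant ρ z w ≤ 8 * L * (D + 1) * (pquant ρ p w + -ρ z) := by
  have hL1 := hL.one_le
  have hs := hz.pos
  have e1 := hL.norm_cgrad_le_add z p (z - w)
  have e2 := norm_cgrad_add_le ρ p (z - p) (p - w)
  rw [sub_add_sub_cancel] at e2
  have e3 := hL.norm_cgrad_le p (z - p)
  have e4 : L * ‖z - p‖ ≤ L * (D * -ρ z) := mul_le_mul_of_nonneg_left hz.le (by linarith)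
  have e5 : L * (‖z - p‖ * ‖z - w‖) ≤ L * (D * -ρ z + ‖z - w‖ ^ 2) :=
    mul_le_mul_of_nonneg_left (mul_le_sq_add_sq.trans (by linarith [hz.sq_le])) (by linarith)
  have e6 := norm_add_sq_le_two (z - p) (p - w)
  rw [sub_add_sub_cancel, norm_sub_rev p w] at e6
  have e7 := norm_mul_sqrt_le hs.le (z - w)
  have e8 := hz.sq_le
  have e9 : L * ‖z - w‖ ^ 2 ≤ L * (2 * (D * -ρ z) + 2 * ‖w - p‖ ^ 2) :=
    mul_le_mul_of_nonneg_left (by linarith) (by linarith)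
  have e10 : ‖w - p‖ ^ 2 ≤ L * ‖w - p‖ ^ 2 := le_mul_of_one_le_left (by positivity) hL1
  have e11 : ‖cgrad ρ p (w - p)‖ ≤ L * ‖cgrad ρ p (w - p)‖ :=
    le_mul_of_one_le_left (by positivity) hL1
  have e12 : D * -ρ z ≤ L * (D * -ρ z) := le_mul_of_one_le_left (by positivity) hL1
  have e13 : -ρ z ≤ L * -ρ z := le_mul_of_one_le_left (by positivity) hL1
  have e14 : 0 ≤ L * D * pquant ρ p w := mul_nonneg (by positivity) (pquant_nonneg _ _ _)
  have e15 : 0 ≤ L * ‖cgrad ρ p (w - p)‖ := by positivity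
  have e16 : 0 ≤ L * ‖w - p‖ ^ 2 := by positivity
  have e0 : 8 * L * (D + 1) * (pquant ρ p w + -ρ z) = 8 * (L * (D * -ρ z)) + 8 * (L * -ρ z) +
    8 * (L * D * pquant ρ p w) + 8 * (L * ‖cgrad ρ p (w - p)‖) + 8 * (L * ‖w - p‖ ^ 2) := by
    unfold pquant; ring
  rw [e0]
  rw [norm_cgrad_sub_comm ρ p p w] at e2
  unfold hquant
  linarith

lemma IsNear.pquant_le (hL : HasC2Bound ρ L) (hD : 0 < D) (hz : IsNear Ω ρ D z p)
    (w : E N) : pquant ρ p w ≤ 4 * L * (D + 1) * (hquant ρ z w + -ρ z) := by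
  have hL1 := hL.one_le
  have hs := hz.pos
  have e1 := hL.norm_cgrad_le_add p z (w - z)
  have e2 := norm_cgrad_add_le ρ p (w - z) (z - p)
  rw [sub_add_sub_cancel] at e2
  have e3 := hL.norm_cgrad_le p (z - p)
  have e4 : L * ‖z - p‖ ≤ L * (D * -ρ z) := mul_le_mul_of_nonneg_left hz.le (by linarith)
  have e5 : L * (‖p - z‖ * ‖w - z‖) ≤ L * (D * -ρ z + ‖w - z‖ ^ 2) :=
    mul_le_mul_of_nonneg_left (mul_le_sq_add_sq.trans (by rw [norm_sub_rev p]; linarith [hz.sq_le]))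
      (by linarith)
  have e6 := norm_add_sq_le_two (w - z) (z - p)
  rw [sub_add_sub_cancel] at e6
  have e8 := hz.sq_le
  have e10 : ‖w - z‖ ^ 2 ≤ L * ‖w - z‖ ^ 2 := le_mul_of_one_le_left (by positivity) hL1
  have e11 : ‖cgrad ρ z (w - z)‖ ≤ L * ‖cgrad ρ z (w - z)‖ :=
    le_mul_of_one_le_left (by positivity) hL1
  have e12 : D * -ρ z ≤ L * (D * -ρ z) := le_mul_of_one_le_left (by positivity) hL1
  have e14 : 0 ≤ L * D * hquant ρ z w := mul_nonneg (by positivity) (hquant_nonneg _ _ _)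
  have e15 : 0 ≤ L * ‖cgrad ρ z (w - z)‖ := by positivity
  have e16 : 0 ≤ L * (‖z - w‖ * √(-ρ z)) := by positivity
  have e17 : 0 ≤ L * -ρ z := by positivity
  have e18 : 0 ≤ L * ‖w - z‖ ^ 2 := by positivity
  have e0 : 4 * L * (D + 1) * (hquant ρ z w + -ρ z) = 4 * (L * (D * -ρ z)) + 4 * (L * -ρ z) +
    4 * (L * D * hquant ρ z w) + 4 * (L * ‖cgrad ρ z (w - z)‖) + 4 * (L * ‖w - z‖ ^ 2) +
      4 * (L * (‖z - w‖ * √(-ρ z))) := by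
    unfold hquant; rw [norm_cgrad_sub_comm ρ z w z, norm_sub_rev w z]; ring
  rw [e0]
  unfold pquant
  linarith

lemma HasC2Bound.abs_sub_le_hquant (hL : HasC2Bound ρ L) (z w : E N) :
    |ρ w - ρ z| ≤ L * hquant ρ z w := by
  have hL1 := hL.one_le
  have e1 := hL.taylor z w
  have e2 : |fderiv ℝ ρ z (w - z)| ≤ ‖cgrad ρ z (z - w)‖ := by
    rw [norm_cgrad_sub_comm, ← cgrad_re]; exact abs_re_le_norm _
  have e3 : |ρ w - ρ z| ≤ ‖cgrad ρ z (z - w)‖ + L * ‖w - z‖ ^ 2 := by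
    have := abs_add_le (ρ w - ρ z - fderiv ℝ ρ z (w - z)) (fderiv ℝ ρ z (w - z))
    rw [sub_add_cancel] at this
    linarith
  have e4 : ‖cgrad ρ z (z - w)‖ ≤ L * ‖cgrad ρ z (z - w)‖ :=
    le_mul_of_one_le_left (by positivity) hL1
  have e5 : 0 ≤ L * (‖z - w‖ * √(-ρ z)) := by positivity
  unfold hquant
  rw [norm_sub_rev w z] at e3
  linarith

lemma HasC2Bound.hquant_swap_le (hL : HasC2Bound ρ L) (hz : 0 ≤ -ρ z) :
    hquant ρ w z ≤ 4 * L * hquant ρ z w := by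
  have hL1 := hL.one_le
  have e1 := hL.norm_cgrad_le_add w z (w - z)
  rw [norm_cgrad_sub_comm ρ z w z, norm_sub_rev w z] at e1
  have e2 := (abs_le.1 (hL.abs_sub_le_hquant z w)).1
  have hH := hquant_nonneg ρ z w
  have e3 : √(-ρ w) ≤ √(-ρ z) + √(L * hquant ρ z w) := by
    refine Real.sqrt_le_iff.2 ⟨by positivity, ?_⟩
    have h1 := sq_sqrt hz
    have h2 := sq_sqrt (show 0 ≤ L * hquant ρ z w by positivity)
    have h3 : 0 ≤ √(-ρ z) * √(L * hquant ρ z w) := by positivity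
    nlinarith
  have e4 : ‖z - w‖ ≤ √(hquant ρ z w) := Real.le_sqrt_of_sq_le (by
    unfold hquant
    have : 0 ≤ ‖z - w‖ * √(-ρ z) := by positivity
    linarith [norm_nonneg (cgrad ρ z (z - w))])
  have e5 : ‖z - w‖ * √(L * hquant ρ z w) ≤ L * hquant ρ z w := by
    rw [Real.sqrt_mul (by linarith)]
    have h1 : √L ≤ L := Real.sqrt_le_iff.2 ⟨by linarith, by nlinarith⟩
    calc ‖z - w‖ * (√L * √(hquant ρ z w)) ≤ √(hquant ρ z w) * (L * √(hquant ρ z w)) := by gcongr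
      _ = L * (√(hquant ρ z w) * √(hquant ρ z w)) := by ring
      _ = _ := by rw [mul_self_sqrt hH]
  have e6 : ‖z - w‖ * √(-ρ w) ≤ ‖z - w‖ * √(-ρ z) + L * hquant ρ z w := by
    calc ‖z - w‖ * √(-ρ w) ≤ ‖z - w‖ * (√(-ρ z) + √(L * hquant ρ z w)) := by gcongr
      _ = ‖z - w‖ * √(-ρ z) + ‖z - w‖ * √(L * hquant ρ z w) := by ring
      _ ≤ _ := by linarith
  have e7 : hquant ρ z w ≤ L * hquant ρ z w := le_mul_of_one_le_left hH hL1
  have e8 : L * (‖z - w‖ * ‖z - w‖) ≤ L * hquant ρ z w := by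
    refine mul_le_mul_of_nonneg_left ?_ (by linarith)
    rw [← sq]; unfold hquant
    have : 0 ≤ ‖z - w‖ * √(-ρ z) := by positivity
    linarith [norm_nonneg (cgrad ρ z (z - w))]
  have e9 : ‖cgrad ρ z (z - w)‖ + ‖z - w‖ ^ 2 + ‖z - w‖ * √(-ρ z) = hquant ρ z w := rfl
  have e10 : hquant ρ w z = ‖cgrad ρ w (w - z)‖ + ‖z - w‖ ^ 2 + ‖z - w‖ * √(-ρ w) := by
    unfold hquant; rw [norm_sub_rev w z]
  rw [e10]
  linarith

/-- Any point is far, in the peaking sense, from one of two nearest points. -/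
lemma IsNear.hquant_le_add (hL : HasC2Bound ρ L) (hD : 0 < D) {q : E N}
    (hz : IsNear Ω ρ D z p) (hw : IsNear Ω ρ D w q) (x : E N) :
    hquant ρ z w ≤ 100 * L ^ 2 * (D + 1) ^ 2 * (pquant ρ p x + pquant ρ q x + -ρ z + -ρ w) := by
  have hL1 := hL.one_le
  have hsz := hz.pos
  have hsw := hw.pos
  have e0 := hz.hquant_le hL hD w
  have e1 := norm_cgrad_add_le ρ p (w - q) (q - x)
  have e2 := norm_cgrad_add_le ρ p (w - x) (x - p)
  rw [sub_add_sub_cancel] at e1 e2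
  have e3 := hL.norm_cgrad_le p (w - q)
  have e4 : L * ‖w - q‖ ≤ L * (D * -ρ w) := mul_le_mul_of_nonneg_left hw.le (by linarith)
  have e5 := hL.norm_cgrad_le_add p q (q - x)
  rw [norm_cgrad_sub_comm ρ q q x] at e5
  have e6 : ‖p - q‖ ^ 2 ≤ 2 * ‖x - p‖ ^ 2 + 2 * ‖x - q‖ ^ 2 := by
    have := norm_add_sq_le_two (p - x) (x - q)
    rwa [sub_add_sub_cancel, norm_sub_rev p x] at this
  have e7 : L * (‖p - q‖ * ‖q - x‖) ≤ L * (2 * ‖x - p‖ ^ 2 + 3 * ‖x - q‖ ^ 2) := by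
    refine mul_le_mul_of_nonneg_left (mul_le_sq_add_sq.trans ?_) (by linarith)
    rw [norm_sub_rev q x]; linarith
  have e8 := norm_add_sq_le_two (w - q) (q - p)
  rw [sub_add_sub_cancel, norm_sub_rev q p] at e8
  have e9 := hw.sq_le
  have hP := pquant_nonneg ρ p x
  have hQ := pquant_nonneg ρ q x
  have f1 : pquant ρ p w ≤ 10 * L * (D + 1) * (pquant ρ p x + pquant ρ q x + -ρ w) := by
    have g1 : D * -ρ w ≤ L * (D * -ρ w) := le_mul_of_one_le_left (by positivity) hL1
    have g2 : ‖x - p‖ ^ 2 ≤ L * ‖x - p‖ ^ 2 := le_mul_of_one_le_left (by positivity) hL1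
    have g3 : ‖x - q‖ ^ 2 ≤ L * ‖x - q‖ ^ 2 := le_mul_of_one_le_left (by positivity) hL1
    have g4 : ‖cgrad ρ p (x - p)‖ ≤ L * ‖cgrad ρ p (x - p)‖ :=
      le_mul_of_one_le_left (by positivity) hL1
    have g5 : ‖cgrad ρ q (x - q)‖ ≤ L * ‖cgrad ρ q (x - q)‖ :=
      le_mul_of_one_le_left (by positivity) hL1
    have g6 : 0 ≤ L * D * (pquant ρ p x + pquant ρ q x) := by positivity
    have g7 : 0 ≤ L * -ρ w := by positivity
    have g8 : 0 ≤ L * ‖cgrad ρ p (x - p)‖ := by positivity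
    have g9 : 0 ≤ L * ‖cgrad ρ q (x - q)‖ := by positivity
    have g12 : 0 ≤ L * (D * -ρ w) := by positivity
    have g10 : 0 ≤ L * ‖x - p‖ ^ 2 := by positivity
    have g11 : 0 ≤ L * ‖x - q‖ ^ 2 := by positivity
    have g0 : 10 * L * (D + 1) * (pquant ρ p x + pquant ρ q x + -ρ w) =
        10 * (L * D * (pquant ρ p x + pquant ρ q x)) + 10 * (L * (D * -ρ w)) + 10 * (L * -ρ w) +
        10 * (L * ‖cgrad ρ p (x - p)‖) + 10 * (L * ‖x - p‖ ^ 2) + 10 * (L * ‖cgrad ρ q (x - q)‖) +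
        10 * (L * ‖x - q‖ ^ 2) := by
      unfold pquant; ring
    rw [g0]
    change ‖cgrad ρ p (w - p)‖ + ‖w - p‖ ^ 2 ≤ _
    linarith
  have hLD : 1 ≤ L * (D + 1) := by nlinarith
  have f2 : -ρ z ≤ 10 * L * (D + 1) * -ρ z := by
    refine le_mul_of_one_le_left hsz.le ?_
    linarith
  calc hquant ρ z w ≤ 8 * L * (D + 1) * (pquant ρ p w + -ρ z) := e0
    _ ≤ 8 * L * (D + 1) *
        (10 * L * (D + 1) * (pquant ρ p x + pquant ρ q x + -ρ w) + 10 * L * (D + 1) * -ρ z) := by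
        gcongr
    _ = 80 * L ^ 2 * (D + 1) ^ 2 * (pquant ρ p x + pquant ρ q x + -ρ z + -ρ w) := by ring
    _ ≤ _ := by gcongr; norm_num

end HGeometry

section LowerNear

variable {D : ℝ}

/-- `g` is a peak function at `p`, comparable with `pquant ρ p` with constants `c`, `C`. -/
structure IsPeak (Ω : Set (E N)) (ρ : E N → ℝ) (c C : ℝ) (p : E N) (g : E N → ℂ) : Prop where
  diff : DifferentiableOn ℂ g Ω
  re_pos : ∀ x ∈ Ω, 0 < (g x).re
  le : ∀ x ∈ Ω, c * (pquant ρ p x + -ρ x) ≤ ‖g x‖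
  ge : ∀ x ∈ Ω, ‖g x‖ ≤ C * pquant ρ p x

lemma DefFun.exists_isPeak (h : DefFun Ω ρ r0 c0) : ∃ c C : ℝ, 0 < c ∧ 0 < C ∧
    ∀ p ∈ frontier Ω, ∃ g, IsPeak Ω ρ c C p g := by
  obtain ⟨c, C, hc, hC, H⟩ := h.exists_peak
  refine ⟨c, C, hc, hC, fun p hp => ?_⟩
  obtain ⟨g, hg, hx⟩ := H p hp
  exact ⟨g, hg, fun x h => (hx x h).1, fun x h => (hx x h).2.1, fun x h => (hx x h).2.2⟩

lemma IsNear.norm_mul_le (hD : 0 < D) (hz : IsNear Ω ρ D z p) (v : E N) :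
    ‖z - p‖ * ‖v‖ ≤ (D + 1) * (‖v‖ * √(-ρ z)) := by
  have h1 : ‖z - p‖ ≤ (D + 1) * √(-ρ z) := by
    refine abs_le_of_sq_le_sq' ?_ (by positivity) |>.2
    rw [mul_pow, sq_sqrt hz.pos.le]
    refine hz.sq_le.trans (mul_le_mul_of_nonneg_right ?_ hz.pos.le)
    nlinarith
  calc ‖z - p‖ * ‖v‖ ≤ (D + 1) * √(-ρ z) * ‖v‖ := by gcongr
    _ = _ := by ring

lemma norm_ofReal_add_ge {s : ℝ} (hs : 0 < s) {G : ℂ} (hG : 0 < G.re) :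
    (s + G : ℂ) ≠ 0 ∧ (s + ‖G‖) / 2 ≤ ‖(s + G : ℂ)‖ := by
  obtain ⟨h0, -, -, h4, -⟩ := div_add_estimates hs hG
  refine ⟨h0, ?_⟩
  have hn : ‖(s : ℂ)‖ = s := by simp [abs_of_pos hs]
  have h1 : s ^ 2 + ‖G‖ ^ 2 ≤ ‖(s + G : ℂ)‖ ^ 2 := by
    rw [← normSq_eq_norm_sq, ← normSq_eq_norm_sq]
    simp only [normSq_apply, add_re, add_im, ofReal_re, ofReal_im]
    nlinarith
  refine abs_le_of_sq_le_sq' ?_ (norm_nonneg _) |>.2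
  nlinarith [sq_nonneg (s - ‖G‖), sq_nonneg (s + ‖G‖), norm_nonneg G]

/-- A bounded holomorphic function vanishing at `z` and large at `w`. -/
lemma exists_lower_near (hL : HasC2Bound ρ L) (hD : 0 < D) {c : ℝ} (hc : 0 < c) (hC : 0 < C)
     (hz : IsNear Ω ρ D z p) (hg : IsPeak Ω ρ c C p g)
    (hΩ : ∀ x ∈ Ω, 0 < -ρ x) (hw : w ∈ Ω) :
    ∃ f : E N → ℂ, DifferentiableOn ℂ f Ω ∧ MapsTo f Ω (ball (0 : ℂ) 1) ∧ f z = 0 ∧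
      min 1 c / (32 * L * (L + 2) * (D + 1)) / ((1 + L * (D + 1)) * (1 + 4 * C * L * (D + 1))) *
        (hquant ρ z w / (-ρ z + hquant ρ z w)) ≤ ‖f w‖ := by
  have hL1 := hL.one_le
  have hs := hz.pos
  set s := -ρ z with hsdef
  obtain ⟨ℓ, hℓ, hℓw⟩ := exists_dual_vector'' ℂ (w - z)
  obtain ⟨u, hu1, hu⟩ : ∃ u : ℂ, ‖u‖ = 1 ∧ u * cgrad ρ p (w - z) = ‖cgrad ρ p (w - z)‖ := by
    obtain ⟨u, hu1, hu⟩ := RCLike.exists_norm_mul_eq_self (cgrad ρ p (w - z))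
    refine ⟨conj u, by simpa using hu1, ?_⟩
    have : conj u * u = 1 := by rw [mul_comm, RCLike.mul_conj, hu1]; simp
    calc conj u * cgrad ρ p (w - z)
        = conj u * (u * ‖cgrad ρ p (w - z)‖) := congrArg (conj u * ·) hu.symm
      _ = _ := by rw [← mul_assoc, this, one_mul]
  set ε := min 1 c / (32 * L * (L + 2) * (D + 1)) with hε
  have hmin : 0 < min 1 c := lt_min one_pos hc
  have hε0 : 0 < ε := by positivity
  set num : E N → ℂ := fun x => u * cgrad ρ p (x - z) + (√s : ℂ) * ℓ (x - z) + ℓ (x - z) ^ 2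
    with hnum
  have hℓle : ∀ v, ‖ℓ v‖ ≤ ‖v‖ := fun v => (ℓ.le_opNorm v).trans (by
    simpa using mul_le_mul_of_nonneg_right hℓ (norm_nonneg v))
  have hnumle : ∀ x, ‖num x‖ ≤ 8 * L * (L + 2) * (D + 1) * (pquant ρ p x + s) := fun x => by
    have e1 := hz.hquant_le hL hD x
    have e2 := hL.norm_cgrad_le_add p z (x - z)
    have e3 : L * (‖p - z‖ * ‖x - z‖) ≤ L * (D * s + ‖x - z‖ ^ 2) :=
      mul_le_mul_of_nonneg_left (mul_le_sq_add_sq.trans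
        (by rw [norm_sub_rev p]; linarith [hz.sq_le])) (by linarith)
    have e4 : ‖num x‖ ≤ ‖cgrad ρ p (x - z)‖ + √s * ‖x - z‖ + ‖x - z‖ ^ 2 := by
      refine (norm_add₃_le).trans ?_
      rw [norm_mul, hu1, one_mul, norm_mul, norm_pow, norm_real, norm_eq_abs,
        abs_of_nonneg (sqrt_nonneg s)]
      gcongr <;> exact hℓle _
    have e5 : hquant ρ z x = ‖cgrad ρ z (x - z)‖ + ‖x - z‖ ^ 2 + √s * ‖x - z‖ := by
      unfold hquant; rw [norm_cgrad_sub_comm, norm_sub_rev z x, mul_comm ‖x - z‖]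
    have e6 : ‖x - z‖ ^ 2 ≤ hquant ρ z x := by
      rw [e5]
      have : 0 ≤ √s * ‖x - z‖ := by positivity
      linarith [norm_nonneg (cgrad ρ z (x - z))]
    have e7 : L * ‖x - z‖ ^ 2 ≤ L * hquant ρ z x := mul_le_mul_of_nonneg_left e6 (by linarith)
    have e8 : (1 + L) * hquant ρ z x ≤ (1 + L) * (8 * L * (D + 1) * (pquant ρ p x + s)) :=
      mul_le_mul_of_nonneg_left e1 (by linarith)
    have e9 : L * (D * s) ≤ 8 * L * (D + 1) * (pquant ρ p x + s) := by
      have := pquant_nonneg ρ p x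
      have h1 : 0 ≤ 8 * L * (D + 1) * pquant ρ p x := by positivity
      have h2 : 0 ≤ L * s := by positivity
      have h3 : 0 ≤ L * (D * s) := by positivity
      linarith
    linarith
  have hden : ∀ x ∈ Ω, (s + g x : ℂ) ≠ 0 ∧ min 1 c * (pquant ρ p x + s) / 2 ≤ ‖(s + g x : ℂ)‖ := by
    intro x hx
    obtain ⟨h1, h2⟩ := norm_ofReal_add_ge hs (hg.re_pos x hx)
    refine ⟨h1, le_trans ?_ h2⟩
    have h3 := hg.le x hx
    have h4 : min 1 c * pquant ρ p x ≤ c * pquant ρ p x :=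
      mul_le_mul_of_nonneg_right (min_le_right _ _) (pquant_nonneg _ _ _)
    have h5 : min 1 c * s ≤ 1 * s := mul_le_mul_of_nonneg_right (min_le_left _ _) hs.le
    have h6 := mul_pos hc (hΩ x hx)
    linarith
  refine ⟨fun x => ε * (num x * (s + g x)⁻¹), ?_, fun x hx => ?_, ?_, ?_⟩
  · have hn : Differentiable ℂ num := by
      have hsub : Differentiable ℂ fun x : E N => x - z := differentiable_id.sub_const z
      exact ((((cgrad ρ p).differentiable.comp hsub).const_mul u).add
        ((ℓ.differentiable.comp hsub).const_mul _)).add ((ℓ.differentiable.comp hsub).pow 2)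
    exact (hn.differentiableOn.fun_mul ((hg.diff.const_add _).fun_inv
      fun x hx => (hden x hx).1)).const_mul _
  · obtain ⟨h1, h2⟩ := hden x hx
    have hP := pquant_nonneg ρ p x
    rw [mem_ball_zero_iff, norm_mul, norm_mul, norm_inv, norm_real, norm_eq_abs, abs_of_pos hε0]
    have h3 : 0 < min 1 c * (pquant ρ p x + s) / 2 := by positivity
    calc ε * (‖num x‖ * ‖(s + g x : ℂ)‖⁻¹)
        ≤ ε * (8 * L * (L + 2) * (D + 1) * (pquant ρ p x + s) *
            (min 1 c * (pquant ρ p x + s) / 2)⁻¹) := by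
          gcongr
          exact hnumle x
      _ = 1 / 2 := by rw [hε]; field_simp; norm_num
      _ < 1 := by norm_num
  · simp [hnum]
  · have hH := hquant_nonneg ρ z w
    have e1 : num w = (‖cgrad ρ p (w - z)‖ + √s * ‖w - z‖ + ‖w - z‖ ^ 2 : ℝ) := by
      simp only [hnum]
      rw [hu, hℓw]
      push_cast
      rfl
    have e2 : hquant ρ z w ≤ (1 + L * (D + 1)) * ‖num w‖ := by
      rw [e1, norm_real, norm_eq_abs, abs_of_nonneg (by positivity)]
      have h1 := hL.norm_cgrad_le_add z p (z - w)
      have h2 := mul_le_mul_of_nonneg_left (hz.norm_mul_le hD (z - w)) (zero_le_one.trans hL1)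
      have h3 : 0 ≤ L * (D + 1) * ‖cgrad ρ p (z - w)‖ := by positivity
      have h4 : 0 ≤ L * (D + 1) * ‖z - w‖ ^ 2 := by positivity
      unfold hquant
      rw [norm_cgrad_sub_comm ρ p w z, norm_sub_rev w z]
      linarith
    have e3 : ‖(s + g w : ℂ)‖ ≤ (1 + 4 * C * L * (D + 1)) * (s + hquant ρ z w) := by
      have h1 := norm_add_le (s : ℂ) (g w)
      rw [norm_real, norm_eq_abs, abs_of_pos hs] at h1
      have h2 := (hg.ge w hw).trans (mul_le_mul_of_nonneg_left (hz.pquant_le hL hD w) hC.le)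
      linarith
    have e4 : 0 < s + hquant ρ z w := by linarith
    have hn0 : 0 < ‖(s + g w : ℂ)‖ := norm_pos_iff.2 (hden w hw).1
    rw [norm_mul, norm_mul, norm_inv, norm_real, norm_eq_abs, abs_of_pos hε0,
      div_mul_eq_mul_div, mul_div_assoc]
    gcongr ε * ?_
    rw [div_div, ← div_eq_mul_inv, div_le_div_iff₀ (by positivity) hn0]
    calc hquant ρ z w * ‖(s + g w : ℂ)‖
        ≤ ((1 + L * (D + 1)) * ‖num w‖) * ((1 + 4 * C * L * (D + 1)) * (s + hquant ρ z w)) := by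
          gcongr
      _ = _ := by ring

end LowerNear

section LowerFar

variable {D : ℝ}

/-- One minus the squared pseudohyperbolic distance in the disc. -/
def pick (a b : ℂ) : ℝ := (1 - ‖a‖ ^ 2) * (1 - ‖b‖ ^ 2) / ‖1 - conj a * b‖ ^ 2

lemma pick_comm (a b : ℂ) : pick a b = pick b a := by
  unfold pick
  rw [mul_comm (1 - ‖a‖ ^ 2), ← norm_conj (1 - conj a * b)]
  simp [mul_comm]

lemma pick_le_of_separated (ha : ‖a‖ < 1) (hb : ‖b‖ < 1) (hκ : 0 < κ)
    (hab : ‖1 - a‖ ≤ κ / 2) (hbκ : κ ≤ ‖1 - b‖) : pick a b ≤ 8 * ‖1 - a‖ / κ ^ 2 := by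
  have h1 : κ / 2 ≤ ‖1 - conj a * b‖ := by
    have e : 1 - conj a * b = (1 - b) - -(b * conj (1 - a)) := by
      simp only [map_sub, map_one]; ring
    have h := norm_sub_norm_le (1 - b) (-(b * conj (1 - a)))
    rw [← e, norm_neg, norm_mul, norm_conj] at h
    have : ‖b‖ * ‖1 - a‖ ≤ 1 * ‖1 - a‖ := by gcongr
    linarith
  have h2 := one_sub_norm_sq_le ha 1 (by simp)
  have h3 : 1 - ‖b‖ ^ 2 ≤ 1 := by nlinarith [sq_nonneg ‖b‖]
  have h4 : 0 ≤ 1 - ‖b‖ ^ 2 := by nlinarith [norm_nonneg b]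
  have h5 : (κ / 2) ^ 2 ≤ ‖1 - conj a * b‖ ^ 2 := by gcongr
  unfold pick
  rw [div_le_div_iff₀ (by nlinarith) (by positivity)]
  calc (1 - ‖a‖ ^ 2) * (1 - ‖b‖ ^ 2) * κ ^ 2 ≤ 2 * ‖1 - a‖ * 1 * κ ^ 2 := by gcongr
    _ = 8 * ‖1 - a‖ * (κ / 2) ^ 2 := by ring
    _ ≤ _ := by gcongr

lemma pick_le_of_opposite (ha : ‖a‖ < 1) (hb : ‖b‖ < 1)
    (ha1 : ‖1 - a‖ ≤ 1 / 2) (hb1 : ‖1 + b‖ ≤ 1 / 2) : pick a b ≤ 4 * ‖1 - a‖ * ‖1 + b‖ := by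
  have h1 : 1 ≤ ‖1 - conj a * b‖ := by
    have e : (2 : ℂ) = (1 - conj a * b) + ((1 + b) - b * conj (1 - a)) := by
      simp only [map_sub, map_one]; ring
    have h := norm_add_le (1 - conj a * b) ((1 + b) - b * conj (1 - a))
    have h' := norm_sub_le (1 + b) (b * conj (1 - a))
    rw [← e] at h
    rw [norm_mul, norm_conj] at h'
    have : ‖b‖ * ‖1 - a‖ ≤ 1 * ‖1 - a‖ := by gcongr
    have h2 : ‖(2 : ℂ)‖ = 2 := by simp
    linarith
  have h2 := one_sub_norm_sq_le ha 1 (by simp)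
  have h3 := one_sub_norm_sq_le hb (-1) (by simp)
  rw [show ‖(-1 - b : ℂ)‖ = ‖1 + b‖ by rw [← norm_neg]; ring_nf] at h3
  have h4 : 0 ≤ 1 - ‖b‖ ^ 2 := by nlinarith [norm_nonneg b]
  unfold pick
  refine (div_le_self (mul_nonneg (by nlinarith [norm_nonneg a]) h4) (one_le_pow₀ h1)).trans ?_
  calc (1 - ‖a‖ ^ 2) * (1 - ‖b‖ ^ 2) ≤ (2 * ‖1 - a‖) * (2 * ‖1 + b‖) := by gcongr
    _ = _ := by ring

lemma norm_lt_one_of_sq_add_lt {s : ℂ} {y : ℝ} (h : ‖s‖ ^ 2 + y ^ 2 < 1) : ‖s‖ < 1 := by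
  nlinarith [norm_nonneg s, sq_nonneg y]

lemma differentiableOn_div_add (hd : DifferentiableOn ℂ g Ω)
    (hre : ∀ x ∈ Ω, 0 < (g x).re) (hm : 0 < m) :
    DifferentiableOn ℂ (fun x => (m / (m + g x) : ℂ)) Ω := by
  simp only [div_eq_mul_inv]
  exact ((hd.const_add _).fun_inv fun x hx => (div_add_estimates hm (hre x hx)).1).const_mul _

lemma exists_far_one (hd : DifferentiableOn ℂ g Ω)
    (hre : ∀ x ∈ Ω, 0 < (g x).re) {θ k : ℝ} (hm : 0 < m) (hk : 0 < k)
    (hz : z ∈ Ω) (hw : w ∈ Ω) (h1 : ‖g z‖ ≤ θ * m) (h2 : k * m ≤ ‖g w‖)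
    (hθ : θ ≤ k / (1 + k) / 2) :
    ∃ F : E N → ℂ, DifferentiableOn ℂ F Ω ∧ MapsTo F Ω (ball (0 : ℂ) 1) ∧
      pick (F z) (F w) ≤ 8 * θ / (k / (1 + k)) ^ 2 := by
  have hF : ∀ x ∈ Ω, ‖(m / (m + g x) : ℂ)‖ < 1 := fun x hx =>
    norm_lt_one_of_sq_add_lt (div_add_estimates hm (hre x hx)).2.2.2.1
  refine ⟨fun x => m / (m + g x), differentiableOn_div_add hd hre hm,
    fun x hx => mem_ball_zero_iff.2 (hF x hx), ?_⟩
  have e1 : ‖1 - (m / (m + g z) : ℂ)‖ ≤ θ :=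
    (div_add_estimates hm (hre z hz)).2.2.2.2.1.trans ((div_le_iff₀ hm).2 h1)
  have e2 : k / (1 + k) ≤ ‖1 - (m / (m + g w) : ℂ)‖ := by
    refine le_trans ?_ (div_add_estimates hm (hre w hw)).2.2.2.2.2.2
    rw [div_le_div_iff₀ (by positivity) (by positivity)]
    nlinarith [norm_nonneg (g w)]
  refine (pick_le_of_separated (hF z hz) (hF w hw) (κ := k / (1 + k)) (by positivity)
    (e1.trans hθ) e2).trans ?_
  gcongr

lemma exists_far_two {g1 g2 : E N → ℂ} (hd1 : DifferentiableOn ℂ g1 Ω)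
    (hd2 : DifferentiableOn ℂ g2 Ω) (hre1 : ∀ x ∈ Ω, 0 < (g1 x).re)
    (hre2 : ∀ x ∈ Ω, 0 < (g2 x).re) {θ1 θ2 : ℝ} (hm : 0 < m)
    (hz : z ∈ Ω) (hw : w ∈ Ω) (h1 : ‖g1 z‖ ≤ θ1 * m) (h2 : ‖g2 w‖ ≤ θ2 * m) (hθ1 : θ1 ≤ 1 / 4)
    (hθ2 : θ2 ≤ 1 / 4) (hsep : ∀ x ∈ Ω, 50 * m ≤ ‖g1 x‖ ∨ 50 * m ≤ ‖g2 x‖) :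
    ∃ F : E N → ℂ, DifferentiableOn ℂ F Ω ∧ MapsTo F Ω (ball (0 : ℂ) 1) ∧
      pick (F z) (F w) ≤ 16 * θ1 * θ2 := by
  set s : E N → ℂ := fun x => m / (m + g1 x) with hs
  set t : E N → ℂ := fun x => m / (m + g2 x) with ht
  have hsm : ∀ x ∈ Ω, 50 * m ≤ ‖g1 x‖ → ‖s x‖ ≤ 1 / 50 := fun x hx h => by
    refine (div_add_estimates hm (hre1 x hx)).2.2.2.2.2.1.trans ?_
    rw [div_le_div_iff₀ (by linarith) (by norm_num)]; linarith
  have htm : ∀ x ∈ Ω, 50 * m ≤ ‖g2 x‖ → ‖t x‖ ≤ 1 / 50 := fun x hx h => by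
    refine (div_add_estimates hm (hre2 x hx)).2.2.2.2.2.1.trans ?_
    rw [div_le_div_iff₀ (by linarith) (by norm_num)]; linarith
  have hs1 : ∀ x ∈ Ω, s x ≠ 1 ∧ ‖s x‖ ^ 2 + ‖1 - s x‖ ^ 2 < 1 := fun x hx =>
    ⟨(div_add_estimates hm (hre1 x hx)).2.1, (div_add_estimates hm (hre1 x hx)).2.2.2.1⟩
  have ht1 : ∀ x ∈ Ω, t x ≠ 1 ∧ ‖t x‖ ^ 2 + ‖1 - t x‖ ^ 2 < 1 := fun x hx =>
    ⟨(div_add_estimates hm (hre2 x hx)).2.1, (div_add_estimates hm (hre2 x hx)).2.2.2.1⟩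
  have key : ∀ x ∈ Ω, (1 - s x) ^ 2 + (1 - t x) ^ 2 ≠ 0 ∧ ‖glue (s x) (t x)‖ < 1 := by
    intro x hx
    rcases hsep x hx with h | h
    · obtain ⟨e1, e2, -⟩ := glue_estimates (ht1 x hx).2 (ht1 x hx).1 (hsm x hx h)
      have e3 : (1 - s x) ^ 2 + (1 - t x) ^ 2 ≠ 0 := by rwa [add_comm]
      rw [glue_swap e3, norm_neg] at e2
      exact ⟨e3, e2⟩
    · obtain ⟨e1, e2, -⟩ := glue_estimates (hs1 x hx).2 (hs1 x hx).1 (htm x hx h)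
      exact ⟨e1, e2⟩
  have hsd : DifferentiableOn ℂ s Ω := differentiableOn_div_add hd1 hre1 hm
  have htd : DifferentiableOn ℂ t Ω := differentiableOn_div_add hd2 hre2 hm
  have hg1 : ‖g1 z‖ < 50 * m := h1.trans_lt (by nlinarith)
  have hg2 : ‖g2 w‖ < 50 * m := h2.trans_lt (by nlinarith)
  have a1 : ‖1 - s z‖ ≤ θ1 :=
    (div_add_estimates hm (hre1 z hz)).2.2.2.2.1.trans ((div_le_iff₀ hm).2 h1)
  have a2 : ‖1 - t w‖ ≤ θ2 :=
    (div_add_estimates hm (hre2 w hw)).2.2.2.2.1.trans ((div_le_iff₀ hm).2 h2)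
  have b1 : ‖1 - glue (s z) (t z)‖ ≤ 2 * θ1 := by
    have h := (hsep z hz).resolve_left (not_le.2 hg1)
    linarith [(glue_estimates (hs1 z hz).2 (hs1 z hz).1 (htm z hz h)).2.2]
  have b2 : ‖1 + glue (s w) (t w)‖ ≤ 2 * θ2 := by
    have h := (hsep w hw).resolve_right (not_le.2 hg2)
    have h' := (glue_estimates (ht1 w hw).2 (ht1 w hw).1 (hsm w hw h)).2.2
    rw [glue_swap (key w hw).1, sub_neg_eq_add] at h'
    linarith
  refine ⟨fun x => glue (s x) (t x), ?_, fun x hx => mem_ball_zero_iff.2 (key x hx).2, ?_⟩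
  · simp only [glue, div_eq_mul_inv]
    have hs' := hsd.const_sub (1 : ℂ)
    have ht' := htd.const_sub (1 : ℂ)
    exact (hsd.sub (htd.mul (hs'.pow 2))).sub (((hs'.pow 2).mul
      (((hs'.pow 2).add (ht'.pow 2)).inv fun x hx => (key x hx).1)).mul
      ((hsd.mul htd).mul ((hsd.const_sub 4).sub htd)))
  · refine (pick_le_of_opposite (key z hz).2 (key w hw).2 (by linarith) (by linarith)).trans ?_
    calc 4 * ‖1 - glue (s z) (t z)‖ * ‖1 + glue (s w) (t w)‖ ≤ 4 * (2 * θ1) * (2 * θ2) := by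
          gcongr
          linarith [norm_nonneg (1 - glue (s z) (t z))]
      _ = _ := by ring

/-- A holomorphic map to the disc separating two points which are far apart relative to their
distances to the boundary. -/
lemma exists_lower_far (hL : HasC2Bound ρ L) (hD : 0 < D) {c : ℝ} (hc : 0 < c) (hC : 0 < C)
    (hΩ : ∀ x ∈ Ω, 0 < -ρ x) :
    ∃ A0 K : ℝ, 0 < A0 ∧ 0 < K ∧ ∀ z ∈ Ω, ∀ w ∈ Ω, ∀ p q, IsNear Ω ρ D z p → IsNear Ω ρ D w q →
      ∀ g1 g2, IsPeak Ω ρ c C p g1 → IsPeak Ω ρ c C q g2 → A0 ≤ aquant ρ z w →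
      ∃ F : E N → ℂ, DifferentiableOn ℂ F Ω ∧ MapsTo F Ω (ball (0 : ℂ) 1) ∧
        pick (F z) (F w) ≤ K / aquant ρ z w ^ 2 := by
  have hL1 := hL.one_le
  set Ks := 100 * L ^ 2 * (D + 1) ^ 2 with hKs
  have hKs0 : 0 < Ks := by positivity
  set K1 := C * ((L + 1) * D) with hK1
  have hK₁0 : 0 < K1 := by positivity
  set l := c / (200 * Ks) with hl
  have hl0 : 0 < l := by positivity
  set η := min (1 / (4 * Ks)) (l / (4 * K1)) with hη
  have hη0 : 0 < η := lt_min (by positivity) (by positivity)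
  set k := c * η with hk
  have hk0 : 0 < k := by positivity
  set κ := k / (1 + k) with hκ
  have hκ0 : 0 < κ := by positivity
  refine ⟨√(2 * K1 / (η * κ)), max (8 * K1 / (κ ^ 2 * η)) (16 * (K1 / l) ^ 2),
    by positivity, by positivity, ?_⟩
  intro z hz w hw p q hzp hwq g1 g2 hg1 hg2 hA
  set H := hquant ρ z w with hH
  have hsz := hzp.pos
  have hsw := hwq.pos
  have hA0 : 0 < aquant ρ z w := lt_of_lt_of_le (by positivity) hA
  have hAsq : aquant ρ z w ^ 2 = H ^ 2 / (-ρ z * -ρ w) := by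
    unfold aquant
    rw [div_pow, mul_pow, sq_sqrt hsz.le, sq_sqrt hsw.le]
  have hH0 : 0 < H := by
    have hH' := hquant_nonneg ρ z w
    rcases hH'.lt_or_eq with h | h
    · exact h
    · unfold aquant at hA0; rw [← h] at hA0; simp at hA0
  have hbound : 2 * K1 / (η * κ) ≤ H ^ 2 / (-ρ z * -ρ w) := by
    rw [← hAsq]; exact (Real.sqrt_le_left hA0.le).1 hA
  rw [hAsq, div_div_eq_mul_div]
  rw [div_le_div_iff₀ (by positivity) (by positivity)] at hbound
  have G1 : ‖g1 z‖ ≤ K1 * -ρ z := by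
    refine (hg1.ge z hz).trans ?_
    rw [hK1, mul_assoc]
    exact mul_le_mul_of_nonneg_left (hzp.pquant_self_le hL) hC.le
  have G2 : ‖g2 w‖ ≤ K1 * -ρ w := by
    refine (hg2.ge w hw).trans ?_
    rw [hK1, mul_assoc]
    exact mul_le_mul_of_nonneg_left (hwq.pquant_self_le hL) hC.le
  have small : ∀ {a b : ℝ}, 0 < a → 0 < b → a * b = -ρ z * -ρ w → η * H ≤ b → K1 * a / H ≤ κ / 2 ∧
        8 * (K1 * a / H) / κ ^ 2 ≤ 8 * K1 / (κ ^ 2 * η) * (-ρ z * -ρ w) / H ^ 2 := by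
    intro a b ha hb hab hηb
    constructor
    · rw [div_le_div_iff₀ hH0 (by norm_num)]
      have h1 : K1 * a * (η * H) ≤ K1 * a * b := by gcongr
      have h2 : K1 * a * 2 * (η * H) ≤ κ * H * (η * H) := by
        rw [← hab] at hbound
        calc K1 * a * 2 * (η * H) ≤ 2 * (K1 * a * b) := by linarith
          _ = 2 * K1 * (a * b) := by ring
          _ ≤ H ^ 2 * (η * κ) := hbound
          _ = _ := by ring
      exact le_of_mul_le_mul_right h2 (by positivity)
    · rw [← hab]
      have h3 : 8 * (K1 * a / H) / κ ^ 2 = 8 * K1 / (κ ^ 2 * η) * (a * (η * H)) / H ^ 2 := by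
        field_simp
      rw [h3]
      gcongr
  by_cases c1 : η * H ≤ -ρ w
  · obtain ⟨s1, s2⟩ := small hsz hsw rfl c1
    obtain ⟨F, hF, hFm, hFp⟩ := exists_far_one hg1.diff hg1.re_pos hH0 hk0 hz hw
      (θ := K1 * -ρ z / H) (by rwa [div_mul_cancel₀ _ hH0.ne']) (by
        refine le_trans ?_ (hg1.le w hw)
        rw [hk, mul_assoc]
        have := pquant_nonneg ρ p w
        gcongr; linarith) s1
    refine ⟨F, hF, hFm, hFp.trans (s2.trans ?_)⟩
    gcongr
    exact le_max_left _ _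
  by_cases c2 : η * H ≤ -ρ z
  · obtain ⟨s1, s2⟩ := small hsw hsz (mul_comm _ _) c2
    obtain ⟨F, hF, hFm, hFp⟩ := exists_far_one hg2.diff hg2.re_pos hH0 hk0 hw hz
      (θ := K1 * -ρ w / H) (by rwa [div_mul_cancel₀ _ hH0.ne']) (by
        refine le_trans ?_ (hg2.le z hz)
        rw [hk, mul_assoc]
        have := pquant_nonneg ρ q z
        gcongr; linarith) s1
    rw [pick_comm] at hFp
    refine ⟨F, hF, hFm, hFp.trans (s2.trans ?_)⟩
    gcongr
    exact le_max_left _ _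
  push Not at c1 c2
  have hη1 : η * H ≤ 1 / (4 * Ks) * H := mul_le_mul_of_nonneg_right (min_le_left _ _) hH0.le
  have hη2 : η * H ≤ l / (4 * K1) * H := mul_le_mul_of_nonneg_right (min_le_right _ _) hH0.le
  have quarter : ∀ {a : ℝ}, a < η * H → K1 * a / (l * H) ≤ 1 / 4 := fun {a} ha => by
    rw [div_le_div_iff₀ (by positivity) (by norm_num)]
    have : K1 * a ≤ K1 * (l / (4 * K1) * H) := by gcongr; linarith
    have e : K1 * (l / (4 * K1) * H) = l * H / 4 := by field_simp
    linarith
  obtain ⟨F, hF, hFm, hFp⟩ := exists_far_two hg1.diff hg2.diff hg1.re_pos hg2.re_pos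
    (m := l * H) (by positivity) hz hw (θ1 := K1 * -ρ z / (l * H)) (θ2 := K1 * -ρ w / (l * H))
    (by rwa [div_mul_cancel₀ _ (by positivity)]) (by rwa [div_mul_cancel₀ _ (by positivity)])
    (quarter c2) (quarter c1) (fun x hx => by
      by_contra! hcon
      have h1 := hzp.hquant_le_add hL hD hwq x
      have hx1 := hg1.le x hx
      have hx2 := hg2.le x hx
      have hρx := mul_pos hc (hΩ x hx)
      rw [mul_add] at hx1 hx2
      have h3 : c * (pquant ρ p x + pquant ρ q x) ≤ 100 * (l * H) := by
        rw [mul_add]; linarith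
      have h4 : 100 * (l * H) = c * H / (2 * Ks) := by rw [hl]; field_simp; norm_num
      have h5 : Ks * (pquant ρ p x + pquant ρ q x) ≤ H / 2 := by
        rw [h4, le_div_iff₀ (by positivity)] at h3
        nlinarith
      have h6 : Ks * (1 / (4 * Ks) * H) = H / 4 := by field_simp
      have h7 : Ks * -ρ z < Ks * (1 / (4 * Ks) * H) := by gcongr; linarith
      have h8 : Ks * -ρ w < Ks * (1 / (4 * Ks) * H) := by gcongr; linarith
      linarith)
  refine ⟨F, hF, hFm, hFp.trans ?_⟩
  have : 16 * (K1 * -ρ z / (l * H)) * (K1 * -ρ w / (l * H)) =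
      16 * (K1 / l) ^ 2 * (-ρ z * -ρ w) / H ^ 2 := by field_simp
  rw [this]
  gcongr
  exact le_max_right _ _

end LowerFar

/-- The lower bound: a holomorphic map to the disc realizing it. -/
lemma DefFun.exists_lower (h : DefFun Ω ρ r0 c0) : ∃ c : ℝ, 0 < c ∧ ∀ z ∈ Ω, ∀ w ∈ Ω,
    ∃ f : E N → ℂ, DifferentiableOn ℂ f Ω ∧ MapsTo f Ω (ball (0 : ℂ) 1) ∧ f z = 0 ∧
      log (1 + c * aquant ρ z w) ≤ artanh ‖f w‖ := by
  obtain ⟨L, hL⟩ := exists_hasC2Bound h.contDiff h.compact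
  obtain ⟨D, hD, hnear⟩ := h.exists_isNear
  obtain ⟨cp, Cp, hcp, hCp, hpeak⟩ := h.exists_isPeak
  have hΩ : ∀ x ∈ Ω, 0 < -ρ x := fun x hx => neg_pos.2 ((h.mem_iff x).1 hx)
  obtain ⟨A0, K, hA₀, hK, hfar⟩ := exists_lower_far (Ω := Ω) hL hD hcp hCp hΩ
  have hL1 := hL.one_le
  set A1 := max A0 (2 * √K) with hA1
  have hA₁0 : 0 < A1 := lt_max_of_lt_left hA₀
  set c1 := min 1 cp / (32 * L * (L + 2) * (D + 1)) /
    ((1 + L * (D + 1)) * (1 + 4 * Cp * L * (D + 1))) with hc1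
  have hc₁0 : 0 < c1 := by
    have : 0 < min 1 cp := lt_min one_pos hcp
    positivity
  set c2 := c1 / (L * A1 + 1 + A1) with hc2
  have hc₂0 : 0 < c2 := by positivity
  refine ⟨min (c2 / 2) (min (√(c2 / A1)) (1 / (2 * √K))), by positivity, fun z hz w hw => ?_⟩
  set c := min (c2 / 2) (min (√(c2 / A1)) (1 / (2 * √K))) with hc
  have hc0 : 0 < c := by positivity
  have hcA : c ^ 2 ≤ c2 / A1 := by
    have h1 : c ≤ √(c2 / A1) := (min_le_right _ _).trans (min_le_left _ _)
    calc c ^ 2 ≤ √(c2 / A1) ^ 2 := by gcongr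
      _ = _ := sq_sqrt (by positivity)
  have hcK : c ≤ 1 / (2 * √K) := (min_le_right _ _).trans (min_le_right _ _)
  obtain ⟨p, hp⟩ := hnear z hz
  obtain ⟨q, hq⟩ := hnear w hw
  obtain ⟨g1, hg1⟩ := hpeak p hp.mem
  obtain ⟨g2, hg2⟩ := hpeak q hq.mem
  rcases le_total (aquant ρ z w) A1 with hA | hA
  · obtain ⟨f, hf, hfm, hfz, hfw⟩ := exists_lower_near hL hD hcp hCp hp hg1 hΩ hw
    refine ⟨f, hf, hfm, hfz, log_le_artanh_of_mul_le (mem_ball_zero_iff.1 (hfm hw))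
      (aquant_nonneg ρ z w) hA hc₂0 (le_trans ?_ hfw) hc0 (min_le_left _ _)
      ((le_div_iff₀ hA₁0).1 hcA)⟩
    have ha : 0 < √(-ρ z) := sqrt_pos.2 (hΩ z hz)
    have hb : 0 < √(-ρ w) := sqrt_pos.2 (hΩ w hw)
    have ha2 : √(-ρ z) ^ 2 = -ρ z := sq_sqrt (hΩ z hz).le
    have hb2 : √(-ρ w) ^ 2 = -ρ w := sq_sqrt (hΩ w hw).le
    have hH : hquant ρ z w = aquant ρ z w * (√(-ρ z) * √(-ρ w)) := by
      rw [aquant, div_mul_cancel₀ _ (by positivity)]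
    have hsub := (abs_le.1 (hL.abs_sub_le_hquant z w)).2
    have hA0 := aquant_nonneg ρ z w
    rw [hH] at hsub
    rw [← hc1, hH, hc2, div_mul_eq_mul_div, mul_div_assoc]
    generalize √(-ρ z) = a at *
    generalize √(-ρ w) = b at *
    generalize aquant ρ z w = A at *
    rw [← ha2]
    refine mul_le_mul_of_nonneg_left ?_ hc₁0.le
    have hLA : L * (A * (a * b)) ≤ L * A1 * (a * b) := by
      rw [mul_assoc]; gcongr
    have hab : a ≤ (L * A1 + 1) * b := by
      by_contra! hcon
      nlinarith [mul_lt_mul_of_pos_right hcon ha, mul_lt_mul_of_pos_right hcon hb,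
        mul_pos (mul_pos (by positivity : 0 < L * A1) hb) hb]
    rw [div_le_div_iff₀ (by positivity) (by positivity)]
    calc A * (a ^ 2 + A * (a * b)) = A * a * (a + A * b) := by ring
      _ ≤ A * a * ((L * A1 + 1) * b + A1 * b) := by gcongr
      _ = _ := by ring
  · obtain ⟨F, hF, hFm, hFp⟩ := hfar z hz w hw p q hp hq g1 g2 hg1 hg2 ((le_max_left _ _).trans hA)
    obtain ⟨f, hf, hfm, hfz, hfw⟩ := exists_moebius_normalized hF hFm hz hw
    refine ⟨f, hf, hfm, hfz, log_le_artanh_of_one_sub_sq_le (norm_nonneg _)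
      (mem_ball_zero_iff.1 (hfm hw)) hA₁0 hA (hfw.le.trans hFp) hc0 ?_⟩
    have hsK : 0 < √K := sqrt_pos.2 hK
    have h1 : 1 / A1 ≤ 1 / (2 * √K) := by
      gcongr; exact le_max_right _ _
    calc K * (1 / A1 + c) ^ 2 ≤ K * (1 / (2 * √K) + 1 / (2 * √K)) ^ 2 := by gcongr
      _ = K / √K ^ 2 := by field_simp; norm_num
      _ = 1 := by rw [sq_sqrt hK.le, div_self hK.ne']
      _ ≤ 1 := le_rfl

set_option maxHeartbeats 1000000 in
/-- The logarithm of the Cayley transform maps a smaller disc into a lens with parabolic ends. -/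
lemma sq_im_log_lt {Λ : ℝ} (hΛ : 0 < Λ) (hζ : ‖ζ‖ < 1) {k : ℝ}
    (hk : k = (exp Λ - 1) / (exp Λ + 1)) :
    (1 + k * ζ) / (1 - k * ζ) ∈ Complex.slitPlane ∧ 1 - k * ζ ≠ 0 ∧
      (Complex.log ((1 + k * ζ) / (1 - k * ζ))).im ^ 2 <
        5 * (Λ - (Complex.log ((1 + k * ζ) / (1 - k * ζ))).re) ∧
      (Complex.log ((1 + k * ζ) / (1 - k * ζ))).im ^ 2 <
        5 * (Λ + (Complex.log ((1 + k * ζ) / (1 - k * ζ))).re) := by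
  set e := exp Λ with he
  have he1 : 1 < e := Real.one_lt_exp_iff.2 hΛ
  have hk0 : 0 < k := by rw [hk]; exact div_pos (by linarith) (by linarith)
  have hk1 : k < 1 := by rw [hk, div_lt_one (by linarith)]; linarith
  set u : ℂ := k * ζ with hu
  have hu1 : ‖u‖ ^ 2 < k ^ 2 := by
    rw [hu, norm_mul, norm_real, norm_of_nonneg hk0.le, mul_pow]
    have : ‖ζ‖ ^ 2 < 1 := by nlinarith [norm_nonneg ζ]
    nlinarith [pow_pos hk0 2]
  have hu2 : u.re ^ 2 + u.im ^ 2 < k ^ 2 := by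
    rwa [← normSq_eq_norm_sq, normSq_apply, ← sq, ← sq] at hu1
  have hure : |u.re| < 1 := by
    rw [← sq_lt_one_iff_abs_lt_one]; nlinarith [sq_nonneg u.im]
  have hne : 1 - u ≠ 0 := fun h => by
    have := congrArg Complex.re h
    simp at this
    linarith [(abs_lt.1 hure).2]
  set d := Complex.normSq (1 - u) with hd
  have hd0 : 0 < d := normSq_pos.2 hne
  have hdval : d = (1 - u.re) ^ 2 + u.im ^ 2 := by simp [hd, normSq_apply]; ring
  set q := (1 + u) / (1 - u) with hq
  have hqre : q.re * d = 1 - (u.re ^ 2 + u.im ^ 2) := by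
    rw [hq, Complex.div_re, ← hd]; field_simp; simp; ring
  have hqn : ‖q‖ ^ 2 * d = (1 + u.re) ^ 2 + u.im ^ 2 := by
    rw [← normSq_eq_norm_sq, hq, Complex.normSq_div, ← hd, div_mul_cancel₀ _ hd0.ne']
    simp [normSq_apply]; ring
  have hqre0 : 0 < q.re := by
    have : 0 < q.re * d := by rw [hqre]; nlinarith
    exact pos_of_mul_pos_left this hd0.le
  have hq0 : q ≠ 0 := fun h => by simp [h] at hqre0
  refine ⟨Or.inl hqre0, hne, ?_⟩
  set W := Complex.log q with hW
  set X := ‖q‖ with hX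
  have hX0 : 0 < X := norm_pos_iff.2 hq0
  have hXe : exp W.re = X := by rw [hW, Complex.log_re, Real.exp_log hX0]
  have hcos : q.re = X * Real.cos W.im := by
    rw [← hXe, ← Complex.exp_re, hW, Complex.exp_log hq0]
  have key : e * (X ^ 2 + 1) < (e ^ 2 + 1) * (X * Real.cos W.im) := by
    rw [← hcos]
    have h1 : k * (e + 1) = e - 1 := by rw [hk]; field_simp
    have h2 : (u.re ^ 2 + u.im ^ 2) * (e + 1) ^ 2 < (e - 1) ^ 2 := by
      rw [← h1, mul_pow]; gcongr
    have h3 : (e * (X ^ 2 + 1)) * d < ((e ^ 2 + 1) * q.re) * d := by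
      have : (e * (X ^ 2 + 1)) * d = e * (X ^ 2 * d + d) := by ring
      rw [this, hqn, mul_assoc, hqre, hdval]
      nlinarith
    exact lt_of_mul_lt_mul_right h3 hd0.le
  have hcos1 := Real.cos_le_one W.im
  have hfac : (e * X - 1) * (X - e) < 0 := by
    have : (e ^ 2 + 1) * (X * Real.cos W.im) ≤ (e ^ 2 + 1) * X := by gcongr; nlinarith
    nlinarith
  have hXe1 : X < e := by
    by_contra! hcon
    nlinarith [mul_nonneg (by nlinarith : 0 ≤ e * X - 1) (by linarith : 0 ≤ X - e)]
  have hXe2 : 1 < e * X := by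
    by_contra! hcon
    nlinarith [mul_nonneg (by linarith : 0 ≤ 1 - e * X) (by linarith : 0 ≤ e - X)]
  have hpi : |W.im| ≤ Real.pi := by
    rw [hW, Complex.log_im]; exact Complex.abs_arg_le_pi q
  have hquad := Real.cos_le_one_sub_mul_cos_sq hpi
  have hfive : 1 / 5 * W.im ^ 2 ≤ 2 / Real.pi ^ 2 * W.im ^ 2 := by
    gcongr ?_ * _
    rw [div_le_div_iff₀ (by norm_num) (by positivity)]
    have := pow_le_pow_left₀ Real.pi_pos.le Real.pi_lt_d2.le 2
    linarith
  have f1 : X / e < Real.cos W.im := by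
    rw [div_lt_iff₀ (by linarith)]
    have h1 : X ^ 2 * (e ^ 2 + 1) ≤ e ^ 2 * (X ^ 2 + 1) := by nlinarith
    have h2 : (X * (e ^ 2 + 1)) * X < (X * (e ^ 2 + 1)) * (Real.cos W.im * e) := by nlinarith
    exact lt_of_mul_lt_mul_left h2 (by positivity)
  have f2 : 1 / (e * X) < Real.cos W.im := by
    rw [div_lt_iff₀ (by positivity)]
    have h1 : e ^ 2 + 1 ≤ e ^ 2 * (X ^ 2 + 1) := by nlinarith
    have h2 : (e ^ 2 + 1) * 1 < (e ^ 2 + 1) * (Real.cos W.im * (e * X)) := by nlinarith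
    exact lt_of_mul_lt_mul_left h2 (by positivity)
  have g1 : X / e = exp (W.re - Λ) := by rw [Real.exp_sub, hXe]
  have g2 : 1 / (e * X) = exp (-(Λ + W.re)) := by
    rw [Real.exp_neg, exp_add, hXe, one_div]
  have e1 := Real.add_one_le_exp (W.re - Λ)
  have e2 := Real.add_one_le_exp (-(Λ + W.re))
  rw [← g1] at e1
  rw [← g2] at e2
  constructor <;> linarith

set_option maxHeartbeats 1000000 in
/-- A disc in the parabolic neighbourhood of a segment, joining `0` to `1`, whose hyperbolic
length is optimal up to an additive constant. -/
lemma exists_parabolic_disc (hε : 0 < ε) : ∃ c : ℝ, 0 < c ∧ ∀ a b : ℝ, 0 < a → a ≤ 1 →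
    0 < b → b ≤ 1 → ∃ ψ : ℂ → ℂ, DifferentiableOn ℂ ψ (ball 0 1) ∧ ψ 0 = 0 ∧
      (∃ t ∈ ball (0 : ℂ) 1, ψ t = 1 ∧ c * (a * b) ≤ 1 - ‖t‖ ^ 2) ∧
      ∀ ζ ∈ ball (0 : ℂ) 1, (ψ ζ).im ^ 2 < ε * ((ψ ζ).re + a) ∧
        (ψ ζ).im ^ 2 < ε * (1 + b - (ψ ζ).re) := by
  set Λ := 8 / ε with hΛ
  have hΛ0 : 0 < Λ := by positivity
  set k := (exp Λ - 1) / (exp Λ + 1) with hk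
  have he1 : 1 < exp Λ := Real.one_lt_exp_iff.2 hΛ0
  have hk0 : 0 < k := div_pos (by linarith) (by linarith)
  have hk1 : k < 1 := by rw [hk, div_lt_one (by linarith)]; linarith
  have hratio : (1 + k) / (1 - k) = exp Λ := by
    rw [div_eq_iff (by linarith), hk]; field_simp; ring
  -- the real trace of the basic map
  set g : ℝ → ℝ := fun s => 1 / 2 + log ((1 + k * s) / (1 - k * s)) / (2 * Λ) with hg
  have hgneg : ∀ s, g (-s) = 1 - g s := fun s => by
    have : (1 + k * -s) / (1 - k * -s) = ((1 + k * s) / (1 - k * s))⁻¹ := by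
      rw [inv_div]; congr 1 <;> ring
    simp only [hg, this, Real.log_inv]; ring
  have hg1 : g 1 = 1 := by
    simp only [hg, mul_one, hratio, Real.log_exp]; field_simp; norm_num
  have hgm1 : g (-1) = 0 := by rw [hgneg, hg1, sub_self]
  have hgc : ContinuousOn g (Icc (-1) 1) := by
    have h1 : ∀ s ∈ Icc (-1 : ℝ) 1, 0 < 1 - k * s := fun s hs => by nlinarith [hs.1, hs.2]
    have h2 : ∀ s ∈ Icc (-1 : ℝ) 1, 0 < 1 + k * s := fun s hs => by nlinarith [hs.1, hs.2]
    refine continuousOn_const.add (ContinuousOn.div_const (ContinuousOn.log (ContinuousOn.div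
      (by fun_prop) (by fun_prop) fun s hs => (h1 s hs).ne') fun s hs => ?_) _)
    exact (div_pos (h2 s hs) (h1 s hs)).ne'
  set M := k / (Λ * (1 - k) ^ 2) with hM
  have hM0 : 0 < M := div_pos hk0 (mul_pos hΛ0 (pow_pos (by linarith) 2))
  have hglip : ∀ s ∈ Icc (-1 : ℝ) 1, g s ≤ M * (1 + s) := fun s hs => by
    have h1 : 0 < 1 - k * s := by nlinarith [hs.1, hs.2]
    have h2 : 0 < 1 + k * s := by nlinarith [hs.1, hs.2]
    have h4 : 1 - k ≤ 1 - k * s := by nlinarith [hs.1, hs.2]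
    have h3 : log ((1 + k * s) / (1 - k * s)) + Λ ≤ 2 * k * (1 + s) / (1 - k) ^ 2 := by
      conv_lhs => rw [← Real.log_exp Λ, ← hratio]
      rw [← Real.log_mul (by positivity) (div_pos (by linarith) (by linarith)).ne']
      refine (Real.log_le_sub_one_of_pos (mul_pos (by positivity)
        (div_pos (by linarith) (by linarith)))).trans ?_
      have h5 : 0 < 1 - k := by linarith
      have : (1 + k * s) / (1 - k * s) * ((1 + k) / (1 - k)) - 1 =
          2 * k * (1 + s) / ((1 - k * s) * (1 - k)) := by field_simp; ring
      rw [this, sq]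
      have := mul_nonneg hk0.le (by linarith [hs.1] : 0 ≤ 1 + s)
      gcongr
      linarith
    have h6 : g s = (log ((1 + k * s) / (1 - k * s)) + Λ) / (2 * Λ) := by
      simp only [hg]; field_simp; ring
    rw [h6, div_le_iff₀ (by positivity)]
    refine h3.trans_eq ?_
    have h5 : 1 - k ≠ 0 := by linarith
    rw [hM]; field_simp
  have hsurj : ∀ α, 0 < α → α < 1 → ∃ s ∈ Ioo (-1 : ℝ) 1, g s = α ∧
      α * (1 - α) / M ^ 2 ≤ 1 - s ^ 2 := by
    intro α h0 h1
    obtain ⟨s, hs, hsα⟩ := intermediate_value_Icc (by norm_num : (-1 : ℝ) ≤ 1) hgc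
      ⟨hgm1.le.trans h0.le, h1.le.trans hg1.ge⟩
    refine ⟨s, ⟨hs.1.lt_of_ne ?_, hs.2.lt_of_ne ?_⟩, hsα, ?_⟩
    · rintro rfl; linarith
    · rintro rfl; linarith
    · have h2 := hglip s hs
      have h3 := hglip (-s) ⟨by linarith [hs.2], by linarith [hs.1]⟩
      rw [hgneg, hsα] at h3
      rw [hsα] at h2
      rw [div_le_iff₀ (by positivity)]
      calc α * (1 - α) ≤ (M * (1 + s)) * (M * (1 + -s)) := by gcongr; linarith
        _ = _ := by ring
  refine ⟨1 / (324 * M ^ 4), by positivity, fun a b ha ha1 hb hb1 => ?_⟩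
  have hT : 0 < 1 + a + b := by linarith
  obtain ⟨s1, hs1, hgs1, hM1⟩ := hsurj (a / (1 + a + b)) (by positivity)
    ((div_lt_one hT).2 (by linarith))
  obtain ⟨s2, hs2, hgs2, hM2⟩ := hsurj (b / (1 + a + b)) (by positivity)
    ((div_lt_one hT).2 (by linarith))
  set f : ℂ → ℂ := fun ζ => -a + (1 + a + b) *
    (1 / 2 + Complex.log ((1 + k * ζ) / (1 - k * ζ)) / (2 * Λ)) with hf
  have hfreal : ∀ s ∈ Ioo (-1 : ℝ) 1, f s = ((-a + (1 + a + b) * g s : ℝ) : ℂ) := fun s hs => by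
    have h1 : 0 < 1 - k * s := by nlinarith [hs.1, hs.2]
    have h2 : 0 < 1 + k * s := by nlinarith [hs.1, hs.2]
    simp only [hf, hg]
    push_cast [Complex.ofReal_log (div_pos h2 h1).le]
    rfl
  have n1 : ‖(s1 : ℂ)‖ < 1 := by rw [norm_real]; exact abs_lt.2 hs1
  have n2 : ‖(s2 : ℂ)‖ < 1 := by rw [norm_real]; exact abs_lt.2 hs2
  set m : ℂ → ℂ := fun ζ => (ζ - (-s1 : ℂ)) / (1 - conj (-s1 : ℂ) * ζ) with hm
  have hmd : ∀ ζ ∈ ball (0 : ℂ) 1, 1 - conj (-s1 : ℂ) * ζ ≠ 0 := fun ζ hζ =>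
    one_sub_conj_mul_ne_zero (by rwa [norm_neg]) (mem_ball_zero_iff.1 hζ)
  have hmm : MapsTo m (ball 0 1) (ball 0 1) := fun ζ hζ =>
    mem_ball_zero_iff.2 (norm_moebius_lt_one (by rwa [norm_neg]) (mem_ball_zero_iff.1 hζ))
  set t : ℂ := (-s2 - s1 : ℂ) / (1 - conj (s1 : ℂ) * (-s2)) with ht
  have ht1 : t ∈ ball (0 : ℂ) 1 := mem_ball_zero_iff.2 (norm_moebius_lt_one n1 (by rwa [norm_neg]))
  have hfd : DifferentiableOn ℂ f (ball 0 1) := by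
    have hq : DifferentiableOn ℂ (fun ζ : ℂ => (1 + k * ζ) / (1 - k * ζ)) (ball 0 1) :=
      DifferentiableOn.div (by fun_prop) (by fun_prop) fun ζ hζ =>
        (sq_im_log_lt hΛ0 (mem_ball_zero_iff.1 hζ) hk).2.1
    exact ((((hq.clog fun ζ hζ => (sq_im_log_lt hΛ0 (mem_ball_zero_iff.1 hζ) hk).1).div_const
      _).const_add _).const_mul _).const_add _
  refine ⟨fun ζ => f (m ζ), ?_, ?_, ⟨t, ht1, ?_, ?_⟩, fun ζ hζ => ?_⟩
  · exact hfd.comp (DifferentiableOn.div (by fun_prop) (by fun_prop) hmd) hmm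
  · have : m 0 = s1 := by simp [hm]
    simp only [this, hfreal s1 hs1, hgs1]
    rw [mul_div_cancel₀ _ hT.ne']; simp
  · have h1 : m t = ((-s2 : ℝ) : ℂ) := by
      have h2 := hmd t ht1
      have h3 := one_sub_conj_mul_ne_zero n1 (by rwa [norm_neg] : ‖(-s2 : ℂ)‖ < 1)
      simp only [hm]
      rw [div_eq_iff h2]
      rw [conj_ofReal, mul_neg, sub_neg_eq_add] at h3
      have h4 : t * (1 + s1 * s2) = -s2 - s1 := by
        simp only [ht, map_neg, conj_ofReal, mul_neg, sub_neg_eq_add, neg_mul]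
        rw [div_mul_cancel₀ _ h3]
        try ring
      simp only [map_neg, conj_ofReal]
      push_cast
      linear_combination h4
    simp only [h1, hfreal (-s2) ⟨by linarith [hs2.2], by linarith [hs2.1]⟩, hgneg, hgs2]
    rw [mul_sub, mul_div_cancel₀ _ hT.ne']; push_cast; ring
  · rw [ht, one_sub_norm_moebius_sq n1 (by rwa [norm_neg])]
    have h1 : ‖1 - conj (s1 : ℂ) * (-s2)‖ ^ 2 ≤ 2 ^ 2 := by
      gcongr
      refine (norm_sub_le _ _).trans ?_
      rw [norm_mul, norm_conj, norm_neg, norm_one]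
      nlinarith [norm_nonneg (s1 : ℂ), norm_nonneg (s2 : ℂ)]
    have h2 : 0 < ‖1 - conj (s1 : ℂ) * (-s2)‖ ^ 2 := pow_pos (norm_pos_iff.2
      (one_sub_conj_mul_ne_zero n1 (by rwa [norm_neg]))) 2
    have h3 : ∀ x : ℝ, 0 < x → x ≤ 1 → x ≤ 1 + a + b - 1 →
        x / (9 * M ^ 2) ≤ x / (1 + a + b) * (1 - x / (1 + a + b)) / M ^ 2 := by
      intro x hx0 hx1 hx2
      have h4 : x / (1 + a + b) * (1 - x / (1 + a + b)) = x * (1 + a + b - x) /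
          (1 + a + b) ^ 2 := by field_simp
      rw [h4, div_div, div_le_div_iff₀ (by positivity) (by positivity)]
      have : (1 + a + b) ^ 2 ≤ 9 * (1 + a + b - x) := by nlinarith
      calc x * ((1 + a + b) ^ 2 * M ^ 2) ≤ x * (9 * (1 + a + b - x) * M ^ 2) := by gcongr
        _ = _ := by ring
    have h4 := (h3 a ha ha1 (by linarith)).trans hM1
    have h5 := (h3 b hb hb1 (by linarith)).trans hM2
    rw [norm_neg, norm_real, norm_real, norm_eq_abs, norm_eq_abs, sq_abs, sq_abs, le_div_iff₀ h2]
    have h6 : 0 < a / (9 * M ^ 2) := by positivity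
    have h7 : 0 < b / (9 * M ^ 2) := by positivity
    calc 1 / (324 * M ^ 4) * (a * b) * ‖1 - conj (s1 : ℂ) * (-s2)‖ ^ 2
        ≤ 1 / (324 * M ^ 4) * (a * b) * 2 ^ 2 := by gcongr
      _ = a / (9 * M ^ 2) * (b / (9 * M ^ 2)) := by field_simp; norm_num
      _ ≤ _ := by gcongr; linarith
  · have key := (sq_im_log_lt hΛ0 (mem_ball_zero_iff.1 (hmm hζ)) hk).2.2
    set W := Complex.log ((1 + k * m ζ) / (1 - k * m ζ)) with hW
    have e1 : f (m ζ) = ((-a + (1 + a + b) / 2 : ℝ) : ℂ) + (((1 + a + b) / (2 * Λ) : ℝ) : ℂ) * W := by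
      simp only [hf]; push_cast; ring
    have e2 : (f (m ζ)).re = -a + (1 + a + b) / 2 + (1 + a + b) / (2 * Λ) * W.re := by
      rw [e1, add_re, re_ofReal_mul, ofReal_re]
    have e3 : (f (m ζ)).im = (1 + a + b) / (2 * Λ) * W.im := by
      rw [e1, add_im, Complex.im_ofReal_mul, ofReal_im, zero_add]
    have e4 : ε = 8 / Λ := by rw [hΛ]; field_simp
    have key2 : ∀ X, W.im ^ 2 < 5 * X → ((1 + a + b) / (2 * Λ) * W.im) ^ 2 <
        ε * ((1 + a + b) / (2 * Λ) * X) := by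
      intro X hX
      have hX0 : 0 < X := by nlinarith [sq_nonneg W.im]
      calc ((1 + a + b) / (2 * Λ) * W.im) ^ 2 = (1 + a + b) ^ 2 / (4 * Λ ^ 2) * W.im ^ 2 := by ring
        _ < (1 + a + b) ^ 2 / (4 * Λ ^ 2) * (5 * X) := by gcongr
        _ = (1 + a + b) * (5 * (1 + a + b) * X / (4 * Λ ^ 2)) := by ring
        _ ≤ (1 + a + b) * (16 * X / (4 * Λ ^ 2)) := by gcongr; linarith
        _ = _ := by rw [e4]; field_simp; norm_num
    rw [e2, e3]
    constructor
    · convert key2 _ key.2 using 2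
      field_simp; ring
    · convert key2 _ key.1 using 2
      field_simp; ring

/-- An elementary inequality: near the origin of the half plane `x > -θ u`, the quadratic term is
dominated by the linear ones. -/
lemma exists_linear_dominates {B s S : ℝ} (hC : 0 < C) (hB : 0 < B) (hm : 0 < m) (hs : 0 < s)
    (hS : 0 < S) : ∃ r θ ε : ℝ, 0 < r ∧ r ≤ 1 / 4 ∧ 0 < θ ∧ θ * S ≤ r / 2 ∧ 0 < ε ∧
      ∀ u n x y : ℝ, 0 ≤ u → 0 ≤ n → n ≤ B → (m ≤ n ∨ s ≤ u) → x ^ 2 + y ^ 2 ≤ r ^ 2 →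
        -(θ * u) < x → y ^ 2 < ε * (x + θ * u) → -u - n * x + C * (x ^ 2 + y ^ 2) < 0 := by
  obtain ⟨r, hr0, hr1, hr2, hr3⟩ : ∃ r : ℝ, 0 < r ∧ r ≤ 1 / 4 ∧ C * r ≤ m / 4 ∧ C * r < s := by
    refine ⟨min (1 / 4) (min (m / (4 * C)) (s / (2 * C))), by positivity, min_le_left _ _, ?_, ?_⟩
    · calc _ ≤ C * (m / (4 * C)) :=
            mul_le_mul_of_nonneg_left ((min_le_right _ _).trans (min_le_left _ _)) hC.le
        _ = m / 4 := by field_simp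
    · calc _ ≤ C * (s / (2 * C)) :=
            mul_le_mul_of_nonneg_left ((min_le_right _ _).trans (min_le_right _ _)) hC.le
        _ = s / 2 := by field_simp
        _ < s := by linarith
  obtain ⟨ε, hε0, hε1, hε2⟩ : ∃ ε : ℝ, 0 < ε ∧ ε ≤ 1 ∧ C * ε ≤ m / 4 := by
    refine ⟨min 1 (m / (4 * C)), by positivity, min_le_left _ _, ?_⟩
    calc _ ≤ C * (m / (4 * C)) := mul_le_mul_of_nonneg_left (min_le_right _ _) hC.le
      _ = m / 4 := by field_simp
  obtain ⟨θ, hθ0, hθ1, hθ2⟩ : ∃ θ : ℝ, 0 < θ ∧ θ * S ≤ r / 2 ∧ θ * (B + 2 * C) ≤ 1 / 2 := by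
    refine ⟨min (r / (2 * S)) (1 / (2 * (B + 2 * C))), by positivity, ?_, ?_⟩
    · calc _ ≤ r / (2 * S) * S := mul_le_mul_of_nonneg_right (min_le_left _ _) hS.le
        _ = r / 2 := by field_simp
    · calc _ ≤ 1 / (2 * (B + 2 * C)) * (B + 2 * C) :=
            mul_le_mul_of_nonneg_right (min_le_right _ _) (by positivity)
        _ = 1 / 2 := by field_simp
  refine ⟨r, θ, ε, hr0, hr1, hθ0, hθ1, hε0, fun u n x y hu hn hnB hor hxy hx hy => ?_⟩
  have hxr : x ^ 2 ≤ r * |x| := by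
    rw [← sq_abs, sq]
    exact mul_le_mul_of_nonneg_right (abs_le_of_sq_le_sq (by nlinarith [sq_nonneg y]) hr0.le)
      (abs_nonneg x)
  have hθu : 0 ≤ θ * u := by positivity
  have hBθ : 0 ≤ θ * B := by positivity
  have hCθ : 0 ≤ θ * C := by positivity
  rcases le_or_gt 0 x with h0 | h0
  · rw [abs_of_nonneg h0] at hxr
    rcases hor with h | h
    · have h1 : C * (x ^ 2 + y ^ 2) ≤ C * r * x + (C * ε) * x + (θ * C) * ε * u := by nlinarith
      have h2 : C * r * x ≤ m / 4 * x := mul_le_mul_of_nonneg_right hr2 h0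
      have h3 : C * ε * x ≤ m / 4 * x := mul_le_mul_of_nonneg_right hε2 h0
      have h4 : (θ * C) * ε * u ≤ 1 / 4 * 1 * u := by
        gcongr; nlinarith
      have h5 : m * x ≤ n * x := mul_le_mul_of_nonneg_right h h0
      rcases hu.eq_or_lt with rfl | hu'
      · have : 0 < m * x := mul_pos hm (by simpa using hx)
        nlinarith
      · have : 0 ≤ m * x := mul_nonneg hm.le h0
        nlinarith
    · have h1 : C * (x ^ 2 + y ^ 2) ≤ C * r :=
        mul_le_mul_of_nonneg_left (hxy.trans (by nlinarith)) hC.le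
      have : 0 ≤ n * x := mul_nonneg hn h0
      linarith
  · rw [abs_of_neg h0] at hxr
    have hu' : 0 < u := by
      by_contra! h
      obtain rfl : u = 0 := le_antisymm h hu
      simp only [mul_zero, neg_zero] at hx
      linarith
    have h1 : x ^ 2 + y ^ 2 ≤ 2 * (θ * u) := by nlinarith
    have h2 : C * (x ^ 2 + y ^ 2) ≤ C * (2 * (θ * u)) := mul_le_mul_of_nonneg_left h1 hC.le
    have h3 : n * -x ≤ B * (θ * u) := mul_le_mul hnB (by linarith) (by linarith) hB.le
    have h4 := mul_le_mul_of_nonneg_right hθ2 hu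
    nlinarith

/-- The complex inner normal direction of the sublevel sets of `ρ`. -/
def normalVec (ρ : E N → ℝ) (p : E N) : E N := -(InnerProductSpace.toDual ℂ (E N)).symm (cgrad ρ p)

lemma cgrad_normalVec (ρ : E N → ℝ) (p : E N) :
    cgrad ρ p (normalVec ρ p) = -((‖normalVec ρ p‖ ^ 2 : ℝ) : ℂ) := by
  rw [normalVec, map_neg, norm_neg, ← InnerProductSpace.toDual_symm_apply]
  exact congrArg Neg.neg ((inner_self_eq_norm_sq_to_K _).trans (by norm_cast))

lemma norm_fderiv_le_norm_normalVec (ρ : E N → ℝ) (p : E N) : ‖fderiv ℝ ρ p‖ ≤ ‖normalVec ρ p‖ := by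
  rw [normalVec, norm_neg, LinearIsometryEquiv.norm_map]
  refine ContinuousLinearMap.opNorm_le_bound _ (norm_nonneg _) fun v => ?_
  rw [← cgrad_re]
  exact (abs_re_le_norm _).trans ((cgrad ρ p).le_opNorm v)

lemma HasC2Bound.norm_normalVec_le (hL : HasC2Bound ρ L) (p : E N) : ‖normalVec ρ p‖ ≤ L := by
  rw [normalVec, norm_neg, LinearIsometryEquiv.norm_map]
  exact ContinuousLinearMap.opNorm_le_bound _ (by linarith [hL.one_le]) (hL.norm_cgrad_le p)

lemma HasC2Bound.norm_normalVec_sub_le (hL : HasC2Bound ρ L) (p q : E N) :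
    ‖normalVec ρ p - normalVec ρ q‖ ≤ L * ‖p - q‖ := by
  have hL1 := hL.one_le
  rw [normalVec, normalVec, ← neg_sub', norm_neg, ← map_sub, LinearIsometryEquiv.norm_map]
  exact ContinuousLinearMap.opNorm_le_bound _ (by positivity) fun v =>
    (norm_cgrad_sub_apply_le ρ p q v).trans
      (mul_le_mul_of_nonneg_right (hL.fderiv_sub_le p q) (norm_nonneg _))

/-- A curve which joins `z` to `w` and is transversal to the boundary at both ends; `b` is a
free parameter. -/
def joinCurve (ρ : E N → ℝ) (l : ℝ) (z w b : E N) (ζ : ℂ) : E N :=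
  z + (3 * ζ ^ 2 - 2 * ζ ^ 3) • (w - z) + (l * (ζ * (1 - ζ) ^ 2)) • normalVec ρ z +
    (l * (ζ ^ 2 * (1 - ζ))) • normalVec ρ w + (ζ ^ 2 * (1 - ζ) ^ 2) • b

lemma joinCurve_swap (ρ : E N → ℝ) (l : ℝ) (z w b : E N) (ζ : ℂ) :
    joinCurve ρ l z w b (1 - ζ) = joinCurve ρ l w z b ζ := by
  simp only [joinCurve]; module

lemma norm_add_four_sq_le (a b c d : E N) :
    ‖a + b + c + d‖ ^ 2 ≤ 4 * (‖a‖ ^ 2 + ‖b‖ ^ 2 + ‖c‖ ^ 2 + ‖d‖ ^ 2) := by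
  have := norm_add_sq_le_two (a + b) (c + d)
  rw [← add_assoc] at this
  linarith [norm_add_sq_le_two a b, norm_add_sq_le_two c d]

set_option maxHeartbeats 1000000 in
lemma HasC2Bound.joinCurve_le (hL : HasC2Bound ρ L) {l : ℝ} (hM : 0 ≤ M) (hl : 0 < l)
    (hl1 : l ≤ 1) {b : E N} (hG : ‖cgrad ρ z (w - z)‖ ≤ M * l) (hd : ‖w - z‖ ^ 2 ≤ M * l)
    (hb : ‖b‖ ≤ M * l) (hζ : ‖ζ‖ ≤ 1) :
    ρ (joinCurve ρ l z w b ζ) ≤ ρ z + l * (-(‖normalVec ρ z‖ ^ 2 * ζ.re) +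
      (5 * M + 5 * L ^ 2 + 4 * L * M + L * (4 * (25 * M + 20 * L ^ 2 + 16 * M ^ 2))) *
        ‖ζ‖ ^ 2) := by
  have hL1 := hL.one_le
  have hL0 : 0 ≤ L := by linarith
  have hnz := hL.norm_normalVec_le z
  have hnw := hL.norm_normalVec_le w
  have hn : ‖(l : ℂ)‖ = l := by rw [norm_real, norm_of_nonneg hl.le]
  have h1 : ‖1 - ζ‖ ≤ 2 := (norm_sub_le _ _).trans (by rw [norm_one]; linarith)
  have h2 : ‖3 - 2 * ζ‖ ≤ 5 := (norm_sub_le _ _).trans (by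
    rw [norm_mul, norm_ofNat, norm_ofNat]; linarith)
  have h3 : ‖ζ - 2‖ ≤ 3 := (norm_sub_le _ _).trans (by rw [norm_ofNat]; linarith)
  have hζ2 : ‖ζ‖ ^ 2 ≤ 1 := pow_le_one₀ (norm_nonneg _) hζ
  set n := normalVec ρ z with hnn
  set n' := normalVec ρ w
  set v1 := (3 * ζ ^ 2 - 2 * ζ ^ 3) • (w - z) with hv1
  set v2 := (l * (ζ * (1 - ζ) ^ 2)) • n with hv2
  set v3 := (l * (ζ ^ 2 * (1 - ζ))) • n' with hv3
  set v4 := (ζ ^ 2 * (1 - ζ) ^ 2) • b with hv4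
  have e : joinCurve ρ l z w b ζ - z = v1 + v2 + v3 + v4 := by simp only [joinCurve]; abel
  have n1 : ‖v1‖ ≤ 5 * ‖ζ‖ ^ 2 * ‖w - z‖ := by
    rw [hv1, norm_smul, show 3 * ζ ^ 2 - 2 * ζ ^ 3 = (3 - 2 * ζ) * ζ ^ 2 by ring, norm_mul,
      norm_pow]
    gcongr
  have n2 : ‖v2‖ ≤ l * (‖ζ‖ * 2 ^ 2) * L := by
    rw [hv2, norm_smul, norm_mul, norm_mul, norm_pow, hn]; gcongr
  have n3 : ‖v3‖ ≤ l * (‖ζ‖ ^ 2 * 2) * L := by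
    rw [hv3, norm_smul, norm_mul, norm_mul, norm_pow, hn]; gcongr
  have n4 : ‖v4‖ ≤ ‖ζ‖ ^ 2 * 2 ^ 2 * (M * l) := by
    rw [hv4, norm_smul, norm_mul, norm_pow, norm_pow]; gcongr
  have hsq : ‖v1 + v2 + v3 + v4‖ ^ 2 ≤ l * (4 * (25 * M + 20 * L ^ 2 + 16 * M ^ 2)) * ‖ζ‖ ^ 2 := by
    have hζ4 : (‖ζ‖ ^ 2) ^ 2 ≤ ‖ζ‖ ^ 2 := by nlinarith [sq_nonneg ‖ζ‖]
    have hll : l ^ 2 ≤ l := by nlinarith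
    have s1 : ‖v1‖ ^ 2 ≤ 25 * ‖ζ‖ ^ 2 * (M * l) := by
      calc _ ≤ (5 * ‖ζ‖ ^ 2 * ‖w - z‖) ^ 2 := by gcongr
        _ = 25 * (‖ζ‖ ^ 2) ^ 2 * ‖w - z‖ ^ 2 := by ring
        _ ≤ _ := by gcongr
    have s2 : ‖v2‖ ^ 2 ≤ l * ‖ζ‖ ^ 2 * (16 * L ^ 2) := by
      calc _ ≤ (l * (‖ζ‖ * 2 ^ 2) * L) ^ 2 := by gcongr
        _ = l ^ 2 * ‖ζ‖ ^ 2 * (16 * L ^ 2) := by ring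
        _ ≤ _ := by gcongr
    have s3 : ‖v3‖ ^ 2 ≤ l * ‖ζ‖ ^ 2 * (4 * L ^ 2) := by
      calc _ ≤ (l * (‖ζ‖ ^ 2 * 2) * L) ^ 2 := by gcongr
        _ = l ^ 2 * (‖ζ‖ ^ 2) ^ 2 * (4 * L ^ 2) := by ring
        _ ≤ _ := by gcongr
    have s4 : ‖v4‖ ^ 2 ≤ ‖ζ‖ ^ 2 * l * (16 * M ^ 2) := by
      calc _ ≤ (‖ζ‖ ^ 2 * 2 ^ 2 * (M * l)) ^ 2 := by gcongr
        _ = (‖ζ‖ ^ 2) ^ 2 * l ^ 2 * (16 * M ^ 2) := by ring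
        _ ≤ _ := by gcongr
    linarith [norm_add_four_sq_le v1 v2 v3 v4]
  have hre : (cgrad ρ z (v1 + v2 + v3 + v4)).re ≤ -(l * (‖n‖ ^ 2 * ζ.re)) +
      l * ((5 * M + 5 * L ^ 2 + 4 * L * M) * ‖ζ‖ ^ 2) := by
    have e2 : cgrad ρ z v2 = -((l * ‖n‖ ^ 2 : ℝ) : ℂ) * ζ -
        ((l * ‖n‖ ^ 2 : ℝ) : ℂ) * (ζ ^ 2 * (ζ - 2)) := by
      rw [hv2, map_smul, hnn, cgrad_normalVec, smul_eq_mul]; push_cast; ring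
    have t1 : ‖cgrad ρ z v1‖ ≤ 5 * ‖ζ‖ ^ 2 * (M * l) := by
      rw [hv1, map_smul, norm_smul, show 3 * ζ ^ 2 - 2 * ζ ^ 3 = (3 - 2 * ζ) * ζ ^ 2 by ring,
        norm_mul, norm_pow]
      gcongr
    have t2 : ‖((l * ‖n‖ ^ 2 : ℝ) : ℂ) * (ζ ^ 2 * (ζ - 2))‖ ≤ l * L ^ 2 * (‖ζ‖ ^ 2 * 3) := by
      rw [norm_mul, norm_mul, norm_pow, norm_real, norm_of_nonneg (by positivity)]
      gcongr
    have t3 : ‖cgrad ρ z v3‖ ≤ L * (l * (‖ζ‖ ^ 2 * 2) * L) :=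
      (hL.norm_cgrad_le z _).trans (by gcongr)
    have t4 : ‖cgrad ρ z v4‖ ≤ L * (‖ζ‖ ^ 2 * 2 ^ 2 * (M * l)) :=
      (hL.norm_cgrad_le z _).trans (by gcongr)
    have e3 : (-((l * ‖n‖ ^ 2 : ℝ) : ℂ) * ζ).re = -(l * (‖n‖ ^ 2 * ζ.re)) := by
      rw [← Complex.ofReal_neg, re_ofReal_mul]; ring
    rw [map_add, map_add, map_add, e2, add_re, add_re, add_re, sub_re, e3]
    linarith [re_le_norm (cgrad ρ z v1), re_le_norm (cgrad ρ z v3), re_le_norm (cgrad ρ z v4),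
      (abs_le.1 (abs_re_le_norm (((l * ‖n‖ ^ 2 : ℝ) : ℂ) * (ζ ^ 2 * (ζ - 2))))).1]
  have ht := (abs_le.1 (hL.taylor z (joinCurve ρ l z w b ζ))).2
  rw [e, ← cgrad_re] at ht
  have := mul_le_mul_of_nonneg_left hsq hL0
  linarith

/-- Near its starting point, the curve `joinCurve` maps a parabolic region into the domain. -/
lemma DefFun.exists_joinCurve_mem (h : DefFun Ω ρ r0 c0)
    (hL : HasC2Bound ρ L) {S : ℝ} (hM : 0 ≤ M) (hS : 0 < S) :
    ∃ r θ ε : ℝ, 0 < r ∧ r ≤ 1 / 4 ∧ 0 < θ ∧ θ * S ≤ r / 2 ∧ 0 < ε ∧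
      ∀ l : ℝ, 0 < l → l ≤ 1 → ∀ z ∈ closure Ω, ∀ w b : E N, ‖cgrad ρ z (w - z)‖ ≤ M * l →
        ‖w - z‖ ^ 2 ≤ M * l → ‖b‖ ≤ M * l → ∀ ζ : ℂ, ‖ζ‖ ≤ r → -(θ * (-ρ z / l)) < ζ.re →
        ζ.im ^ 2 < ε * (ζ.re + θ * (-ρ z / l)) → joinCurve ρ l z w b ζ ∈ Ω := by
  have hL1 := hL.one_le
  obtain ⟨a, ha, hab⟩ := h.exists_bdist_le
  obtain ⟨r, θ, ε, hr, hr1, hθ, hθS, hε, H⟩ := exists_linear_dominates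
    (C := 5 * M + 5 * L ^ 2 + 4 * L * M + L * (4 * (25 * M + 20 * L ^ 2 + 16 * M ^ 2)))
    (B := L ^ 2) (by positivity) (by positivity) (pow_pos h.c₀_pos 2) (mul_pos ha h.r₀_pos) hS
  refine ⟨r, θ, ε, hr, hr1, hθ, hθS, hε, fun l hl hl1 z hz w b hG hd hb ζ hζ hre him => ?_⟩
  have hσ : 0 ≤ -ρ z := by linarith [h.nonpos_of_mem_closure hz]
  have hor : c0 ^ 2 ≤ ‖normalVec ρ z‖ ^ 2 ∨ a * r0 ≤ -ρ z / l := by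
    rcases le_or_gt (infDist z (frontier Ω)) r0 with hd | hd
    · exact .inl (pow_le_pow_left₀ h.c₀_pos.le
        ((h.grad_le z hd).trans (norm_fderiv_le_norm_normalVec ρ z)) 2)
    · right
      have hzΩ : z ∈ Ω := by
        by_contra hzn
        have : z ∈ frontier Ω := by rw [h.isOpen.frontier_eq]; exact ⟨hz, hzn⟩
        rw [infDist_zero_of_mem this] at hd
        linarith [h.r₀_pos]
      calc a * r0 ≤ a * bdist Ω z := mul_le_mul_of_nonneg_left hd.le ha.le
        _ ≤ -ρ z := hab z hzΩ
        _ ≤ -ρ z / l := by rw [le_div_iff₀ hl]; nlinarith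
  have hnsq : ‖ζ‖ ^ 2 = ζ.re ^ 2 + ζ.im ^ 2 := by
    rw [sq_norm, normSq_apply]; ring
  have key := H (-ρ z / l) (‖normalVec ρ z‖ ^ 2) ζ.re ζ.im (by positivity) (by positivity)
    (by gcongr; exact hL.norm_normalVec_le z) hor (by rw [← hnsq]; gcongr) hre him
  rw [h.mem_iff]
  have hj := hL.joinCurve_le hM hl hl1 hG hd hb (hζ.trans (by linarith))
  rw [hnsq] at hj
  have : l * (-ρ z / l) = -ρ z := by field_simp
  nlinarith [mul_neg_of_pos_of_neg hl key]

/-- There is an analytic disc in `Ω` through `z` and `w` with hyperbolic distance of the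
parameters controlled by `q`. -/
def HasDisc (Ω : Set (E N)) (z w : E N) (q : ℝ) : Prop :=
  ∃ φ : ℂ → E N, DifferentiableOn ℂ φ (ball 0 1) ∧ MapsTo φ (ball (0 : ℂ) 1) Ω ∧ φ 0 = z ∧
    ∃ a ∈ ball (0 : ℂ) 1, φ a = w ∧ q ≤ 1 - ‖a‖ ^ 2

lemma HasDisc.mono {q q' : ℝ} (h : HasDisc Ω z w q) (hq : q' ≤ q) : HasDisc Ω z w q' := by
  obtain ⟨φ, h1, h2, h3, a, ha, h4, h5⟩ := h
  exact ⟨φ, h1, h2, h3, a, ha, h4, hq.trans h5⟩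

lemma DefFun.exists_hasDisc_of_joinCurve (h : DefFun Ω ρ r0 c0) (hL : HasC2Bound ρ L) {S : ℝ}
    (hM : 0 ≤ M) (hS : 0 < S) : ∃ r : ℝ, 0 < r ∧ r ≤ 1 / 4 ∧ ∀ ε1 : ℝ, 0 < ε1 → ∃ c : ℝ, 0 < c ∧
      ∀ l : ℝ, 0 < l → l ≤ 1 → ∀ z ∈ Ω, ∀ w ∈ Ω, ∀ b : ℂ → E N, Differentiable ℂ b →
        ‖cgrad ρ z (w - z)‖ ≤ M * l → ‖cgrad ρ w (z - w)‖ ≤ M * l → ‖w - z‖ ^ 2 ≤ M * l →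
        (∀ ζ, ‖ζ‖ ≤ 2 → ‖b ζ‖ ≤ M * l) → -ρ z ≤ S * l → -ρ w ≤ S * l →
        (∀ ζ : ℂ, r / 2 ≤ ζ.re → ζ.re ≤ 1 - r / 2 → |ζ.im| ≤ ε1 → joinCurve ρ l z w (b ζ) ζ ∈ Ω) →
        HasDisc Ω z w (c * (-ρ z * -ρ w / l ^ 2)) := by
  obtain ⟨r, θ, ε, hr, hr1, hθ, hθS, hε, H⟩ := h.exists_joinCurve_mem hL hM hS
  refine ⟨r, hr, hr1, fun ε1 hε1 => ?_⟩
  obtain ⟨ε', hε', hε'1, hε'2, hε'3⟩ : ∃ ε' : ℝ, 0 < ε' ∧ ε' ≤ ε ∧ 2 * ε' ≤ ε1 ^ 2 ∧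
      4 * ε' ≤ 3 * r ^ 2 := by
    refine ⟨min ε (min (ε1 ^ 2 / 2) (3 * r ^ 2 / 4)), by positivity, min_le_left _ _, ?_, ?_⟩
    · linarith [(min_le_right ε _).trans (min_le_left (ε1 ^ 2 / 2) (3 * r ^ 2 / 4))]
    · linarith [(min_le_right ε _).trans (min_le_right (ε1 ^ 2 / 2) (3 * r ^ 2 / 4))]
  obtain ⟨c, hc, hψ⟩ := exists_parabolic_disc hε'
  refine ⟨c * θ ^ 2, by positivity, fun l hl hl1 z hz w hw b hb hGz hGw hd hbM hzS hwS hmid => ?_⟩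
  have hbd : ∀ z ∈ Ω, -ρ z ≤ S * l → 0 < θ * (-ρ z / l) ∧ θ * (-ρ z / l) ≤ r / 2 := by
    intro z hz hzS
    have : 0 < -ρ z := by linarith [(h.mem_iff z).1 hz]
    refine ⟨by positivity, le_trans ?_ hθS⟩
    gcongr
    rwa [div_le_iff₀ hl]
  obtain ⟨hu1, hu1'⟩ := hbd z hz hzS
  obtain ⟨hu2, hu2'⟩ := hbd w hw hwS
  set u1 := θ * (-ρ z / l) with hu₁e
  set u2 := θ * (-ρ w / l) with hu₂e
  obtain ⟨ψ, hψd, hψ0, ⟨t, ht, hψt, htc⟩, hψr⟩ := hψ u1 u2 hu1 (by linarith) hu2 (by linarith)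
  refine ⟨fun ζ => joinCurve ρ l z w (b (ψ ζ)) (ψ ζ), ?_, fun ζ hζ => ?_, ?_, t, ht, ?_, ?_⟩
  · have : Differentiable ℂ fun ζ => joinCurve ρ l z w (b ζ) ζ := by
      simp only [joinCurve]; fun_prop
    exact this.comp_differentiableOn hψd
  · obtain ⟨i1, i2⟩ := hψr ζ hζ
    change joinCurve ρ l z w (b (ψ ζ)) (ψ ζ) ∈ Ω
    generalize ψ ζ = X at i1 i2 ⊢
    have near : ∀ (Y : ℂ) (u : ℝ), Y.im ^ 2 < ε' * (Y.re + u) → u ≤ r / 2 → Y.re < r / 2 →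
        ‖Y‖ ≤ r ∧ -u < Y.re ∧ Y.im ^ 2 < ε * (Y.re + u) := by
      intro Y u hY hu hYr
      have h0 : 0 < Y.re + u := pos_of_mul_pos_right ((sq_nonneg _).trans_lt hY) hε'.le
      refine ⟨?_, by linarith, hY.trans_le (by gcongr)⟩
      refine le_of_sq_le_sq ?_ hr.le
      rw [sq_norm, normSq_apply]
      have h1 : ε' * (Y.re + u) ≤ ε' * 1 := by gcongr; linarith
      nlinarith
    have hp1 : 0 < X.re + u1 := pos_of_mul_pos_right ((sq_nonneg _).trans_lt i1) hε'.le
    have hp2 : 0 < 1 + u2 - X.re := pos_of_mul_pos_right ((sq_nonneg _).trans_lt i2) hε'.le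
    have him : X.im ^ 2 < 2 * ε' := by nlinarith
    have hX2 : ‖X‖ ≤ 2 := by
      refine le_of_sq_le_sq ?_ zero_le_two
      rw [sq_norm, normSq_apply]
      nlinarith
    rcases lt_or_ge X.re (r / 2) with hX | hX
    · obtain ⟨k1, k2, k3⟩ := near X u1 i1 hu1' hX
      exact H l hl hl1 z (subset_closure hz) w _ hGz hd (hbM X hX2) X k1 k2 k3
    rcases lt_or_ge (1 - r / 2) X.re with hX' | hX'
    · have e : (1 - X).re = 1 - X.re := by simp
      have e' : (1 - X).im = -X.im := by simp
      obtain ⟨k1, k2, k3⟩ := near (1 - X) u2 (by rw [e, e', neg_sq]; linarith) hu2'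
        (by rw [e]; linarith)
      have := H l hl hl1 w (subset_closure hw) z _ hGw (by rwa [norm_sub_rev]) (hbM X hX2)
        (1 - X) k1 k2 k3
      rwa [joinCurve_swap] at this
    · exact hmid X hX hX' (abs_le_of_sq_le_sq (by linarith) hε1.le)
  · simp [hψ0, joinCurve]
  · simp [hψt, joinCurve]; norm_num
  · refine le_trans (le_of_eq ?_) htc
    rw [hu₁e, hu₂e]; field_simp

/-- Nearby points are joined by affine discs. -/
lemma DefFun.exists_affine_disc (h : DefFun Ω ρ r0 c0) (hL : HasC2Bound ρ L)
    (hz : z ∈ Ω) (hw : w ∈ Ω) (hA : aquant ρ z w ≤ 1 / (16 * L)) :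
    ∃ φ : ℂ → E N, DifferentiableOn ℂ φ (ball 0 1) ∧ MapsTo φ (ball (0 : ℂ) 1) Ω ∧ φ 0 = z ∧
      ∃ a ∈ ball (0 : ℂ) 1, φ a = w ∧ ‖a‖ ≤ 8 * L * aquant ρ z w ∧ ‖a‖ ≤ 1 / 2 := by
  have hL1 := hL.one_le
  have hσz : 0 < -ρ z := by linarith [(h.mem_iff z).1 hz]
  have hσw : 0 < -ρ w := by linarith [(h.mem_iff w).1 hw]
  set A := aquant ρ z w with hAe
  have hA0 : 0 ≤ A := aquant_nonneg ρ z w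
  have hp := sqrt_pos.2 hσz
  have hq := sqrt_pos.2 hσw
  have hH : hquant ρ z w = A * (√(-ρ z) * √(-ρ w)) := by
    rw [hAe, aquant, div_mul_cancel₀ _ (by positivity)]
  have hp2 := sq_sqrt hσz.le
  have hq2 := sq_sqrt hσw.le
  have hab := (abs_le.1 (hL.abs_sub_le_hquant z w)).1
  have hGH : ‖cgrad ρ z (z - w)‖ ≤ hquant ρ z w := by
    rw [hquant]; nlinarith [sq_nonneg ‖z - w‖, mul_nonneg (norm_nonneg (z - w)) hp.le]
  have hdH : ‖z - w‖ * √(-ρ z) ≤ hquant ρ z w := by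
    rw [hquant]; nlinarith [sq_nonneg ‖z - w‖, norm_nonneg (cgrad ρ z (z - w))]
  rw [hH] at hab hGH hdH
  set p := √(-ρ z)
  set q := √(-ρ w)
  have hLA : 16 * (L * A) ≤ 1 := by
    rw [le_div_iff₀ (by positivity)] at hA; linarith
  have hd : ‖z - w‖ ≤ A * q := le_of_mul_le_mul_right (by linarith) hp
  have hpq : 0 < p * q := mul_pos hp hq
  have hqp : q ≤ 2 * p := by
    by_contra! hc
    have : L * (A * (p * q)) ≤ p * q := by nlinarith
    nlinarith
  rcases hA0.eq_or_lt with hA0 | hApos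
  · have : z = w := by
      rw [← hA0, zero_mul] at hd
      exact sub_eq_zero.1 (norm_le_zero_iff.1 hd)
    exact ⟨fun _ => z, differentiableOn_const _, fun _ _ => hz, rfl, 0, by simp, this,
      by rw [norm_zero, ← hA0, mul_zero], by simp⟩
  have hnt : ‖((8 * L * A : ℝ) : ℂ)‖ = 8 * L * A := by
    rw [norm_real, norm_of_nonneg (by positivity)]
  have ht0 : ((8 * L * A : ℝ) : ℂ) ≠ 0 := by rw [← norm_ne_zero_iff, hnt]; positivity
  set t : ℂ := ((8 * L * A : ℝ) : ℂ)
  refine ⟨fun ζ => z + (ζ / t) • (w - z), by fun_prop, fun ζ hζ => ?_, by simp, t,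
    by rw [mem_ball_zero_iff, hnt]; linarith, by simp [ht0], hnt.le, by rw [hnt]; linarith⟩
  have hζ1 : ‖ζ‖ ≤ 1 := (mem_ball_zero_iff.1 hζ).le
  have hζt : ‖ζ / t‖ ≤ 1 / (8 * L * A) := by rw [norm_div, hnt]; gcongr
  have hv1 : ‖cgrad ρ z ((ζ / t) • (w - z))‖ ≤ p * q / (8 * L) := by
    rw [map_smul, norm_smul, norm_cgrad_sub_comm]
    calc _ ≤ 1 / (8 * L * A) * (A * (p * q)) := by gcongr
      _ = _ := by field_simp
  have hv2 : ‖(ζ / t) • (w - z)‖ ≤ q / (8 * L) := by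
    rw [norm_smul, norm_sub_rev]
    calc _ ≤ 1 / (8 * L * A) * (A * q) := by gcongr
      _ = _ := by field_simp
  have hv2' : L * ‖(ζ / t) • (w - z)‖ ^ 2 ≤ q ^ 2 / 64 := by
    calc _ ≤ L * (q / (8 * L)) ^ 2 := by gcongr
      _ = q ^ 2 / 64 / L := by field_simp; norm_num
      _ ≤ _ := div_le_self (by positivity) hL1
  have hv1' : p * q / (8 * L) ≤ p * q / 8 := by gcongr; linarith
  have ht := (abs_le.1 (hL.taylor z (z + (ζ / t) • (w - z)))).2
  rw [add_sub_cancel_left, ← cgrad_re] at ht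
  have := re_le_norm (cgrad ρ z ((ζ / t) • (w - z)))
  exact (h.mem_iff _).2 (by nlinarith)

lemma HasC2Bound.joinCurve_middle_le (hL : HasC2Bound ρ L) {l H : ℝ} (hl : 0 < l) (hH : 0 ≤ H)
     (hG : ‖cgrad ρ z (w - z)‖ ≤ H) (hd : ‖w - z‖ ^ 2 ≤ H) (hζ : ‖ζ‖ ≤ 2) :
    ρ (joinCurve ρ l z w 0 ζ) ≤ ρ z + (28 * H - l * (‖normalVec ρ z‖ ^ 2 * (ζ * (1 - ζ)).re) +
      12 * l * L ^ 2 * √H + L * (1568 * H + 1800 * l ^ 2 * L ^ 2)) := by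
  have hL1 := hL.one_le
  have hL0 : 0 ≤ L := by linarith
  have hn : ‖(l : ℂ)‖ = l := by rw [norm_real, norm_of_nonneg hl.le]
  have hnz := hL.norm_normalVec_le z
  have hnw := hL.norm_normalVec_le w
  have h1 : ‖1 - ζ‖ ≤ 3 := (norm_sub_le _ _).trans (by rw [norm_one]; linarith)
  have hp : ‖3 * ζ ^ 2 - 2 * ζ ^ 3‖ ≤ 28 := by
    refine (norm_sub_le _ _).trans ?_
    rw [norm_mul, norm_mul, norm_pow, norm_pow, norm_ofNat, norm_ofNat]
    have h2 : ‖ζ‖ ^ 2 ≤ 2 ^ 2 := by gcongr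
    have h3 : ‖ζ‖ ^ 3 ≤ 2 ^ 3 := by gcongr
    linarith
  have hds : ‖w - z‖ ≤ √H := Real.le_sqrt_of_sq_le hd
  have hdn := (hL.norm_normalVec_sub_le w z).trans (mul_le_mul_of_nonneg_left hds hL0)
  set n := normalVec ρ z with hnn
  set n' := normalVec ρ w
  set P := 3 * ζ ^ 2 - 2 * ζ ^ 3
  have e : joinCurve ρ l z w 0 ζ - z = P • (w - z) + (l * (ζ * (1 - ζ))) • n +
      (l * (ζ ^ 2 * (1 - ζ))) • (n' - n) := by
    simp only [joinCurve]; module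
  have e' : joinCurve ρ l z w 0 ζ - z = P • (w - z) + ((l * (ζ * (1 - ζ) ^ 2)) • n +
      (l * (ζ ^ 2 * (1 - ζ))) • n') := by
    simp only [joinCurve]; module
  have n2 : ‖(l * (ζ ^ 2 * (1 - ζ)))‖ ≤ l * (2 ^ 2 * 3) := by
    rw [norm_mul, norm_mul, norm_pow, hn]; gcongr
  have n1 : ‖(l * (ζ * (1 - ζ) ^ 2))‖ ≤ l * (2 * 3 ^ 2) := by
    rw [norm_mul, norm_mul, norm_pow, hn]; gcongr
  have hsq : ‖joinCurve ρ l z w 0 ζ - z‖ ^ 2 ≤ 1568 * H + 1800 * l ^ 2 * L ^ 2 := by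
    rw [e']
    refine (norm_add_sq_le_two _ _).trans ?_
    have k1 : ‖P • (w - z)‖ ^ 2 ≤ 28 ^ 2 * H := by rw [norm_smul, mul_pow]; gcongr
    have k2 : ‖(l * (ζ * (1 - ζ) ^ 2)) • n + (l * (ζ ^ 2 * (1 - ζ))) • n'‖ ^ 2 ≤
        (l * (2 * 3 ^ 2) * L + l * (2 ^ 2 * 3) * L) ^ 2 := by
      gcongr
      refine (norm_add_le _ _).trans ?_
      rw [norm_smul, norm_smul]
      gcongr
    linarith
  have hre : (cgrad ρ z (joinCurve ρ l z w 0 ζ - z)).re ≤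
      28 * H - l * (‖n‖ ^ 2 * (ζ * (1 - ζ)).re) + 12 * l * L ^ 2 * √H := by
    have t1 : ‖cgrad ρ z (P • (w - z))‖ ≤ 28 * H := by rw [map_smul, norm_smul]; gcongr
    have t2 : ‖cgrad ρ z ((l * (ζ ^ 2 * (1 - ζ))) • (n' - n))‖ ≤
        L * (l * (2 ^ 2 * 3) * (L * √H)) := by
      refine (hL.norm_cgrad_le z _).trans ?_
      rw [norm_smul]; gcongr
    have e3 : cgrad ρ z ((l * (ζ * (1 - ζ))) • n) = ((-(l * ‖n‖ ^ 2) : ℝ) : ℂ) * (ζ * (1 - ζ)) := by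
      rw [map_smul, hnn, cgrad_normalVec, smul_eq_mul]; push_cast; ring
    rw [e, map_add, map_add, e3, add_re, add_re, re_ofReal_mul]
    linarith [re_le_norm (cgrad ρ z (P • (w - z))),
      re_le_norm (cgrad ρ z ((l * (ζ ^ 2 * (1 - ζ))) • (n' - n)))]
  have ht := (abs_le.1 (hL.taylor z (joinCurve ρ l z w 0 ζ))).2
  rw [← cgrad_re] at ht
  linarith [mul_le_mul_of_nonneg_left hsq hL0]

lemma HasC2Bound.neg_le_hquant (hL : HasC2Bound ρ L) {A0 : ℝ} (hA0 : 0 < A0)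
    (hz : 0 < -ρ z) (hw : 0 < -ρ w) (hA : A0 * (√(-ρ z) * √(-ρ w)) ≤ hquant ρ z w) :
    -ρ z ≤ (1 / A0 + L) * hquant ρ z w ∧ -ρ w ≤ (1 / A0 + L) * hquant ρ z w := by
  have hab := abs_le.1 (hL.abs_sub_le_hquant z w)
  have key : ∀ x : ℝ, A0 * x ≤ hquant ρ z w → x ≤ 1 / A0 * hquant ρ z w := fun x hx => by
    rw [one_div, ← div_eq_inv_mul, le_div_iff₀ hA0]; linarith
  have hm := key _ hA
  have hLH := mul_nonneg (zero_le_one.trans hL.one_le) (hquant_nonneg ρ z w)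
  rw [add_mul]
  rcases le_total (-ρ z) (-ρ w) with hle | hle
  · have := mul_le_mul_of_nonneg_left (sqrt_le_sqrt hle) (sqrt_nonneg (-ρ z))
    rw [mul_self_sqrt hz.le] at this
    constructor <;> linarith
  · have := mul_le_mul_of_nonneg_right (sqrt_le_sqrt hle) (sqrt_nonneg (-ρ w))
    rw [mul_self_sqrt hw.le] at this
    constructor <;> linarith

set_option maxHeartbeats 1000000 in
lemma DefFun.exists_hasDisc_local (h : DefFun Ω ρ r0 c0) (hL : HasC2Bound ρ L) {A0 : ℝ}
    (hA0 : 0 < A0) : ∃ h0 c : ℝ, 0 < h0 ∧ 0 < c ∧ ∀ z ∈ Ω, ∀ w ∈ Ω,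
      A0 * (√(-ρ z) * √(-ρ w)) ≤ hquant ρ z w → hquant ρ z w ≤ h0 →
        HasDisc Ω z w (c * (-ρ z * -ρ w / hquant ρ z w ^ 2)) := by
  have hL1 := hL.one_le
  obtain ⟨a, ha, hab⟩ := h.exists_bdist_le
  have hc0 := h.c₀_pos
  have hS : 0 < 1 / A0 + L := by positivity
  obtain ⟨r, hr, hr1, hdisc⟩ := h.exists_hasDisc_of_joinCurve hL (by positivity : 0 ≤ 4 * L) hS
  obtain ⟨c, hc, hdisc⟩ := hdisc 1 one_pos
  obtain ⟨K, hK1, hK⟩ : ∃ K : ℝ, 1 ≤ K ∧ 2 * (28 + 1568 * L) ≤ K * (c0 ^ 2 * (r / 4)) := by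
    refine ⟨1 + 2 * (28 + 1568 * L) / (c0 ^ 2 * (r / 4)), le_add_of_nonneg_right (by positivity),
      ?_⟩
    rw [add_mul, div_mul_cancel₀ _ (by positivity)]
    exact le_add_of_nonneg_left (by positivity)
  obtain ⟨η, hη0, hη1, hη⟩ : ∃ η : ℝ, 0 < η ∧ η ≤ 1 ∧
      (12 * K * L ^ 2 + 1800 * L ^ 3 * K ^ 2) * η < 28 + 1568 * L := by
    refine ⟨min 1 (1 / (12 * K * L ^ 2 + 1800 * L ^ 3 * K ^ 2)), by positivity, min_le_left _ _, ?_⟩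
    calc _ ≤ (12 * K * L ^ 2 + 1800 * L ^ 3 * K ^ 2) *
          (1 / (12 * K * L ^ 2 + 1800 * L ^ 3 * K ^ 2)) :=
          mul_le_mul_of_nonneg_left (min_le_right _ _) (by positivity)
      _ = 1 := by field_simp
      _ < _ := by linarith
  refine ⟨min (η ^ 2) (min (1 / K) (a * r0 / (1 / A0 + L))), c / K ^ 2, ?_, by positivity,
    fun z hz w hw hA hh => ?_⟩
  · have := h.r₀_pos
    positivity
  have hσz : 0 < -ρ z := by linarith [(h.mem_iff z).1 hz]
  have hσw : 0 < -ρ w := by linarith [(h.mem_iff w).1 hw]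
  have hHpos : 0 < hquant ρ z w := lt_of_lt_of_le (by positivity) hA
  obtain ⟨hzS, hwS⟩ := hL.neg_le_hquant hA0 hσz hσw hA
  have hsw := hL.hquant_swap_le hσz.le (w := w)
  have hGH : ∀ x y, ‖cgrad ρ x (y - x)‖ ≤ hquant ρ x y := fun x y => by
    rw [norm_cgrad_sub_comm, hquant]
    have : 0 ≤ ‖x - y‖ * √(-ρ x) := by positivity
    nlinarith [sq_nonneg ‖x - y‖]
  have hdH : ‖w - z‖ ^ 2 ≤ hquant ρ z w := by
    rw [norm_sub_rev, hquant]
    have : 0 ≤ ‖z - w‖ * √(-ρ z) := by positivity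
    linarith [norm_nonneg (cgrad ρ z (z - w))]
  have hGz := hGH z w
  have hGw := (hGH w z).trans hsw
  obtain ⟨hh1, hh2, hh3⟩ := (by simpa only [le_min_iff] using hh :
    hquant ρ z w ≤ η ^ 2 ∧ hquant ρ z w ≤ 1 / K ∧ hquant ρ z w ≤ a * r0 / (1 / A0 + L))
  generalize hquant ρ z w = H at *
  have hHl : H ≤ K * H := by nlinarith
  have hnear : infDist z (frontier Ω) ≤ r0 := by
    rw [le_div_iff₀ hS] at hh3
    exact le_of_mul_le_mul_left ((hab z hz).trans (by linarith)) ha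
  have hn : c0 ^ 2 ≤ ‖normalVec ρ z‖ ^ 2 :=
    pow_le_pow_left₀ hc0.le ((h.grad_le z hnear).trans (norm_fderiv_le_norm_normalVec ρ z)) 2
  have hM : ∀ x, x ≤ 4 * L * H → x ≤ 4 * L * (K * H) := fun x hx => hx.trans (by gcongr)
  have hM' : H ≤ 4 * L * H := by nlinarith
  refine (hdisc (K * H) (by positivity) ?_ z hz w hw (fun _ => 0) (differentiable_const _)
    (hM _ (hGz.trans hM')) (hM _ hGw) (hM _ (hdH.trans hM'))
    (fun _ _ => by rw [norm_zero]; positivity) (hzS.trans (by gcongr)) (hwS.trans (by gcongr))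
    fun ζ hζ1 hζ2 hζ3 => ?_).mono (le_of_eq ?_)
  · rw [le_div_iff₀ (by positivity)] at hh2; linarith
  · have hζ : ‖ζ‖ ≤ 2 := by
      refine (Complex.norm_le_abs_re_add_abs_im ζ).trans ?_
      rw [abs_of_nonneg (by linarith)]; linarith
    have hm := hL.joinCurve_middle_le (l := K * H) (by positivity) hHpos.le hGz hdH hζ
    have hre : r / 4 ≤ (ζ * (1 - ζ)).re := by
      simp only [mul_re, sub_re, one_re, sub_im, one_im]
      nlinarith [sq_nonneg ζ.im, mul_nonneg (sub_nonneg.2 hζ1) (sub_nonneg.2 hζ2)]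
    have h1 : c0 ^ 2 * (r / 4) ≤ ‖normalVec ρ z‖ ^ 2 * (ζ * (1 - ζ)).re := by gcongr
    have h2 := mul_le_mul_of_nonneg_left h1 (by positivity : 0 ≤ K * H)
    have h3 := mul_le_mul_of_nonneg_left hK hHpos.le
    have h4 : √H ≤ η := Real.sqrt_le_iff.2 ⟨hη0.le, hh1⟩
    have h5 : H ≤ η := hh1.trans (by nlinarith)
    have h6 : 12 * (K * H) * L ^ 2 * √H ≤ 12 * (K * H) * L ^ 2 * η := by gcongr
    have h7 : L * (1800 * (K * H) ^ 2 * L ^ 2) ≤ 1800 * L ^ 3 * K ^ 2 * H * η := by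
      calc _ = 1800 * L ^ 3 * K ^ 2 * H * H := by ring
        _ ≤ _ := by gcongr
    have h8 := mul_lt_mul_of_pos_left hη hHpos
    exact (h.mem_iff _).2 (by linarith)
  · field_simp

/-- Weierstrass approximation of a continuous curve by an entire one. -/
lemma exists_entire_approx {e : ℝ → E N} (he : Continuous e) (hε : 0 < ε) :
    ∃ b : ℂ → E N, Differentiable ℂ b ∧ ∀ t ∈ Icc (0 : ℝ) 1, ‖b t - e t‖ < ε := by
  let f : C(unitInterval, E N) := ⟨fun t => e t, he.comp continuous_subtype_val⟩
  obtain ⟨n, hn⟩ := ((tendsto_order.1 (tendsto_iff_norm_sub_tendsto_zero.1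
    (bernsteinApproximation_uniform f))).2 ε hε).exists
  refine ⟨fun ζ => ∑ k : Fin (n + 1),
    ((n.choose k : ℂ) * ζ ^ (k : ℕ) * (1 - ζ) ^ (n - k)) • f (bernstein.z k), by fun_prop,
    fun t ht => lt_of_le_of_lt (le_of_eq ?_)
      (lt_of_le_of_lt ((bernsteinApproximation n f - f).norm_coe_le_norm ⟨t, ht⟩) hn)⟩
  rw [ContinuousMap.sub_apply, bernsteinApproximation.apply]
  congr 2
  refine sum_congr rfl fun k _ => ?_
  rw [bernstein_apply, ← Complex.coe_smul]
  push_cast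
  rfl

/-- A curve which is in `Ω` near its end points can be moved into `Ω` by an entire correction. -/
lemma exists_entire_correction (hΩ : IsOpen Ω) (hc : IsConnected Ω) {J : ℝ → E N}
    (hJ : Continuous J) (hτ0 : 0 < τ) (hτ : τ ≤ 1 / 4) (h0 : J τ ∈ Ω)
    (h1 : J (1 - τ) ∈ Ω) : ∃ b : ℂ → E N, Differentiable ℂ b ∧
      (∀ t ∈ Icc τ (1 - τ), J t + ((t : ℂ) ^ 2 * (1 - t) ^ 2) • b t ∈ Ω) ∧
      ∀ t ∈ Icc (0 : ℝ) 1, t ≤ τ ∨ 1 - τ ≤ t → ‖b t‖ ≤ 1 := by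
  obtain ⟨P, hP⟩ := (hΩ.isConnected_iff_isPathConnected.1 hc).joinedIn _ h0 _ h1
  obtain ⟨δ, hδ, hδΩ⟩ := (isCompact_range P.continuous).exists_thickening_subset_open hΩ
    (range_subset_iff.2 hP)
  set k : ℝ → ℝ := fun t => max τ (min (1 - τ) t) with hk
  have hkc : Continuous k := by fun_prop
  have hk1 : ∀ t, τ ≤ k t := fun t => le_max_left _ _
  have hk2 : ∀ t, k t ≤ 1 - τ := fun t => max_le (by linarith) (min_le_left _ _)
  set e : ℝ → E N := fun t => (((k t ^ 2 * (1 - k t) ^ 2)⁻¹ : ℝ) : ℂ) •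
    (P.extend ((k t - τ) / (1 - 2 * τ)) - J (k t)) with he
  have hkpos : ∀ t, 0 < k t ^ 2 * (1 - k t) ^ 2 := fun t =>
    mul_pos (pow_pos (by linarith [hk1 t]) 2) (pow_pos (by linarith [hk2 t]) 2)
  have hec : Continuous e := by
    refine (Complex.continuous_ofReal.comp ((by fun_prop : Continuous
      fun t => k t ^ 2 * (1 - k t) ^ 2).inv₀ fun t => (hkpos t).ne')).smul
      ((P.continuous_extend.comp (by fun_prop)).sub (hJ.comp hkc))
  obtain ⟨b, hb, hbe⟩ := exists_entire_approx hec (lt_min hδ one_pos)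
  refine ⟨b, hb, fun t ht => ?_, fun t ht hor => ?_⟩
  · have hkt : k t = t := by
      simp only [hk]
      rw [min_eq_right ht.2, max_eq_right ht.1]
    have hpos := hkpos t
    have h := (hbe t ⟨by linarith [ht.1], by linarith [ht.2]⟩).trans_le (min_le_left _ _)
    rw [hkt] at hpos
    refine hδΩ (mem_thickening_iff.2 ⟨P.extend ((t - τ) / (1 - 2 * τ)), ?_, ?_⟩)
    · rw [← P.extend_range]; exact mem_range_self _
    · have e1 : J t + ((t : ℂ) ^ 2 * (1 - t) ^ 2) • b t - P.extend ((t - τ) / (1 - 2 * τ)) =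
          ((t ^ 2 * (1 - t) ^ 2 : ℝ) : ℂ) • (b t - e t) := by
        simp only [he, hkt]
        rw [smul_sub, smul_smul, ← ofReal_mul, mul_inv_cancel₀ hpos.ne',
          Complex.ofReal_one, one_smul]
        push_cast
        abel
      rw [dist_eq_norm, e1, norm_smul, norm_real, norm_of_nonneg hpos.le]
      have : t ^ 2 * (1 - t) ^ 2 ≤ 1 := by
        rw [← mul_pow]
        have := ht.1
        have := ht.2
        exact pow_le_one₀ (mul_nonneg (by linarith) (by linarith)) (by nlinarith)
      exact (mul_le_of_le_one_left (norm_nonneg _) this).trans_lt h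
  · have : e t = 0 := by
      rcases hor with h | h
      · have hkt : k t = τ := max_eq_left ((min_le_right _ _).trans h)
        simp only [he, hkt, sub_self, zero_div, P.extend_zero, smul_zero]
      · have hkt : k t = 1 - τ := by
          simp only [hk]; rw [min_eq_left h, max_eq_right (by linarith)]
        simp only [he, hkt, sub_sub, ← two_mul]
        rw [div_self (by linarith), P.extend_one, sub_self, smul_zero]
    have h := (hbe t ht).trans_le (min_le_right _ _)
    rw [this, sub_zero] at h
    exact h.le

lemma DefFun.exists_hasDisc_nhds (h : DefFun Ω ρ r0 c0) (hL : HasC2Bound ρ L)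
    (hconn : IsConnected Ω) {p : E N × E N} (hp : p ∈ closure Ω ×ˢ closure Ω) :
    ∃ U ∈ 𝓝 p, ∃ c : ℝ, 0 < c ∧ ∀ q ∈ U, q.1 ∈ Ω → q.2 ∈ Ω →
      HasDisc Ω q.1 q.2 (c * (-ρ q.1 * -ρ q.2)) := by
  have hL1 := hL.one_le
  obtain ⟨B, hB, hBΩ⟩ := h.exists_bdist_bound
  obtain ⟨D, hD0, hD⟩ := h.bounded.closure.exists_pos_norm_le
  have hdist : ∀ z ∈ closure Ω, ∀ w ∈ closure Ω, ‖w - z‖ ≤ 2 * D := fun z hz w hw =>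
    (norm_sub_le _ _).trans (by linarith [hD z hz, hD w hw])
  set M := L * (2 * D) + (2 * D) ^ 2 + 1 with hM
  have hM1 : 1 ≤ M := le_add_of_nonneg_left (by positivity)
  have hG : ∀ z ∈ closure Ω, ∀ w ∈ closure Ω, ‖cgrad ρ z (w - z)‖ ≤ M := fun z hz w hw =>
    (hL.norm_cgrad_le z _).trans (by
      have := mul_le_mul_of_nonneg_left (hdist z hz w hw) (by linarith : 0 ≤ L)
      linarith [sq_nonneg (2 * D)])
  have hd : ∀ z ∈ closure Ω, ∀ w ∈ closure Ω, ‖w - z‖ ^ 2 ≤ M := fun z hz w hw => by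
    have := pow_le_pow_left₀ (norm_nonneg _) (hdist z hz w hw) 2
    have : 0 ≤ L * (2 * D) := by positivity
    linarith
  have hS : 0 < L * B := by positivity
  have hσ : ∀ z ∈ Ω, -ρ z ≤ L * B * 1 := fun z hz => by
    rw [mul_one]
    exact (neg_le_abs _).trans ((h.neg_le_bdist hL z).trans (by gcongr; exact hBΩ z hz))
  obtain ⟨r, θ, ε, hr, hr1, hθ, -, hε, H⟩ := h.exists_joinCurve_mem hL (by linarith : 0 ≤ M) hS
  have near : ∀ z ∈ closure Ω, ∀ w ∈ closure Ω, ∀ b : E N, ‖b‖ ≤ 1 → ∀ t : ℝ, 0 < t → t ≤ r →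
      joinCurve ρ 1 z w b t ∈ Ω := by
    intro z hz w hw b hb t ht htr
    have : 0 ≤ θ * (-ρ z / 1) := by
      have := h.nonpos_of_mem_closure hz
      rw [div_one]; exact mul_nonneg hθ.le (by linarith)
    refine H 1 one_pos le_rfl z hz w b (by simpa using hG z hz w hw)
      (by simpa using hd z hz w hw) (by linarith) t ?_ ?_ ?_
    · rwa [norm_real, norm_of_nonneg ht.le]
    · rw [ofReal_re]; linarith
    · rw [ofReal_re, ofReal_im, zero_pow two_ne_zero]
      exact mul_pos hε (by linarith)
  have near' : ∀ b : E N, ‖b‖ ≤ 1 → ∀ t : ℝ, t < 1 → 1 - r ≤ t →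
      joinCurve ρ 1 p.1 p.2 b t ∈ Ω := fun b hb t ht htr => by
    have := near p.2 hp.2 p.1 hp.1 b hb (1 - t) (by linarith) (by linarith)
    rw [← joinCurve_swap] at this
    simpa using this
  have eJ : ∀ (z w b : E N) (ζ : ℂ),
      joinCurve ρ 1 z w b ζ = joinCurve ρ 1 z w 0 ζ + (ζ ^ 2 * (1 - ζ) ^ 2) • b := by
    intro z w b ζ; simp only [joinCurve, smul_zero, add_zero]
  obtain ⟨b, hb, hb1, hb2⟩ := exists_entire_correction h.isOpen hconn
    (J := fun t : ℝ => joinCurve ρ 1 p.1 p.2 0 t) (by simp only [joinCurve]; fun_prop) hr hr1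
    (near _ hp.1 _ hp.2 0 (by simp) r hr le_rfl) (near' 0 (by simp) (1 - r) (by linarith) le_rfl)
  have hin : ∀ t : ℝ, 0 < t → t < 1 → joinCurve ρ 1 p.1 p.2 (b t) t ∈ Ω := by
    intro t ht0 ht1
    rcases le_or_gt t r with h1 | h1
    · exact near _ hp.1 _ hp.2 _ (hb2 t ⟨ht0.le, ht1.le⟩ (.inl h1)) t ht0 h1
    rcases le_or_gt (1 - r) t with h2 | h2
    · exact near' _ (hb2 t ⟨ht0.le, ht1.le⟩ (.inr h2)) t ht1 h2
    · rw [eJ]; exact hb1 t ⟨h1.le, h2.le⟩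
  obtain ⟨Mb, hMb⟩ := (isCompact_closedBall (0 : ℂ) 2).exists_bound_of_continuousOn
    hb.continuous.continuousOn
  have hMb0 : 0 ≤ Mb := (norm_nonneg _).trans (hMb 0 (by simp))
  obtain ⟨r', hr', hr'1, hdisc⟩ := h.exists_hasDisc_of_joinCurve hL (by linarith : 0 ≤ M + Mb) hS
  have hnc : Continuous (normalVec ρ) := by
    refine (LipschitzWith.of_dist_le_mul (K := ⟨L, by linarith⟩) fun x y => ?_).continuous
    rw [dist_eq_norm, dist_eq_norm]
    exact hL.norm_normalVec_sub_le x y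
  have hcont : Continuous fun x : (E N × E N) × ℂ => joinCurve ρ 1 x.1.1 x.1.2 (b x.2) x.2 := by
    have := hb.continuous
    simp only [joinCurve]; fun_prop
  set T : Set ℂ := (fun t : ℝ => (t : ℂ)) '' Icc (r' / 2) (1 - r' / 2)
  have hT : IsCompact T := isCompact_Icc.image Complex.continuous_ofReal
  obtain ⟨U, V, hU, hV, hpU, hTV, hUV⟩ := generalized_tube_lemma (isCompact_singleton (x := p)) hT
    (h.isOpen.preimage hcont) (by
      rintro ⟨q, ζ⟩ ⟨hq, t, ht, rfl⟩
      obtain rfl : q = p := hq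
      exact hin t (by linarith [ht.1]) (by linarith [ht.2]))
  obtain ⟨δ, hδ, hδV⟩ := hT.exists_thickening_subset_open hV hTV
  obtain ⟨c, hc, hdisc⟩ := hdisc (δ / 2) (by positivity)
  refine ⟨U, hU.mem_nhds (hpU rfl), c, hc, fun q hq h1 h2 => ?_⟩
  have h1' := subset_closure h1
  have h2' := subset_closure h2
  have := hdisc 1 one_pos le_rfl q.1 h1 q.2 h2 b hb (by linarith [hG _ h1' _ h2'])
    (by linarith [hG _ h2' _ h1']) (by linarith [hd _ h1' _ h2'])
    (fun ζ hζ => by linarith [hMb ζ (mem_closedBall_zero_iff.2 hζ)]) (hσ _ h1) (hσ _ h2)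
    fun ζ i1 i2 i3 => hUV (a := (q, ζ)) ⟨hq, hδV (mem_thickening_iff.2
      ⟨(ζ.re : ℂ), mem_image_of_mem _ ⟨i1, i2⟩, ?_⟩)⟩
  · simpa using this
  · rw [Complex.dist_of_re_eq (by simp), ofReal_im, Real.dist_0_eq_abs]
    linarith

lemma DefFun.exists_hasDisc (h : DefFun Ω ρ r0 c0) (hL : HasC2Bound ρ L)
    (hconn : IsConnected Ω) : ∃ c : ℝ, 0 < c ∧ ∀ z ∈ Ω, ∀ w ∈ Ω,
      HasDisc Ω z w (c * (-ρ z * -ρ w)) := by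
  have hK : IsCompact (closure Ω ×ˢ closure Ω) :=
    h.bounded.isCompact_closure.prod h.bounded.isCompact_closure
  obtain ⟨c, hc, H⟩ := hK.induction_on (p := fun U => ∃ c : ℝ, 0 < c ∧ ∀ q ∈ U, q.1 ∈ Ω →
      q.2 ∈ Ω → HasDisc Ω q.1 q.2 (c * (-ρ q.1 * -ρ q.2))) ⟨1, one_pos, by simp⟩
    (fun s t hst ⟨c, hc, H⟩ => ⟨c, hc, fun q hq => H q (hst hq)⟩)
    (fun s t ⟨c, hc, H⟩ ⟨c', hc', H'⟩ => ⟨min c c', lt_min hc hc', fun q hq h1 h2 => by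
      have : 0 ≤ -ρ q.1 * -ρ q.2 := mul_nonneg (by linarith [(h.mem_iff _).1 h1])
        (by linarith [(h.mem_iff _).1 h2])
      rcases hq with hq | hq
      · exact (H q hq h1 h2).mono (mul_le_mul_of_nonneg_right (min_le_left _ _) this)
      · exact (H' q hq h1 h2).mono (mul_le_mul_of_nonneg_right (min_le_right _ _) this)⟩)
    (fun p hp => by
      obtain ⟨U, hU, hc⟩ := h.exists_hasDisc_nhds hL hconn hp
      exact ⟨U, mem_nhdsWithin_of_mem_nhds hU, hc⟩)
  exact ⟨c, hc, fun z hz w hw => H (z, w) ⟨subset_closure hz, subset_closure hw⟩ hz hw⟩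

lemma artanh_le_log_of_le_half (ht0 : 0 ≤ t) (ht : t ≤ 1 / 2) : artanh t ≤ log (1 + 2 * t) := by
  rw [artanh, div_le_iff₀ two_pos, mul_comm, ← Nat.cast_two (R := ℝ), ← log_pow]
  refine log_le_log (div_pos (by linarith) (by linarith)) ?_
  rw [div_le_iff₀ (by linarith)]
  push_cast
  nlinarith [mul_nonneg ht0 ht0, mul_nonneg (mul_nonneg ht0 ht0) (sub_nonneg.2 ht)]

lemma artanh_le_log_of_le_one_sub_sq {c : ℝ} (ht0 : 0 ≤ t) (ht : t < 1) (hc : 0 < c)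
    (hA : 0 < A) (h : c / A ^ 2 ≤ 1 - t ^ 2) :
    artanh t ≤ log (1 + 2 / √c * A) := by
  rw [artanh, div_le_iff₀ two_pos, mul_comm, ← Nat.cast_two (R := ℝ), ← log_pow]
  refine log_le_log (div_pos (by linarith) (by linarith)) ?_
  have h1 : (1 + t) / (1 - t) ≤ 4 * A ^ 2 / c := by
    rw [div_le_iff₀ (by positivity)] at h
    rw [div_le_div_iff₀ (by linarith) hc]
    nlinarith [mul_nonneg (mul_nonneg (sub_nonneg.2 ht.le) (sq_nonneg A)) ht0, sq_nonneg A,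
      mul_nonneg (sub_nonneg.2 ht.le) (sq_nonneg A)]
  refine h1.trans ?_
  have h2 : 4 * A ^ 2 / c = (2 / √c * A) ^ 2 := by
    rw [mul_pow, div_pow, sq_sqrt hc.le]; ring
  rw [h2]
  push_cast
  exact pow_le_pow_left₀ (by positivity) (by linarith) 2

lemma DefFun.exists_upper (h : DefFun Ω ρ r0 c0) (hL : HasC2Bound ρ L) (hconn : IsConnected Ω) :
    ∃ C : ℝ, 0 < C ∧ ∀ z ∈ Ω, ∀ w ∈ Ω, ∃ φ : ℂ → E N, DifferentiableOn ℂ φ (ball 0 1) ∧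
      MapsTo φ (ball (0 : ℂ) 1) Ω ∧ φ 0 = z ∧ ∃ a ∈ ball (0 : ℂ) 1, φ a = w ∧
        artanh ‖a‖ ≤ log (1 + C * aquant ρ z w) := by
  have hLpos : 0 < L := lt_of_lt_of_le one_pos hL.one_le
  obtain ⟨h₀, c1, hh0, hc1, hloc⟩ := h.exists_hasDisc_local hL (A0 := 1 / (16 * L)) (by positivity)
  obtain ⟨c2, hc2, hglob⟩ := h.exists_hasDisc hL hconn
  set c := min c1 (c2 * h₀ ^ 2) with hc
  have hcpos : 0 < c := by positivity
  refine ⟨max (16 * L) (2 / √c), by positivity, fun z hz w hw => ?_⟩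
  have hz0 := sqrt_pos.2 (neg_pos.2 ((h.mem_iff z).1 hz))
  have hw0 := sqrt_pos.2 (neg_pos.2 ((h.mem_iff w).1 hw))
  have hA0 : 0 ≤ aquant ρ z w := aquant_nonneg _ _ _
  have mono : ∀ {C : ℝ}, 0 < C → C ≤ max (16 * L) (2 / √c) → log (1 + C * aquant ρ z w) ≤
        log (1 + max (16 * L) (2 / √c) * aquant ρ z w) := fun hC hle =>
    log_le_log (by positivity) (by gcongr)
  by_cases hA : aquant ρ z w ≤ 1 / (16 * L)
  · obtain ⟨φ, hd, hm, h0, a, ha, haw, hb, hb2⟩ := h.exists_affine_disc hL hz hw hA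
    refine ⟨φ, hd, hm, h0, a, ha, haw, (artanh_le_log_of_le_half (norm_nonneg a) hb2).trans
      (le_trans ?_ (mono (by positivity) (le_max_left _ _)))⟩
    exact log_le_log (by positivity) (by linarith)
  · push Not at hA
    have hApos : 0 < aquant ρ z w := lt_trans (by positivity) hA
    have hH : 1 / (16 * L) * (√(-ρ z) * √(-ρ w)) ≤ hquant ρ z w := by
      rw [aquant, lt_div_iff₀ (by positivity)] at hA
      exact hA.le
    have hHpos : 0 < hquant ρ z w := lt_of_lt_of_le (by positivity) hH
    have heq : c / aquant ρ z w ^ 2 = c * (-ρ z * -ρ w / hquant ρ z w ^ 2) := by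
      rw [aquant, div_pow, mul_pow, sq_sqrt (sqrt_pos.1 hz0).le,
        sq_sqrt (sqrt_pos.1 hw0).le, div_div_eq_mul_div, mul_div_assoc]
    have hσ : 0 ≤ -ρ z * -ρ w := mul_nonneg (sqrt_pos.1 hz0).le (sqrt_pos.1 hw0).le
    have hdisc : HasDisc Ω z w (c / aquant ρ z w ^ 2) := by
      rw [heq]
      rcases le_total (hquant ρ z w) h₀ with hle | hle
      · exact (hloc z hz w hw hH hle).mono
          (mul_le_mul_of_nonneg_right (min_le_left _ _) (by positivity))
      · refine (hglob z hz w hw).mono ?_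
        calc c * (-ρ z * -ρ w / hquant ρ z w ^ 2)
            ≤ c2 * h₀ ^ 2 * (-ρ z * -ρ w / h₀ ^ 2) := by
              gcongr
              exact min_le_right _ _
          _ = c2 * (-ρ z * -ρ w) := by field_simp
    obtain ⟨φ, hd, hm, h0, a, ha, haw, hq⟩ := hdisc
    exact ⟨φ, hd, hm, h0, a, ha, haw, (artanh_le_log_of_le_one_sub_sq (norm_nonneg a)
      (by simpa using ha) hcpos hApos hq).trans (mono (by positivity) (le_max_right _ _))⟩

lemma artanh_le_artanh {s : ℝ} (hs : 0 ≤ s) (hst : s ≤ t) (ht : t < 1) : artanh s ≤ artanh t := by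
  have : 0 < 1 - t := by linarith
  unfold artanh
  gcongr
  · exact div_pos (by linarith) (by linarith)
  · linarith

lemma artanh_nonneg (h0 : 0 ≤ t) (h1 : t < 1) : 0 ≤ artanh t := by
  simpa [artanh] using artanh_le_artanh le_rfl h0 h1

/-- The moduli of the parameters at which an analytic disc in `Ω` centred at `z` hits `w`. -/
def discRadii (Ω : Set (E N)) (z w : E N) : Set ℝ :=
  { r : ℝ | ∃ φ : ℂ → E N, DifferentiableOn ℂ φ (ball 0 1) ∧
    MapsTo φ (ball (0:ℂ) 1) Ω ∧ φ 0 = z ∧ ∃ a ∈ ball (0:ℂ) 1, φ a = w ∧ r = ‖a‖ }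

lemma mem_Ico_of_mem_discRadii (h : r ∈ discRadii Ω z w) : r ∈ Ico (0 : ℝ) 1 := by
  obtain ⟨φ, -, -, -, a, ha, -, rfl⟩ := h
  exact ⟨norm_nonneg a, by simpa using ha⟩

lemma bddBelow_discRadii (z w : E N) : BddBelow (discRadii Ω z w) :=
  ⟨0, fun _ h => (mem_Ico_of_mem_discRadii h).1⟩

lemma sInf_discRadii_mem_Ico (h : (discRadii Ω z w).Nonempty) :
    sInf (discRadii Ω z w) ∈ Ico (0 : ℝ) 1 :=
  ⟨Real.sInf_nonneg fun _ h => (mem_Ico_of_mem_discRadii h).1,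
    h.elim fun _ hr => (csInf_le (bddBelow_discRadii z w) hr).trans_lt
      (mem_Ico_of_mem_discRadii hr).2⟩

lemma lempert_le_artanh (h : r ∈ discRadii Ω z w) : lempert Ω z w ≤ artanh r :=
  artanh_le_artanh (sInf_discRadii_mem_Ico ⟨r, h⟩).1 (csInf_le (bddBelow_discRadii z w) h)
    (mem_Ico_of_mem_discRadii h).2

lemma lempert_nonneg (h : (discRadii Ω z w).Nonempty) : 0 ≤ lempert Ω z w :=
  artanh_nonneg (sInf_discRadii_mem_Ico h).1 (sInf_discRadii_mem_Ico h).2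

lemma norm_le_of_mem_discRadii (hf : DifferentiableOn ℂ f Ω)
    (hm : MapsTo f Ω (ball (0 : ℂ) 1)) (hz : f z = 0)
    (h : r ∈ discRadii Ω z w) : ‖f w‖ ≤ r := by
  obtain ⟨φ, hd, hφ, h0, a, ha, rfl, rfl⟩ := h
  exact Complex.norm_le_norm_of_mapsTo_ball (f := f ∘ φ) (hf.comp hd hφ)
    ((hm.comp hφ).mono_right ball_subset_closedBall) (by simp [h0, hz]) (by simpa using ha)

lemma caratheodory_le_artanh (h : r ∈ discRadii Ω z w) : caratheodory Ω z w ≤ artanh r := by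
  refine artanh_le_artanh (Real.sSup_nonneg ?_) (Real.sSup_le ?_ (mem_Ico_of_mem_discRadii h).1)
    (mem_Ico_of_mem_discRadii h).2
  · rintro _ ⟨f, -, -, -, rfl⟩
    exact norm_nonneg _
  · rintro _ ⟨f, hf, hm, hz, rfl⟩
    exact norm_le_of_mem_discRadii hf hm hz h

lemma artanh_le_caratheodory (hf : DifferentiableOn ℂ f Ω)
    (hm : MapsTo f Ω (ball (0 : ℂ) 1)) (hz : f z = 0)
    (h : (discRadii Ω z w).Nonempty) : artanh ‖f w‖ ≤ caratheodory Ω z w := by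
  obtain ⟨r, hr⟩ := h
  have hle : ∀ s ∈ { r : ℝ | ∃ f : E N → ℂ, DifferentiableOn ℂ f Ω ∧
      MapsTo f Ω (ball (0:ℂ) 1) ∧ f z = 0 ∧ r = ‖f w‖ }, s ≤ r := by
    rintro _ ⟨f, hf, hm, hz, rfl⟩
    exact norm_le_of_mem_discRadii hf hm hz hr
  refine artanh_le_artanh (norm_nonneg _) (le_csSup ⟨r, hle⟩ ⟨f, hf, hm, hz, rfl⟩) ?_
  exact (Real.sSup_le hle (mem_Ico_of_mem_discRadii hr).1).trans_lt (mem_Ico_of_mem_discRadii hr).2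

lemma artanh_le_lempert (hf : DifferentiableOn ℂ f Ω)
    (hm : MapsTo f Ω (ball (0 : ℂ) 1)) (hz : f z = 0)
    (h : (discRadii Ω z w).Nonempty) : artanh ‖f w‖ ≤ lempert Ω z w :=
  artanh_le_artanh (norm_nonneg _)
    (le_csInf h fun _ hr => norm_le_of_mem_discRadii hf hm hz hr) (sInf_discRadii_mem_Ico h).2

lemma artanh_le_add_of_one_sub_sq_le {x y : ℝ} (hx0 : 0 ≤ x) (hx : x < 1) (hy0 : 0 ≤ y)
    (hy : y < 1) (hm0 : 0 ≤ m) (hm : m < 1)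
    (h : 1 - m ^ 2 ≤ (1 - x ^ 2) * (1 - y ^ 2) / (1 - x * y) ^ 2) :
    artanh y ≤ artanh x + artanh m := by
  have hxy : 0 < 1 - x * y := by nlinarith
  rw [le_div_iff₀ (by positivity)] at h
  have hle : y - x ≤ m * (1 - x * y) := by
    refine le_of_sq_le_sq ?_ (by positivity)
    nlinarith
  unfold artanh
  rw [← add_div, ← Real.log_mul (div_pos (by linarith) (by linarith)).ne'
    (div_pos (by linarith) (by linarith)).ne']
  refine div_le_div_of_nonneg_right (log_le_log (div_pos (by linarith) (by linarith)) ?_) two_pos.le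
  rw [div_mul_div_comm, div_le_div_iff₀ (by linarith) (mul_pos (by linarith) (by linarith))]
  nlinarith

lemma artanh_le_artanh_add_lempert {F : E N → ℂ} (hF : DifferentiableOn ℂ F Ω)
    (hm : MapsTo F Ω (ball (0 : ℂ) 1)) {q : E N} (hp : p ∈ Ω) (hq : q ∈ Ω)
    (h : (discRadii Ω p q).Nonempty) : artanh ‖F q‖ ≤ artanh ‖F p‖ + lempert Ω p q := by
  obtain ⟨f, hf, hfm, hfp, hfq⟩ := exists_moebius_normalized hF hm hp hq
  have hFp : ‖F p‖ < 1 := by simpa using hm hp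
  have hFq : ‖F q‖ < 1 := by simpa using hm hq
  refine (artanh_le_add_of_one_sub_sq_le (norm_nonneg _) hFp (norm_nonneg _) hFq
    (norm_nonneg (f q)) (by simpa using hfm hq) ?_).trans
    (by gcongr; exact artanh_le_lempert hf hfm hfp h)
  have h1 : 0 < 1 - ‖F p‖ * ‖F q‖ := by nlinarith [norm_nonneg (F p), norm_nonneg (F q)]
  have h2 : 1 - ‖F p‖ * ‖F q‖ ≤ ‖1 - conj (F p) * F q‖ := by
    simpa using norm_sub_norm_le (1 : ℂ) (conj (F p) * F q)
  rw [hfq]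
  gcongr
  exact mul_nonneg (by nlinarith [norm_nonneg (F p)]) (by nlinarith [norm_nonneg (F q)])

lemma artanh_le_chain {F : E N → ℂ} (hF : DifferentiableOn ℂ F Ω)
    (hm : MapsTo F Ω (ball (0 : ℂ) 1)) (h : ∀ z ∈ Ω, ∀ w ∈ Ω, (discRadii Ω z w).Nonempty)
    (n : ℕ) (p : Fin (n + 1) → E N) (hp : ∀ i, p i ∈ Ω) :
    artanh ‖F (p (Fin.last n))‖ ≤
      artanh ‖F (p 0)‖ + ∑ i : Fin n, lempert Ω (p i.castSucc) (p i.succ) := by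
  induction n with
  | zero => simp
  | succ n ih =>
    rw [Fin.sum_univ_castSucc, ← add_assoc]
    have h1 := ih (fun i => p i.castSucc) fun i => hp _
    have h2 := artanh_le_artanh_add_lempert hF hm (hp (Fin.last n).castSucc)
      (hp (Fin.last n).succ) (h _ (hp _) _ (hp _))
    rw [Fin.succ_last] at h2 ⊢
    exact h2.trans (add_le_add_left h1 _)

lemma kobayashi_le_lempert (h : ∀ z ∈ Ω, ∀ w ∈ Ω, (discRadii Ω z w).Nonempty)
    (hz : z ∈ Ω) (hw : w ∈ Ω) : kobayashi Ω z w ≤ lempert Ω z w := by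
  refine csInf_le ⟨0, ?_⟩ ⟨1, ![z, w], rfl, rfl, fun i => by fin_cases i <;> assumption, by simp⟩
  rintro _ ⟨n, p, -, -, hp, rfl⟩
  exact sum_nonneg fun i _ => lempert_nonneg (h _ (hp _) _ (hp _))

lemma artanh_le_kobayashi (hf : DifferentiableOn ℂ f Ω)
    (hm : MapsTo f Ω (ball (0 : ℂ) 1)) (h : ∀ z ∈ Ω, ∀ w ∈ Ω, (discRadii Ω z w).Nonempty)
     (hz : z ∈ Ω) (hw : w ∈ Ω) (hfz : f z = 0) :
    artanh ‖f w‖ ≤ kobayashi Ω z w := by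
  refine le_csInf ⟨_, 1, ![z, w], rfl, rfl, fun i => by fin_cases i <;> assumption, rfl⟩ ?_
  rintro _ ⟨n, p, rfl, rfl, hp, rfl⟩
  simpa [hfz, artanh] using artanh_le_chain hf hm h n p hp

end Estimates

/-- Sharp two-sided estimates for the Carathéodory distance, the
Kobayashi distance and the Lempert function on a bounded strongly pseudoconvex
domain with `C^{2,α}`-smooth boundary. -/
theorem stmt0 {N : ℕ} {α : ℝ} (hα : α ∈ Set.Ioc (0:ℝ) 1)
    (Ω : Set (E N)) (hΩ : IsStronglyPseudoconvexDomain 2 α Ω)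
    (π : E N → E N) (hπ : IsClosestPointSelection Ω π)
    (d : E N → E N → ℝ)
    (hd : d = caratheodory Ω ∨ d = kobayashi Ω ∨ d = lempert Ω) :
    ∃ c C : ℝ, 0 < c ∧ c < C ∧ ∀ z ∈ Ω, ∀ w ∈ Ω, Real.log (1 + c * Afun Ω π z w) ≤ d z w ∧
      d z w ≤ Real.log (1 + C * Afun Ω π z w) := by
  obtain ⟨z0, hz0⟩ := hΩ.2.1.nonempty
  obtain ⟨ρ, r0, c0, h⟩ := exists_defFun hΩ ⟨π z0, (hπ z0 hz0).1⟩
  obtain ⟨L, hL⟩ := exists_hasC2Bound h.contDiff h.compact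
  obtain ⟨K, hK, hcomp⟩ := h.exists_afun_comparable
  obtain ⟨c, hc, hlow⟩ := h.exists_lower
  obtain ⟨C, hC, hup⟩ := h.exists_upper hL hΩ.2.1
  have hKpos : 0 < K := one_pos.trans_le hK
  have hne : ∀ z ∈ Ω, ∀ w ∈ Ω, (discRadii Ω z w).Nonempty := fun z hz w hw => by
    obtain ⟨φ, hφ, hm, h0, a, ha, haw, -⟩ := hup z hz w hw
    exact ⟨‖a‖, φ, hφ, hm, h0, a, ha, haw, rfl⟩
  refine ⟨c / K, C * K + c / K, by positivity, by nlinarith [mul_pos hC hKpos], fun z hz w hw => ?_⟩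
  obtain ⟨hle, hge⟩ := hcomp π hπ z hz w hw
  have hq := aquant_nonneg ρ z w
  have hA : 0 ≤ Afun Ω π z w := nonneg_of_mul_nonneg_right (hq.trans hge) hKpos
  obtain ⟨f, hf, hfm, hfz, hfw⟩ := hlow z hz w hw
  obtain ⟨φ, hφ, hm, h0, a, ha, haw, har⟩ := hup z hz w hw
  have hr : ‖a‖ ∈ discRadii Ω z w := ⟨φ, hφ, hm, h0, a, ha, haw, rfl⟩
  have hfin : artanh ‖f w‖ ≤ d z w ∧ d z w ≤ artanh ‖a‖ := by
    rcases hd with rfl | rfl | rfl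
    · exact ⟨artanh_le_caratheodory hf hfm hfz ⟨_, hr⟩, caratheodory_le_artanh hr⟩
    · exact ⟨artanh_le_kobayashi hf hfm hne hz hw hfz,
        (kobayashi_le_lempert hne hz hw).trans (lempert_le_artanh hr)⟩
    · exact ⟨artanh_le_lempert hf hfm hfz ⟨_, hr⟩, lempert_le_artanh hr⟩
  constructor
  · refine le_trans (log_le_log (by positivity) ?_) (hfw.trans hfin.1)
    have : c / K * Afun Ω π z w ≤ c / K * (K * aquant ρ z w) := by gcongr
    have e : c / K * (K * aquant ρ z w) = c * aquant ρ z w := by field_simp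
    linarith
  · refine hfin.2.trans (har.trans (log_le_log (by positivity) ?_))
    have h1 : C * aquant ρ z w ≤ C * (K * Afun Ω π z w) := by gcongr
    have h2 : 0 ≤ c / K * Afun Ω π z w := by positivity
    linarith

end InvDist
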